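/- (Group/RAAG version of the main theorem, existence form.) Fix a finite set 𝔯 of resources. Let (A ∪ X, ρ) be a finite resource alphabet with involution, partitioned into constants A and variables X, each closed under involution, such that no letter of A is self-involuting (ā ≠ a for all a ∈ A), with distinguished variables X₁, …, X_k ∈ X; let μ : M(A ∪ X, ρ) → N be a morphism of monoids with involution into a finite monoid with involution N, and let (U, V) be a pair of words over A ∪ X. Let G(A, ρ) be the free partially commutative group, i.e., the quotient of M(A, ρ) by the congruence generated by {a ā = 1 : a ∈ A}, with canonical projection π_G : M(A,ρ) → G(A,ρ). Call σ a group solution of (U, V, μ) if σ : M(A ∪ X, ρ) → M(A, ρ) is a morphism of monoids with involution with σ(a) = a for all a ∈ A, σ(Y) is a reduced trace for every variable Y (no factor a ā), π_G(σ(U)) = π_G(σ(V)) in G(A,ρ), and μ(σ(Y)) = μ(Y) for all Y ∈ X. Then there exist a finite alphabet C with A ⊆ C, letters c₁, …, c_k ∈ C, and a rational set R of A-endomorphisms of the free monoid C* such that: (i) every h ∈ R maps each letter of C to a word over A; (ii) {(π(h(c₁)), …, π(h(c_k))) : h ∈ R} = {(σ(X₁), …, σ(X_k)) : σ is a group solution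 of (U, V, μ)}, where π : A* → M(A, ρ) is the canonical projection; and (iii) R is infinite if and only if there are infinitely many group solutions. -/

import Mathlib

open scoped Classical

universe u

/-- The partial-commutation relation on words: `ab = ba` whenever `ρ a ∩ ρ b = ∅`. -/
def traceRel {R : Type u} (Γ : Type u) (ρ : Γ → Set R) :
    FreeMonoid Γ → FreeMonoid Γ → Prop := fun u v =>
  ∃ a b : Γ, ρ a ∩ ρ b = ∅ ∧ u = FreeMonoid.of a * FreeMonoid.of b ∧
    v = FreeMonoid.of b * FreeMonoid.of a

/-- The congruence on the free monoid generated by partial commutation. -/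
def traceCon {R : Type u} (Γ : Type u) (ρ : Γ → Set R) : Con (FreeMonoid Γ) :=
  conGen (traceRel Γ ρ)

/-- The trace monoid `M(Γ, ρ)`. -/
abbrev Trace {R : Type u} (Γ : Type u) (ρ : Γ → Set R) : Type u :=
  (traceCon Γ ρ).Quotient

/-- Canonical projection from words to traces. -/
def traceMk {R Γ : Type u} (ρ : Γ → Set R) : FreeMonoid Γ →* Trace Γ ρ :=
  (traceCon Γ ρ).mk'

/-- The trace of a single letter. -/
def traceOf {R Γ : Type u} (ρ : Γ → Set R) (a : Γ) : Trace Γ ρ :=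
  traceMk ρ (FreeMonoid.of a)

/-- Word-level involution: reverse the word and apply `bar` letterwise. -/
def wordStar {Γ : Type u} (bar : Γ → Γ) (u : FreeMonoid Γ) : FreeMonoid Γ :=
  FreeMonoid.ofList (((FreeMonoid.toList u).map bar).reverse)

/-- A subset of a monoid `E` is rational if it is the set of products (in order) of the
labels along accepting paths of a nondeterministic finite automaton with finitely many
states and finitely many transitions labeled by elements of `E`. -/
def RationalSet {E : Type u} [Monoid E] (Rset : Set E) : Prop :=
  ∃ (Q : Type u) (_ : Finite Q) (init final : Q → Prop) (T : Q → E → Q → Prop),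
    {x : Q × E × Q | T x.1 x.2.1 x.2.2}.Finite ∧
    Rset = {e | ∃ (n : ℕ) (qs : Fin (n + 1) → Q) (ls : Fin n → E),
      init (qs 0) ∧ final (qs (Fin.last n)) ∧
      (∀ i : Fin n, T (qs i.castSucc) (ls i) (qs i.succ)) ∧
      e = (List.ofFn ls).prod}

/-- The congruence on the trace monoid `M(A, ρA)` generated by `a ā = 1`; its quotient is
the free partially commutative group (RAAG) `G(A, ρA)`. -/
def raagCon {R A : Type u} (ρA : A → Set R) (barA : A → A) : Con (Trace A ρA) :=
  conGen (fun u v => ∃ a : A, u = traceOf ρA a * traceOf ρA (barA a) ∧ v = 1)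

/-- A group solution of the equation `(U, V)` with constraint `μ`: an `A`-morphism of
monoids with involution `σ : M(A ∪ X, ρ) → M(A, ρA)` such that `σ(Y)` is a reduced trace
for every variable `Y`, `σ(U) = σ(V)` holds in the RAAG `G(A, ρA)` (i.e. after the
canonical projection `π_G`), and `μ(σ(Y)) = μ(Y)` for every variable `Y` (computed on any
word representative of `σ(Y)`, re-embedded via `Sum.inl`). -/
def IsSolutionG {R A X N : Type u} [Monoid N]
    (barA : A → A) (barX : X → X) (ρ : A ⊕ X → Set R) (ρA : A → Set R)
    (μ : Trace (A ⊕ X) ρ →* N) (U V : FreeMonoid (A ⊕ X))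
    (σ : Trace (A ⊕ X) ρ →* Trace A ρA) : Prop :=
  (∀ a : A, σ (traceOf ρ (Sum.inl a)) = traceOf ρA a) ∧
  (∀ (u : FreeMonoid (A ⊕ X)) (w : FreeMonoid A),
    σ (traceMk ρ u) = traceMk ρA w →
    σ (traceMk ρ (wordStar (Sum.map barA barX) u)) = traceMk ρA (wordStar barA w)) ∧
  (∀ Y : X, ¬ ∃ (p q : Trace A ρA) (a : A),
    σ (traceOf ρ (Sum.inr Y)) = p * (traceOf ρA a * traceOf ρA (barA a)) * q) ∧
  (raagCon ρA barA).mk' (σ (traceMk ρ U)) = (raagCon ρA barA).mk' (σ (traceMk ρ V)) ∧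
  (∀ (Y : X) (w : FreeMonoid A), σ (traceOf ρ (Sum.inr Y)) = traceMk ρA w →
    μ (traceMk ρ (FreeMonoid.map Sum.inl w)) = μ (traceOf ρ (Sum.inr Y)))

universe v

/-- Paths in a labelled automaton. -/
inductive PPath {Q E : Type u} [Monoid E] (T : Q → E → Q → Prop) : Q → E → Q → Prop
  | nil (q : Q) : PPath T q 1 q
  | cons {q r s : Q} {e f : E} : T q e r → PPath T r f s → PPath T q (e * f) s

theorem PPath.trans {Q E : Type u} [Monoid E] {T : Q → E → Q → Prop} {q r s : Q} {e f : E}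
    (h : PPath T q e r) (h' : PPath T r f s) : PPath T q (e * f) s := by
  induction h with
  | nil q => simpa using h'
  | cons ht _ ih => rw [mul_assoc]; exact PPath.cons ht (ih h')

theorem PPath.single {Q E : Type u} [Monoid E] {T : Q → E → Q → Prop} {q r : Q} {e : E}
    (h : T q e r) : PPath T q e r := by
  have := PPath.cons h (PPath.nil (T := T) r)
  simpa using this

theorem PPath_iff {Q E : Type u} [Monoid E] (T : Q → E → Q → Prop) (q r : Q) (e : E) :
    PPath T q e r ↔ ∃ (n : ℕ) (qs : Fin (n + 1) → Q) (ls : Fin n → E),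
      qs 0 = q ∧ qs (Fin.last n) = r ∧
      (∀ i : Fin n, T (qs i.castSucc) (ls i) (qs i.succ)) ∧
      e = (List.ofFn ls).prod := by
  constructor
  · intro h
    induction h with
    | nil q => exact ⟨0, fun _ => q, Fin.elim0, rfl, rfl, fun i => i.elim0, by simp⟩
    | @cons q r s e f ht _ ih =>
      obtain ⟨n, qs, ls, h0, h1, h2, h3⟩ := ih
      refine ⟨n + 1, Fin.cons q qs, Fin.cons e ls, rfl, ?_, ?_, ?_⟩
      · rw [← Fin.succ_last, Fin.cons_succ, h1]
      · intro i
        refine Fin.cases ?_ (fun j => ?_) i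
        · simpa [h0] using ht
        · have := h2 j
          rw [← Fin.succ_castSucc]
          simpa using this
      · simp [List.ofFn_succ, h3]
  · rintro ⟨n, qs, ls, h0, h1, h2, h3⟩
    induction n generalizing q e with
    | zero =>
      subst h0 h1 h3
      simpa using PPath.nil (T := T) (qs 0)
    | succ n ih =>
      have := ih (qs 1) ((List.ofFn (fun i => ls i.succ)).prod) (fun i => qs i.succ)
        (fun i => ls i.succ) rfl (by simpa using h1)
        (fun i => by simpa using h2 i.succ) rfl
      have h4 := h2 0
      have h5 := PPath.cons h4 this
      rw [h3, List.ofFn_succ, List.prod_cons, ← h0]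
      exact h5

theorem rational_iff {E : Type u} [Monoid E] (S : Set E) :
    RationalSet S ↔ ∃ (Q : Type u) (_ : Finite Q) (I F : Q → Prop) (T : Q → E → Q → Prop),
      {x : Q × E × Q | T x.1 x.2.1 x.2.2}.Finite ∧
      S = {e | ∃ q r, I q ∧ F r ∧ PPath T q e r} := by
  unfold RationalSet
  refine exists_congr fun Q => exists_congr fun _ => exists_congr fun I => exists_congr fun F =>
    exists_congr fun T => and_congr_right fun _ => ?_
  refine Eq.congr_right (Set.ext fun e => ?_)
  simp only [Set.mem_ofPred_eq, PPath_iff]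
  constructor
  · rintro ⟨n, qs, ls, h0, h1, h2, h3⟩
    exact ⟨_, _, h0, h1, n, qs, ls, rfl, rfl, h2, h3⟩
  · rintro ⟨q, r, hq, hr, n, qs, ls, rfl, rfl, h2, h3⟩
    exact ⟨n, qs, ls, hq, hr, h2, h3⟩

theorem rational_finite {E : Type u} [Monoid E] (S : Set E) (hS : S.Finite) : RationalSet S := by
  rw [rational_iff]
  refine ⟨ULift Bool, inferInstance, fun q => q = ⟨false⟩, fun q => q = ⟨true⟩,
    fun q e r => q = ⟨false⟩ ∧ r = ⟨true⟩ ∧ e ∈ S, ?_, ?_⟩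
  · have := Set.Finite.image (fun e => ((⟨false⟩ : ULift.{u} Bool), e, (⟨true⟩ : ULift.{u} Bool))) hS
    refine this.subset ?_
    rintro ⟨q, e, r⟩ ⟨h1, h2, h3⟩
    simp only at h1 h2 h3
    subst h1 h2
    exact ⟨e, h3, rfl⟩
  · ext e
    constructor
    · intro h
      exact ⟨_, _, rfl, rfl, PPath.single ⟨rfl, rfl, h⟩⟩
    · rintro ⟨q, r, rfl, rfl, h⟩
      cases h with
      | cons ht hp =>
        obtain ⟨-, rfl, he⟩ := ht
        cases hp with
        | nil => simpa using he
        | cons ht' _ => simp at ht'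

/-- Automata whose transitions carry labels in `b * closure P`. -/
theorem rational_big {E : Type u} [Monoid E] {Q : Type u} [Finite Q] (I F : Q → Prop)
    (D : Set (Q × E × Set E × Q)) (hD : D.Finite) (hP : ∀ x ∈ D, x.2.2.1.Finite) :
    RationalSet {e | ∃ q r, I q ∧ F r ∧
      PPath (fun q e r => ∃ b P, (q, b, P, r) ∈ D ∧ ∃ c ∈ Submonoid.closure P, e = b * c) q e r} := by
  rw [rational_iff]
  have : Finite D := hD
  let T : (Q ⊕ D) → E → (Q ⊕ D) → Prop := fun x e y => match x, y with
    | Sum.inl q, Sum.inl r => False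
    | Sum.inl q, Sum.inr d => d.1.1 = q ∧ e = d.1.2.1
    | Sum.inr d, Sum.inl r => d.1.2.2.2 = r ∧ e = 1
    | Sum.inr d, Sum.inr d' => d = d' ∧ e ∈ d.1.2.2.1
  refine ⟨Q ⊕ D, inferInstance, Sum.elim I (fun _ => False), Sum.elim F (fun _ => False), T, ?_, ?_⟩
  · have hL : (⋃ d : D, ({d.1.2.1} ∪ {1} ∪ d.1.2.2.1 : Set E)).Finite :=
      Set.finite_iUnion fun d => ((Set.finite_singleton _).union (Set.finite_singleton _)).union
        (hP _ d.2)
    refine ((Set.finite_univ (α := Q ⊕ D)).prod (hL.prod (Set.finite_univ (α := Q ⊕ D)))).subset ?_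
    rintro ⟨x, e, y⟩ h
    refine ⟨trivial, ?_, trivial⟩
    simp only [Set.mem_iUnion]
    rcases x with q | d <;> rcases y with r | d'
    · exact h.elim
    · exact ⟨d', Or.inl (Or.inl h.2)⟩
    · exact ⟨d, Or.inl (Or.inr h.2)⟩
    · exact ⟨d, Or.inr h.2⟩
  · ext e
    constructor
    · rintro ⟨q, r, hq, hr, h⟩
      refine ⟨Sum.inl q, Sum.inl r, hq, hr, ?_⟩
      clear hq hr
      induction h with
      | nil q => exact PPath.nil _
      | @cons q r s e f ht _ ih =>
        obtain ⟨b, P, hd, c, hc, rfl⟩ := ht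
        refine PPath.trans ?_ ih
        refine PPath.cons (r := Sum.inr ⟨_, hd⟩) ⟨rfl, rfl⟩ ?_
        have : PPath T (Sum.inr ⟨_, hd⟩) c (Sum.inr ⟨_, hd⟩) := by
          induction hc using Submonoid.closure_induction with
          | mem x hx => exact PPath.single ⟨rfl, hx⟩
          | one => exact PPath.nil _
          | mul x y _ _ hx hy => exact hx.trans hy
        have h2 : PPath T (Sum.inr ⟨_, hd⟩) 1 (Sum.inl r) := PPath.single ⟨rfl, rfl⟩
        simpa using this.trans h2
    · rintro ⟨x, y, hx, hy, h⟩
      have key : ∀ x e y, PPath T x e y → ∀ r, y = Sum.inl r → 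
          (match x with
            | Sum.inl q => PPath (fun q e r => ∃ b P, (q, b, P, r) ∈ D ∧
                ∃ c ∈ Submonoid.closure P, e = b * c) q e r
            | Sum.inr d => ∃ c ∈ Submonoid.closure d.1.2.2.1, ∃ f, e = c * f ∧
               PPath (fun q e r => ∃ b P, (q, b, P, r) ∈ D ∧
                ∃ c ∈ Submonoid.closure P, e = b * c) d.1.2.2.2 f r) := by
        intro x e y h
        induction h with
        | nil q => rintro r rfl; exact PPath.nil _
        | @cons q r s e f ht _ ih =>
          intro r' hr'
          have ih := ih r' hr'
          rcases q with q | d <;> rcases r with r | d'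
          · exact ht.elim
          · obtain ⟨h1, h2⟩ := ht
            obtain ⟨c, hc, f', rfl, hp⟩ := ih
            subst h1 h2
            simp only [← mul_assoc]
            exact PPath.cons ⟨_, _, d'.2, c, hc, rfl⟩ hp
          · obtain ⟨rfl, rfl⟩ := ht
            exact ⟨1, Submonoid.one_mem _, f, rfl, ih⟩
          · obtain ⟨rfl, h2⟩ := ht
            obtain ⟨c, hc, f', rfl, hp⟩ := ih
            exact ⟨e * c, Submonoid.mul_mem _ (Submonoid.subset_closure h2) hc, f', by
              rw [mul_assoc], hp⟩
      rcases x with q | d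
      · rcases y with r | d'
        · exact ⟨q, r, hx, hy, key _ _ _ h r rfl⟩
        · exact hy.elim
      · exact hx.elim

/-- Restricting a rational set by a recognizable condition on images of letters. -/
theorem rational_inter {C : Type u} [Finite C] {N : Type u} [Monoid N] [Finite N]
    (S : Set (Monoid.End (FreeMonoid C))) (hS : RationalSet S) (φ : C → N)
    (Φ : (C → N) → Prop) :
    RationalSet {h | h ∈ S ∧ Φ (fun c => FreeMonoid.lift φ (h (FreeMonoid.of c)))} := by
  rw [rational_iff] at hS ⊢
  obtain ⟨Q, _, I, F, T, hT, rfl⟩ := hS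
  let act : (C → N) → Monoid.End (FreeMonoid C) → (C → N) := fun f e c =>
    FreeMonoid.lift f (e (FreeMonoid.of c))
  have act_lift : ∀ f e w, FreeMonoid.lift (act f e) w = FreeMonoid.lift f (e w) := by
    intro f e w
    have : FreeMonoid.lift (act f e) = (FreeMonoid.lift f).comp e := by
      apply FreeMonoid.hom_eq
      intro x
      rw [FreeMonoid.lift_eval_of]; rfl
    rw [this]; rfl
  have act_one : ∀ f, act f 1 = f := by intro f; funext c; simp [act]
  have act_mul : ∀ f e g, act f (e * g) = act (act f e) g := by
    intro f e g; funext c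
    show FreeMonoid.lift f (e (g _)) = FreeMonoid.lift (act f e) (g _)
    rw [act_lift]
  let T' : Q × (C → N) → Monoid.End (FreeMonoid C) → Q × (C → N) → Prop := fun x e y =>
    T x.1 e y.1 ∧ y.2 = act x.2 e
  have key : ∀ q e r, PPath T q e r → ∀ f, PPath T' (q, f) e (r, act f e) := by
    intro q e r h
    induction h with
    | nil q => intro f; rw [act_one]; exact PPath.nil _
    | @cons q r s e g ht _ ih =>
      intro f
      rw [act_mul]
      exact PPath.cons (r := (r, act f e)) ⟨ht, rfl⟩ (ih _)
  have key2 : ∀ x e y, PPath T' x e y → PPath T x.1 e y.1 ∧ y.2 = act x.2 e := by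
    intro x e y h
    induction h with
    | nil q => exact ⟨PPath.nil _, (act_one _).symm⟩
    | @cons q r s e g ht _ ih =>
      exact ⟨PPath.cons ht.1 ih.1, by rw [ih.2, ht.2, act_mul]⟩
  refine ⟨Q × (C → N), inferInstance, fun x => I x.1 ∧ x.2 = φ, fun x => F x.1 ∧ Φ x.2, T', ?_, ?_⟩
  · have := (hT.prod (Set.finite_univ (α := (C → N) × (C → N)))).image
      (fun x : (Q × Monoid.End (FreeMonoid C) × Q) × ((C → N) × (C → N)) =>
        ((x.1.1, x.2.1), x.1.2.1, (x.1.2.2, x.2.2)))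
    refine this.subset ?_
    rintro ⟨⟨q, f⟩, e, ⟨r, g⟩⟩ h
    exact ⟨((q, e, r), (f, g)), ⟨h.1, trivial⟩, rfl⟩
  · ext e
    constructor
    · rintro ⟨⟨q, r, hq, hr, h⟩, hΦ⟩
      exact ⟨(q, φ), (r, act φ e), ⟨hq, rfl⟩, ⟨hr, hΦ⟩, key _ _ _ h _⟩
    · rintro ⟨⟨q, f⟩, ⟨r, g⟩, ⟨hq, hf⟩, ⟨hr, hg⟩, h⟩
      obtain ⟨h1, h2⟩ := key2 _ _ _ h
      simp only at hf h2
      subst hf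
      refine ⟨⟨q, r, hq, hr, h1⟩, ?_⟩
      simp only at hg
      rw [h2] at hg
      exact hg

/-! ### Words with involution -/

def lstar {α : Type u} (f : α → α) (l : List α) : List α := (l.map f).reverse

theorem lstar_nil {α : Type u} (f : α → α) : lstar f [] = [] := rfl

theorem lstar_append {α : Type u} (f : α → α) (l m : List α) :
    lstar f (l ++ m) = lstar f m ++ lstar f l := by simp [lstar]

theorem lstar_singleton {α : Type u} (f : α → α) (a : α) : lstar f [a] = [f a] := rfl

theorem lstar_cons {α : Type u} (f : α → α) (a : α) (l : List α) :
    lstar f (a :: l) = lstar f l ++ [f a] := by simp [lstar]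

theorem lstar_lstar {α : Type u} {f : α → α} (hf : Function.Involutive f) (l : List α) :
    lstar f (lstar f l) = l := by
  simp [lstar, hf.comp_self]

theorem lstar_eq_nil {α : Type u} {f : α → α} {l : List α} : lstar f l = [] ↔ l = [] := by
  simp [lstar]

theorem length_lstar {α : Type u} (f : α → α) (l : List α) : (lstar f l).length = l.length := by
  simp [lstar]

theorem mem_lstar {α : Type u} {f : α → α} {l : List α} {a : α} :
    a ∈ lstar f l ↔ ∃ b ∈ l, f b = a := by simp [lstar]

theorem lstar_flatten {α : Type u} (f : α → α) (L : List (List α)) :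
    lstar f L.flatten = (lstar (lstar f) L).flatten := by
  induction L with
  | nil => rfl
  | cons a L ih => rw [List.flatten_cons, lstar_append, lstar_cons, ih]; simp

theorem lstar_map {α β : Type u} (f : α → α) (g : β → β) (k : α → β)
    (hk : ∀ a, k (f a) = g (k a)) (l : List α) : lstar g (l.map k) = (lstar f l).map k := by
  simp [lstar, hk, List.map_reverse]

/-- Compatibility of a letter-to-word map with involutions. -/
def BC {α β : Type u} (f : α → α) (g : β → β) (σ : β → List α) : Prop :=
  ∀ v, σ (g v) = lstar f (σ v)

theorem BC.flatMap {α β : Type u} {f : α → α} {g : β → β} {σ : β → List α} (h : BC f g σ)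
    (l : List β) : (lstar g l).flatMap σ = lstar f (l.flatMap σ) := by
  induction l with
  | nil => rfl
  | cons a l ih => rw [lstar_cons, List.flatMap_append, ih]; simp [lstar_append, h a]

def Red {A : Type u} (ba : A → A) (l : List A) : Prop := l.IsChain (fun x y => y ≠ ba x)

theorem chain_sub {α : Type u} {r : α → α → Prop} {l m : List α} (h : m.IsChain r) (hl : l <:+: m) :
    l.IsChain r := by
  obtain ⟨p, q, rfl⟩ := hl
  exact h.left_of_append.right_of_append

theorem Red.of_sub {A : Type u} {ba : A → A} {l m : List A} (h : Red ba m) (hl : l <:+: m) :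
    Red ba l := chain_sub h hl

theorem red_lstar {A : Type u} {ba : A → A} (hba : Function.Involutive ba) {l : List A}
    (h : Red ba l) : Red ba (lstar ba l) := by
  unfold Red lstar at *
  rw [List.isChain_reverse, List.isChain_map]
  refine h.imp ?_
  intro a b hab
  simp only [ne_eq]
  intro h2
  apply hab
  rw [h2, hba]

theorem red_selfbar {A : Type u} {ba : A → A} (hba : Function.Involutive ba)
    (hfp : ∀ a, ba a ≠ a) (l : List A) (h : Red ba l) (hl : lstar ba l = l) : l = [] := by
  induction hn : l.length using Nat.strong_induction_on generalizing l with
  | _ n ih =>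
    rcases l with _ | ⟨a, l⟩
    · rfl
    · exfalso
      rcases List.eq_nil_or_concat l with rfl | ⟨m, b, rfl⟩
      · simp [lstar] at hl
        exact hfp a hl
      · rw [List.concat_eq_append] at *
        have h1 : lstar ba (a :: (m ++ [b])) = ba b :: (lstar ba m ++ [ba a]) := by
          simp [lstar]
        rw [h1] at hl
        simp only [List.cons.injEq] at hl
        obtain ⟨h2, h3⟩ := hl
        have h4 := List.append_inj' h3 rfl
        have hm : Red ba m := h.of_sub ⟨[a], [b], by simp⟩
        have := ih m.length (by rw [← hn]; simp) m hm h4.1 rfl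
        subst this
        unfold Red at h
        simp at h
        exact h (by simpa using h4.2.symm)

/-! ### Evaluations and substitutions -/

def ev {C V : Type u} (σ : V → List C) : C ⊕ V → List C := Sum.elim (fun c => [c]) σ

def sub {C V : Type u} (τ : V → List (C ⊕ V)) : C ⊕ V → List (C ⊕ V) :=
  Sum.elim (fun c => [Sum.inl c]) τ

def hS {C V : Type u} (h : C → List C) : C ⊕ V → List (C ⊕ V) :=
  Sum.elim (fun c => (h c).map Sum.inl) (fun v => [Sum.inr v])

theorem BC.ev {C V : Type u} {cb : C → C} {vb : V → V} {σ : V → List C} (h : BC cb vb σ) :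
    BC cb (Sum.map cb vb) (ev σ) := by
  rintro (c | v)
  · rfl
  · exact h v

theorem BC.sub {C V : Type u} {cb : C → C} {vb : V → V} {τ : V → List (C ⊕ V)}
    (h : BC (Sum.map cb vb) vb τ) : BC (Sum.map cb vb) (Sum.map cb vb) (sub τ) := by
  rintro (c | v)
  · rfl
  · exact h v

theorem flatMap_map_inl_ev {C V : Type u} (σ : V → List C) (l : List C) :
    (l.map Sum.inl).flatMap (ev σ) = l := by
  induction l with
  | nil => rfl
  | cons a l ih => rw [List.map_cons, List.flatMap_cons, ih]; rfl

theorem ev_sub {C V : Type u} (σ : V → List C) (τ : V → List (C ⊕ V)) (w : List (C ⊕ V)) :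
    (w.flatMap (sub τ)).flatMap (ev σ) = w.flatMap (ev (fun v => (τ v).flatMap (ev σ))) := by
  rw [List.flatMap_assoc]
  congr 1
  funext x
  rcases x with c | v
  · rfl
  · rfl

theorem ev_hS {C V : Type u} (σ : V → List C) (h : C → List C) (w : List (C ⊕ V)) :
    (w.flatMap (hS h)).flatMap (ev (fun v => (σ v).flatMap h)) = (w.flatMap (ev σ)).flatMap h := by
  rw [List.flatMap_assoc, List.flatMap_assoc]
  congr 1
  funext x
  rcases x with c | v
  · simp [hS, ev]
    exact flatMap_map_inl_ev _ _
  · simp [hS, ev]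

theorem BC.comp {α β γ : Type u} {f : α → α} {g : β → β} {k : γ → γ} {σ : β → List α}
    {τ : γ → List β} (h : BC f g σ) (h' : BC g k τ) : BC f k (fun v => (τ v).flatMap σ) := by
  intro v
  simp only
  rw [h' v, h.flatMap]

theorem sound_step {C V I : Type u} {cb : C → C} {vb : V → V} {h : C → List C}
    (hh : BC cb cb h) {τ : V → List (C ⊕ V)} (hτ : BC (Sum.map cb vb) vb τ)
    {W W' : I → List (C ⊕ V)} (hW : ∀ i, (W i).flatMap (sub τ) = (W' i).flatMap (hS h))
    (σ' : V → List C) (hσ' : BC cb vb σ') :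
    ∃ σ : V → List C, BC cb vb σ ∧
      ∀ i, (W i).flatMap (ev σ) = ((W' i).flatMap (ev σ')).flatMap h := by
  refine ⟨fun v => (τ v).flatMap (ev (fun v => (σ' v).flatMap h)), ?_, ?_⟩
  · exact BC.comp (BC.ev (BC.comp hh hσ')) hτ
  · intro i
    rw [← ev_sub, hW, ev_hS]

/-! ### Tokens -/

theorem isChain_lstar_iff {α : Type u} {f : α → α} {r s : α → α → Prop} {l : List α}
    (hrs : ∀ a b, r (f b) (f a) ↔ s a b) :
    (lstar f l).IsChain r ↔ l.IsChain s := by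
  unfold lstar
  rw [List.isChain_reverse, List.isChain_map]
  constructor <;> intro h <;> refine h.imp ?_ <;> intro a b hab
  · exact (hrs a b).1 hab
  · exact (hrs a b).2 hab

theorem splitBy_lstar {α : Type u} {f : α → α} {r : α → α → Bool}
    (hr : ∀ x y, r (f y) (f x) = r x y) (l : List α) :
    (lstar f l).splitBy r = lstar (lstar f) (l.splitBy r) := by
  rw [List.splitBy_eq_iff]
  refine ⟨?_, ?_, ?_, ?_⟩
  · rw [← lstar_flatten, List.flatten_splitBy]
  · rw [mem_lstar]
    rintro ⟨b, hb, h⟩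
    rw [lstar_eq_nil] at h
    exact List.ne_nil_of_mem_splitBy hb h
  · intro m hm
    rw [mem_lstar] at hm
    obtain ⟨b, hb, rfl⟩ := hm
    rw [isChain_lstar_iff (s := fun x y => r x y = true)]
    · exact List.isChain_of_mem_splitBy hb
    · intro a b; rw [hr]
  · rw [isChain_lstar_iff (s := fun a b => ∃ ha hb, r (a.getLast ha) (b.head hb) = false)]
    · exact List.isChain_getLast_head_splitBy r l
    · intro a b
      constructor
      · rintro ⟨ha, hb, h⟩
        have ha' : a ≠ [] := fun h0 => hb (by simp [h0, lstar])
        have hb' : b ≠ [] := fun h0 => ha (by simp [h0, lstar])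
        refine ⟨ha', hb', ?_⟩
        rw [← hr]
        simpa [lstar, List.head_map, List.getLast_map] using h
      · rintro ⟨ha, hb, h⟩
        refine ⟨by simpa [lstar] using hb, by simpa [lstar] using ha, ?_⟩
        rw [← hr] at h
        simpa [lstar, List.head_map, List.getLast_map] using h

theorem length_splitBy_append_le {α : Type u} (r : α → α → Bool) (l m : List α) :
    ((l ++ m).splitBy r).length ≤ (l.splitBy r).length + (m.splitBy r).length := by
  by_cases h : ∀ x ∈ l.getLast?, ∀ y ∈ m.head?, r x y = false
  · rw [List.splitBy_append h]; simp
  · push Not at h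
    obtain ⟨x, hx, y, hy, hxy⟩ := h
    simp only [ne_eq, Bool.not_eq_false] at hxy
    have hl : l.splitBy r ≠ [] := by
      rw [List.splitBy_ne_nil]; rintro rfl; simp at hx
    have hm : m.splitBy r ≠ [] := by
      rw [List.splitBy_ne_nil]; rintro rfl; simp at hy
    obtain ⟨G, g, hG⟩ : ∃ G g, l.splitBy r = G ++ [g] :=
      ⟨_, _, (List.dropLast_append_getLast hl).symm⟩
    obtain ⟨g', G', hG'⟩ : ∃ g' G', m.splitBy r = g' :: G' := List.exists_cons_of_ne_nil hm
    have el : l = G.flatten ++ g := by rw [← List.flatten_splitBy r l, hG]; simp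
    have em : m = g' ++ G'.flatten := by rw [← List.flatten_splitBy r m, hG']; simp
    have hgn : g ≠ [] := List.ne_nil_of_mem_splitBy (r := r) (l := l) (by simp [hG])
    have hgn' : g' ≠ [] := List.ne_nil_of_mem_splitBy (r := r) (l := m) (by simp [hG'])
    have c1 := List.isChain_getLast_head_splitBy r l
    have c2 := List.isChain_getLast_head_splitBy r m
    rw [hG] at c1
    rw [hG'] at c2
    have key : (l ++ m).splitBy r = G ++ (g ++ g') :: G' := by
      rw [List.splitBy_eq_iff]
      refine ⟨?_, ?_, ?_, ?_⟩
      · simp [el, em]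
      · have h1 := List.nil_notMem_splitBy r l
        have h2 := List.nil_notMem_splitBy r m
        rw [hG] at h1; rw [hG'] at h2
        simp at h1 h2 ⊢
        tauto
      · intro k hk
        simp only [List.mem_append, List.mem_cons] at hk
        rcases hk with hk | rfl | hk
        · exact List.isChain_of_mem_splitBy (l := l) (by simp [hG, hk])
        · rw [List.isChain_append]
          refine ⟨List.isChain_of_mem_splitBy (l := l) (by simp [hG]),
            List.isChain_of_mem_splitBy (l := m) (by simp [hG']), ?_⟩
          intro x' hx' y' hy'
          have : x' = x := by
            rw [el, List.getLast?_append_of_ne_nil _ hgn] at hx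
            exact Option.mem_unique hx' hx
          have : y' = y := by
            rw [em, List.head?_append_of_ne_nil _ hgn'] at hy
            exact Option.mem_unique hy' hy
          subst_vars; exact hxy
        · exact List.isChain_of_mem_splitBy (l := m) (by simp [hG', hk])
      · rw [List.isChain_append] at c1 ⊢
        refine ⟨c1.1, ?_, ?_⟩
        · rw [List.isChain_cons] at c2 ⊢
          refine ⟨?_, c2.2⟩
          intro y hy
          obtain ⟨h1, h2, h3⟩ := c2.1 y hy
          exact ⟨by simp [hgn], h2, by rw [List.getLast_append_of_ne_nil _ h1]; exact h3⟩
        · intro x hx y hy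
          obtain ⟨h1, h2, h3⟩ := c1.2.2 x hx g (by simp)
          simp at hy
          subst hy
          exact ⟨h1, by simp [hgn], by rw [List.head_append_of_ne_nil hgn]; exact h3⟩
    rw [key, hG, hG']
    simp

theorem length_splitBy_flatten_le {α : Type u} (r : α → α → Bool) (L : List (List α)) :
    (L.flatten.splitBy r).length ≤ (L.map (fun l => (l.splitBy r).length)).sum := by
  induction L with
  | nil => simp
  | cons a L ih =>
    simp only [List.flatten_cons, List.map_cons, List.sum_cons]
    exact (length_splitBy_append_le r _ _).trans (by omega)

section compress
variable {A C V I : Type u}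

def glueS (glue : C → C → Bool) : C ⊕ V → C ⊕ V → Bool
  | Sum.inl a, Sum.inl b => glue a b
  | _, _ => false

def lets (g : List (C ⊕ V)) : List C := g.flatMap (ev (fun _ => []))

theorem lets_map (t : List C) : lets (t.map (Sum.inl : C → C ⊕ V)) = t := flatMap_map_inl_ev _ _

theorem group_cases {glue : C → C → Bool} (g : List (C ⊕ V))
    (hc : g.IsChain (fun x y => glueS glue x y = true)) (hg : g ≠ []) :
    (∃ v, g = [Sum.inr v]) ∨ ∃ t, t ≠ [] ∧ g = t.map Sum.inl := by
  induction g with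
  | nil => exact absurd rfl hg
  | cons x g ih =>
    rcases g with _ | ⟨y, g⟩
    · rcases x with c | v
      · exact Or.inr ⟨[c], by simp, by simp⟩
      · exact Or.inl ⟨v, rfl⟩
    · rw [List.isChain_cons_cons] at hc
      rcases x with c | v
      · rcases ih hc.2 (by simp) with ⟨v, hv⟩ | ⟨t, ht, h⟩
        · simp only [List.cons.injEq] at hv
          rw [hv.1] at hc
          simp [glueS] at hc
        · exact Or.inr ⟨c :: t, by simp, by simp [h]⟩
      · simp [glueS] at hc

/-- Tokens represented by a group. -/
def grpTok (glue : C → C → Bool) (s : V → List C) : List (C ⊕ V) → List (List C)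
  | [Sum.inr v] => (s v).splitBy glue
  | g => [lets g]

theorem grpTok_map (glue : C → C → Bool) (s : V → List C) (t : List C) :
    grpTok glue s (t.map Sum.inl) = [t] := by
  rcases t with _ | ⟨a, t⟩
  · rfl
  · show [lets ((a :: t).map Sum.inl)] = _
    rw [lets_map]

/-- Adjacent symbols not both letters have values that are not glued. -/
def NG (glue : C → C → Bool) (s : V → List C) : C ⊕ V → C ⊕ V → Prop
  | Sum.inl _, Sum.inl _ => True
  | x, y => ∀ a ∈ (ev s x).getLast?, ∀ b ∈ (ev s y).head?, glue a b = false

theorem splitBy_ev_groups {glue : C → C → Bool} (s : V → List C) (G : List (List (C ⊕ V)))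
    (h1 : ∀ g ∈ G, g ≠ []) (h2 : ∀ g ∈ G, g.IsChain (fun x y => glueS glue x y = true))
    (h3 : G.IsChain fun a b ↦ ∃ ha hb, glueS glue (a.getLast ha) (b.head hb) = false)
    (h4 : G.flatten.IsChain (NG glue s)) (h5 : ∀ x ∈ G.flatten, ev s x ≠ []) :
    (G.flatten.flatMap (ev s)).splitBy glue = G.flatMap (grpTok glue s) := by
  induction G with
  | nil => rfl
  | cons g G ih =>
    have ih' := ih (fun g hg => h1 g (by simp [hg])) (fun g hg => h2 g (by simp [hg])) h3.tail
      (by rw [List.flatten_cons, List.isChain_append] at h4; exact h4.2.1)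
      (fun x hx => h5 x (by simp [hx]))
    have hgn := h1 g (by simp)
    have hg1 : (g.flatMap (ev s)).splitBy glue = grpTok glue s g := by
      rcases group_cases g (h2 g (by simp)) hgn with ⟨v, rfl⟩ | ⟨t, ht, rfl⟩
      · simp [ev, grpTok]
      · rw [flatMap_map_inl_ev, grpTok_map, List.splitBy_of_isChain ht]
        have := h2 _ (List.mem_cons_self)
        rw [List.isChain_map] at this
        exact this
    rw [List.flatten_cons, List.flatMap_append, List.flatMap_cons, List.splitBy_append, ih', hg1]
    intro a ha b hb
    -- last symbol of g
    obtain ⟨g0, x, rfl⟩ : ∃ g0 x, g = g0 ++ [x] := ⟨_, _, (List.dropLast_append_getLast hgn).symm⟩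
    rcases hw : G.flatten with _ | ⟨y, w'⟩
    · rw [hw] at hb; simp at hb
    rw [hw] at hb
    have hx : ev s x ≠ [] := h5 x (by simp)
    have hy : ev s y ≠ [] := h5 y (by simp only [List.flatten_cons, List.mem_append, hw]; simp)
    rw [List.flatMap_append, List.flatMap_cons, List.flatMap_nil, List.append_nil,
      List.getLast?_append_of_ne_nil _ hx] at ha
    rw [List.flatMap_cons, List.head?_append_of_ne_nil _ hy] at hb
    have hNG : NG glue s x y := by
      rw [List.flatten_cons, List.isChain_append] at h4
      exact h4.2.2 x (by simp) y (by rw [hw]; rfl)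
    have hgl : glueS glue x y = false := by
      rcases G with _ | ⟨g', G⟩
      · simp at hw
      · rw [List.isChain_cons_cons] at h3
        obtain ⟨ha', hb', h⟩ := h3.1
        rcases g' with _ | ⟨y', g'⟩
        · exact absurd rfl hb'
        · simp at hw h
          rw [← hw.1]; exact h
    rcases x with c | v
    · rcases y with d | v'
      · simp [ev] at ha hb
        subst ha hb
        exact hgl
      · exact hNG a ha b hb
    · exact hNG a ha b hb

theorem splitBy_ev {glue : C → C → Bool} (s : V → List C) (w : List (C ⊕ V))
    (h4 : w.IsChain (NG glue s)) (h5 : ∀ x ∈ w, ev s x ≠ []) :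
    (w.flatMap (ev s)).splitBy glue = (w.splitBy (glueS glue)).flatMap (grpTok glue s) := by
  have := splitBy_ev_groups (glue := glue) s (w.splitBy (glueS glue))
    (fun g hg => List.ne_nil_of_mem_splitBy hg) (fun g hg => List.isChain_of_mem_splitBy hg)
    (List.isChain_getLast_head_splitBy _ _) (by rwa [List.flatten_splitBy])
    (by rwa [List.flatten_splitBy])
  rwa [List.flatten_splitBy] at this

def mid {α : Type u} (T : List α) : List α := T.tail.dropLast

theorem mid_lstar {α : Type u} (f : α → α) (T : List α) : mid (lstar f T) = lstar f (mid T) := by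
  unfold mid lstar
  rw [List.tail_reverse, List.dropLast_reverse]
  congr 1
  rw [List.map_dropLast, List.map_tail, List.tail_dropLast]

theorem tok_cases {α : Type u} (T : List α) : T = [] ∨ (∃ t, T = [t]) ∨
    ∃ p q, T = p :: (mid T ++ [q]) := by
  rcases T with _ | ⟨p, T⟩
  · exact Or.inl rfl
  · rcases List.eq_nil_or_concat T with rfl | ⟨m, q, rfl⟩
    · exact Or.inr (Or.inl ⟨p, rfl⟩)
    · refine Or.inr (Or.inr ⟨p, q, ?_⟩)
      simp [mid]

noncomputable def tauT (v : V) (T : List (List C)) : List (C ⊕ V) :=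
  if T.length ≤ 1 then T.flatten.map Sum.inl
  else (T.head?.getD []).map Sum.inl ++ ((if mid T = [] then [] else [Sum.inr v]) ++
    (T.getLast?.getD []).map Sum.inl)

theorem tauT_nil (v : V) : tauT v ([] : List (List C)) = [] := by simp [tauT]

theorem tauT_one (v : V) (t : List C) : tauT v [t] = t.map Sum.inl := by simp [tauT]

theorem tauT_two (v : V) (p q : List C) (m : List (List C)) :
    tauT v (p :: (m ++ [q])) = p.map Sum.inl ++ ((if m = [] then [] else [Sum.inr v]) ++
      q.map Sum.inl) := by
  have : mid (p :: (m ++ [q])) = m := by simp [mid]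
  unfold tauT
  rw [if_neg (by simp), this, ← List.cons_append, List.getLast?_concat]
  simp

theorem tauT_lstar (cb : C → C) (vb : V → V) (v : V) (T : List (List C)) :
    tauT (vb v) (lstar (lstar cb) T) = lstar (Sum.map cb vb) (tauT v T) := by
  have hm : ∀ t : List C, lstar (Sum.map cb vb) (t.map Sum.inl) = (lstar cb t).map Sum.inl :=
    fun t => lstar_map cb (Sum.map cb vb) Sum.inl (fun a => rfl) t
  rcases tok_cases T with rfl | ⟨t, rfl⟩ | ⟨p, q, h⟩
  · simp [lstar, tauT_nil]
  · rw [lstar_singleton, tauT_one, tauT_one, hm]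
  · generalize mid T = m at h
    subst h
    have : lstar (lstar cb) (p :: (m ++ [q])) =
      lstar cb q :: (lstar (lstar cb) m ++ [lstar cb p]) := by
      rw [lstar_cons, lstar_append]; rfl
    rw [this, tauT_two, tauT_two, lstar_append, lstar_append, hm, hm]
    by_cases h0 : m = []
    · simp [h0, lstar]
    · rw [if_neg h0, if_neg (by rwa [lstar_eq_nil])]
      simp [lstar]

theorem ev_tauT (s : V → List C) (v : V) (T : List (List C)) (hs : s v = (mid T).flatten) :
    (tauT v T).flatMap (ev s) = T.flatten := by
  rcases tok_cases T with rfl | ⟨t, rfl⟩ | ⟨p, q, h⟩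
  · simp [tauT_nil]
  · rw [tauT_one, flatMap_map_inl_ev]; simp
  · generalize hm : mid T = m at h hs
    subst h
    rw [tauT_two, List.flatMap_append, List.flatMap_append, flatMap_map_inl_ev, flatMap_map_inl_ev]
    by_cases h0 : m = []
    · simp [h0]
    · rw [if_neg h0]; simp [ev, hs]

/-- good ends: chain of not glued symbols with letter ends -/
def EndsOK (glue : C → C → Bool) (s : V → List C) (w : List (C ⊕ V)) : Prop :=
  w.IsChain (NG glue s) ∧ (∀ x ∈ w.head?, ∃ c, x = Sum.inl c) ∧
  (∀ x ∈ w.getLast?, ∃ c, x = Sum.inl c) ∧ ∀ x ∈ w, ev s x ≠ []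

theorem EndsOK.append {glue : C → C → Bool} {s : V → List C} {w w' : List (C ⊕ V)}
    (h : EndsOK glue s w) (h' : EndsOK glue s w') : EndsOK glue s (w ++ w') := by
  rcases eq_or_ne w [] with rfl | hw
  · simpa using h'
  rcases eq_or_ne w' [] with rfl | hw'
  · simpa using h
  refine ⟨?_, ?_, ?_, ?_⟩
  · rw [List.isChain_append]
    refine ⟨h.1, h'.1, ?_⟩
    intro x hx y hy
    obtain ⟨c, rfl⟩ := h.2.2.1 x hx
    obtain ⟨d, rfl⟩ := h'.2.1 y hy
    trivial
  · rw [List.head?_append_of_ne_nil _ hw]; exact h.2.1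
  · rw [List.getLast?_append_of_ne_nil _ hw']; exact h'.2.2.1
  · intro x hx
    rw [List.mem_append] at hx
    exact hx.elim (h.2.2.2 x) (h'.2.2.2 x)

theorem endsOK_map (glue : C → C → Bool) (s : V → List C) (t : List C) :
    EndsOK glue s (t.map Sum.inl) := by
  refine ⟨?_, ?_, ?_, ?_⟩
  · rw [List.isChain_map]
    induction t with
    | nil => simp
    | cons a t ih => rw [List.isChain_cons]; exact ⟨fun _ _ => trivial, ih⟩
  · intro x hx
    rw [List.head?_map] at hx
    simp at hx; obtain ⟨a, _, rfl⟩ := hx; exact ⟨a, rfl⟩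
  · intro x hx
    rw [List.getLast?_map] at hx
    simp at hx; obtain ⟨a, _, rfl⟩ := hx; exact ⟨a, rfl⟩
  · intro x hx
    simp at hx; obtain ⟨a, _, rfl⟩ := hx
    simp [ev]

theorem endsOK_tauT (glue : C → C → Bool) (s : V → List C) (v : V) (w : List C)
    (hs : s v = (mid (w.splitBy glue)).flatten) : EndsOK glue s (tauT v (w.splitBy glue)) := by
  rcases tok_cases (w.splitBy glue) with h | ⟨t, h⟩ | ⟨p, q, h⟩
  · rw [h, tauT_nil]; exact endsOK_map glue s []
  · rw [h, tauT_one]; exact endsOK_map glue s t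
  · have hch := List.isChain_getLast_head_splitBy glue w
    have hne : ∀ g ∈ w.splitBy glue, g ≠ [] := fun g hg => List.ne_nil_of_mem_splitBy hg
    generalize w.splitBy glue = T at h hch hs hne
    generalize hm : mid T = m at h hs
    subst h
    rw [tauT_two]
    by_cases h0 : m = []
    · rw [if_pos h0]; simp only [List.nil_append]
      exact (endsOK_map glue s p).append (endsOK_map glue s q)
    · rw [if_neg h0]
      have hp := hne p (by simp)
      have hq := hne q (by simp)
      obtain ⟨m0, m', rfl⟩ := List.exists_cons_of_ne_nil h0
      have hm0 : m0 ≠ [] := hne m0 (by simp)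
      have hsn : s v ≠ [] := by rw [hs]; simp [hm0]
      refine ⟨?_, ?_, ?_, ?_⟩
      · rw [List.isChain_append, List.isChain_append]
        refine ⟨(endsOK_map glue s p).1, ⟨by simp, (endsOK_map glue s q).1, ?_⟩, ?_⟩
        · intro x hx y hy
          simp at hx; subst hx
          intro a ha b hb
          obtain ⟨m1, m2, h12⟩ : ∃ m1 m2, m0 :: m' = m1 ++ [m2] :=
            ⟨_, _, (List.dropLast_append_getLast h0).symm⟩
          have hm2 : m2 ≠ [] := hne m2 (by rw [h12]; simp)
          rw [h12] at hch hs
          have h3 : [m2, q].IsChain (fun a b ↦ ∃ ha hb, glue (a.getLast ha) (b.head hb) = false) :=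
            chain_sub hch ⟨p :: m1, [], by simp⟩
          simp only [List.isChain_cons_cons] at h3
          obtain ⟨h4, h5, h6⟩ := h3.1
          have e1 : a = m2.getLast h4 := by
            have : (ev s (Sum.inr v)).getLast? = some (m2.getLast h4) := by
              show (s v).getLast? = _
              rw [hs, List.flatten_append]
              simp only [List.flatten_cons, List.flatten_nil, List.append_nil]
              rw [List.getLast?_append_of_ne_nil _ hm2, List.getLast?_eq_getLast_of_ne_nil]
            rw [this] at ha; simpa using ha.symm
          have e2 : b = q.head h5 := by
            rcases q with _ | ⟨q0, q⟩
            · exact absurd rfl h5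
            · simp at hy; subst hy; simp [ev] at hb; simp [hb]
          rw [e1, e2, h6]
        · intro x hx y hy
          simp at hy; subst hy
          have h3 : [p, m0].IsChain (fun a b ↦ ∃ ha hb, glue (a.getLast ha) (b.head hb) = false) :=
            chain_sub hch ⟨[], m' ++ [q], by simp⟩
          simp only [List.isChain_cons_cons] at h3
          obtain ⟨h4, h5, h6⟩ := h3.1
          have hx' : x = Sum.inl (p.getLast h4) := by
            rw [List.getLast?_map, List.getLast?_eq_getLast_of_ne_nil h4] at hx
            simpa using hx.symm
          subst hx'
          intro a ha b hb
          have e1 : a = p.getLast h4 := by simpa [ev] using ha.symm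
          have e2 : b = m0.head h5 := by
            have : (ev s (Sum.inr v)).head? = some (m0.head h5) := by
              show (s v).head? = _
              rw [hs]
              simp only [List.flatten_cons]
              rw [List.head?_append_of_ne_nil _ hm0, List.head?_eq_some_head]
            rw [this] at hb; simpa using hb.symm
          rw [e1, e2, h6]
      · rw [List.head?_append_of_ne_nil _ (by simpa using hp)]; exact (endsOK_map glue s p).2.1
      · rw [← List.append_assoc, List.getLast?_append_of_ne_nil _ (by simpa using hq)]
        exact (endsOK_map glue s q).2.2.1
      · intro x hx
        simp only [List.mem_append, List.mem_singleton] at hx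
        rcases hx with hx | rfl | hx
        · exact (endsOK_map glue s p).2.2.2 x hx
        · exact hsn
        · exact (endsOK_map glue s q).2.2.2 x hx

theorem endsOK_flatMap (glue : C → C → Bool) (s : V → List C) (τ : V → List (C ⊕ V))
    (h : ∀ v, EndsOK glue s (τ v)) (w : List (C ⊕ V)) : EndsOK glue s (w.flatMap (sub τ)) := by
  induction w with
  | nil => exact endsOK_map glue s []
  | cons x w ih =>
    rw [List.flatMap_cons]
    refine EndsOK.append ?_ ih
    rcases x with c | v
    · exact endsOK_map glue s [c]
    · exact h v

end compress

section compress2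
variable {A C V I : Type u}

structure WGood (ba : A → A) (cb : C → C) (vb : V → V) (Eqs : I → I → Prop) (P : C → Prop)
    (α : C → List A) (W : I → List (C ⊕ V)) (σ : V → List C) : Prop where
  bcσ : BC cb vb σ
  bcα : BC ba cb α
  okW : ∀ i c, Sum.inl c ∈ W i → P c ∧ α c ≠ []
  okσ : ∀ v, ∀ c ∈ σ v, P c ∧ α c ≠ []
  eqs : ∀ i j, Eqs i j → (W i).flatMap (ev σ) = (W j).flatMap (ev σ)
  red : ∀ i, Red ba (((W i).flatMap (ev σ)).flatMap α)

def nmS (nm : List C → C) : List (C ⊕ V) → C ⊕ V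
  | [Sum.inr v] => Sum.inr v
  | g => Sum.inl (nm (lets g))

theorem nmS_map (nm : List C → C) (t : List C) :
    nmS nm (t.map (Sum.inl : C → C ⊕ V)) = Sum.inl (nm t) := by
  rcases t with _ | ⟨a, t⟩
  · rfl
  · show Sum.inl (nm (lets ((a :: t).map Sum.inl))) = _
    rw [lets_map]

noncomputable def cτ (glue : C → C → Bool) (σ : V → List C) (v : V) : List (C ⊕ V) :=
  tauT v ((σ v).splitBy glue)

noncomputable def cG (glue : C → C → Bool) (σ : V → List C) (W : I → List (C ⊕ V)) (i : I) :
    List (List (C ⊕ V)) :=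
  ((W i).flatMap (sub (cτ glue σ))).splitBy (glueS glue)

noncomputable def cW (glue : C → C → Bool) (nm : List C → C) (σ : V → List C)
    (W : I → List (C ⊕ V)) (i : I) : List (C ⊕ V) := (cG glue σ W i).map (nmS nm)

noncomputable def cN (D : Set (List C)) (nm : List C → C) (α : C → List A) (iA : A → C)
    (t : List C) : List C := if t ∈ D then [nm t] else (t.flatMap α).map iA

noncomputable def cσ (glue : C → C → Bool) (D : Set (List C)) (nm : List C → C) (α : C → List A)
    (iA : A → C) (σ : V → List C) (v : V) : List C :=
  (mid ((σ v).splitBy glue)).flatMap (cN D nm α iA)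

def cα (h : C → List C) (α : C → List A) (c : C) : List A := (h c).flatMap α

theorem cG_group {glue : C → C → Bool} {σ : V → List C} {W : I → List (C ⊕ V)} {i : I}
    {g : List (C ⊕ V)} (hg : g ∈ cG glue σ W i) :
    (∃ v, g = [Sum.inr v]) ∨ ∃ t, t ≠ [] ∧ g = t.map Sum.inl :=
  group_cases (glue := glue) g (List.isChain_of_mem_splitBy hg) (List.ne_nil_of_mem_splitBy hg)

theorem cG_tok {glue : C → C → Bool} {σ : V → List C} {W : I → List (C ⊕ V)} (i : I) :
    ((W i).flatMap (ev σ)).splitBy glue = (cG glue σ W i).flatMap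
      (grpTok glue (fun v => (mid ((σ v).splitBy glue)).flatten)) := by
  set s : V → List C := fun v => (mid ((σ v).splitBy glue)).flatten with hs
  have h1 : (W i).flatMap (ev σ) = ((W i).flatMap (sub (cτ glue σ))).flatMap (ev s) := by
    rw [ev_sub]
    congr 2
    funext v
    unfold cτ
    rw [ev_tauT s v _ rfl, List.flatten_splitBy]
  rw [h1]
  have := endsOK_flatMap glue s (cτ glue σ) (fun v => endsOK_tauT glue s v (σ v) rfl) (W i)
  exact splitBy_ev s _ this.1 this.2.2.2

theorem splitBy_mid (glue : C → C → Bool) (w : List C) :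
    (mid (w.splitBy glue)).flatten.splitBy glue = mid (w.splitBy glue) := by
  apply List.splitBy_flatten
  · intro h
    exact List.nil_notMem_splitBy glue w (List.mem_of_mem_tail (List.dropLast_subset _ h))
  · intro m hm
    exact List.isChain_of_mem_splitBy (List.mem_of_mem_tail (List.dropLast_subset _ hm))
  · refine chain_sub (List.isChain_getLast_head_splitBy glue w) ?_
    exact (List.dropLast_prefix _).isInfix.trans (List.tail_suffix _).isInfix

theorem cG_sub {glue : C → C → Bool} {σ : V → List C} {W : I → List (C ⊕ V)} {i : I}
    {t : List C} (ht : t.map Sum.inl ∈ cG glue σ W i) : t <:+: (W i).flatMap (ev σ) := by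
  have : t ∈ ((W i).flatMap (ev σ)).splitBy glue := by
    rw [cG_tok, List.mem_flatMap]
    exact ⟨_, ht, by rw [grpTok_map]; simp⟩
  rw [← List.flatten_splitBy glue ((W i).flatMap (ev σ))]
  obtain ⟨a, b, hab⟩ := List.append_of_mem this
  exact ⟨a.flatten, b.flatten, by rw [hab]; simp⟩

theorem cτ_BC {cb : C → C} {vb : V → V} {glue : C → C → Bool} {σ : V → List C}
    (hσ : BC cb vb σ) (hglue : ∀ x y, glue (cb y) (cb x) = glue x y) :
    BC (Sum.map cb vb) vb (cτ glue σ) := by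
  intro v
  unfold cτ
  rw [hσ v, splitBy_lstar hglue, tauT_lstar cb vb]

theorem flatMap_inf {α β : Type u} (f : α → List β) {l m : List α} (h : l <:+: m) :
    l.flatMap f <:+: m.flatMap f := by
  obtain ⟨a, b, rfl⟩ := h
  exact ⟨a.flatMap f, b.flatMap f, by simp⟩

/-- An explicit token is not self-involuting. -/
theorem WGood.tok_ne {ba : A → A} {cb : C → C} {vb : V → V} {Eqs : I → I → Prop} {P : C → Prop}
    {α : C → List A} {W : I → List (C ⊕ V)} {σ : V → List C} (hG : WGood ba cb vb Eqs P α W σ)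
    (hba : Function.Involutive ba) (hfp : ∀ a, ba a ≠ a) {i : I} {t : List C} (htn : t ≠ [])
    (ht : t <:+: (W i).flatMap (ev σ)) : lstar cb t ≠ t := by
  intro h
  have h1 : Red ba (t.flatMap α) := (hG.red i).of_sub (flatMap_inf α ht)
  have h2 : lstar ba (t.flatMap α) = t.flatMap α := by
    rw [← hG.bcα.flatMap, h]
  have h3 := red_selfbar hba hfp _ h1 h2
  rcases t with _ | ⟨c, t⟩
  · exact htn rfl
  · simp only [List.flatMap_cons, List.append_eq_nil_iff] at h3
    have : c ∈ (W i).flatMap (ev σ) := ht.subset (by simp)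
    rw [List.mem_flatMap] at this
    obtain ⟨x, hx, hc⟩ := this
    rcases x with d | v
    · simp [ev] at hc; subst hc
      exact (hG.okW i _ hx).2 h3.1
    · exact (hG.okσ v c hc).2 h3.1

/-- Naming data for a compression step. -/
structure Naming (ba : A → A) (cb : C → C) (iA : A → C) (α : C → List A) (D : Set (List C))
    (nm : List C → C) (h : C → List C) : Prop where
  bch : BC cb cb h
  hA : ∀ a, h (iA a) = [iA a]
  αA : ∀ a, α (iA a) = [a]
  cbA : ∀ a, cb (iA a) = iA (ba a)
  Dbar : ∀ t ∈ D, lstar cb t ∈ D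
  nmh : ∀ t ∈ D, h (nm t) = t
  nmbar : ∀ t ∈ D, nm (lstar cb t) = cb (nm t)

section
variable {ba : A → A} {cb : C → C} {vb : V → V} {Eqs : I → I → Prop} {P : C → Prop}
    {α : C → List A} {W : I → List (C ⊕ V)} {σ : V → List C} {iA : A → C} {D : Set (List C)}
    {nm : List C → C} {h : C → List C} {glue : C → C → Bool}

theorem cN_lstar (hN : Naming ba cb iA α D nm h) (hcb : Function.Involutive cb) (hα : BC ba cb α) :
    BC cb (lstar cb) (cN D nm α iA) := by
  intro t
  unfold cN
  by_cases ht : t ∈ D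
  · rw [if_pos ht, if_pos (hN.Dbar t ht), hN.nmbar t ht]; rfl
  · rw [if_neg ht, if_neg, hα.flatMap, ← lstar_map ba cb iA (fun a => (hN.cbA a).symm)]
    intro h2
    exact ht (by simpa [lstar_lstar hcb] using hN.Dbar _ h2)

theorem cα_iA (hN : Naming ba cb iA α D nm h) (l : List A) :
    (l.map iA).flatMap (cα h α) = l := by
  induction l with
  | nil => rfl
  | cons a l ih => rw [List.map_cons, List.flatMap_cons, ih]; simp [cα, hN.hA, hN.αA]

theorem cα_cN (hN : Naming ba cb iA α D nm h) (t : List C) :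
    (cN D nm α iA t).flatMap (cα h α) = t.flatMap α := by
  unfold cN
  by_cases ht : t ∈ D
  · rw [if_pos ht]; simp [cα, hN.nmh t ht]
  · rw [if_neg ht, cα_iA hN]

theorem flatMap_flatMap_congr {α β γ : Type u} {f : α → List β} {g : β → List γ} {k : α → List γ}
    (l : List α) (hh : ∀ x ∈ l, (f x).flatMap g = k x) : (l.flatMap f).flatMap g = l.flatMap k := by
  induction l with
  | nil => rfl
  | cons a l ih =>
    rw [List.flatMap_cons, List.flatMap_append, List.flatMap_cons, hh a (by simp),
      ih (fun x hx => hh x (by simp [hx]))]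

theorem cα_tok (hN : Naming ba cb iA α D nm h) (T : List (List C)) :
    (T.flatMap (cN D nm α iA)).flatMap (cα h α) = T.flatten.flatMap α := by
  rw [flatMap_flatMap_congr T (fun t _ => cα_cN hN t)]
  induction T with
  | nil => rfl
  | cons a T ih => simp [List.flatMap_cons, ih]

/-- evaluation of the compressed word -/
theorem cev (hD : ∀ i t, t.map Sum.inl ∈ cG glue σ W i → t ∈ D) (i : I) :
    (cW glue nm σ W i).flatMap (ev (cσ glue D nm α iA σ)) =
      (((W i).flatMap (ev σ)).splitBy glue).flatMap (cN D nm α iA) := by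
  rw [cG_tok]
  unfold cW
  rw [List.flatMap_map, flatMap_flatMap_congr _ (k := fun g => ev (cσ glue D nm α iA σ) (nmS nm g))]
  intro g hg
  rcases cG_group hg with ⟨v, rfl⟩ | ⟨t, ht, rfl⟩
  · show List.flatMap (cN D nm α iA) (List.splitBy glue _) = _
    rw [splitBy_mid]; rfl
  · rw [grpTok_map, nmS_map]
    simp [ev, cN, hD i t hg]

theorem chS (hN : Naming ba cb iA α D nm h)
    (hD : ∀ i t, t.map Sum.inl ∈ cG glue σ W i → t ∈ D) (i : I) :
    (W i).flatMap (sub (cτ glue σ)) = (cW glue nm σ W i).flatMap (hS h) := by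
  conv_lhs => rw [← List.flatten_splitBy (glueS glue) ((W i).flatMap (sub (cτ glue σ)))]
  unfold cW
  rw [List.flatMap_map]
  show (cG glue σ W i).flatten = _
  rw [← List.flatMap_id']
  refine List.flatMap_congr ?_
  intro g hg
  rcases cG_group hg with ⟨v, rfl⟩ | ⟨t, ht, rfl⟩
  · rfl
  · rw [nmS_map]; simp [hS, hN.nmh t (hD i t hg)]

theorem compress_good (hG : WGood ba cb vb Eqs P α W σ) (hN : Naming ba cb iA α D nm h)
    (hcb : Function.Involutive cb) (hglue : ∀ x y, glue (cb y) (cb x) = glue x y)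
    (hD : ∀ i t, t.map Sum.inl ∈ cG glue σ W i → t ∈ D)
    (hDne : ∀ t ∈ D, t.flatMap α ≠ []) :
    WGood ba cb vb Eqs (fun c => (∃ t ∈ D, c = nm t) ∨ ∃ a, c = iA a) (cα h α)
      (cW glue nm σ W) (cσ glue D nm α iA σ) := by
  have hNok : ∀ t, ∀ c ∈ cN D nm α iA t,
      ((∃ t ∈ D, c = nm t) ∨ ∃ a, c = iA a) ∧ cα h α c ≠ [] := by
    intro t c hc
    unfold cN at hc
    by_cases ht : t ∈ D
    · rw [if_pos ht] at hc
      simp at hc; subst hc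
      refine ⟨Or.inl ⟨t, ht, rfl⟩, ?_⟩
      unfold cα; rw [hN.nmh t ht]; exact hDne t ht
    · rw [if_neg ht] at hc
      simp only [List.mem_map] at hc
      obtain ⟨a, _, rfl⟩ := hc
      refine ⟨Or.inr ⟨a, rfl⟩, ?_⟩
      simp [cα, hN.hA, hN.αA]
  refine ⟨?_, ?_, ?_, ?_, ?_, ?_⟩
  · intro v
    unfold cσ
    rw [hG.bcσ v, splitBy_lstar hglue, mid_lstar, (cN_lstar hN hcb hG.bcα).flatMap]
  · exact BC.comp hG.bcα hN.bch
  · intro i c hc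
    unfold cW at hc
    rw [List.mem_map] at hc
    obtain ⟨g, hg, hgc⟩ := hc
    rcases cG_group hg with ⟨v, rfl⟩ | ⟨t, ht, rfl⟩
    · simp [nmS] at hgc
    · rw [nmS_map] at hgc
      simp at hgc; subst hgc
      have := hD i t hg
      exact hNok t (nm t) (by unfold cN; simp [this])
  · intro v c hc
    unfold cσ at hc
    rw [List.mem_flatMap] at hc
    obtain ⟨t, _, hc⟩ := hc
    exact hNok t c hc
  · intro i j hij
    rw [cev hD, cev hD, hG.eqs i j hij]
  · intro i
    rw [cev hD, cα_tok hN, List.flatten_splitBy]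
    exact hG.red i

theorem compress_val (hN : Naming ba cb iA α D nm h)
    (hD : ∀ i t, t.map Sum.inl ∈ cG glue σ W i → t ∈ D) (i : I) :
    ((cW glue nm σ W i).flatMap (ev (cσ glue D nm α iA σ))).flatMap (cα h α) =
      ((W i).flatMap (ev σ)).flatMap α := by
  rw [cev hD, cα_tok hN, List.flatten_splitBy]

theorem compress_meas_le (hN : Naming ba cb iA α D nm h) (v : V) :
    ((cσ glue D nm α iA σ v).flatMap (cα h α)).length ≤ ((σ v).flatMap α).length := by
  unfold cσ
  rw [cα_tok hN]
  conv_rhs => rw [← List.flatten_splitBy glue (σ v)]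
  rcases tok_cases ((σ v).splitBy glue) with h | ⟨t, h⟩ | ⟨p, q, h⟩
  · simp [h, mid]
  · simp [h, mid]
  · conv_rhs => rw [h]
    simp only [List.flatten_cons, List.flatten_append, List.flatMap_append, List.length_append]
    omega

theorem compress_meas_lt (hN : Naming ba cb iA α D nm h) (v : V) (hv : σ v ≠ [])
    (hok : ∀ c ∈ σ v, α c ≠ []) :
    ((cσ glue D nm α iA σ v).flatMap (cα h α)).length < ((σ v).flatMap α).length := by
  have key : ∀ t ∈ (σ v).splitBy glue, 0 < (t.flatMap α).length := by
    intro t ht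
    have h1 := List.ne_nil_of_mem_splitBy ht
    rcases t with _ | ⟨c, t⟩
    · exact absurd rfl h1
    · have : c ∈ σ v := by
        rw [← List.flatten_splitBy glue (σ v), List.mem_flatten]
        exact ⟨_, ht, by simp⟩
      have := List.length_pos_of_ne_nil (hok c this)
      simp only [List.flatMap_cons, List.length_append]; omega
  unfold cσ
  rw [cα_tok hN]
  conv_rhs => rw [← List.flatten_splitBy glue (σ v)]
  rcases tok_cases ((σ v).splitBy glue) with h | ⟨t, h⟩ | ⟨p, q, h⟩
  · rw [List.splitBy_eq_nil] at h; exact absurd h hv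
  · have := key t (by rw [h]; simp)
    rw [h]; simpa [mid] using this
  · have := key p (by rw [h]; simp)
    conv_rhs => rw [h]
    simp only [List.flatten_cons, List.flatten_append, List.flatMap_append, List.length_append]
    omega

end
end compress2

section counting
variable {A C V I : Type u}

def occ (w : List (C ⊕ V)) : ℕ := w.countP Sum.isRight

theorem occ_append (w w' : List (C ⊕ V)) : occ (w ++ w') = occ w + occ w' := by simp [occ]

theorem occ_map_inl (t : List C) : occ (t.map (Sum.inl : C → C ⊕ V)) = 0 := by
  simp [occ]

theorem occ_tauT (v : V) (T : List (List C)) : occ (tauT v T) ≤ 1 := by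
  rcases tok_cases T with rfl | ⟨t, rfl⟩ | ⟨p, q, h⟩
  · simp [tauT_nil, occ]
  · rw [tauT_one, occ_map_inl]; omega
  · rw [h, tauT_two, occ_append, occ_append, occ_map_inl, occ_map_inl]
    split_ifs <;> simp [occ]

theorem occ_sub (τ : V → List (C ⊕ V)) (hτ : ∀ v, occ (τ v) ≤ 1) (w : List (C ⊕ V)) :
    occ (w.flatMap (sub τ)) ≤ occ w := by
  induction w with
  | nil => simp [occ]
  | cons x w ih =>
    rw [List.flatMap_cons, occ_append, ← List.singleton_append (x := x), occ_append]
    rcases x with c | v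
    · have : occ (sub τ (Sum.inl c)) = 0 := occ_map_inl [c]
      omega
    · have h1 : occ (sub τ (Sum.inr v)) ≤ 1 := hτ v
      have h2 : occ [(Sum.inr v : C ⊕ V)] = 1 := by simp [occ]
      omega

theorem occ_hS (h : C → List C) (w : List (C ⊕ V)) : occ (w.flatMap (hS h)) = occ w := by
  induction w with
  | nil => rfl
  | cons x w ih =>
    rw [List.flatMap_cons, occ_append, ← List.singleton_append (x := x), occ_append, ih]
    rcases x with c | v
    · rw [show hS h (Sum.inl c) = (h c).map (Sum.inl : C → C ⊕ V) from rfl, occ_map_inl,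
        show [(Sum.inl c : C ⊕ V)] = [c].map Sum.inl from rfl, occ_map_inl]
    · rfl

theorem length_splitBy_le_one {α : Type u} {r : α → α → Bool} {l : List α}
    (h : l.IsChain (fun x y => r x y = true)) : (l.splitBy r).length ≤ 1 := by
  rcases eq_or_ne l [] with rfl | hl
  · simp
  · rw [List.splitBy_of_isChain hl h]; simp

theorem isChain_glueS_map {glue : C → C → Bool} {t : List C}
    (h : t.IsChain (fun x y => glue x y = true)) :
    (t.map (Sum.inl : C → C ⊕ V)).IsChain (fun x y => glueS glue x y = true) := by
  rw [List.isChain_map]; exact h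

theorem length_splitBy_tauT (glue : C → C → Bool) (v : V) (w : List C) :
    ((tauT v (w.splitBy glue)).splitBy (glueS glue)).length ≤ 3 := by
  have hc : ∀ g ∈ w.splitBy glue, g.IsChain (fun x y => glue x y = true) :=
    fun g hg => List.isChain_of_mem_splitBy hg
  rcases tok_cases (w.splitBy glue) with h | ⟨t, h⟩ | ⟨p, q, h⟩
  · rw [h]; simp [tauT_nil]
  · rw [h, tauT_one]
    have := length_splitBy_le_one (isChain_glueS_map (V := V) (hc t (by rw [h]; simp)))
    omega
  · rw [h, tauT_two]
    have h1 := length_splitBy_le_one (isChain_glueS_map (V := V) (hc p (by rw [h]; simp)))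
    have h2 := length_splitBy_le_one (isChain_glueS_map (V := V) (hc q (by rw [h]; simp)))
    refine (length_splitBy_append_le _ _ _).trans ?_
    have h3 := length_splitBy_append_le (glueS glue)
      (if mid (w.splitBy glue) = [] then [] else [(Sum.inr v : C ⊕ V)]) (q.map Sum.inl)
    have h4 : ((if mid (w.splitBy glue) = [] then [] else [(Sum.inr v : C ⊕ V)]).splitBy
        (glueS glue)).length ≤ 1 := by
      split_ifs
      · simp
      · exact length_splitBy_le_one (by simp)
    omega

theorem length_cG_le (glue : C → C → Bool) (σ : V → List C) (W : I → List (C ⊕ V)) (i : I) :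
    (cG glue σ W i).length ≤ ((W i).splitBy (glueS glue)).length + 2 * occ (W i) := by
  unfold cG
  have h1 : ∀ G : List (List (C ⊕ V)), (∀ g ∈ G, g ≠ [] ∧
      g.IsChain (fun x y => glueS glue x y = true)) →
      ((G.flatten.flatMap (sub (cτ glue σ))).splitBy (glueS glue)).length ≤
        G.length + 2 * occ G.flatten := by
    intro G
    induction G with
    | nil => intro _; simp
    | cons g G ih =>
      intro hG
      have ih := ih (fun g hg => hG g (by simp [hg]))
      rw [List.flatten_cons, List.flatMap_append, occ_append]
      refine (length_splitBy_append_le _ _ _).trans ?_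
      have : ((g.flatMap (sub (cτ glue σ))).splitBy (glueS glue)).length ≤ 1 + 2 * occ g := by
        obtain ⟨hgn, hgc⟩ := hG g (by simp)
        rcases group_cases g hgc hgn with ⟨v, rfl⟩ | ⟨t, ht, rfl⟩
        · have h2 : occ [(Sum.inr v : C ⊕ V)] = 1 := by simp [occ]
          rw [h2]
          have := length_splitBy_tauT glue v (σ v)
          simpa [sub, cτ] using this
        · have : (t.map Sum.inl).flatMap (sub (cτ glue σ)) = t.map Sum.inl := by
            clear hG ih hgc hgn ht
            induction t with
            | nil => rfl
            | cons a t ih => rw [List.map_cons, List.flatMap_cons, ih]; rfl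
          rw [this]
          have := length_splitBy_le_one hgc
          omega
      simp only [List.length_cons]
      omega
  have := h1 ((W i).splitBy (glueS glue)) (fun g hg => ⟨List.ne_nil_of_mem_splitBy hg,
    List.isChain_of_mem_splitBy hg⟩)
  rwa [List.flatten_splitBy] at this

theorem occ_cW_le {ba : A → A} {cb : C → C} {iA : A → C} {α : C → List A} {D : Set (List C)}
    {nm : List C → C} {h : C → List C} {glue : C → C → Bool} {σ : V → List C}
    {W : I → List (C ⊕ V)} (hN : Naming ba cb iA α D nm h)
    (hD : ∀ i t, t.map Sum.inl ∈ cG glue σ W i → t ∈ D) (i : I) :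
    occ (cW glue nm σ W i) ≤ occ (W i) := by
  rw [← occ_hS h, ← chS hN hD]
  exact occ_sub _ (fun v => occ_tauT _ _) _

/-- Number of adjacent pairs satisfying `r`. -/
def npair {α : Type u} (r : α → α → Bool) : List α → ℕ
  | [] => 0
  | [_] => 0
  | x :: y :: l => (if r x y then 1 else 0) + npair r (y :: l)

theorem length_splitBy_npair {α : Type u} (r : α → α → Bool) (l : List α) :
    (l.splitBy r).length + npair r l ≤ l.length := by
  induction l with
  | nil => simp [npair]
  | cons x l ih =>
    rcases l with _ | ⟨y, l⟩
    · have : ([x].splitBy r).length ≤ 1 := length_splitBy_le_one (by simp)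
      simp [npair]
      simpa using this
    · simp only [npair, List.length_cons] at ih ⊢
      by_cases h : r x y
      · rw [if_pos h]
        obtain ⟨g', G', hG'⟩ : ∃ g' G', (y :: l).splitBy r = g' :: G' :=
          List.exists_cons_of_ne_nil (by simp)
        have hgn' : g' ≠ [] := List.ne_nil_of_mem_splitBy (r := r) (l := y :: l) (by simp [hG'])
        have em : y :: l = g' ++ G'.flatten := by
          rw [← List.flatten_splitBy r (y :: l), hG']; simp
        have hy : ∀ z ∈ g'.head?, z = y := by
          intro z hz
          rcases g' with _ | ⟨a, g'⟩
          · simp at hz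
          · simp at hz em; rw [← hz, ← em.1]
        have c2 := List.isChain_getLast_head_splitBy r (y :: l)
        rw [hG'] at c2
        have key : (x :: y :: l).splitBy r = (x :: g') :: G' := by
          rw [List.splitBy_eq_iff]
          refine ⟨by rw [em]; simp, ?_, ?_, ?_⟩
          · have h2 := List.nil_notMem_splitBy r (y :: l)
            rw [hG'] at h2
            simp at h2 ⊢
            tauto
          · intro k hk
            simp only [List.mem_cons] at hk
            rcases hk with rfl | hk
            · rw [List.isChain_cons]
              refine ⟨fun z hz => by rw [hy z hz]; exact h,
                List.isChain_of_mem_splitBy (l := y :: l) (by simp [hG'])⟩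
            · exact List.isChain_of_mem_splitBy (l := y :: l) (by simp [hG', hk])
          · rw [List.isChain_cons] at c2 ⊢
            refine ⟨?_, c2.2⟩
            intro z hz
            obtain ⟨h1, h2, h3⟩ := c2.1 z hz
            exact ⟨by simp, h2, by rw [List.getLast_cons h1]; exact h3⟩
        rw [key]
        rw [hG'] at ih
        simp at ih ⊢; omega
      · rw [if_neg h]
        have := length_splitBy_append_le r [x] (y :: l)
        have h1 : ([x].splitBy r).length ≤ 1 := length_splitBy_le_one (by simp)
        simp only [List.singleton_append] at this
        omega

def bothL (x y : C ⊕ V) : Bool := x.isLeft && y.isLeft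

theorem npair_bothL (w : List (C ⊕ V)) : w.length ≤ 1 + npair bothL w + 2 * occ w := by
  have : w.length ≤ 1 + npair bothL w + 2 * occ w ∧
      (∀ v ∈ w.head?, v.isRight → w.length ≤ npair bothL w + 2 * occ w) := by
    induction w with
    | nil => simp
    | cons x w ih =>
      rcases w with _ | ⟨y, w⟩
      · rcases x with c | v <;> simp [npair, occ]
      · have e : occ (x :: y :: w) = (if x.isRight then 1 else 0) + occ (y :: w) := by
          simp only [occ, List.countP_cons]; omega
        rw [e]
        simp only [npair]
        have ih2 := ih.2 y (by simp)
        have ih1 := ih.1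
        generalize occ (y :: w) = o at *
        generalize npair bothL (y :: w) = n at *
        simp only [List.length_cons] at *
        rcases x with c | v <;> rcases y with d | v' <;> simp [bothL] at * <;> omega
  exact this.1

/-! orientation -/

def glueL (L : C → Bool) (x y : C) : Bool := L x && !L y

theorem card_orient [Fintype C] {cb : C → C} (hcb : Function.Involutive cb) (x y : C) (h1 : y ≠ x)
    (h2 : y ≠ cb x) :
    4 * ((Finset.univ.filter (fun L : C → Bool => ∀ c, L (cb c) = !L c)).filter
      (fun L => glueL L x y = true)).card =
      (Finset.univ.filter (fun L : C → Bool => ∀ c, L (cb c) = !L c)).card := by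
  set S := (Finset.univ.filter (fun L : C → Bool => ∀ c, L (cb c) = !L c)) with hS
  let fl : C → (C → Bool) → (C → Bool) := fun c L d => if d = c ∨ d = cb c then !L d else L d
  have flS : ∀ c, ∀ L ∈ S, fl c L ∈ S := by
    intro c L hL
    simp only [hS, Finset.mem_filter, Finset.mem_univ, true_and] at hL ⊢
    intro d
    simp only [fl]
    have : (cb d = c ∨ cb d = cb c) ↔ (d = c ∨ d = cb c) := by
      rw [hcb.injective.eq_iff, ← hcb.eq_iff, or_comm]
    by_cases hd : d = c ∨ d = cb c
    · rw [if_pos hd, if_pos (this.2 hd), hL]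
    · rw [if_neg hd, if_neg (mt this.1 hd), hL]
  have flfl : ∀ c L, fl c (fl c L) = L := by
    intro c L; funext d; simp only [fl]; split_ifs <;> simp
  have flx : ∀ L, fl x L x = !L x := by intro L; simp [fl]
  have fly : ∀ L, fl y L y = !L y := by intro L; simp [fl]
  have fxy : ∀ L, fl x L y = L y := by
    intro L; simp only [fl]; rw [if_neg]; rintro (h | h)
    · exact h1 h
    · exact h2 h
  have fyx : ∀ L, fl y L x = L x := by
    intro L; simp only [fl]; rw [if_neg]; rintro (h | h)
    · exact h1 h.symm
    · exact h2 (by rw [h, hcb])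
  let N : Bool → Bool → ℕ := fun p q => (S.filter (fun L => L x = p ∧ L y = q)).card
  have e1 : ∀ p q, N p q = N (!p) q := by
    intro p q
    refine Finset.card_nbij' (fl x) (fl x) ?_ ?_ (fun L _ => flfl _ _) (fun L _ => flfl _ _)
    · intro L hL
      simp only [Finset.coe_filter, Set.mem_ofPred_eq] at hL ⊢
      exact ⟨flS x L hL.1, by rw [flx, hL.2.1], by rw [fxy, hL.2.2]⟩
    · intro L hL
      simp only [Finset.coe_filter, Set.mem_ofPred_eq] at hL ⊢
      exact ⟨flS x L hL.1, by rw [flx, hL.2.1]; simp, by rw [fxy, hL.2.2]⟩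
  have e2 : ∀ p q, N p q = N p (!q) := by
    intro p q
    refine Finset.card_nbij' (fl y) (fl y) ?_ ?_ (fun L _ => flfl _ _) (fun L _ => flfl _ _)
    · intro L hL
      simp only [Finset.coe_filter, Set.mem_ofPred_eq] at hL ⊢
      exact ⟨flS y L hL.1, by rw [fyx, hL.2.1], by rw [fly, hL.2.2]⟩
    · intro L hL
      simp only [Finset.coe_filter, Set.mem_ofPred_eq] at hL ⊢
      exact ⟨flS y L hL.1, by rw [fyx, hL.2.1], by rw [fly, hL.2.2]; simp⟩
  have e3 : S.card = N true true + N true false + (N false true + N false false) := by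
    have k1 := Finset.card_filter_add_card_filter_not (s := S) (fun L => L x = true)
    have k2 := Finset.card_filter_add_card_filter_not
      (s := S.filter (fun L => L x = true)) (fun L => L y = true)
    have k3 := Finset.card_filter_add_card_filter_not
      (s := S.filter (fun L => ¬ L x = true)) (fun L => L y = true)
    simp only [Finset.filter_filter, Bool.not_eq_true] at k1 k2 k3
    simp only [N]
    omega
  have e4 : (S.filter (fun L => glueL L x y = true)) = S.filter (fun L => L x = true ∧ L y = false) := by
    congr 1; funext L; simp [glueL]
  rw [e4, e3]
  have a1 := e1 true true
  have a2 := e1 true false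
  have a3 := e2 true true
  simp only [Bool.not_true, Bool.not_false] at a1 a2 a3
  show 4 * N true false = _
  omega

def AdjOK (cb : C → C) (w : List (C ⊕ V)) : Prop :=
  w.IsChain (fun x y => ∀ c d, x = Sum.inl c → y = Sum.inl d → d ≠ c ∧ d ≠ cb c)

theorem exists_orient [Finite C] [Fintype I] {cb : C → C} (hcb : Function.Involutive cb)
    (hfp : ∀ c, cb c ≠ c) (W : I → List (C ⊕ V)) (hW : ∀ i, AdjOK cb (W i)) :
    ∃ L : C → Bool, (∀ c, L (cb c) = !L c) ∧
      ∑ i, npair bothL (W i) ≤ 4 * ∑ i, npair (glueS (glueL L)) (W i) := by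
  have := Fintype.ofFinite C
  set S := (Finset.univ.filter (fun L : C → Bool => ∀ c, L (cb c) = !L c)) with hS
  have hne : S.Nonempty := by
    obtain ⟨e⟩ := Fintype.truncEquivFin C
    refine ⟨fun c => decide (e c < e (cb c)), ?_⟩
    simp only [hS, Finset.mem_filter, Finset.mem_univ, true_and]
    intro c
    rw [hcb]
    have : e c ≠ e (cb c) := fun h => hfp c (e.injective h).symm
    rcases lt_or_gt_of_ne this with h | h
    · simp [h, h.le]
    · simp [h, h.le]
  have key : ∀ w : List (C ⊕ V), AdjOK cb w →
      S.card * npair bothL w ≤ 4 * ∑ L ∈ S, npair (glueS (glueL L)) w := by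
    intro w
    induction w with
    | nil => simp [npair]
    | cons x w ih =>
      rcases w with _ | ⟨y, w⟩
      · simp [npair]
      · intro hw
        unfold AdjOK at hw
        rw [List.isChain_cons_cons] at hw
        have ih := ih hw.2
        simp only [npair]
        rw [Finset.sum_add_distrib, mul_add, mul_add]
        refine add_le_add ?_ ih
        rcases x with c | v
        · rcases y with d | v
          · have h0 := hw.1 c d rfl rfl
            have := card_orient hcb c d h0.1 h0.2
            have e : ∑ L ∈ S, (if glueS (glueL L) (Sum.inl c : C ⊕ V) (Sum.inl d) = true then 1 else 0)
                = (S.filter (fun L => glueL L c d = true)).card := by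
              rw [Finset.card_filter]; rfl
            have e2 : bothL (Sum.inl c : C ⊕ V) (Sum.inl d) = true := rfl
            rw [if_pos e2, mul_one]
            refine this.ge.trans (le_of_eq ?_)
            rw [← e]
          · simp [bothL]
        · simp [bothL]
  by_contra hcon
  push Not at hcon
  have h1 : ∑ L ∈ S, (4 * ∑ i, npair (glueS (glueL L)) (W i)) < ∑ L ∈ S, ∑ i, npair bothL (W i) := by
    refine Finset.sum_lt_sum_of_nonempty hne ?_
    intro L hL
    exact hcon L (by simpa [hS] using hL)
  have h2 : ∑ i, S.card * npair bothL (W i) ≤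
      ∑ i, 4 * ∑ L ∈ S, npair (glueS (glueL L)) (W i) :=
    Finset.sum_le_sum (fun i _ => key (W i) (hW i))
  rw [Finset.sum_const, smul_eq_mul, ← Finset.mul_sum, Finset.sum_comm] at h1
  rw [← Finset.mul_sum, ← Finset.mul_sum] at h2
  omega

end counting

section expo
variable {Γ : Type u}

def IsAff {M : Type u} [AddCommMonoid M] (e : M → ℕ) : Prop := ∃ (a : ℕ) (f : M →+ ℕ), ∀ x, e x = a + f x

def xp {M : Type u} (x : M) (l : List (Γ × (M → ℕ))) : List Γ :=
  l.flatMap (fun p => List.replicate (p.2 x) p.1)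

theorem xp_cons {M : Type u} (x : M) (p : Γ × (M → ℕ)) (l : List (Γ × (M → ℕ))) :
    xp x (p :: l) = List.replicate (p.2 x) p.1 ++ xp x l := rfl

theorem semilin_eq {M : Type u} [AddCommMonoid M] [AddMonoid.FG M] {e e' : M → ℕ} (h : IsAff e)
    (h' : IsAff e') : IsSemilinearSet {x | e x = e' x} := by
  obtain ⟨a, f, hf⟩ := h
  obtain ⟨b, g, hg⟩ := h'
  simp only [hf, hg]
  exact isSemilinearSet_setOfPred_eq a b f g

theorem isAff_const {M : Type u} [AddCommMonoid M] (n : ℕ) : IsAff (fun _ : M => n) :=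
  ⟨n, 0, fun _ => by simp⟩

theorem IsAff.fst {M : Type u} [AddCommMonoid M] {e : M → ℕ} (h : IsAff e) :
    IsAff (fun x : M × ℕ => e x.1) := by
  obtain ⟨a, f, hf⟩ := h
  exact ⟨a, f.comp (AddMonoidHom.fst M ℕ), fun x => by simp [hf]⟩

theorem isAff_snd {M : Type u} [AddCommMonoid M] : IsAff (fun x : M × ℕ => x.2) :=
  ⟨0, AddMonoidHom.snd M ℕ, fun x => by simp⟩

theorem IsAff.add {M : Type u} [AddCommMonoid M] {e e' : M → ℕ} (h : IsAff e) (h' : IsAff e') :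
    IsAff (fun x => e x + e' x) := by
  obtain ⟨a, f, hf⟩ := h
  obtain ⟨b, g, hg⟩ := h'
  exact ⟨a + b, f + g, fun x => by simp [hf, hg]; ring⟩

def lft {M : Type u} (l : List (Γ × (M → ℕ))) : List (Γ × (M × ℕ → ℕ)) :=
  l.map (fun p => (p.1, fun x => p.2 x.1))

theorem xp_lft {M : Type u} (l : List (Γ × (M → ℕ))) (x : M × ℕ) : xp x (lft l) = xp x.1 l := by
  unfold xp lft; rw [List.flatMap_map]

theorem aff_lft {M : Type u} [AddCommMonoid M] {l : List (Γ × (M → ℕ))} (h : ∀ p ∈ l, IsAff p.2) :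
    ∀ p ∈ lft l, IsAff p.2 := by
  unfold lft
  intro p hp
  rw [List.mem_map] at hp
  obtain ⟨q, hq, rfl⟩ := hp
  exact (h q hq).fst

theorem semilin_xp (n : ℕ) : ∀ {M : Type u} [AddCommMonoid M] [AddMonoid.FG M]
    (l l' : List (Γ × (M → ℕ))), (∀ p ∈ l, IsAff p.2) → (∀ p ∈ l', IsAff p.2) →
    l.length + l'.length ≤ n → IsSemilinearSet {x : M | xp x l = xp x l'} := by
  induction n with
  | zero =>
    intro M _ _ l l' _ _ hn
    have h1 : l = [] := List.length_eq_zero_iff.1 (by omega)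
    have h2 : l' = [] := List.length_eq_zero_iff.1 (by omega)
    subst h1 h2
    simpa using (IsSemilinearSet.univ : IsSemilinearSet (Set.univ : Set M))
  | succ n ih =>
    intro M _ _ l l' hl hl' hn
    have c0 : ∀ (p : Γ × (M → ℕ)) (l l' : List (Γ × (M → ℕ))), IsAff p.2 → (∀ p ∈ l, IsAff p.2) →
        (∀ p ∈ l', IsAff p.2) → l.length + l'.length ≤ n →
        IsSemilinearSet {x : M | p.2 x = 0 ∧ xp x l = xp x l'} := by
      intro p l l' hp h1 h2 h3
      exact (semilin_eq hp (isAff_const 0)).inter (ih l l' h1 h2 h3)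
    rcases l with _ | ⟨⟨c, f⟩, l⟩
    · rcases l' with _ | ⟨⟨d, g⟩, l'⟩
      · simpa using (IsSemilinearSet.univ : IsSemilinearSet (Set.univ : Set M))
      · convert c0 (d, g) [] l' (hl' _ (by simp)) (by simp) (fun p hp => hl' p (by simp [hp]))
          (by simp at hn ⊢; omega) using 1
        ext x
        simp only [xp_cons, Set.mem_ofPred_eq]
        simp only [xp, List.flatMap_nil]
        rw [eq_comm, List.append_eq_nil_iff, List.replicate_eq_nil_iff, eq_comm (a := [])]
    · rcases l' with _ | ⟨⟨d, g⟩, l'⟩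
      · convert c0 (c, f) l [] (hl _ (by simp)) (fun p hp => hl p (by simp [hp])) (by simp)
          (by simp at hn ⊢; omega) using 1
        ext x
        simp only [xp_cons, Set.mem_ofPred_eq]
        simp only [xp, List.flatMap_nil]
        rw [List.append_eq_nil_iff, List.replicate_eq_nil_iff]
      · have af := hl (c, f) (by simp)
        have ag := hl' (d, g) (by simp)
        have al : ∀ p ∈ l, IsAff p.2 := fun p hp => hl p (by simp [hp])
        have al' : ∀ p ∈ l', IsAff p.2 := fun p hp => hl' p (by simp [hp])
        simp only [List.length_cons] at hn
        by_cases hcd : c = d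
        · subst hcd
          have key : ∀ (f g : M → ℕ) (l l' : List (Γ × (M → ℕ))), IsAff f → IsAff g →
              (∀ p ∈ l, IsAff p.2) → (∀ p ∈ l', IsAff p.2) → l.length + 1 + (l'.length + 1) ≤ n + 1 →
              IsSemilinearSet {x : M | f x ≤ g x ∧ xp x ((c,f)::l) = xp x ((c,g)::l')} := by
            intro f g l l' af ag al al' hn
            have hs := (semilin_eq (af.fst.add isAff_snd) ag.fst).inter
              (ih (M := M × ℕ) (lft l) ((c, fun x => x.2) :: lft l') (aff_lft al)
                (by
                  intro p hp
                  rw [List.mem_cons] at hp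
                  rcases hp with rfl | hp
                  · exact isAff_snd
                  · exact aff_lft al' p hp) (by simp [lft]; omega))
            have := hs.image (AddMonoidHom.fst M ℕ)
            convert this using 1
            ext x
            simp only [Set.mem_ofPred_eq, Set.mem_image, Set.mem_inter_iff, xp_cons, xp_lft,
              AddMonoidHom.coe_fst]
            constructor
            · rintro ⟨h1, h2⟩
              refine ⟨(x, g x - f x), ⟨by simp; omega, ?_⟩, rfl⟩
              have : g x = f x + (g x - f x) := by omega
              rw [this, List.replicate_add, List.append_assoc] at h2
              exact List.append_cancel_left h2
            · rintro ⟨⟨x', y⟩, ⟨h1, h2⟩, rfl⟩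
              simp only at h1 h2 ⊢
              refine ⟨by omega, ?_⟩
              rw [← h1, List.replicate_add, List.append_assoc, h2]
          convert (key f g l l' af ag al al' hn).union (key g f l' l ag af al' al (by omega)) using 1
          ext x
          simp only [Set.mem_ofPred_eq, Set.mem_union]
          constructor
          · intro h
            rcases le_total (f x) (g x) with h1 | h1
            · exact Or.inl ⟨h1, h⟩
            · exact Or.inr ⟨h1, h.symm⟩
          · rintro (h | h)
            · exact h.2
            · exact h.2.symm
        · convert (c0 (c, f) l ((d, g) :: l') af al hl' (by simp; omega)).union
            (c0 (d, g) ((c, f) :: l) l' ag hl al' (by simp; omega)) using 1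
          ext x
          simp only [Set.mem_ofPred_eq, Set.mem_union, xp_cons]
          constructor
          · intro h
            by_cases h1 : f x = 0
            · left; refine ⟨h1, ?_⟩; simpa [h1] using h
            · by_cases h2 : g x = 0
              · right; refine ⟨h2, ?_⟩; simpa [h2] using h
              · exfalso
                obtain ⟨m, hm⟩ := Nat.exists_eq_succ_of_ne_zero h1
                obtain ⟨k, hk⟩ := Nat.exists_eq_succ_of_ne_zero h2
                rw [hm, hk, List.replicate_succ, List.replicate_succ] at h
                simp only [List.cons_append, List.cons.injEq] at h
                exact hcd h.1
          · rintro (⟨h1, h⟩ | ⟨h1, h⟩)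
            · rw [h1]; simpa using h
            · rw [h1]; simpa using h
end expo

/-! the working alphabet -/

inductive CC (A I : Type u) (M : ℕ) : Type u
  | con (a : A) : CC A I M
  | bk (b : Bool) (m : Fin M) (s : Bool) : CC A I M
  | out (i : I) (s : Bool) : CC A I M

namespace CC
variable {A I : Type u} {M : ℕ}

instance [Finite A] [Finite I] : Finite (CC A I M) := by
  let f : CC A I M → A ⊕ (Bool × Fin M × Bool) ⊕ (I × Bool) := fun c => match c with
    | con a => Sum.inl a
    | bk b m s => Sum.inr (Sum.inl (b, m, s))
    | out i s => Sum.inr (Sum.inr (i, s))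
  refine Finite.of_injective f ?_
  rintro (a | ⟨b, m, s⟩ | ⟨i, s⟩) (a' | ⟨b', m', s'⟩ | ⟨i', s'⟩) h <;> simp_all [f]

def bar (ba : A → A) : CC A I M → CC A I M
  | con a => con (ba a)
  | bk b m s => bk b m (!s)
  | out i s => out i (!s)

theorem bar_inv {ba : A → A} (h : Function.Involutive ba) :
    Function.Involutive (bar ba : CC A I M → CC A I M) := by
  rintro (a | ⟨b, m, s⟩ | ⟨i, s⟩)
  · simp [bar, h a]
  · simp [bar]
  · simp [bar]

theorem bar_ne {ba : A → A} (h : ∀ a, ba a ≠ a) (c : CC A I M) : bar ba c ≠ c := by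
  rcases c with (a | ⟨b, m, s⟩ | ⟨i, s⟩)
  · simp [bar, h a]
  · simp [bar]
  · simp [bar]

def inB (b : Bool) : CC A I M → Prop
  | bk b' _ _ => b' = b
  | _ => False

def hT (ba : A → A) (b : Bool) (tk : Fin M → List (CC A I M)) : CC A I M → List (CC A I M)
  | con a => [con a]
  | bk b' m s => if b' = b then (if s then lstar (bar ba) (tk m) else tk m) else [bk b' m s]
  | out i s => [out i s]

theorem hT_BC {ba : A → A} (h : Function.Involutive ba) (b : Bool) (tk : Fin M → List (CC A I M)) :
    BC (bar ba) (bar ba) (hT ba b tk) := by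
  rintro (a | ⟨b', m, s⟩ | ⟨i, s⟩)
  · rfl
  · show hT ba b tk (bk b' m (!s)) = _
    simp only [hT]
    by_cases hb : b' = b
    · rw [if_pos hb, if_pos hb]
      cases s
      · simp
      · simp [lstar_lstar (bar_inv h)]
    · rw [if_neg hb, if_neg hb]; rfl
  · rfl

/-- existence of names -/
theorem exists_naming {ba : A → A} (hba : Function.Involutive ba) (b : Bool)
    (D : Finset (List (CC A I M))) (hcard : D.card ≤ M)
    (hD : ∀ t ∈ D, lstar (bar ba) t ≠ t) (hM : 0 < M) [Finite A] [Finite I] :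
    ∃ (nm : List (CC A I M) → CC A I M) (tk : Fin M → List (CC A I M)),
      (∀ t, (t ∈ D ∨ lstar (bar ba) t ∈ D) → inB b (nm t) ∧ hT ba b tk (nm t) = t ∧
        nm (lstar (bar ba) t) = bar ba (nm t)) ∧
      ∀ m, tk m = [] ∨ (tk m ∈ D ∨ lstar (bar ba) (tk m) ∈ D) := by
  have hinv := bar_inv (I := I) (M := M) hba
  have hll := fun t => lstar_lstar hinv t
  let _ : Encodable (List (CC A I M)) := Encodable.ofCountable _
  let o : List (CC A I M) → Prop := fun t => Encodable.encode t < Encodable.encode (lstar (bar ba) t)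
  have ho : ∀ t, lstar (bar ba) t ≠ t → (o (lstar (bar ba) t) ↔ ¬ o t) := by
    intro t ht
    simp only [o, hll]
    have : Encodable.encode (lstar (bar ba) t) ≠ Encodable.encode t :=
      fun h => ht (Encodable.encode_injective h)
    omega
  let Dp := D.image (fun t => if o t then t else lstar (bar ba) t)
  have hDp : Dp.card ≤ M := Finset.card_image_le.trans hcard
  have hne : ∀ t, (t ∈ D ∨ lstar (bar ba) t ∈ D) → lstar (bar ba) t ≠ t := by
    rintro t (h | h)
    · exact hD t h
    · intro h2; have := hD _ h; rw [hll] at this; exact this h2.symm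
  have hmem : ∀ t, (t ∈ D ∨ lstar (bar ba) t ∈ D) → o t → t ∈ Dp := by
    intro t ht hot
    simp only [Dp, Finset.mem_image]
    rcases ht with h | h
    · exact ⟨t, h, if_pos hot⟩
    · refine ⟨_, h, ?_⟩
      rw [if_neg, hll]
      rw [ho t (hne t (Or.inr h))]; simpa using hot
  have hDpo : ∀ t ∈ Dp, o t ∧ (t ∈ D ∨ lstar (bar ba) t ∈ D) := by
    intro t ht
    simp only [Dp, Finset.mem_image] at ht
    obtain ⟨t', h1, h2⟩ := ht
    split_ifs at h2 with h3
    · subst h2; exact ⟨h3, Or.inl h1⟩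
    · subst h2
      exact ⟨(ho t' (hD t' h1)).2 h3, Or.inr (by rw [hll]; exact h1)⟩
  obtain ⟨e⟩ : Nonempty (Dp ↪ Fin M) := Function.Embedding.nonempty_of_card_le (by simpa using hDp)
  let nm : List (CC A I M) → CC A I M := fun t =>
    if h : t ∈ Dp then bk b (e ⟨t, h⟩) false
    else if h : lstar (bar ba) t ∈ Dp then bk b (e ⟨_, h⟩) true else bk b ⟨0, hM⟩ false
  let tk : Fin M → List (CC A I M) := fun m => if h : ∃ t, e t = m then (Classical.choose h).1 else []
  have htk : ∀ t, tk (e t) = t.1 := by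
    intro t
    have h : ∃ t', e t' = e t := ⟨t, rfl⟩
    simp only [tk]
    rw [dif_pos h, e.injective (Classical.choose_spec h)]
  have hnm1 : ∀ t (h : t ∈ Dp), nm t = bk b (e ⟨t, h⟩) false := fun t h => by
    simp only [nm]; rw [dif_pos h]
  have hnm2 : ∀ t (h : lstar (bar ba) t ∈ Dp), nm t = bk b (e ⟨_, h⟩) true := fun t h => by
    have h' : t ∉ Dp := by
      intro h2
      have := (hDpo _ h).1
      rw [ho t (hne t (hDpo t h2).2)] at this
      exact this (hDpo t h2).1
    simp only [nm]; rw [dif_neg h', dif_pos h]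
  refine ⟨nm, tk, ?_, ?_⟩
  · intro t ht
    by_cases hot : o t
    · have h1 := hmem t ht hot
      have h2 : lstar (bar ba) (lstar (bar ba) t) ∈ Dp := by rw [hll]; exact h1
      rw [hnm1 t h1, hnm2 _ h2]
      refine ⟨rfl, ?_, ?_⟩
      · simp [hT, htk]
      · simp only [bar, Bool.not_false]
        congr 2
        exact Subtype.ext (hll t)
    · have h1 := hmem (lstar (bar ba) t) (by rw [hll]; exact ht.symm) ((ho t (hne t ht)).2 hot)
      rw [hnm2 t h1, hnm1 _ h1]
      refine ⟨rfl, ?_, rfl⟩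
      simp [hT, htk, hll]
  · intro m
    by_cases h : ∃ t, e t = m
    · right
      obtain ⟨t, rfl⟩ := h
      rw [htk]
      exact (hDpo _ t.2).2
    · left; simp only [tk]; rw [dif_neg h]
end CC

section endo
variable {C : Type u}

def toEnd (h : C → List C) : Monoid.End (FreeMonoid C) :=
  FreeMonoid.lift (fun c => FreeMonoid.ofList (h c))

theorem toEnd_of (h : C → List C) (c : C) : toEnd h (FreeMonoid.of c) = FreeMonoid.ofList (h c) :=
  FreeMonoid.lift_eval_of _ _

theorem toEnd_ofList (h : C → List C) (l : List C) :
    toEnd h (FreeMonoid.ofList l) = FreeMonoid.ofList (l.flatMap h) := by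
  induction l with
  | nil => exact map_one (toEnd h)
  | cons a l ih =>
    rw [FreeMonoid.ofList_cons, map_mul, ih, toEnd_of, List.flatMap_cons, FreeMonoid.ofList_append]

theorem toEnd_mul (h k : C → List C) : toEnd h * toEnd k = toEnd (fun c => (k c).flatMap h) := by
  apply FreeMonoid.hom_eq
  intro c
  show toEnd h (toEnd k (FreeMonoid.of c)) = _
  rw [toEnd_of, toEnd_ofList]
  exact (toEnd_of (fun c => (k c).flatMap h) c).symm

theorem toEnd_one : toEnd (fun c : C => [c]) = 1 := by
  apply FreeMonoid.hom_eq
  intro c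
  exact toEnd_of _ c

end endo

/-! finite unions of sets `b * P^*` -/

def SLset {E : Type u} [Monoid E] (S : Set E) : Prop :=
  ∃ F : Set (E × Set E), F.Finite ∧ (∀ x ∈ F, x.2.Finite) ∧
    S = {e | ∃ x ∈ F, ∃ c ∈ Submonoid.closure x.2, e = x.1 * c}

theorem SLset.finite {E : Type u} [Monoid E] {S : Set E} (h : S.Finite) : SLset S := by
  refine ⟨(fun e => (e, ∅)) '' S, h.image _, ?_, ?_⟩
  · rintro _ ⟨e, _, rfl⟩; exact Set.finite_empty
  · ext e
    simp only [Set.mem_ofPred_eq, Set.mem_image, Submonoid.closure_empty, Submonoid.mem_bot]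
    constructor
    · intro he; exact ⟨_, ⟨e, he, rfl⟩, 1, by simp, by simp⟩
    · rintro ⟨_, ⟨e', he', rfl⟩, c, hc, rfl⟩
      simp only [Submonoid.closure_empty, Submonoid.mem_bot] at hc
      subst hc; simpa using he'

theorem SLset.iUnion {E : Type u} [Monoid E] {J : Type u} [Finite J] {S : J → Set E}
    (h : ∀ j, SLset (S j)) : SLset (⋃ j, S j) := by
  choose F hF hF2 hS using h
  refine ⟨⋃ j, F j, Set.finite_iUnion hF, ?_, ?_⟩
  · intro x hx
    obtain ⟨j, hj⟩ := Set.mem_iUnion.1 hx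
    exact hF2 j x hj
  · ext e
    rw [Set.mem_iUnion]
    constructor
    · rintro ⟨j, hj⟩
      rw [hS j] at hj
      obtain ⟨x, hx, hc⟩ := hj
      exact ⟨x, Set.mem_iUnion.2 ⟨j, hx⟩, hc⟩
    · rintro ⟨x, hx, hc⟩
      obtain ⟨j, hj⟩ := Set.mem_iUnion.1 hx
      refine ⟨j, ?_⟩
      rw [hS j]
      exact ⟨x, hj, hc⟩

theorem SLset.union {E : Type u} [Monoid E] {S S' : Set E} (h : SLset S) (h' : SLset S') :
    SLset (S ∪ S') := by
  have := SLset.iUnion (J := ULift.{u} Bool) (S := fun j => if j.down then S else S') (by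
    rintro ⟨_ | _⟩ <;> simpa)
  convert this using 1
  ext e
  simp [or_comm]

theorem rational_sl {E : Type u} [Monoid E] {Q : Type u} [Finite Q] (I F : Q → Prop)
    (T : Q → E → Q → Prop) (hT : ∀ q r, SLset {e | T q e r}) :
    RationalSet {e | ∃ q r, I q ∧ F r ∧ PPath T q e r} := by
  choose G hG hG2 hG3 using hT
  have := rational_big I F {x : Q × E × Set E × Q | (x.2.1, x.2.2.1) ∈ G x.1 x.2.2.2} (by
    have : (⋃ p : Q × Q, (fun x : E × Set E => (p.1, x.1, x.2, p.2)) '' (G p.1 p.2)).Finite :=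
      Set.finite_iUnion (fun p => (hG p.1 p.2).image _)
    refine this.subset ?_
    rintro ⟨q, b, P, r⟩ h
    exact Set.mem_iUnion.2 ⟨(q, r), ⟨(b, P), h, rfl⟩⟩) (by
    rintro ⟨q, b, P, r⟩ h
    exact hG2 q r _ h)
  have hTT : T = (fun q e r => ∃ b P, (q, b, P, r) ∈ {x : Q × E × Set E × Q |
      (x.2.1, x.2.2.1) ∈ G x.1 x.2.2.2} ∧ ∃ c ∈ Submonoid.closure P, e = b * c) := by
    funext q e r
    refine propext ?_
    have := Set.ext_iff.1 (hG3 q r) e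
    rw [Set.mem_ofPred_eq] at this
    rw [this]
    constructor
    · rintro ⟨⟨b, P⟩, h1, h2⟩; exact ⟨b, P, h1, h2⟩
    · rintro ⟨b, P, h1, h2⟩; exact ⟨(b, P), h1, h2⟩
  rw [hTT]
  exact this

/-! the block family -/
namespace CC
variable {A I : Type u} {M : ℕ}

theorem hT_comp {ba : A → A} (hba : Function.Involutive ba) (b : Bool)
    (tk tk' : Fin M → List (CC A I M)) (c : CC A I M) :
    (hT ba b tk' c).flatMap (hT ba b tk) = hT ba b (fun m => (tk' m).flatMap (hT ba b tk)) c := by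
  rcases c with (a | ⟨b', m, s⟩ | ⟨i, s⟩)
  · simp [hT]
  · by_cases hb : b' = b
    · cases s
      · simp [hT, hb]
      · simp only [hT, hb, if_true]
        rw [(hT_BC hba b tk).flatMap]
    · simp [hT, hb]
  · simp [hT]

theorem hT_one {ba : A → A} (b : Bool) (c : CC A I M) : hT ba b (fun m => [bk b m false]) c = [c] := by
  rcases c with (a | ⟨b', m, s⟩ | ⟨i, s⟩)
  · simp [hT]
  · by_cases hb : b' = b
    · cases s
      · simp [hT, hb]
      · simp [hT, hb, lstar, bar]
    · simp [hT, hb]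
  · simp [hT]

theorem hT_fix {ba : A → A} (b : Bool) (tk : Fin M → List (CC A I M)) {c : CC A I M}
    (hc : ¬ inB b c) : hT ba b tk c = [c] := by
  rcases c with (a | ⟨b', m, s⟩ | ⟨i, s⟩)
  · rfl
  · simp [hT, show ¬ b' = b from hc]
  · rfl

def tkB (base : Fin M → CC A I M) (l : Fin M → ℕ) (m : Fin M) : List (CC A I M) :=
  List.replicate (l m) (base m)

theorem repl_fix {ba : A → A} (b : Bool) (tk : Fin M → List (CC A I M)) {c : CC A I M}
    (hc : ¬ inB b c) (n : ℕ) : (List.replicate n c).flatMap (hT ba b tk) = List.replicate n c := by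
  induction n with
  | zero => rfl
  | succ n ih => rw [List.replicate_succ, List.flatMap_cons, ih, hT_fix b tk hc]; rfl

noncomputable def eB (ba : A → A) (base : Fin M → CC A I M) (l : Fin M → ℕ) :
    Monoid.End (FreeMonoid (CC A I M)) := toEnd (hT ba true (tkB base l))

noncomputable def eL (ba : A → A) (base : Fin M → CC A I M) (l : Fin M → ℕ) :
    Monoid.End (FreeMonoid (CC A I M)) :=
  toEnd (hT ba true (fun m => tkB base l m ++ [bk true m false]))

theorem eB_mul {ba : A → A} (hba : Function.Involutive ba) {base : Fin M → CC A I M}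
    (hb : ∀ m, ¬ inB true (base m)) (l p : Fin M → ℕ) :
    eB ba base l * eL ba base p = eB ba base (l + p) := by
  unfold eB eL
  rw [toEnd_mul]
  congr 1
  funext c
  rw [hT_comp hba]
  congr 1
  funext m
  rw [List.flatMap_append]
  unfold tkB
  rw [repl_fix true _ (hb m)]
  simp only [List.flatMap_cons, List.flatMap_nil, List.append_nil, hT, if_true]
  rw [if_neg (by simp), ← List.replicate_add, add_comm]; rfl

theorem eL_mul {ba : A → A} (hba : Function.Involutive ba) {base : Fin M → CC A I M}
    (hb : ∀ m, ¬ inB true (base m)) (l p : Fin M → ℕ) :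
    eL ba base l * eL ba base p = eL ba base (l + p) := by
  unfold eL
  rw [toEnd_mul]
  congr 1
  funext c
  rw [hT_comp hba]
  congr 1
  funext m
  rw [List.flatMap_append]
  unfold tkB
  rw [repl_fix true _ (hb m)]
  simp only [List.flatMap_cons, List.flatMap_nil, List.append_nil, hT, if_true]
  rw [if_neg (by simp), ← List.append_assoc, ← List.replicate_add, add_comm]; rfl

theorem eL_zero {ba : A → A} (base : Fin M → CC A I M) : eL ba base 0 = 1 := by
  unfold eL
  rw [← toEnd_one]
  congr 1
  funext c
  exact hT_one true c

theorem mem_closure_eL {ba : A → A} (hba : Function.Involutive ba) {base : Fin M → CC A I M}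
    (hb : ∀ m, ¬ inB true (base m)) (P : Set (Fin M → ℕ)) (c : Monoid.End (FreeMonoid (CC A I M))) :
    c ∈ Submonoid.closure (eL ba base '' P) ↔ ∃ s ∈ AddSubmonoid.closure P, c = eL ba base s := by
  constructor
  · intro h
    induction h using Submonoid.closure_induction with
    | mem x hx =>
      obtain ⟨p, hp, rfl⟩ := hx
      exact ⟨p, AddSubmonoid.subset_closure hp, rfl⟩
    | one => exact ⟨0, zero_mem _, (eL_zero base).symm⟩
    | mul x y _ _ hx hy =>
      obtain ⟨s, hs, rfl⟩ := hx
      obtain ⟨t, ht, rfl⟩ := hy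
      exact ⟨s + t, add_mem hs ht, eL_mul hba hb s t⟩
  · rintro ⟨s, hs, rfl⟩
    induction hs using AddSubmonoid.closure_induction with
    | mem x hx => exact Submonoid.subset_closure ⟨x, hx, rfl⟩
    | zero => rw [eL_zero]; exact one_mem _
    | add x y _ _ hx hy => rw [← eL_mul hba hb]; exact mul_mem hx hy

theorem SLset_eB {ba : A → A} (hba : Function.Involutive ba) {base : Fin M → CC A I M}
    (hb : ∀ m, ¬ inB true (base m)) {L : Set (Fin M → ℕ)} (hL : IsSemilinearSet L) :
    SLset {e | ∃ l ∈ L, e = eB ba base l} := by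
  obtain ⟨S, hS, hS2, rfl⟩ := hL
  choose! a t ht hs using fun s (hs : s ∈ S) => hS2 s hs
  refine ⟨(fun s => (eB ba base (a s), eL ba base '' (t s))) '' S, hS.image _, ?_, ?_⟩
  · rintro _ ⟨s, h, rfl⟩
    exact (ht s h).image _
  · ext e
    simp only [Set.mem_ofPred_eq, Set.mem_sUnion]
    constructor
    · rintro ⟨l, ⟨s, h, hl⟩, rfl⟩
      refine ⟨_, ⟨s, h, rfl⟩, ?_⟩
      rw [hs s h] at hl
      obtain ⟨c, hc, rfl⟩ := hl
      exact ⟨_, (mem_closure_eL hba hb _ _).2 ⟨c, hc, rfl⟩, (eB_mul hba hb _ _).symm⟩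
    · rintro ⟨_, ⟨s, h, rfl⟩, c, hc, rfl⟩
      obtain ⟨d, hd, rfl⟩ := (mem_closure_eL hba hb _ _).1 hc
      refine ⟨a s + d, ⟨s, h, ?_⟩, eB_mul hba hb _ _⟩
      have := Set.ext_iff.1 (hs s h) (a s + d)
      exact this.2 ⟨d, hd, rfl⟩

end CC

namespace CC
variable {A I V : Type u} {M : ℕ}

theorem xp_append {Γ M : Type u} (x : M) (l l' : List (Γ × (M → ℕ))) :
    xp x (l ++ l') = xp x l ++ xp x l' := by simp [xp]

theorem xp_flatMap {Γ M Δ : Type u} (x : M) (f : Δ → List (Γ × (M → ℕ))) (w : List Δ) :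
    xp x (w.flatMap f) = w.flatMap (fun d => xp x (f d)) := by
  unfold xp; rw [List.flatMap_assoc]

def syStar {Γ M : Type u} (f : Γ → Γ) (l : List (Γ × (M → ℕ))) : List (Γ × (M → ℕ)) :=
  (l.map (fun p => (f p.1, p.2))).reverse

theorem xp_syStar {Γ M : Type u} (f : Γ → Γ) (x : M) (l : List (Γ × (M → ℕ))) :
    xp x (syStar f l) = lstar f (xp x l) := by
  induction l with
  | nil => rfl
  | cons p l ih =>
    have : syStar f (p :: l) = syStar f l ++ [(f p.1, p.2)] := by simp [syStar]
    rw [this, xp_append, xp_cons x p l, lstar_append, ih]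
    simp [xp, lstar]

theorem aff_syStar {Γ M : Type u} [AddCommMonoid M] (f : Γ → Γ) {l : List (Γ × (M → ℕ))}
    (h : ∀ p ∈ l, IsAff p.2) : ∀ p ∈ syStar f l, IsAff p.2 := by
  intro p hp
  simp only [syStar, List.mem_reverse, List.mem_map] at hp
  obtain ⟨q, hq, rfl⟩ := hp
  exact h q hq

theorem aff_flatMap {Γ M Δ : Type u} [AddCommMonoid M] (f : Δ → List (Γ × (M → ℕ))) (w : List Δ)
    (h : ∀ d, ∀ p ∈ f d, IsAff p.2) : ∀ p ∈ w.flatMap f, IsAff p.2 := by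
  intro p hp
  rw [List.mem_flatMap] at hp
  obtain ⟨d, _, hd⟩ := hp
  exact h d p hd

abbrev Mx (V : Type u) (M : ℕ) : Type u := (V × Bool → ℕ) × (Fin M → ℕ)

def τB (sh : V → CC A I M × Bool × CC A I M) (wt : V × Bool → ℕ) (v : V) : List (CC A I M ⊕ V) :=
  List.replicate (wt (v, false)) (Sum.inl (sh v).1) ++ ((if (sh v).2.1 then [Sum.inr v] else []) ++
    List.replicate (wt (v, true)) (Sum.inl (sh v).2.2))

def syT (sh : V → CC A I M × Bool × CC A I M) (v : V) : List ((CC A I M ⊕ V) × (Mx V M → ℕ)) :=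
  [(Sum.inl (sh v).1, fun x => x.1 (v, false))] ++
    ((if (sh v).2.1 then [(Sum.inr v, fun _ => 1)] else []) ++
    [(Sum.inl (sh v).2.2, fun x => x.1 (v, true))])

theorem isAff_left (v : V × Bool) : IsAff (fun x : Mx V M => x.1 v) :=
  ⟨0, (Pi.evalAddMonoidHom _ v).comp (AddMonoidHom.fst _ _), fun x => by simp⟩

theorem isAff_right (m : Fin M) : IsAff (fun x : Mx V M => x.2 m) :=
  ⟨0, (Pi.evalAddMonoidHom _ m).comp (AddMonoidHom.snd _ _), fun x => by simp⟩

theorem aff_syT (sh : V → CC A I M × Bool × CC A I M) (v : V) : ∀ p ∈ syT sh v, IsAff p.2 := by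
  intro p hp
  unfold syT at hp
  split_ifs at hp <;> simp at hp
  · rcases hp with rfl | rfl | rfl
    · exact isAff_left _
    · exact isAff_const 1
    · exact isAff_left _
  · rcases hp with rfl | rfl
    · exact isAff_left _
    · exact isAff_left _

theorem xp_syT (sh : V → CC A I M × Bool × CC A I M) (v : V) (x : Mx V M) :
    xp x (syT sh v) = τB sh x.1 v := by
  unfold syT τB
  rw [xp_append, xp_append]
  congr 1
  · simp [xp]
  · congr 1
    · split_ifs <;> simp [xp]
    · simp [xp]

def syL (sh : V → CC A I M × Bool × CC A I M) :
    CC A I M ⊕ V → List ((CC A I M ⊕ V) × (Mx V M → ℕ)) :=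
  Sum.elim (fun c => [(Sum.inl c, fun _ => 1)]) (syT sh)

theorem aff_syL (sh : V → CC A I M × Bool × CC A I M) (d : CC A I M ⊕ V) :
    ∀ p ∈ syL sh d, IsAff p.2 := by
  rcases d with c | v
  · intro p hp
    simp [syL] at hp; subst hp; exact isAff_const 1
  · exact aff_syT sh v

theorem xp_syL (sh : V → CC A I M × Bool × CC A I M) (w : List (CC A I M ⊕ V)) (x : Mx V M) :
    xp x (w.flatMap (syL sh)) = w.flatMap (sub (τB sh x.1)) := by
  rw [xp_flatMap]
  congr 1
  funext d
  rcases d with c | v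
  · simp [syL, xp, sub]
  · exact xp_syT sh v x

def syR (ba : A → A) (base : Fin M → CC A I M) :
    CC A I M ⊕ V → List ((CC A I M ⊕ V) × (Mx V M → ℕ))
  | Sum.inl (bk true m s) => [(Sum.inl (if s then bar ba (base m) else base m), fun x => x.2 m)]
  | c => [(c, fun _ => 1)]

theorem aff_syR (ba : A → A) (base : Fin M → CC A I M) (d : CC A I M ⊕ V) :
    ∀ p ∈ syR ba base d, IsAff p.2 := by
  rcases d with (a | ⟨_ | _, m, s⟩ | ⟨i, s⟩) | v <;> intro p hp <;> simp [syR] at hp <;> subst hp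
  · exact isAff_const 1
  · exact isAff_const 1
  · exact isAff_right m
  · exact isAff_const 1
  · exact isAff_const 1

theorem lstar_replicate {Γ : Type u} (f : Γ → Γ) (n : ℕ) (c : Γ) :
    lstar f (List.replicate n c) = List.replicate n (f c) := by simp [lstar]

theorem xp_syR (ba : A → A) (base : Fin M → CC A I M) (w : List (CC A I M ⊕ V)) (x : Mx V M) :
    xp x (w.flatMap (syR ba base)) = w.flatMap (hS (hT ba true (tkB base x.2))) := by
  rw [xp_flatMap]
  congr 1
  funext d
  rcases d with (a | ⟨_ | _, m, s⟩ | ⟨i, s⟩) | v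
  · simp [syR, xp, hS, hT]
  · simp [syR, xp, hS, hT]
  · cases s
    · simp [syR, xp, hS, hT, tkB]
    · simp [syR, xp, hS, hT, tkB, lstar_replicate]
  · simp [syR, xp, hS, hT]
  · simp [syR, xp, hS]

def ΛB (ba : A → A) (vb : V → V) (W W' : I → List (CC A I M ⊕ V)) (base : Fin M → CC A I M)
    (sh : V → CC A I M × Bool × CC A I M) : Set (Fin M → ℕ) :=
  {l | ∃ wt, BC (Sum.map (bar ba) vb) vb (τB sh wt) ∧
    ∀ i, (W i).flatMap (sub (τB sh wt)) = (W' i).flatMap (hS (hT ba true (tkB base l)))}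

theorem ΛB_semilin [Finite V] [Finite I] (ba : A → A) (vb : V → V) (W W' : I → List (CC A I M ⊕ V))
    (base : Fin M → CC A I M) (sh : V → CC A I M × Bool × CC A I M) :
    IsSemilinearSet (ΛB ba vb W W' base sh) := by
  have h1 : IsSemilinearSet (⋂ v, {x : Mx V M | xp x (syT sh (vb v)) =
      xp x (syStar (Sum.map (bar ba) vb) (syT sh v))}) :=
    IsSemilinearSet.iInter (fun v => semilin_xp _ _ _ (aff_syT sh _) (aff_syStar _ (aff_syT sh _)) le_rfl)
  have h2 : IsSemilinearSet (⋂ i, {x : Mx V M | xp x ((W i).flatMap (syL sh)) =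
      xp x ((W' i).flatMap (syR ba base))}) :=
    IsSemilinearSet.iInter (fun v => semilin_xp _ _ _ (aff_flatMap _ _ (aff_syL sh))
      (aff_flatMap _ _ (aff_syR ba base)) le_rfl)
  convert (h1.inter h2).image (AddMonoidHom.snd (V × Bool → ℕ) (Fin M → ℕ)) using 1
  ext l
  simp only [ΛB, BC, Set.mem_ofPred_eq, Set.mem_image, Set.mem_inter_iff, Set.mem_iInter, xp_syStar,
    xp_syT, xp_syL, xp_syR, AddMonoidHom.coe_snd, Prod.exists]
  constructor
  · rintro ⟨wt, ha, hb⟩; exact ⟨wt, l, ⟨ha, hb⟩, rfl⟩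
  · rintro ⟨wt, l', ⟨ha, hb⟩, rfl⟩; exact ⟨wt, ha, hb⟩

end CC

namespace CC
variable {A I V : Type u} {M : ℕ}

def SoundS (ba : A → A) (vb : V → V) (W : I → List (CC A I M ⊕ V)) (h : CC A I M → List (CC A I M))
    (W' : I → List (CC A I M ⊕ V)) : Prop :=
  ∃ τ, BC (Sum.map (bar ba) vb) vb τ ∧ ∀ i, (W i).flatMap (sub τ) = (W' i).flatMap (hS h)

def FH (ba : A → A) (h : CC A I M → List (CC A I M)) : Prop :=
  BC (bar ba) (bar ba) h ∧ (∀ a, h (con a) = [con a]) ∧ ∀ c, (h c).length ≤ 2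

def ers : CC A I M → List (CC A I M)
  | con a => [con a]
  | _ => []

def finL (W : I → List (CC A I M ⊕ V)) : CC A I M → List (CC A I M)
  | out i false => (W i).flatMap (ev (fun _ => []))
  | c => [c]

abbrev QW (A I V : Type u) (M : ℕ) : Type u := I → {l : List (CC A I M ⊕ V) // l.length ≤ M}

def qv (W : QW A I V M) (i : I) : List (CC A I M ⊕ V) := (W i).1

def TT (ba : A → A) (vb : V → V) (Eqs : I → I → Prop) (W0 : QW A I V M) :
    QW A I V M ⊕ ULift.{u} Bool → Monoid.End (FreeMonoid (CC A I M)) →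
      QW A I V M ⊕ ULift.{u} Bool → Prop
  | Sum.inr ⟨false⟩, e, Sum.inl W => W = W0 ∧ e = toEnd ers
  | Sum.inl W, e, Sum.inl W' => (∃ h, FH ba h ∧ SoundS ba vb (qv W) h (qv W') ∧ e = toEnd h) ∨
      ∃ base sh, (∀ m, ¬ inB true (base m)) ∧
        ∃ l ∈ ΛB ba vb (qv W) (qv W') base sh, e = eB ba base l
  | Sum.inl W, e, Sum.inr ⟨true⟩ => (∀ i j, Eqs i j →
      (qv W i).flatMap (ev (fun _ => [])) = (qv W j).flatMap (ev (fun _ => []))) ∧ e = toEnd (finL (qv W))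
  | _, _, _ => False

theorem FH_finite [Finite A] [Finite I] (ba : A → A) :
    {h : CC A I M → List (CC A I M) | FH ba h}.Finite := by
  have h1 : (Set.univ.pi (fun _ : CC A I M => {l : List (CC A I M) | l.length ≤ 2})).Finite :=
    Set.Finite.pi' (fun _ => List.finite_length_le _ 2) |>.subset (fun f hf c => hf c trivial)
  refine h1.subset ?_
  intro h hh c _
  exact hh.2.2 c

instance [Finite A] [Finite I] [Finite V] : Finite (QW A I V M) := by
  have : Finite {l : List (CC A I M ⊕ V) // l.length ≤ M} := List.finite_length_le _ M
  infer_instance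

theorem TT_rational [Finite A] [Finite I] [Finite V] (ba : A → A) (hba : Function.Involutive ba)
    (vb : V → V) (Eqs : I → I → Prop) (W0 : QW A I V M) :
    RationalSet {e | PPath (TT ba vb Eqs W0) (Sum.inr ⟨false⟩) e (Sum.inr ⟨true⟩)} := by
  have := rational_sl (fun q => q = Sum.inr ⟨false⟩) (fun q => q = Sum.inr ⟨true⟩)
    (TT ba vb Eqs W0) (by
    intro q r
    have hemp : SLset (∅ : Set (Monoid.End (FreeMonoid (CC A I M)))) := SLset.finite Set.finite_empty
    rcases q with W | ⟨_ | _⟩ <;> rcases r with W' | ⟨_ | _⟩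
    · simp only [TT]
      have h1 : SLset {e | ∃ h : CC A I M → List (CC A I M), FH ba h ∧
          SoundS ba vb (qv W) h (qv W') ∧ e = toEnd h} := by
        apply SLset.finite
        refine ((FH_finite ba).image toEnd).subset ?_
        rintro e ⟨h, h1, _, rfl⟩
        exact ⟨h, h1, rfl⟩
      have h2 : SLset (⋃ p : (ULift.{u} (Fin M) → CC A I M) × (V → CC A I M × Bool × CC A I M),
          {e | (∀ m, ¬ inB true (p.1 ⟨m⟩)) ∧ ∃ l ∈ ΛB ba vb (qv W) (qv W') (fun m => p.1 ⟨m⟩) p.2,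
            e = eB ba (fun m => p.1 ⟨m⟩) l}) := by
        apply SLset.iUnion
        rintro ⟨base, sh⟩
        by_cases hb : ∀ m, ¬ inB true (base ⟨m⟩)
        · simp only [hb, implies_true, true_and, not_false_eq_true]
          exact SLset_eB hba hb (ΛB_semilin ba vb _ _ _ sh)
        · simp only [hb, false_and]
          exact hemp
      convert h1.union h2 using 1
      ext e
      simp only [Set.mem_ofPred_eq, Set.mem_union, Set.mem_iUnion, Prod.exists]
      refine or_congr_right ?_
      constructor
      · rintro ⟨base, sh, h⟩
        exact ⟨fun m => base m.down, sh, h⟩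
      · rintro ⟨base, sh, h⟩
        exact ⟨fun m => base ⟨m⟩, sh, h⟩
    · simpa [TT] using hemp
    · apply SLset.finite
      refine (Set.finite_singleton (toEnd (finL (qv W)))).subset ?_
      rintro e ⟨_, rfl⟩; rfl
    · apply SLset.finite
      refine (Set.finite_singleton (toEnd ers)).subset ?_
      rintro e ⟨_, rfl⟩; rfl
    · simpa [TT] using hemp
    · simpa [TT] using hemp
    · simpa [TT] using hemp
    · simpa [TT] using hemp
    · simpa [TT] using hemp)
  convert this using 1
  ext e
  simp

theorem toEnd_apply {C : Type u} (h : C → List C) (x : FreeMonoid C) :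
    FreeMonoid.toList (toEnd h x) = (FreeMonoid.toList x).flatMap h := by
  conv_lhs => rw [← FreeMonoid.ofList_toList x, toEnd_ofList]
  rfl

/-- soundness -/
theorem TT_sound {ba : A → A} (hba : Function.Involutive ba)
    {vb : V → V} {Eqs : I → I → Prop} {W0 : QW A I V M}
    {q r : QW A I V M ⊕ ULift.{u} Bool} {g : Monoid.End (FreeMonoid (CC A I M))}
    (h : PPath (TT ba vb Eqs W0) q g r) (hr : r = Sum.inr ⟨true⟩) : 
    (∀ a, g (FreeMonoid.of (con a)) = FreeMonoid.of (con a)) ∧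
    ∀ W, q = Sum.inl W → ∃ σ : V → List (CC A I M), BC (bar ba) vb σ ∧
      (∀ i j, Eqs i j → (qv W i).flatMap (ev σ) = (qv W j).flatMap (ev σ)) ∧
      ∀ i, FreeMonoid.toList (g (FreeMonoid.of (out i false))) = (qv W i).flatMap (ev σ) := by
  induction h with
  | nil q => exact ⟨fun a => rfl, fun W hW => by simp [hr] at hW⟩
  | @cons q r s e f hT hp ih =>
    have ih := ih hr
    have hcomp : ∀ x, (e * f) x = e (f x) := fun x => rfl
    rcases q with W | ⟨_ | _⟩ <;> rcases r with W' | ⟨_ | _⟩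
    · have key : ∃ h, BC (bar ba) (bar ba) h ∧ (∀ a, h (con a) = [con a]) ∧
          SoundS ba vb (qv W) h (qv W') ∧ e = toEnd h := by
        rcases hT with ⟨h, h1, h2, h3⟩ | ⟨base, sh, hb, l, ⟨wt, h1, h2⟩, h3⟩
        · exact ⟨h, h1.1, h1.2.1, h2, h3⟩
        · exact ⟨_, hT_BC hba true (tkB base l), fun a => rfl, ⟨_, h1, h2⟩, h3⟩
      obtain ⟨h, hbc, hcon, ⟨τ, hτ, hW⟩, rfl⟩ := key
      refine ⟨fun a => by rw [hcomp, ih.1, toEnd_of, hcon]; rfl, ?_⟩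
      intro W1 hW1
      simp only [Sum.inl.injEq] at hW1
      subst hW1
      obtain ⟨σ', hσ', heq, hval⟩ := ih.2 W' rfl
      obtain ⟨σ, hσ, hs⟩ := sound_step hbc hτ hW σ' hσ'
      refine ⟨σ, hσ, fun i j hij => by rw [hs, hs, heq i j hij], fun i => ?_⟩
      rw [hcomp, toEnd_apply, hval, hs]
    · exact hT.elim
    · obtain ⟨h1, rfl⟩ := hT
      have hf : f = 1 := by
        cases hp with
        | nil => rfl
        | @cons _ r' _ e' f' h _ =>
          rcases r' with _ | ⟨_ | _⟩ <;> exact h.elim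
      subst hf
      refine ⟨fun a => by rw [mul_one, toEnd_of]; rfl, ?_⟩
      intro W1 hW1
      simp only [Sum.inl.injEq] at hW1
      subst hW1
      refine ⟨fun _ => [], fun v => rfl, h1, fun i => ?_⟩
      rw [mul_one, toEnd_of]; rfl
    · obtain ⟨rfl, rfl⟩ := hT
      refine ⟨fun a => by rw [hcomp, ih.1, toEnd_of]; rfl, ?_⟩
      intro W1 hW1; simp at hW1
    all_goals exact hT.elim

end CC

namespace CC
variable {A I V : Type u} {M : ℕ}

theorem bar_inB (ba : A → A) (b : Bool) (c : CC A I M) : inB b (bar ba c) ↔ inB b c := by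
  rcases c with (a | ⟨b', m, s⟩ | ⟨i, s⟩) <;> rfl

theorem WGood_letter {ba : A → A} {cb : CC A I M → CC A I M} {vb : V → V} {Eqs : I → I → Prop}
    {P : CC A I M → Prop} {α : CC A I M → List A}
    {W : I → List (CC A I M ⊕ V)} {σ : V → List (CC A I M)}
    (hG : WGood ba cb vb Eqs P α W σ) {i : I} {c : CC A I M}
    (hc : c ∈ (W i).flatMap (ev σ)) : P c ∧ α c ≠ [] := by
  rw [List.mem_flatMap] at hc
  obtain ⟨x, hx, hc⟩ := hc
  rcases x with d | v
  · simp only [ev, Sum.elim_inl, List.mem_singleton] at hc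
    subst hc
    exact hG.okW i _ hx
  · exact hG.okσ v c hc

/-- one compression stage -/
theorem stage [Finite A] [Finite I] [Fintype I] {ba : A → A} (hba : Function.Involutive ba)
    (hfp : ∀ a, ba a ≠ a)
    (b : Bool) {vb : V → V} {Eqs : I → I → Prop}
    {P : CC A I M → Prop} {α : CC A I M → List A}
    {W : I → List (CC A I M ⊕ V)} {σ : V → List (CC A I M)}
    (hG : WGood ba (bar ba) vb Eqs P α W σ) (hα : ∀ a, α (con a) = [a])
    (glue : CC A I M → CC A I M → Bool)
    (hcard : ∑ i, (cG glue σ W i).length ≤ M) (hM : 0 < M) :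
    ∃ (D : Set (List (CC A I M))) (nm : List (CC A I M) → CC A I M) (tk : Fin M → List (CC A I M)),
      Naming ba (bar ba) con α D nm (hT ba b tk) ∧
      (∀ i t, t.map Sum.inl ∈ cG glue σ W i → t ∈ D) ∧
      (∀ t ∈ D, t.flatMap α ≠ []) ∧ (∀ t ∈ D, inB b (nm t)) ∧
      (∀ m, tk m = [] ∨ tk m ∈ D) ∧
      ∀ t ∈ D, ∃ i, t.map Sum.inl ∈ cG glue σ W i ∨
        (lstar (bar ba) t).map Sum.inl ∈ cG glue σ W i := by
  have hinv := bar_inv (I := I) (M := M) hba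
  let D0 : Finset (List (CC A I M)) :=
    Finset.univ.biUnion (fun i => ((cG glue σ W i).filter
      (fun g => decide (∃ t, t ≠ [] ∧ g = t.map Sum.inl))).toFinset.image lets)
  have hD0 : ∀ t, t ∈ D0 ↔ ∃ i, t.map Sum.inl ∈ cG glue σ W i := by
    intro t
    simp only [D0, Finset.mem_biUnion, Finset.mem_univ, true_and, Finset.mem_image,
      List.mem_toFinset, List.mem_filter, decide_eq_true_eq]
    constructor
    · rintro ⟨i, g, ⟨hg, t', _, rfl⟩, h⟩
      rw [lets_map] at h; subst h
      exact ⟨i, hg⟩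
    · rintro ⟨i, hi⟩
      refine ⟨i, _, ⟨hi, t, ?_, rfl⟩, lets_map t⟩
      have := List.ne_nil_of_mem_splitBy hi
      simpa using this
  have hc : D0.card ≤ M := by
    refine le_trans (Finset.card_biUnion_le.trans (Finset.sum_le_sum ?_)) hcard
    intro i _
    exact Finset.card_image_le.trans ((List.toFinset_card_le _).trans (List.length_filter_le _ _))
  have hne : ∀ t i, t.map Sum.inl ∈ cG glue σ W i → t ≠ [] := by
    intro t i hi
    have := List.ne_nil_of_mem_splitBy hi
    simpa using this
  have hself : ∀ t ∈ D0, lstar (bar ba) t ≠ t := by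
    intro t ht
    obtain ⟨i, hi⟩ := (hD0 t).1 ht
    exact hG.tok_ne hba hfp (hne t i hi) (cG_sub hi)
  have hav : ∀ t ∈ D0, t.flatMap α ≠ [] := by
    intro t ht
    obtain ⟨i, hi⟩ := (hD0 t).1 ht
    have h1 := hne t i hi
    have h2 := (cG_sub hi).subset
    rcases t with _ | ⟨c, t⟩
    · exact absurd rfl h1
    · have := (WGood_letter hG (h2 (List.mem_cons_self))).2
      simp [this]
  obtain ⟨nm, tk, h1, h2⟩ := exists_naming hba b D0 hc hself hM
  refine ⟨{t | t ∈ D0 ∨ lstar (bar ba) t ∈ D0}, nm, tk, ⟨hT_BC hba b tk, fun a => rfl, hα,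
    fun a => rfl, ?_, fun t ht => (h1 t ht).2.1, fun t ht => (h1 t ht).2.2⟩, ?_, ?_, 
    fun t ht => (h1 t ht).1, h2, ?_⟩
  · rintro t (h | h)
    · right; rw [lstar_lstar hinv]; exact h
    · left; exact h
  · intro i t ht
    exact Or.inl ((hD0 t).2 ⟨i, ht⟩)
  · rintro t (h | h)
    · exact hav t h
    · have := hav _ h
      rw [hG.bcα.flatMap] at this
      intro h0; rw [h0] at this; exact this rfl
  · rintro t (h | h)
    · obtain ⟨i, hi⟩ := (hD0 t).1 h
      exact ⟨i, Or.inl hi⟩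
    · obtain ⟨i, hi⟩ := (hD0 _).1 h
      exact ⟨i, Or.inr hi⟩

theorem WGood.mono {ba : A → A} {cb : CC A I M → CC A I M} {vb : V → V} {Eqs : I → I → Prop}
    {P Q : CC A I M → Prop} {α : CC A I M → List A}
    {W : I → List (CC A I M ⊕ V)} {σ : V → List (CC A I M)}
    (hG : WGood ba cb vb Eqs P α W σ) (h : ∀ c, P c → Q c) : WGood ba cb vb Eqs Q α W σ :=
  ⟨hG.bcσ, hG.bcα, fun i c hc => ⟨h _ (hG.okW i c hc).1, (hG.okW i c hc).2⟩,
    fun v c hc => ⟨h _ (hG.okσ v c hc).1, (hG.okσ v c hc).2⟩, hG.eqs, hG.red⟩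

def mkQ (W : I → List (CC A I M ⊕ V)) (h : ∀ i, (W i).length ≤ M) : QW A I V M := fun i => ⟨W i, h i⟩

theorem qv_mkQ (W : I → List (CC A I M ⊕ V)) (h : ∀ i, (W i).length ≤ M) : qv (mkQ W h) = W := rfl

noncomputable def gEq (x y : CC A I M) : Bool := decide (x = y)

theorem eqchain {C : Type u} {t : List C} (h : t.IsChain (fun x y => x = y)) :
    ∀ c ∈ t.head?, t = List.replicate t.length c := by
  induction t with
  | nil => simp
  | cons a t ih =>
    intro c hc
    simp only [List.head?_cons, Option.mem_def, Option.some.injEq] at hc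
    subst hc
    rcases t with _ | ⟨b, t⟩
    · rfl
    · rw [List.isChain_cons_cons] at h
      have := ih h.2 b (by simp)
      rw [List.length_cons, List.replicate_succ, h.1]
      congr 1

theorem gEq_tok {t : List (CC A I M)} (h : t.IsChain (fun x y => gEq x y = true)) 
    (d : CC A I M) : ∃ c n, t = List.replicate n c ∧ (c = d ∨ c ∈ t) := by
  rcases t with _ | ⟨c, t⟩
  · exact ⟨d, 0, rfl, Or.inl rfl⟩
  · refine ⟨c, (c :: t).length, eqchain (h.imp (fun x y hxy => by simpa [gEq] using hxy)) c (by simp), 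
      Or.inr (by simp)⟩

theorem gEq_shape (σ : V → List (CC A I M)) (d : CC A I M) (v : V) :
    ∃ (x : CC A I M × Bool × CC A I M) (n m : ℕ), cτ gEq σ v =
      List.replicate n (Sum.inl x.1) ++ ((if x.2.1 then [Sum.inr v] else []) ++
      List.replicate m (Sum.inl x.2.2)) := by
  unfold cτ
  have hc : ∀ t ∈ (σ v).splitBy gEq, ∃ c n, t = List.replicate n c := by
    intro t ht
    obtain ⟨c, n, h, _⟩ := gEq_tok (List.isChain_of_mem_splitBy ht) d
    exact ⟨c, n, h⟩
  rcases tok_cases ((σ v).splitBy gEq) with h | ⟨t, h⟩ | ⟨p, q, h⟩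
  · rw [h, tauT_nil]
    exact ⟨(d, false, d), 0, 0, by simp⟩
  · obtain ⟨c, n, hn⟩ := hc t (by rw [h]; simp)
    rw [h, tauT_one, hn]
    exact ⟨(c, false, d), n, 0, by simp⟩
  · obtain ⟨c, n, hn⟩ := hc p (by rw [h]; simp)
    obtain ⟨c', n', hn'⟩ := hc q (by rw [h]; simp)
    rw [h, tauT_two, hn, hn']
    refine ⟨(c, decide (mid ((σ v).splitBy gEq) ≠ []), c'), n, n', ?_⟩
    simp only [List.map_replicate]
    by_cases h0 : mid ((σ v).splitBy gEq) = []
    · simp [h0]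
    · simp [h0]

end CC

namespace CC
variable {A I V : Type u} {M : ℕ}

theorem isChain_and' {α : Type u} {r s : α → α → Prop} {l : List α} (h1 : l.IsChain r)
    (h2 : l.IsChain s) : l.IsChain (fun x y => r x y ∧ s x y) := by
  induction l with
  | nil => simp
  | cons a l ih =>
    rcases l with _ | ⟨b, l⟩
    · simp
    · rw [List.isChain_cons_cons] at *
      exact ⟨⟨h1.1, h2.1⟩, ih h1.2 h2.2⟩

structure Step (ba : A → A) (vb : V → V) (Eqs : I → I → Prop) (b : Bool)
    (α : CC A I M → List A) (W : I → List (CC A I M ⊕ V)) (σ : V → List (CC A I M))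
    (h : CC A I M → List (CC A I M)) (W1 : I → List (CC A I M ⊕ V)) (σ1 : V → List (CC A I M)) : Prop where
  good : WGood ba (bar ba) vb Eqs (fun c => inB b c ∨ ∃ a, c = con a) (cα h α) W1 σ1
  acon : ∀ a, cα h α (con a) = [a]
  val : ∀ i, ((W1 i).flatMap (ev σ1)).flatMap (cα h α) = ((W i).flatMap (ev σ)).flatMap α
  le : ∀ v, ((σ1 v).flatMap (cα h α)).length ≤ ((σ v).flatMap α).length
  lt : ∀ v, σ v ≠ [] → ((σ1 v).flatMap (cα h α)).length < ((σ v).flatMap α).length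
  occ_le : ∀ i, occ (W1 i) ≤ occ (W i)

theorem mkStep [Finite A] [Finite I] [Fintype I] {ba : A → A} (hba : Function.Involutive ba)
    {b : Bool} {vb : V → V} {Eqs : I → I → Prop}
    {P : CC A I M → Prop} {α : CC A I M → List A}
    {W : I → List (CC A I M ⊕ V)} {σ : V → List (CC A I M)}
    (hG : WGood ba (bar ba) vb Eqs P α W σ)
    {glue : CC A I M → CC A I M → Bool} (hglue : ∀ x y, glue (bar ba y) (bar ba x) = glue x y)
    {D : Set (List (CC A I M))} {nm : List (CC A I M) → CC A I M} {tk : Fin M → List (CC A I M)}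
    (hN : Naming ba (bar ba) con α D nm (hT ba b tk))
    (hD : ∀ i t, t.map Sum.inl ∈ cG glue σ W i → t ∈ D)
    (hne : ∀ t ∈ D, t.flatMap α ≠ []) (hin : ∀ t ∈ D, inB b (nm t)) :
    Step ba vb Eqs b α W σ (hT ba b tk) (cW glue nm σ W) (cσ glue D nm α con σ) := by
  refine ⟨?_, ?_, ?_, ?_, ?_, ?_⟩
  · refine WGood.mono (compress_good hG hN (bar_inv hba) hglue hD hne) ?_
    rintro c (⟨t, ht, rfl⟩ | h)
    · exact Or.inl (hin t ht)
    · exact Or.inr h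
  · intro a; show List.flatMap α [con a] = [a]; simp [hN.αA]
  · exact compress_val hN hD
  · exact compress_meas_le hN
  · intro v hv
    exact compress_meas_lt hN v hv (fun c hc => (hG.okσ v c hc).2)
  · exact occ_cW_le hN hD

theorem length_cW {glue : CC A I M → CC A I M → Bool} {nm : List (CC A I M) → CC A I M}
    {σ : V → List (CC A I M)} {W : I → List (CC A I M ⊕ V)} (i : I) :
    (cW glue nm σ W i).length = (cG glue σ W i).length := by simp [cW]

theorem cG_chain {glue : CC A I M → CC A I M → Bool} 
    {σ : V → List (CC A I M)} {W : I → List (CC A I M ⊕ V)} {i : I} {t : List (CC A I M)}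
    (h : t.map Sum.inl ∈ cG glue σ W i) : t.IsChain (fun x y => glue x y = true) := by
  have := List.isChain_of_mem_splitBy h
  rw [List.isChain_map] at this
  exact this

theorem block_step [Finite A] [Finite I] [Fintype I] {ba : A → A} (hba : Function.Involutive ba)
    (hfp : ∀ a, ba a ≠ a) {vb : V → V} {Eqs : I → I → Prop} (W0 : QW A I V M)
    {P : CC A I M → Prop} (hP : ∀ c, P c → ¬ inB true c) {α : CC A I M → List A}
    {W : I → List (CC A I M ⊕ V)} {σ : V → List (CC A I M)}
    (hG : WGood ba (bar ba) vb Eqs P α W σ) (hα : ∀ a, α (con a) = [a])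
    (hlen : ∀ i, (W i).length ≤ M) (hM : 0 < M)
    (hcard : ∑ i, (W i).length + 2 * ∑ i, occ (W i) ≤ M) :
    ∃ h W1 σ1, ∃ hlen1 : ∀ i, (W1 i).length ≤ M, Step ba vb Eqs true α W σ h W1 σ1 ∧
      TT ba vb Eqs W0 (Sum.inl (mkQ W hlen)) (toEnd h) (Sum.inl (mkQ W1 hlen1)) ∧
      (∑ i, (W1 i).length ≤ ∑ i, (W i).length + 2 * ∑ i, occ (W i)) ∧ ∀ i, AdjOK (bar ba) (W1 i) := by
  have hinv := bar_inv (I := I) (M := M) hba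
  have hglue : ∀ x y : CC A I M, gEq (bar ba y) (bar ba x) = gEq x y := by
    intro x y
    simp only [gEq, decide_eq_decide, hinv.injective.eq_iff]
    exact eq_comm
  have hS : ∑ i, (cG gEq σ W i).length ≤ ∑ i, (W i).length + 2 * ∑ i, occ (W i) := by
    rw [Finset.mul_sum, ← Finset.sum_add_distrib]
    refine Finset.sum_le_sum (fun i _ => ?_)
    have h1 := length_cG_le gEq σ W i
    have h2 := length_splitBy_npair (glueS gEq) (W i)
    omega
  obtain ⟨D, nm, tk, hN, hD, hne, hin, htk, hDc⟩ := stage hba hfp true hG hα gEq (hS.trans hcard) hM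
  have hstep := mkStep hba hG hglue hN hD hne hin
  have hlen1 : ∀ i, (cW gEq nm σ W i).length ≤ M := by
    intro i
    rw [length_cW]
    exact (Finset.single_le_sum (f := fun i => (cG gEq σ W i).length) (fun _ _ => Nat.zero_le _) (Finset.mem_univ i)).trans
      (hS.trans hcard)
  let d0 : CC A I M := bk false ⟨0, hM⟩ false
  have hDrep : ∀ t ∈ D, ∃ c n, t = List.replicate n c ∧ ¬ inB true c := by
    intro t ht
    have key : ∀ (t : List (CC A I M)) (i : I), t.map Sum.inl ∈ cG gEq σ W i → ∃ c n, t = List.replicate n c ∧ ¬ inB true c := by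
      intro t i hi
      obtain ⟨c, n, h1, h2⟩ := gEq_tok (cG_chain hi) d0
      refine ⟨c, n, h1, ?_⟩
      rcases h2 with rfl | h2
      · simp [d0, inB]
      · exact hP c (WGood_letter hG ((cG_sub hi).subset h2)).1
    obtain ⟨i, hi | hi⟩ := hDc t ht
    · exact key t i hi
    · obtain ⟨c, n, h1, h2⟩ := key _ i hi
      refine ⟨bar ba c, n, ?_, by rwa [bar_inB]⟩
      rw [← lstar_lstar hinv t, h1, lstar_replicate]
  have htkrep : ∀ m, ∃ c n, tk m = List.replicate n c ∧ ¬ inB true c := by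
    intro m
    rcases htk m with h | h
    · exact ⟨d0, 0, by rw [h]; rfl, by simp [d0, inB]⟩
    · exact hDrep _ h
  choose base l hbl hbb using htkrep
  have htkB : tkB base l = tk := by funext m; rw [hbl]; rfl
  choose sh n m hsh using gEq_shape σ d0
  refine ⟨_, _, _, hlen1, hstep, ?_, ?_, ?_⟩
  · right
    refine ⟨base, sh, hbb, l, ⟨fun p => if p.2 then m p.1 else n p.1, ?_, ?_⟩, ?_⟩
    · have : τB sh (fun p => if p.2 then m p.1 else n p.1) = cτ gEq σ := by
        funext v; rw [hsh]; simp [τB]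
      rw [this]
      exact cτ_BC hG.bcσ hglue
    · intro i
      have : τB sh (fun p => if p.2 then m p.1 else n p.1) = cτ gEq σ := by
        funext v; rw [hsh]; simp [τB]
      rw [this, htkB]
      exact chS hN hD i
    · unfold eB; rw [htkB]
  · simp only [length_cW]; exact hS
  · intro i
    have hred := hstep.good.red i
    have hnot : ∀ x y, [x, y] <:+: cW gEq nm σ W i → ∀ c d, x = Sum.inl c → y = Sum.inl d → d ≠ bar ba c := by
      rintro x y hxy c d rfl rfl hdc
      have h1 := flatMap_inf (cα (hT ba true tk) α) (flatMap_inf (ev (cσ gEq D nm α con σ)) hxy)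
      have h2 := hred.of_sub h1
      simp only [List.flatMap_cons, ev, Sum.elim_inl, List.flatMap_nil, List.append_nil, hdc,
        List.singleton_append] at h2
      rw [hstep.good.bcα c] at h2
      have h3 := (hstep.good.okW i c (hxy.subset (by simp))).2
      rcases List.eq_nil_or_concat (cα (hT ba true tk) α c) with h4 | ⟨m, q, h4⟩
      · exact h3 h4
      · rw [h4] at h2
        have : [q, ba q] <:+: (m.concat q) ++ lstar ba (m.concat q) := by
          refine ⟨m, lstar ba m, ?_⟩
          simp [lstar]
        have := h2.of_sub this
        simp [Red] at this
    have hch : (cG gEq σ W i).IsChain (fun g g' => ∀ c d, nmS nm g = Sum.inl c → nmS nm g' = Sum.inl d → d ≠ c) := by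
      have h1 := List.isChain_getLast_head_splitBy (glueS gEq) ((W i).flatMap (sub (cτ gEq σ)))
      have h2 : (cG gEq σ W i).IsChain (fun g g' => [g, g'] <:+: cG gEq σ W i) := List.isChain_isInfix _
      have h3 : (cG gEq σ W i).IsChain (fun g g' => (∃ ha hb, glueS gEq (g.getLast ha) (g'.head hb) = false) ∧ 
        [g, g'] <:+: cG gEq σ W i) := isChain_and' h1 h2
      refine h3.imp ?_
      rintro g g' ⟨⟨ha, hb, hgl⟩, hinf⟩ c d hc hd rfl
      have hg : g ∈ cG gEq σ W i := hinf.subset (by simp)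
      have hg' : g' ∈ cG gEq σ W i := hinf.subset (by simp)
      rcases cG_group hg with ⟨v, rfl⟩ | ⟨t, ht, rfl⟩
      · simp [nmS] at hc
      rcases cG_group hg' with ⟨v, rfl⟩ | ⟨t', ht', rfl⟩
      · simp [nmS] at hd
      rw [nmS_map] at hc hd
      simp only [Sum.inl.injEq] at hc hd
      have : t = t' := by
        rw [← hN.nmh t (hD i t hg), ← hN.nmh t' (hD i t' hg'), hc, hd]
      subst this
      obtain ⟨c', n, h1, _⟩ := gEq_tok (cG_chain hg) d0
      subst h1
      simp [glueS, gEq] at hgl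
    unfold AdjOK
    have h5 : (cW gEq nm σ W i).IsChain (fun x y => ∀ c d, x = Sum.inl c → y = Sum.inl d → d ≠ c) := by
      unfold cW; rw [List.isChain_map]; exact hch
    have h6 := List.isChain_isInfix (cW gEq nm σ W i)
    exact (isChain_and' h5 h6).imp
      (fun x y hxy c d hc hd => ⟨hxy.1 c d hc hd, hnot _ _ hxy.2 c d hc hd⟩)

theorem pair_step [Finite A] [Finite I] [Fintype I] {ba : A → A} (hba : Function.Involutive ba)
    (hfp : ∀ a, ba a ≠ a) {vb : V → V} {Eqs : I → I → Prop} (W0 : QW A I V M)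
    {P : CC A I M → Prop} {α : CC A I M → List A}
    {W : I → List (CC A I M ⊕ V)} {σ : V → List (CC A I M)}
    (hG : WGood ba (bar ba) vb Eqs P α W σ) (hα : ∀ a, α (con a) = [a])
    (hlen : ∀ i, (W i).length ≤ M) (hM : 0 < M)
    (hadj : ∀ i, AdjOK (bar ba) (W i)) {K : ℕ}
    (hcard : 3 * ∑ i, (W i).length + Nat.card I + 10 * ∑ i, occ (W i) ≤ 4 * K) (hKM : K ≤ M) :
    ∃ h W1 σ1, ∃ hlen1 : ∀ i, (W1 i).length ≤ M, Step ba vb Eqs false α W σ h W1 σ1 ∧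
      TT ba vb Eqs W0 (Sum.inl (mkQ W hlen)) (toEnd h) (Sum.inl (mkQ W1 hlen1)) ∧
      (∑ i, (W1 i).length ≤ K) := by
  have hinv := bar_inv (I := I) (M := M) hba
  obtain ⟨L, hL, hsum⟩ := exists_orient hinv (bar_ne hfp) W hadj
  have hglue : ∀ x y : CC A I M, glueL L (bar ba y) (bar ba x) = glueL L x y := by
    intro x y
    simp only [glueL, hL]
    cases L x <;> cases L y <;> rfl
  have hS : ∑ i, (cG (glueL L) σ W i).length ≤ K := by
    have h1 : ∑ i, (cG (glueL L) σ W i).length + ∑ i, npair (glueS (glueL L)) (W i) ≤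
        ∑ i, (W i).length + 2 * ∑ i, occ (W i) := by
      rw [Finset.mul_sum, ← Finset.sum_add_distrib, ← Finset.sum_add_distrib]
      refine Finset.sum_le_sum (fun i _ => ?_)
      have h1 := length_cG_le (glueL L) σ W i
      have h2 := length_splitBy_npair (glueS (glueL L)) (W i)
      omega
    have h2 : ∑ i, (W i).length ≤ Nat.card I + ∑ i, npair bothL (W i) + 2 * ∑ i, occ (W i) := by
      rw [Nat.card_eq_fintype_card, ← Finset.card_univ, Finset.card_eq_sum_ones, Finset.mul_sum,
        ← Finset.sum_add_distrib, ← Finset.sum_add_distrib]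
      exact Finset.sum_le_sum (fun i _ => npair_bothL (W i))
    omega
  obtain ⟨D, nm, tk, hN, hD, hne, hin, htk, hDc⟩ := stage hba hfp false hG hα (glueL L) (hS.trans hKM) hM
  have hstep := mkStep hba hG hglue hN hD hne hin
  have hlen1 : ∀ i, (cW (glueL L) nm σ W i).length ≤ M := by
    intro i
    rw [length_cW]
    exact (Finset.single_le_sum (f := fun i => (cG (glueL L) σ W i).length) (fun _ _ => Nat.zero_le _) (Finset.mem_univ i)).trans
      (hS.trans hKM)
  have hD2 : ∀ t ∈ D, t.length ≤ 2 := by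
    intro t ht
    have key : ∀ (t : List (CC A I M)) (i : I), t.map Sum.inl ∈ cG (glueL L) σ W i → t.length ≤ 2 := by
      intro t i hi
      have := cG_chain hi
      rcases t with _ | ⟨a, _ | ⟨b, _ | ⟨c, t⟩⟩⟩ <;> try simp
      simp only [List.isChain_cons_cons, glueL, Bool.and_eq_true, Bool.not_eq_true'] at this
      rw [this.2.1.1] at this
      simp at this
    obtain ⟨i, hi | hi⟩ := hDc t ht
    · exact key t i hi
    · have := key _ i hi
      rwa [length_lstar] at this
  have htk2 : ∀ m, (tk m).length ≤ 2 := by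
    intro m
    rcases htk m with h | h
    · simp [h]
    · exact hD2 _ h
  refine ⟨_, _, _, hlen1, hstep, ?_, ?_⟩
  · left
    refine ⟨_, ⟨hT_BC hba false tk, fun a => rfl, ?_⟩, ⟨cτ (glueL L) σ, cτ_BC hG.bcσ hglue, chS hN hD⟩, rfl⟩
    rintro (a | ⟨b', m, s⟩ | ⟨i, s⟩)
    · simp [hT]
    · simp only [hT]
      split_ifs
      · rw [length_lstar]; exact htk2 m
      · exact htk2 m
      · simp
    · simp [hT]
  · simp only [length_cW]; exact hS

theorem complete [Finite A] [Finite I] [Fintype I] [Fintype V] {ba : A → A} (hba : Function.Involutive ba)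
    (hfp : ∀ a, ba a ≠ a) {vb : V → V} {Eqs : I → I → Prop} (W0 : QW A I V M) {K n0 : ℕ}
    (hK : 16 * n0 + Nat.card I ≤ K) (hMK : K + 4 * n0 + 1 ≤ M) (n : ℕ) :
    ∀ {P : CC A I M → Prop} {α : CC A I M → List A}
    {W : I → List (CC A I M ⊕ V)} {σ : V → List (CC A I M)},
    (∑ v, ((σ v).flatMap α).length = n) → (∀ c, P c → ¬ inB true c) → 
    WGood ba (bar ba) vb Eqs P α W σ → (∀ a, α (con a) = [a]) →
    (∑ i, (W i).length ≤ K) → (∑ i, occ (W i) ≤ n0) → 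
    ∀ hlen : ∀ i, (W i).length ≤ M, ∃ g, PPath (TT ba vb Eqs W0) (Sum.inl (mkQ W hlen)) g (Sum.inr ⟨true⟩) ∧
      ∀ i, (FreeMonoid.toList (g (FreeMonoid.of (out i false)))).flatMap α =
        ((W i).flatMap (ev σ)).flatMap α := by
  induction n using Nat.strong_induction_on with
  | _ n ih =>
  intro P α W σ hmeas hP hG hα hWK hocc hlen
  by_cases hσ : ∀ v, σ v = []
  · have hσ' : σ = fun _ => [] := funext hσ
    subst hσ'
    refine ⟨_, PPath.single (e := toEnd (finL W)) ⟨hG.eqs, rfl⟩, fun i => ?_⟩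
    rw [toEnd_of]; rfl
  · push Not at hσ
    obtain ⟨v0, hv0⟩ := hσ
    obtain ⟨h1, W1, σ1, hlen1, hs1, ht1, hc1, hadj⟩ := block_step hba hfp W0 hP hG hα hlen (by omega) (by omega)
    have ho1 : ∑ i, occ (W1 i) ≤ n0 := (Finset.sum_le_sum (fun i _ => hs1.occ_le i)).trans hocc
    obtain ⟨h2, W2, σ2, hlen2, hs2, ht2, hc2⟩ := pair_step (K := K) hba hfp W0 hs1.good hs1.acon hlen1 (by omega) hadj 
      (by omega) (by omega)
    have ho2 : ∑ i, occ (W2 i) ≤ n0 := (Finset.sum_le_sum (fun i _ => hs2.occ_le i)).trans ho1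
    have hlt : ∑ v, ((σ2 v).flatMap (cα h2 (cα h1 α))).length < n := by
      rw [← hmeas]
      refine (Finset.sum_le_sum (fun v _ => hs2.le v)).trans_lt ?_
      exact Finset.sum_lt_sum (fun v _ => hs1.le v) ⟨v0, Finset.mem_univ _, hs1.lt v0 hv0⟩
    obtain ⟨g, hg, hgv⟩ := ih _ hlt rfl (by
      rintro c (h | ⟨a, rfl⟩)
      · rcases c with (a | ⟨b', m, s⟩ | ⟨i, s⟩) <;> simp_all [inB]
      · simp [inB]) hs2.good hs2.acon hc2 ho2 hlen2
    refine ⟨_, PPath.cons ht1 (PPath.cons ht2 hg), fun i => ?_⟩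
    rw [← hs1.val, ← hs2.val, ← hgv]
    show List.flatMap α (FreeMonoid.toList (toEnd h1 (toEnd h2 (g (FreeMonoid.of (out i false)))))) = _
    rw [toEnd_apply, toEnd_apply, List.flatMap_assoc, List.flatMap_assoc]
    rfl

def a0 : CC A I M → List A
  | con a => [a]
  | _ => []

theorem ers_a0 (l : List (CC A I M)) : l.flatMap ers = (l.flatMap a0).map con := by
  induction l with
  | nil => rfl
  | cons c l ih =>
    rw [List.flatMap_cons, List.flatMap_cons, List.map_append, ih]
    rcases c with (a | ⟨b', m, s⟩ | ⟨i, s⟩) <;> rfl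

theorem a0_con (l : List A) : (l.map (con : A → CC A I M)).flatMap a0 = l := by
  induction l with
  | nil => rfl
  | cons a l ih => rw [List.map_cons, List.flatMap_cons, ih]; rfl

theorem a0_BC (ba : A → A) : BC ba (bar ba) (a0 : CC A I M → List A) := by
  rintro (a | ⟨b', m, s⟩ | ⟨i, s⟩) <;> rfl

theorem ev_a0 (w : List (A ⊕ V)) (σ : V → List (CC A I M)) :
    ((w.map (Sum.map con id)).flatMap (ev σ)).flatMap a0 = w.flatMap (ev (fun v => (σ v).flatMap a0)) := by
  induction w with
  | nil => rfl
  | cons x w ih =>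
    rw [List.map_cons, List.flatMap_cons, List.flatMap_append, ih, List.flatMap_cons]
    rcases x with a | v <;> rfl

theorem ev_con (w : List (A ⊕ V)) (σ : V → List A) :
    ((w.map (Sum.map (con : A → CC A I M) id)).flatMap (ev (fun v => (σ v).map con))) = 
     (w.flatMap (ev σ)).map con := by
  induction w with
  | nil => rfl
  | cons x w ih =>
    rw [List.map_cons, List.flatMap_cons, ih, List.flatMap_cons, List.map_append]
    rcases x with a | v <;> rfl

end CC

open CC in
/-- Word equations with involution and reduced sides -/
theorem thmC {A I V : Type u} [Finite A] [Finite I] [Finite V] {ba : A → A} (hba : Function.Involutive ba)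
    (hfp : ∀ a, ba a ≠ a) (vb : V → V) (Eqs : I → I → Prop) (w0 : I → List (A ⊕ V)) :
    ∃ (C : Type u) (_ : Finite C) (cn : A → C) (o : I → C) (S : Set (Monoid.End (FreeMonoid C))),
      Function.Injective cn ∧ RationalSet S ∧
      (∀ h ∈ S, ∀ a, h (FreeMonoid.of (cn a)) = FreeMonoid.of (cn a)) ∧
      (∀ h ∈ S, ∀ d, ∃ w : List A, FreeMonoid.toList (h (FreeMonoid.of d)) = w.map cn) ∧
      (∀ h ∈ S, ∃ σ : V → List A, BC ba vb σ ∧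
        (∀ i j, Eqs i j → (w0 i).flatMap (ev σ) = (w0 j).flatMap (ev σ)) ∧
        ∀ i, FreeMonoid.toList (h (FreeMonoid.of (o i))) = ((w0 i).flatMap (ev σ)).map cn) ∧
      ∀ σ : V → List A, BC ba vb σ →
        (∀ i j, Eqs i j → (w0 i).flatMap (ev σ) = (w0 j).flatMap (ev σ)) →
        (∀ i, Red ba ((w0 i).flatMap (ev σ))) →
        ∃ h ∈ S, ∀ i, FreeMonoid.toList (h (FreeMonoid.of (o i))) = ((w0 i).flatMap (ev σ)).map cn := by
  have := Fintype.ofFinite I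
  have := Fintype.ofFinite V
  let n0 := ∑ i, occ (w0 i)
  let K := 16 * n0 + Nat.card I + ∑ i, (w0 i).length
  let M := K + 4 * n0 + 1
  let W : I → List (CC A I M ⊕ V) := fun i => (w0 i).map (Sum.map con id)
  have hsum : ∑ i, (W i).length ≤ K := by simp [W, K]
  have hlen : ∀ i, (W i).length ≤ M := by
    intro i
    have := (Finset.single_le_sum (f := fun i => (W i).length) (fun _ _ => Nat.zero_le _) (Finset.mem_univ i)).trans hsum
    simp only [M]; omega
  have hocc : ∑ i, occ (W i) ≤ n0 := by
    refine Finset.sum_le_sum (fun i _ => ?_)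
    simp only [W, occ, List.countP_map]
    refine le_of_eq ?_
    congr 1
    funext x
    rcases x <;> rfl
  let W0 := mkQ W hlen
  have hst : ∀ h, PPath (TT ba vb Eqs W0) (Sum.inr ⟨false⟩) h (Sum.inr ⟨true⟩) → ∃ g,
      h = toEnd ers * g ∧ PPath (TT ba vb Eqs W0) (Sum.inl W0) g (Sum.inr ⟨true⟩) := by
    intro h hp
    cases hp with
    | @cons _ r' _ e' f' h hp =>
      rcases r' with W' | ⟨_ | _⟩
      · obtain ⟨rfl, rfl⟩ := h
        exact ⟨f', rfl, hp⟩
      · exact h.elim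
      · exact h.elim
  refine ⟨CC A I M, inferInstance, con, fun i => out i false,
    {e | PPath (TT ba vb Eqs W0) (Sum.inr ⟨false⟩) e (Sum.inr ⟨true⟩)}, ?_, TT_rational ba hba vb Eqs W0, ?_, ?_, ?_, ?_⟩
  · intro a b h; simpa using h
  · intro h hh
    exact (TT_sound hba hh rfl).1
  · intro h hh d
    obtain ⟨g, rfl, hg⟩ := hst h hh
    exact ⟨(FreeMonoid.toList (g (FreeMonoid.of d))).flatMap a0, by
      show FreeMonoid.toList (toEnd ers (g (FreeMonoid.of d))) = _
      rw [toEnd_apply, ers_a0]⟩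
  · intro h hh
    obtain ⟨g, rfl, hg⟩ := hst h hh
    obtain ⟨σ, hσ, he, hv⟩ := (TT_sound hba hg rfl).2 W0 rfl
    have hW : ∀ i, ((W i).flatMap (ev σ)).flatMap a0 = (w0 i).flatMap (ev (fun v => (σ v).flatMap a0)) :=
      fun i => ev_a0 _ _
    refine ⟨fun v => (σ v).flatMap a0, ?_, ?_, ?_⟩
    · intro v
      show List.flatMap a0 (σ (vb v)) = _
      rw [hσ v, (a0_BC ba).flatMap]
    · intro i j hij
      rw [← hW, ← hW]
      exact congrArg _ (he i j hij)
    · intro i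
      show FreeMonoid.toList (toEnd ers (g (FreeMonoid.of (out i false)))) = _
      rw [toEnd_apply, ers_a0, hv]
      exact congrArg _ (hW i)
  · intro σ hσ he hr
    have hWv : ∀ i, (W i).flatMap (ev (fun v => (σ v).map con)) = ((w0 i).flatMap (ev σ)).map con :=
      fun i => ev_con _ _
    have hG : WGood ba (bar ba) vb Eqs (fun c => ∃ a, c = con a) a0 W (fun v => (σ v).map con) := by
      refine ⟨?_, a0_BC ba, ?_, ?_, ?_, ?_⟩
      · intro v
        show List.map con (σ (vb v)) = _
        rw [hσ v]
        exact (lstar_map ba (bar ba) con (fun a => rfl) (σ v)).symm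
      · intro i c hc
        simp only [W, List.mem_map] at hc
        obtain ⟨x, hx, hc⟩ := hc
        rcases x with a | v
        · simp at hc; subst hc; exact ⟨⟨a, rfl⟩, by simp [a0]⟩
        · simp at hc
      · intro v c hc
        simp only [List.mem_map] at hc
        obtain ⟨a, _, rfl⟩ := hc
        exact ⟨⟨a, rfl⟩, by simp [a0]⟩
      · intro i j hij
        rw [hWv, hWv, he i j hij]
      · intro i
        rw [hWv, a0_con]
        exact hr i
    obtain ⟨g, hg, hv⟩ := complete (M := M) hba hfp W0 (K := K) (n0 := n0) (by simp only [K]; omega) le_rfl _ rfl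
      (by rintro c ⟨a, rfl⟩; simp [inB]) hG (fun a => rfl) hsum hocc hlen
    refine ⟨toEnd ers * g, PPath.cons (r := Sum.inl W0) ⟨rfl, rfl⟩ hg, fun i => ?_⟩
    show FreeMonoid.toList (toEnd ers (g (FreeMonoid.of (out i false)))) = _
    rw [toEnd_apply, ers_a0, hv, hWv, a0_con]

section tags
variable {α β : Type v} {R : Type u}

/-- `a` occurs before `b` in `l` -/
def bf : List α → α → α → Prop
  | [], _, _ => False
  | c :: l, a, b => (a = c ∧ b ∈ l) ∨ bf l a b

theorem bf_cons (c : α) (l : List α) (a b : α) : bf (c :: l) a b ↔ (a = c ∧ b ∈ l) ∨ bf l a b := Iff.rfl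

theorem bf.left {l : List α} {a b : α} (h : bf l a b) : a ∈ l := by
  induction l with
  | nil => exact h.elim
  | cons c l ih => rcases h with ⟨rfl, _⟩ | h
                   · simp
                   · simp [ih h]

theorem bf.right {l : List α} {a b : α} (h : bf l a b) : b ∈ l := by
  induction l with
  | nil => exact h.elim
  | cons c l ih => rcases h with ⟨_, h⟩ | h
                   · simp [h]
                   · simp [ih h]

theorem bf.ne {l : List α} (hl : l.Nodup) {a b : α} (h : bf l a b) : a ≠ b := by
  induction l with
  | nil => exact h.elim
  | cons c l ih =>
    rw [List.nodup_cons] at hl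
    rcases h with ⟨rfl, h⟩ | h
    · rintro rfl; exact hl.1 h
    · exact ih hl.2 h

theorem bf.trans {l : List α} (hl : l.Nodup) {a b c : α} (h : bf l a b) (h' : bf l b c) : bf l a c := by
  induction l with
  | nil => exact h.elim
  | cons d l ih =>
    rw [List.nodup_cons] at hl
    rcases h with ⟨rfl, h⟩ | h
    · rcases h' with ⟨rfl, h'⟩ | h'
      · exact absurd h hl.1
      · exact Or.inl ⟨rfl, h'.right⟩
    · rcases h' with ⟨rfl, h'⟩ | h'
      · exact absurd h.right hl.1
      · exact Or.inr (ih hl.2 h h')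

theorem bf.asymm {l : List α} (hl : l.Nodup) {a b : α} (h : bf l a b) : ¬ bf l b a :=
  fun h' => (h.trans hl h').ne hl rfl

theorem bf_total {l : List α} {a b : α} (ha : a ∈ l) (hb : b ∈ l) (hne : a ≠ b) :
    bf l a b ∨ bf l b a := by
  induction l with
  | nil => simp at ha
  | cons c l ih =>
    simp only [List.mem_cons] at ha hb
    simp only [bf_cons]
    rcases ha with rfl | ha <;> rcases hb with rfl | hb
    · exact absurd rfl hne
    · exact Or.inl (Or.inl ⟨rfl, hb⟩)
    · exact Or.inr (Or.inl ⟨rfl, ha⟩)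
    · rcases ih ha hb with h | h
      · exact Or.inl (Or.inr h)
      · exact Or.inr (Or.inr h)

theorem bf_append {x y : List α} {a b : α} :
    bf (x ++ y) a b ↔ bf x a b ∨ bf y a b ∨ (a ∈ x ∧ b ∈ y) := by
  induction x with
  | nil => simp [bf]
  | cons c x ih =>
    simp only [List.cons_append, bf_cons, ih, List.mem_append, List.mem_cons]
    tauto

theorem bf_reverse {l : List α} {a b : α} : bf l.reverse a b ↔ bf l b a := by
  induction l with
  | nil => simp [bf]
  | cons c l ih =>
    simp only [List.reverse_cons, bf_append, bf_cons, ih, List.mem_reverse, bf, List.mem_singleton,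
      List.not_mem_nil]
    tauto

theorem bf_map {l : List α} {e : α → β} (he : ∀ a ∈ l, ∀ b ∈ l, e a = e b → a = b) {a b : α}
    (ha : a ∈ l) (hb : b ∈ l) : bf (l.map e) (e a) (e b) ↔ bf l a b := by
  induction l with
  | nil => simp at ha
  | cons c l ih =>
    have he' : ∀ a ∈ l, ∀ b ∈ l, e a = e b → a = b := fun a ha b hb =>
      he a (by simp [ha]) b (by simp [hb])
    have hmem : ∀ x ∈ (c :: l), (e x ∈ l.map e ↔ x ∈ l) := by
      intro x hx
      simp only [List.mem_map]
      constructor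
      · rintro ⟨y, hy, h⟩
        rw [← he y (by simp [hy]) x hx h]; exact hy
      · intro h; exact ⟨x, h, rfl⟩
    have hc : e a = e c ↔ a = c := ⟨fun h => he a ha c (by simp) h, fun h => by rw [h]⟩
    rw [List.map_cons, bf_cons, bf_cons, hc, hmem b hb]
    refine or_congr Iff.rfl ?_
    constructor
    · intro h
      exact (ih he' ((hmem a ha).1 h.left) ((hmem b hb).1 h.right)).1 h
    · intro h
      exact (ih he' h.left h.right).2 h

theorem bf_filter {l : List α} {p : α → Bool} {a b : α} :
    bf (l.filter p) a b ↔ bf l a b ∧ p a = true ∧ p b = true := by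
  induction l with
  | nil => simp [bf]
  | cons c l ih =>
    by_cases hc : p c = true
    · rw [List.filter_cons_of_pos hc, bf_cons, bf_cons, ih, List.mem_filter]
      constructor
      · rintro (⟨rfl, h1, h2⟩ | h)
        · exact ⟨Or.inl ⟨rfl, h1⟩, hc, h2⟩
        · exact ⟨Or.inr h.1, h.2⟩
      · rintro ⟨⟨rfl, h1⟩ | h, h2, h3⟩
        · exact Or.inl ⟨rfl, h1, h3⟩
        · exact Or.inr ⟨h, h2, h3⟩
    · rw [List.filter_cons_of_neg hc, bf_cons, ih]
      constructor
      · rintro h; exact ⟨Or.inr h.1, h.2⟩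
      · rintro ⟨⟨rfl, h1⟩ | h, h2, h3⟩
        · exact absurd h2 hc
        · exact ⟨h, h2, h3⟩

theorem bf_iff_sublist {l : List α} {a b : α} : bf l a b ↔ [a, b].Sublist l := by
  induction l with
  | nil => simp [bf]
  | cons c l ih =>
    rw [bf_cons, ih]
    constructor
    · rintro (⟨rfl, h⟩ | h)
      · exact (List.singleton_sublist.2 h).cons_cons _
      · exact h.cons _
    · intro h
      cases h with
      | cons _ h => exact Or.inr h
      | cons_cons _ h => exact Or.inl ⟨rfl, List.singleton_sublist.1 h⟩

theorem bf_pairwise {l : List α} {r : α → α → Prop} (h : l.Pairwise r) {a b : α} (hab : bf l a b) :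
    r a b := by
  induction l with
  | nil => exact hab.elim
  | cons c l ih =>
    rw [List.pairwise_cons] at h
    rcases hab with ⟨rfl, hb⟩ | hab
    · exact h.1 b hb
    · exact ih h.2 hab

theorem pairwise_of_bf {l : List α} {r : α → α → Prop} (h : ∀ a b, bf l a b → r a b) : l.Pairwise r := by
  induction l with
  | nil => simp
  | cons c l ih =>
    rw [List.pairwise_cons]
    exact ⟨fun b hb => h c b (Or.inl ⟨rfl, hb⟩), ih (fun a b hab => h a b (Or.inr hab))⟩

theorem bf_ext {l m : List α} (hl : l.Nodup) (hm : m.Nodup) (hp : l.Perm m)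
    (h : ∀ a b, bf l a b → bf m a b) : l = m := by
  refine List.Perm.eq_of_pairwise (le := fun a b => bf m a b) ?_ (pairwise_of_bf h)
    (pairwise_of_bf (fun a b h => h)) hp
  intro a b _ _ h1 h2
  exact absurd h2 (h1.asymm hm)

def dp (T : α → Set R) (a b : α) : Prop := ∃ r, r ∈ T a ∧ r ∈ T b

theorem dp.symm {T : α → Set R} {a b : α} (h : dp T a b) : dp T b a := by
  obtain ⟨r, h1, h2⟩ := h; exact ⟨r, h2, h1⟩

def pr (T : α → Set R) (l : List α) : α → α → Prop :=
  Relation.TransGen (fun a b => bf l a b ∧ dp T a b)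

theorem pr.bf {T : α → Set R} {l : List α} (hl : l.Nodup) {a b : α} (h : pr T l a b) : bf l a b := by
  induction h with
  | single h => exact h.1
  | tail _ h ih => exact ih.trans hl h.1

theorem pr.of {T : α → Set R} {l : List α} {a b : α} (h : _root_.bf l a b) (h' : dp T a b) : pr T l a b :=
  Relation.TransGen.single ⟨h, h'⟩

theorem pr.trans {T : α → Set R} {l : List α} {a b c : α} (h : pr T l a b) (h' : pr T l b c) :
    pr T l a c := Relation.TransGen.trans h h'

theorem pr.irrefl {T : α → Set R} {l : List α} (hl : l.Nodup) {a : α} : ¬ pr T l a a :=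
  fun h => (h.bf hl).ne hl rfl

/-- structure preserving relabelling -/
structure Iso {A : Type u} (e : α → β) (l : List α) (T : α → Set R) (lab : α → A) (m : List β)
    (T2 : β → Set R) (lab2 : β → A) : Prop where
  ndl : l.Nodup
  inj : ∀ a ∈ l, ∀ b ∈ l, e a = e b → a = b
  perm : (l.map e).Perm m
  ty : ∀ a ∈ l, T2 (e a) = T a
  la : ∀ a ∈ l, lab2 (e a) = lab a
  ord : ∀ a b, dp T a b → bf l a b → bf m (e a) (e b)

variable {A : Type u}

namespace Iso
variable {e : α → β} {l : List α} {T : α → Set R} {lab : α → A} {m : List β}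
    {T2 : β → Set R} {lab2 : β → A}

theorem ndm (h : Iso e l T lab m T2 lab2) : m.Nodup :=
  h.perm.nodup_iff.1 (List.Nodup.map_on (fun a ha b hb hab => h.inj a ha b hb hab) h.ndl)

theorem mem (h : Iso e l T lab m T2 lab2) {a : α} (ha : a ∈ l) : e a ∈ m :=
  h.perm.subset (List.mem_map_of_mem ha)

theorem surj (h : Iso e l T lab m T2 lab2) {b : β} (hb : b ∈ m) : ∃ a ∈ l, e a = b := by
  have := h.perm.symm.subset hb
  simpa using this

theorem dp_iff (h : Iso e l T lab m T2 lab2) {a b : α} (ha : a ∈ l) (hb : b ∈ l) :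
    dp T2 (e a) (e b) ↔ dp T a b := by
  unfold dp; rw [h.ty a ha, h.ty b hb]

theorem ord_iff (h : Iso e l T lab m T2 lab2) {a b : α} (ha : a ∈ l) (hb : b ∈ l) (hd : dp T a b) :
    bf m (e a) (e b) ↔ bf l a b := by
  refine ⟨fun h1 => ?_, h.ord a b hd⟩
  have hne : a ≠ b := fun h2 => h1.ne h.ndm (by rw [h2])
  rcases bf_total ha hb hne with h2 | h2
  · exact h2
  · exact absurd (h.ord b a hd.symm h2) (h1.asymm h.ndm)

theorem pr_iff (h : Iso e l T lab m T2 lab2) {a b : α} (ha : a ∈ l) (hb : b ∈ l) :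
    pr T2 m (e a) (e b) ↔ pr T l a b := by
  constructor
  · intro h1
    have : ∀ x y, pr T2 m x y → ∀ b ∈ l, y = e b → ∀ a ∈ l, x = e a → pr T l a b := by
      intro x y hxy
      induction hxy with
      | single hs =>
        rintro b hb rfl a ha rfl
        have hd := (h.dp_iff ha hb).1 hs.2
        exact pr.of ((h.ord_iff ha hb hd).1 hs.1) hd
      | tail _ hs ih =>
        rintro b hb rfl a ha rfl
        obtain ⟨c, hc, rfl⟩ := h.surj hs.1.left
        have hd := (h.dp_iff hc hb).1 hs.2
        exact (ih c hc rfl a ha rfl).trans (pr.of ((h.ord_iff hc hb hd).1 hs.1) hd)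
    exact this _ _ h1 b hb rfl a ha rfl
  · intro h1
    clear ha hb
    induction h1 with
    | single hs => exact pr.of (h.ord _ _ hs.2 hs.1) ((h.dp_iff hs.1.left hs.1.right).2 hs.2)
    | tail _ hs ih => exact ih.trans (pr.of (h.ord _ _ hs.2 hs.1) ((h.dp_iff hs.1.left hs.1.right).2 hs.2))

end Iso
end tags

section stage
variable {α β : Type v} {R A : Type u}

theorem exists_last (l : List α) (hl : l ≠ []) : ∃ b ∈ l, ∀ c ∈ l, c = b ∨ bf l c b := by
  obtain ⟨x, b, rfl⟩ : ∃ x b, l = x ++ [b] := ⟨_, _, (List.dropLast_append_getLast hl).symm⟩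
  refine ⟨b, by simp, fun c hc => ?_⟩
  simp only [List.mem_append, List.mem_singleton] at hc
  rcases hc with hc | hc
  · right; rw [bf_append]; right; right; exact ⟨hc, by simp⟩
  · left; exact hc

theorem pr_reverse {T : α → Set R} {l : List α} {a b : α} : pr T l.reverse a b ↔ pr T l b a := by
  have : ∀ (l : List α) (a b : α), pr T l.reverse a b → pr T l b a := by
    intro l a b h
    induction h with
    | single h => exact pr.of (bf_reverse.1 h.1) h.2.symm
    | tail _ h ih => exact (pr.of (bf_reverse.1 h.1) h.2.symm).trans ih
  refine ⟨this l a b, fun h => this l.reverse b a ?_⟩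
  rw [List.reverse_reverse]; exact h

/-- two letters of type `S` separated by a letter meeting `S` -/
def sep (S : Set R) (T : α → Set R) (l : List α) (a b : α) : Prop :=
  T a = S ∧ T b = S ∧ ∃ z, bf l a z ∧ bf l z b ∧ T z ≠ S ∧ ∃ r ∈ T z, r ∈ S

/-- same run -/
def sm (S : Set R) (T : α → Set R) (l : List α) (a b : α) : Prop :=
  T b = S ∧ ¬ sep S T l a b ∧ ¬ sep S T l b a

noncomputable def cont (S : Set R) (T : α → Set R) (lab : α → A) (l : List α) (a : α) : List A :=
  (l.filter (fun b => decide (sm S T l a b))).map lab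

def Gm (S : Set R) (T : α → Set R) (l : List α) (a : α) : Set R :=
  {s | s ∉ S ∧ ∃ y, s ∈ T y ∧ pr T l y a ∧ ∀ b, sep S T l b a → pr T l b y}

noncomputable def pick [Nonempty R] (S G : Set R) : R :=
  if h : G.Nonempty then h.some else if h : Sᶜ.Nonempty then h.some else Classical.arbitrary R

theorem pick_mem [Nonempty R] {S G : Set R} (h : G.Nonempty) : pick S G ∈ G := by
  unfold pick; rw [dif_pos h]; exact h.some_mem

theorem pick_not_mem [Nonempty R] {S G : Set R} (hS : S ≠ Set.univ) (hG : ∀ s ∈ G, s ∉ S) :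
    pick S G ∉ S := by
  unfold pick
  split_ifs with h1 h2
  · exact hG _ h1.some_mem
  · exact h2.some_mem
  · exact absurd (Set.nonempty_compl.2 hS) h2

noncomputable def sc [Nonempty R] (ori : List A → Bool) (S : Set R) (T : α → Set R) (lab : α → A)
    (l : List α) (a : α) : R :=
  if ori (cont S T lab l a) = true then pick S (Gm S T l a) else pick S (Gm S T l.reverse a)

noncomputable def nT [Nonempty R] (ori : List A → Bool) (S : Set R) (T : α → Set R) (lab : α → A)
    (l : List α) (a : α) : Set R :=
  if a ∈ l ∧ T a = S then insert (sc ori S T lab l a) S else T a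

structure Good [Nonempty R] (ori : List A → Bool) (S : Set R) (T : α → Set R) (lab : α → A)
    (l l' : List α) : Prop where
  perm : l.Perm l'
  ord : ∀ a b, dp T a b → bf l a b → bf l' a b
  run : ∀ a b z, T a = S → sm S T l a b → bf l' a z → bf l' z b → T z = S
  lft : ∀ a y, a ∈ l → T a = S → ori (cont S T lab l a) = true → sc ori S T lab l a ∈ T y →
    bf l' y a → pr T l y a
  rgt : ∀ a y, a ∈ l → T a = S → ori (cont S T lab l a) = false → sc ori S T lab l a ∈ T y →
    bf l' a y → pr T l a y

theorem sep_reverse {S : Set R} {T : α → Set R} {l : List α} {a b : α} :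
    sep S T l.reverse a b ↔ sep S T l b a := by
  unfold sep
  constructor
  · rintro ⟨h1, h2, z, h3, h4, h5⟩
    exact ⟨h2, h1, z, bf_reverse.1 h4, bf_reverse.1 h3, h5⟩
  · rintro ⟨h1, h2, z, h3, h4, h5⟩
    exact ⟨h2, h1, z, bf_reverse.2 h4, bf_reverse.2 h3, h5⟩

theorem sm_reverse {S : Set R} {T : α → Set R} {l : List α} {a b : α} :
    sm S T l.reverse a b ↔ sm S T l a b := by
  unfold sm; rw [sep_reverse, sep_reverse]; tauto

section facts
variable {S : Set R} {T : α → Set R} {l : List α}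

theorem dp_S (hS : S.Nonempty) {a b : α} (ha : T a = S) (hb : T b = S) : dp T a b := by
  obtain ⟨r, hr⟩ := hS; exact ⟨r, by rw [ha]; exact hr, by rw [hb]; exact hr⟩

theorem dp_z {z a : α} (hz : ∃ r ∈ T z, r ∈ S) (ha : T a = S) : dp T z a := by
  obtain ⟨r, hr, hs⟩ := hz; exact ⟨r, hr, by rw [ha]; exact hs⟩

theorem sep.pr {a b : α} (h : sep S T l a b) : pr T l a b := by
  obtain ⟨h1, h2, z, h3, h4, _, h5⟩ := h
  exact (pr.of h3 (dp_z h5 h1).symm).trans (pr.of h4 (dp_z h5 h2))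

theorem sep.asymm (hl : l.Nodup) {a b : α} (h : sep S T l a b) : ¬ sep S T l b a :=
  fun h' => (h.pr.bf hl).asymm hl (h'.pr.bf hl)

theorem sep.irrefl (hl : l.Nodup) {a : α} : ¬ sep S T l a a := fun h => h.asymm hl h

theorem sm.refl (hl : l.Nodup) {a : α} (ha : T a = S) : sm S T l a a :=
  ⟨ha, sep.irrefl hl, sep.irrefl hl⟩

theorem sm.symm {a b : α} (ha : T a = S) (h : sm S T l a b) : sm S T l b a := ⟨ha, h.2.2, h.2.1⟩

theorem sep_sm_right (hl : l.Nodup) {a a' b : α} (ha' : a' ∈ l) (h : sep S T l b a) (hs : sm S T l a a') :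
    sep S T l b a' := by
  obtain ⟨h1, h2, z, h3, h4, h5, h6⟩ := h
  have hne : z ≠ a' := fun h => h5 (by rw [h]; exact hs.1)
  rcases bf_total h4.left ha' hne with h | h
  · exact ⟨h1, hs.1, z, h3, h, h5, h6⟩
  · exact absurd ⟨hs.1, h2, z, h, h4, h5, h6⟩ hs.2.2

theorem sep_sm_left (hl : l.Nodup) {a a' b : α} (ha' : a' ∈ l) (h : sep S T l a b) (hs : sm S T l a a') :
    sep S T l a' b := by
  rw [← sep_reverse] at h ⊢
  exact sep_sm_right (by simpa using hl) (by simpa using ha') h (sm_reverse.2 hs)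

theorem sm.trans (hl : l.Nodup) {a b c : α} (ha : T a = S) (hb : b ∈ l) (h : sm S T l a b) (h' : sm S T l b c) :
    sm S T l a c :=
  ⟨h'.1, fun hs => h'.2.1 (sep_sm_left hl hb hs h), fun hs => h'.2.2 (sep_sm_right hl hb hs h)⟩

theorem sm_or (a b : α) (hb : T b = S) : sm S T l a b ∨ sep S T l a b ∨ sep S T l b a := by
  unfold sm; tauto

theorem pr_sm_right (hl : l.Nodup) {y a a' : α} (ha' : a' ∈ l) (ha : T a = S)
    (hs : sm S T l a a') (hy : T y ≠ S) (h : pr T l y a) : pr T l y a' := by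
  have key : ∀ c x, bf l c x → dp T c x → T c ≠ S → T x = S → sm S T l x a' → pr T l c a' := by
    intro c x h1 h2 h3 h4 h5
    have hcS : ∃ r ∈ T c, r ∈ S := by
      obtain ⟨r, h6, h7⟩ := h2; exact ⟨r, h6, by rw [← h4]; exact h7⟩
    have hne : c ≠ a' := fun h => h3 (by rw [h]; exact h5.1)
    rcases bf_total h1.left ha' hne with h | h
    · exact pr.of h (dp_z hcS h5.1)
    · exact absurd ⟨h5.1, h4, c, h, h1, h3, hcS⟩ h5.2.2
  have : ∀ x, pr T l y x → T x = S → sm S T l x a' → pr T l y a' := by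
    intro x hx
    induction hx with
    | single h => intro h1 h2; exact key _ _ h.1 h.2 hy h1 h2
    | @tail c x h1 h2 ih =>
      intro h3 h4
      by_cases hc : T c = S
      · rcases sm_or (l := l) c x h3 with h5 | h5 | h5
        · exact ih hc (h5.trans hl hc h2.1.right h4)
        · exact pr.trans h1 (sep_sm_right hl ha' h5 h4).pr
        · exact absurd (h5.pr.bf hl) (h2.1.asymm hl)
      · exact pr.trans h1 (key _ _ h2.1 h2.2 hc h3 h4)
  exact this a h ha hs

theorem pr_sm_left (hl : l.Nodup) {y a a' : α} (ha' : a' ∈ l) (ha : T a = S)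
    (hs : sm S T l a a') (hy : T y ≠ S) (h : pr T l a y) : pr T l a' y := by
  rw [← pr_reverse] at h ⊢
  exact pr_sm_right (by simpa using hl) (by simpa using ha') ha (sm_reverse.2 hs) hy h

theorem cont_sm (hl : l.Nodup) (lab : α → A) {a a' : α} (ha : T a = S) (hm : a ∈ l) (ha' : a' ∈ l)
    (hs : sm S T l a a') : cont S T lab l a' = cont S T lab l a := by
  unfold cont
  congr 2
  ext b
  simp only [decide_eq_decide]
  exact ⟨fun h => hs.trans hl ha ha' h, fun h => (hs.symm ha).trans hl hs.1 hm h⟩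

theorem Gm_sm (hl : l.Nodup) (hS : S.Nonempty) {a a' : α} (ha : T a = S) (hm : a ∈ l) (ha' : a' ∈ l)
    (hs : sm S T l a a') : Gm S T l a' = Gm S T l a := by
  have : ∀ a a', T a = S → a ∈ l → a' ∈ l → sm S T l a a' → ∀ s, s ∈ Gm S T l a → s ∈ Gm S T l a' := by
    rintro a a' ha hm ha' hs s ⟨h1, y, h2, h3, h4⟩
    have hy : T y ≠ S := fun h => h1 (h ▸ h2)
    exact ⟨h1, y, h2, pr_sm_right hl ha' ha hs hy h3,
      fun b hb => h4 b (sep_sm_right hl hm hb (hs.symm ha))⟩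
  ext s
  exact ⟨this a' a hs.1 ha' hm (hs.symm ha) s, this a a' ha hm ha' hs s⟩

theorem sc_sm [Nonempty R] (ori : List A → Bool) (lab : α → A) (hl : l.Nodup) (hS : S.Nonempty) {a a' : α} (ha : T a = S) (hm : a ∈ l) (ha' : a' ∈ l)
    (hs : sm S T l a a') : sc ori S T lab l a' = sc ori S T lab l a := by
  unfold sc
  rw [cont_sm hl lab ha hm ha' hs, Gm_sm hl hS ha hm ha' hs,
    Gm_sm (l := l.reverse) (by simpa using hl) hS ha (by simpa using hm) (by simpa using ha') (sm_reverse.2 hs)]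

theorem sc_not_mem [Nonempty R] (ori : List A → Bool) (lab : α → A) (hS : S ≠ Set.univ) (a : α) :
    sc ori S T lab l a ∉ S := by
  unfold sc
  split_ifs
  · exact pick_not_mem hS (fun s h => h.1)
  · exact pick_not_mem hS (fun s h => h.1)

/-- `Gm` is nonempty if there is a previous run, and contains a witness. -/
theorem Gm_nonempty (hl : l.Nodup) (hS : S.Nonempty) (hmin : ∀ z ∈ l, T z ⊆ S → T z = S) {a b : α}
    (h : sep S T l b a) : (Gm S T l a).Nonempty := by
  have hmb : b ∈ l.filter (fun b => decide (sep S T l b a)) := by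
    rw [List.mem_filter]; exact ⟨by obtain ⟨_, _, z, h, _⟩ := h; exact h.left, by simpa using h⟩
  obtain ⟨c, hc, hlast⟩ := exists_last _ (List.ne_nil_of_mem hmb)
  rw [List.mem_filter, decide_eq_true_eq] at hc
  obtain ⟨h1, h2, z, h3, h4, h5, h6⟩ := hc.2
  obtain ⟨s, hs, hsS⟩ : ∃ s ∈ T z, s ∉ S := by
    by_contra hcon; push Not at hcon
    exact h5 (hmin z h3.right hcon)
  refine ⟨s, hsS, z, hs, pr.of h4 (dp_z h6 h2), fun b' hb' => ?_⟩
  have hcz : pr T l c z := pr.of h3 (dp_z h6 h1).symm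
  have hmb' : b' ∈ l.filter (fun b => decide (sep S T l b a)) := by
    rw [List.mem_filter]; exact ⟨by obtain ⟨_, _, z, h, _⟩ := hb'; exact h.left, by simpa using hb'⟩
  rcases hlast b' hmb' with rfl | h7
  · exact hcz
  · rw [bf_filter] at h7
    exact (pr.of h7.1 (dp_S hS hb'.1 h1)).trans hcz

/-- automatic clause -/
theorem prev_pr [Nonempty R] {ori : List A → Bool} {lab : α → A} (hl : l.Nodup) (hS : S.Nonempty)
    (hmin : ∀ z ∈ l, T z ⊆ S → T z = S) {a w b : α} (hw : w ∈ l)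
    (hL : ori (cont S T lab l a) = true) (hs : sc ori S T lab l a ∈ T w) (hn : ¬ pr T l w a)
    (hb : sep S T l b a) : pr T l b w := by
  unfold sc at hs
  rw [if_pos hL] at hs
  obtain ⟨_, y, h1, h2, h3⟩ := pick_mem (S := S) (Gm_nonempty hl hS hmin hb)
  have hne : w ≠ y := fun h => hn (h ▸ h2)
  rcases bf_total hw (h2.bf hl).left hne with h | h
  · exact absurd ((pr.of h ⟨_, hs, h1⟩).trans h2) hn
  · exact (h3 b hb).trans (pr.of h ⟨_, h1, hs⟩)

end facts

/-! ### invariance under isomorphism -/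
namespace Iso
variable {S : Set R} {e : α → β} {l : List α} {T : α → Set R} {lab : α → A} {m : List β}
    {T2 : β → Set R} {lab2 : β → A}

theorem rev (h : Iso e l T lab m T2 lab2) : Iso e l.reverse T lab m.reverse T2 lab2 where
  ndl := by simpa using h.ndl
  inj := fun a ha b hb => h.inj a (by simpa using ha) b (by simpa using hb)
  perm := by
    rw [List.map_reverse]
    exact (List.reverse_perm _).trans (h.perm.trans (List.reverse_perm _).symm)
  ty := fun a ha => h.ty a (by simpa using ha)
  la := fun a ha => h.la a (by simpa using ha)
  ord := fun a b hd hb => bf_reverse.2 (h.ord b a hd.symm (bf_reverse.1 hb))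

theorem sep_imp (h : Iso e l T lab m T2 lab2) {a b : α} (hs : sep S T l a b) : sep S T2 m (e a) (e b) := by
  obtain ⟨h1, h2, z, h3, h4, h5, h6⟩ := hs
  refine ⟨by rw [h.ty a h3.left]; exact h1, by rw [h.ty b h4.right]; exact h2, e z,
    h.ord _ _ (dp_z h6 h1).symm h3, h.ord _ _ (dp_z h6 h2) h4, ?_⟩
  rw [h.ty z h3.right]; exact ⟨h5, h6⟩

theorem sep_iff (h : Iso e l T lab m T2 lab2) {a b : α} (ha : a ∈ l) (hb : b ∈ l) :
    sep S T2 m (e a) (e b) ↔ sep S T l a b := by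
  refine ⟨?_, h.sep_imp⟩
  rintro ⟨h1, h2, z', h3, h4, h5, h6⟩
  obtain ⟨z, hz, rfl⟩ := h.surj h3.right
  rw [h.ty _ ha] at h1; rw [h.ty _ hb] at h2; rw [h.ty _ hz] at h5 h6
  exact ⟨h1, h2, z, (h.ord_iff ha hz (dp_z h6 h1).symm).1 h3, (h.ord_iff hz hb (dp_z h6 h2)).1 h4, h5, h6⟩

theorem sm_iff (h : Iso e l T lab m T2 lab2) {a b : α} (ha : a ∈ l) (hb : b ∈ l) :
    sm S T2 m (e a) (e b) ↔ sm S T l a b := by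
  unfold sm; rw [h.sep_iff ha hb, h.sep_iff hb ha, h.ty b hb]

theorem cont_eq (h : Iso e l T lab m T2 lab2) (hS : S.Nonempty) {a : α} (ha : a ∈ l) :
    cont S T2 lab2 m (e a) = cont S T lab l a := by
  have key : (l.filter (fun b => decide (sm S T l a b))).map e = m.filter (fun b => decide (sm S T2 m (e a) b)) := by
    have hnd : ((l.filter (fun b => decide (sm S T l a b))).map e).Nodup := by
      refine List.Nodup.map_on ?_ (h.ndl.filter _)
      intro x hx y hy hxy
      exact h.inj x (List.mem_filter.1 hx).1 y (List.mem_filter.1 hy).1 hxy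
    refine bf_ext hnd (h.ndm.filter _) ?_ ?_
    · rw [List.perm_ext_iff_of_nodup hnd (h.ndm.filter _)]
      intro b
      simp only [List.mem_map, List.mem_filter, decide_eq_true_eq]
      constructor
      · rintro ⟨c, ⟨hc, hs⟩, rfl⟩
        exact ⟨h.mem hc, (h.sm_iff ha hc).2 hs⟩
      · rintro ⟨hb, hs⟩
        obtain ⟨c, hc, rfl⟩ := h.surj hb
        exact ⟨c, ⟨hc, (h.sm_iff ha hc).1 hs⟩, rfl⟩
    · intro x y hxy
      obtain ⟨x, hx, rfl⟩ := List.mem_map.1 hxy.left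
      obtain ⟨y, hy, rfl⟩ := List.mem_map.1 hxy.right
      rw [bf_map (fun a ha b hb => h.inj a (List.mem_filter.1 ha).1 b (List.mem_filter.1 hb).1) hx hy, bf_filter] at hxy
      simp only [List.mem_filter, decide_eq_true_eq] at hx hy hxy
      rw [bf_filter]
      refine ⟨h.ord _ _ (dp_S hS hx.2.1 hy.2.1) hxy.1, ?_, ?_⟩
      · simpa using (h.sm_iff ha hx.1).2 hx.2
      · simpa using (h.sm_iff ha hy.1).2 hy.2
  unfold cont
  rw [← key, List.map_map]
  refine List.map_congr_left fun b hb => ?_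
  exact h.la b (List.mem_filter.1 hb).1

theorem Gm_eq (h : Iso e l T lab m T2 lab2) {a : α} (ha : a ∈ l) :
    Gm S T2 m (e a) = Gm S T l a := by
  ext s
  constructor
  · rintro ⟨h1, y, h2, h3, h4⟩
    obtain ⟨y, hy, rfl⟩ := h.surj (h3.bf h.ndm).left
    rw [h.ty y hy] at h2
    refine ⟨h1, y, h2, (h.pr_iff hy ha).1 h3, fun b hb => ?_⟩
    exact (h.pr_iff (hb.pr.bf h.ndl).left hy).1 (h4 _ (h.sep_imp hb))
  · rintro ⟨h1, y, h2, h3, h4⟩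
    have hy := (h3.bf h.ndl).left
    refine ⟨h1, e y, by rw [h.ty y hy]; exact h2, (h.pr_iff hy ha).2 h3, fun b hb => ?_⟩
    obtain ⟨b, hbl, rfl⟩ := h.surj (hb.pr.bf h.ndm).left
    exact (h.pr_iff hbl hy).2 (h4 _ ((h.sep_iff hbl ha).1 hb))

variable [Nonempty R] {ori : List A → Bool}

theorem sc_eq (h : Iso e l T lab m T2 lab2) (hS : S.Nonempty) {a : α} (ha : a ∈ l) :
    sc ori S T2 lab2 m (e a) = sc ori S T lab l a := by
  unfold sc
  rw [h.cont_eq hS ha, h.Gm_eq ha, h.rev.Gm_eq (by simpa using ha)]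

theorem nT_eq (h : Iso e l T lab m T2 lab2) (hS : S.Nonempty) {a : α} (ha : a ∈ l) :
    nT ori S T2 lab2 m (e a) = nT ori S T lab l a := by
  unfold nT
  rw [h.sc_eq hS ha, h.ty a ha]
  have := h.mem ha
  simp [ha, this]

/-- uniqueness: good orders of isomorphic lists are isomorphic w.r.t. the new types -/
theorem good (h : Iso e l T lab m T2 lab2) (hS : S.Nonempty) (hSu : S ≠ Set.univ) {l' : List α} {m' : List β}
    (hl : Good ori S T lab l l') (hm : Good ori S T2 lab2 m m') :
    Iso e l' (nT ori S T lab l) lab m' (nT ori S T2 lab2 m) lab2 where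
  ndl := hl.perm.nodup_iff.1 h.ndl
  inj := fun a ha b hb => h.inj a (hl.perm.mem_iff.2 ha) b (hl.perm.mem_iff.2 hb)
  perm := ((hl.perm.map e).symm.trans h.perm).trans hm.perm
  ty := fun a ha => h.nT_eq hS (hl.perm.mem_iff.2 ha)
  la := fun a ha => h.la a (hl.perm.mem_iff.2 ha)
  ord := by
    intro a b hd hab
    have ha := hl.perm.mem_iff.2 hab.left
    have hb := hl.perm.mem_iff.2 hab.right
    have hndl' : l'.Nodup := hl.perm.nodup_iff.1 h.ndl
    have hndm' : m'.Nodup := hm.perm.nodup_iff.1 h.ndm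
    have hne : a ≠ b := hab.ne hndl'
    by_cases hdT : dp T a b
    · have hab' : bf l a b := by
        rcases bf_total ha hb hne with h1 | h1
        · exact h1
        · exact absurd (hl.ord _ _ hdT.symm h1) (hab.asymm hndl')
      exact hm.ord _ _ ((h.dp_iff ha hb).2 hdT) (h.ord _ _ hdT hab')
    -- new dependency
    have kp : ∀ a b, pr T l a b → bf l' a b := by
      intro a b hp
      induction hp with
      | single h => exact hl.ord _ _ h.2 h.1
      | tail _ h ih => exact ih.trans hndl' (hl.ord _ _ h.2 h.1)
    have kpm : ∀ a b, pr T2 m a b → bf m' a b := by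
      intro a b hp
      induction hp with
      | single h => exact hm.ord _ _ h.2 h.1
      | tail _ h ih => exact ih.trans hndm' (hm.ord _ _ h.2 h.1)
    have hmne : e a ≠ e b := fun h1 => hne (h.inj a ha b hb h1)
    have tot := bf_total (hm.perm.subset (h.mem ha)) (hm.perm.subset (h.mem hb)) hmne
    obtain ⟨r, hr1, hr2⟩ := hd
    unfold nT at hr1 hr2
    by_cases hA : T a = S
    · by_cases hB : T b = S
      · exact absurd (dp_S hS hA hB) hdT
      rw [if_pos ⟨ha, hA⟩] at hr1
      rw [if_neg (fun h => hB h.2)] at hr2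
      rcases hr1 with rfl | hr1
      · cases hori : ori (cont S T lab l a) with
        | true =>
          rcases tot with h1 | h1
          · exact h1
          · have := hm.lft (e a) (e b) (h.mem ha) (by rw [h.ty a ha]; exact hA)
              (by rw [h.cont_eq hS ha]; exact hori) (by rw [h.sc_eq hS ha, h.ty b hb]; exact hr2) h1
            exact absurd (kp _ _ ((h.pr_iff hb ha).1 this)) (hab.asymm hndl')
        | false =>
          exact kpm _ _ ((h.pr_iff ha hb).2 (hl.rgt a b ha hA hori hr2 hab))
      · exact absurd ⟨r, by rw [hA]; exact hr1, hr2⟩ hdT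
    · rw [if_neg (fun h => hA h.2)] at hr1
      by_cases hB : T b = S
      · rw [if_pos ⟨hb, hB⟩] at hr2
        rcases hr2 with rfl | hr2
        · cases hori : ori (cont S T lab l b) with
          | true =>
            exact kpm _ _ ((h.pr_iff ha hb).2 (hl.lft b a hb hB hori hr1 hab))
          | false =>
            rcases tot with h1 | h1
            · exact h1
            · have := hm.rgt (e b) (e a) (h.mem hb) (by rw [h.ty b hb]; exact hB)
                (by rw [h.cont_eq hS hb]; exact hori) (by rw [h.sc_eq hS hb, h.ty a ha]; exact hr1) h1
              exact absurd (kp _ _ ((h.pr_iff hb ha).1 this)) (hab.asymm hndl')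
        · exact absurd ⟨r, hr1, by rw [hB]; exact hr2⟩ hdT
      · rw [if_neg (fun h => hB h.2)] at hr2
        exact absurd ⟨r, hr1, hr2⟩ hdT

end Iso
end stage

section exist
variable {α β : Type v} {R A : Type u} [Nonempty R]

/-- `a` has to come before `w` -/
def pushed (ori : List A → Bool) (S : Set R) (T : α → Set R) (lab : α → A) (l : List α) (w a : α) : Prop :=
  ∃ w' ∈ l, (w' = w ∨ pr T l w' w) ∧ (pr T l a w' ∨
    (ori (cont S T lab l a) = true ∧ sc ori S T lab l a ∈ T w' ∧ ¬ pr T l w' a))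

noncomputable def rk (ori : List A → Bool) (S : Set R) (T : α → Set R) (lab : α → A) (l : List α) (w : α) : ℕ :=
  if T w = S then 2 * (l.toFinset.filter (fun b => T b = S ∧ bf l b w)).card + 1
  else 2 * (l.toFinset.filter (fun b => T b = S ∧ pushed ori S T lab l w b)).card

noncomputable def st (ori : List A → Bool) (S : Set R) (T : α → Set R) (lab : α → A) (l : List α) : List α :=
  l.mergeSort (fun a b => decide (rk ori S T lab l a ≤ rk ori S T lab l b))

variable {ori : List A → Bool} {S : Set R} {T : α → Set R} {lab : α → A} {l : List α}

theorem st_perm : l.Perm (st ori S T lab l) := (List.mergeSort_perm _ _).symm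

theorem st_sorted {a b : α} (h : bf (st ori S T lab l) a b) : rk ori S T lab l a ≤ rk ori S T lab l b := by
  have := bf_pairwise (List.pairwise_mergeSort (le := fun a b => decide (rk ori S T lab l a ≤ rk ori S T lab l b))
    (by intro a b c; simp only [decide_eq_true_eq]; exact le_trans)
    (by intro a b; simp only [Bool.or_eq_true, decide_eq_true_eq]; exact le_total _ _) l) h
  simpa using this

theorem st_stable {a b : α} (h : bf l a b) (hr : rk ori S T lab l a ≤ rk ori S T lab l b) :
    bf (st ori S T lab l) a b := by
  rw [bf_iff_sublist] at h ⊢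
  exact List.pair_sublist_mergeSort
    (by intro a b c; simp only [decide_eq_true_eq]; exact le_trans)
    (by intro a b; simp only [Bool.or_eq_true, decide_eq_true_eq]; exact le_total _ _)
    (by simpa using hr) h

theorem pushed_down (hl : l.Nodup) (hS : S.Nonempty) (hSu : S ≠ Set.univ)
    (hmin : ∀ z ∈ l, T z ⊆ S → T z = S) {w a b : α} (hw : T w ≠ S) (ha : T a = S) (hb : T b = S)
    (hal : a ∈ l) (hbl : b ∈ l)
    (hab : bf l b a ∨ sm S T l a b) (h : pushed ori S T lab l w a) : pushed ori S T lab l w b := by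
  obtain ⟨w', hw', h1, h2⟩ := h
  rcases sm_or (S := S) (T := T) (l := l) a b hb with hs | hs | hs
  · rcases h2 with h2 | ⟨h2, h3, h4⟩
    · by_cases hwS : T w' = S
      · -- move to w itself
        rcases h1 with rfl | h1
        · exact absurd hwS hw
        · refine ⟨w, (h1.bf hl).right, Or.inl rfl, Or.inl ?_⟩
          exact pr_sm_left hl hbl ha hs hw (h2.trans h1)
      · exact ⟨w', hw', h1, Or.inl (pr_sm_left hl hbl ha hs hwS h2)⟩
    · have hwS : T w' ≠ S := fun h => sc_not_mem ori lab hSu a (h ▸ h3)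
      refine ⟨w', hw', h1, Or.inr ⟨?_, ?_, fun h => h4 ?_⟩⟩
      · rw [cont_sm hl lab ha hal hbl hs]; exact h2
      · rw [sc_sm ori lab hl hS ha hal hbl hs]; exact h3
      · exact pr_sm_right hl hal hb (hs.symm ha) hwS h
  · rcases hab with h | h
    · exact absurd (hs.pr.bf hl) (h.asymm hl)
    · exact absurd hs h.2.1
  · refine ⟨w', hw', h1, Or.inl ?_⟩
    rcases h2 with h2 | ⟨h2, h3, h4⟩
    · exact hs.pr.trans h2
    · exact prev_pr hl hS hmin hw' h2 h3 h4 hs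

theorem rk_pushed (hl : l.Nodup) (hS : S.Nonempty) (hSu : S ≠ Set.univ)
    (hmin : ∀ z ∈ l, T z ⊆ S → T z = S) {w a : α} (hw : T w ≠ S) (ha : T a = S) (hal : a ∈ l) :
    (pushed ori S T lab l w a → rk ori S T lab l a < rk ori S T lab l w) ∧
    (¬ pushed ori S T lab l w a → rk ori S T lab l w < rk ori S T lab l a) := by
  unfold rk
  rw [if_neg hw, if_pos ha]
  constructor
  · intro h
    have : (l.toFinset.filter (fun b => T b = S ∧ bf l b a)).card <
        (l.toFinset.filter (fun b => T b = S ∧ pushed ori S T lab l w b)).card := by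
      apply Finset.card_lt_card
      rw [Finset.ssubset_iff_of_subset]
      · refine ⟨a, by simp [hal, ha, h], ?_⟩
        simp only [Finset.mem_filter, not_and]
        intro _ _ h'; exact h'.ne hl rfl
      · intro b hb
        simp only [Finset.mem_filter, List.mem_toFinset] at hb ⊢
        exact ⟨hb.1, hb.2.1, pushed_down hl hS hSu hmin hw ha hb.2.1 hal hb.1 (Or.inl hb.2.2) h⟩
    omega
  · intro h
    have : (l.toFinset.filter (fun b => T b = S ∧ pushed ori S T lab l w b)).card ≤
        (l.toFinset.filter (fun b => T b = S ∧ bf l b a)).card := by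
      apply Finset.card_le_card
      intro b hb
      simp only [Finset.mem_filter, List.mem_toFinset] at hb ⊢
      refine ⟨hb.1, hb.2.1, ?_⟩
      have hne : b ≠ a := fun h' => h (h' ▸ hb.2.2)
      rcases bf_total hb.1 hal hne with h1 | h1
      · exact h1
      · exact absurd (pushed_down hl hS hSu hmin hw hb.2.1 ha hb.1 hal (Or.inl h1) hb.2.2) h
    omega

theorem pr_cmp (hl : l.Nodup) {a b : α} (h : pr T l a b) : ¬ pr T l b a :=
  fun h' => pr.irrefl hl (h.trans h')

theorem not_pushed (hl : l.Nodup) {w a : α} (h : pr T l w a) : ¬ pushed ori S T lab l w a := by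
  rintro ⟨w', _, h1, h2⟩
  have h3 : pr T l w' a := by
    rcases h1 with rfl | h1
    · exact h
    · exact h1.trans h
  rcases h2 with h2 | h2
  · exact pr_cmp hl h2 h3
  · exact h2.2.2 h3

theorem st_good (hl : l.Nodup) (hS : S.Nonempty) (hSu : S ≠ Set.univ)
    (hmin : ∀ z ∈ l, T z ⊆ S → T z = S) : Good ori S T lab l (st ori S T lab l) := by
  have hmem : ∀ a, a ∈ st ori S T lab l → a ∈ l := fun a ha => st_perm.mem_iff.2 ha
  refine ⟨st_perm, ?_, ?_, ?_, ?_⟩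
  · intro a b hd hab
    refine st_stable hab ?_
    have hp := pr.of hab hd
    by_cases ha : T a = S <;> by_cases hb : T b = S
    · unfold rk; rw [if_pos ha, if_pos hb]
      have : (l.toFinset.filter (fun c => T c = S ∧ bf l c a)).card ≤
        (l.toFinset.filter (fun c => T c = S ∧ bf l c b)).card := by
        apply Finset.card_le_card
        intro c hc
        simp only [Finset.mem_filter] at hc ⊢
        exact ⟨hc.1, hc.2.1, hc.2.2.trans hl hab⟩
      omega
    · exact ((rk_pushed hl hS hSu hmin hb ha hab.left).1 ⟨b, hab.right, Or.inl rfl, Or.inl hp⟩).le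
    · exact ((rk_pushed hl hS hSu hmin ha hb hab.right).2 (not_pushed hl hp)).le
    · unfold rk; rw [if_neg ha, if_neg hb]
      have : (l.toFinset.filter (fun c => T c = S ∧ pushed ori S T lab l a c)).card ≤
        (l.toFinset.filter (fun c => T c = S ∧ pushed ori S T lab l b c)).card := by
        apply Finset.card_le_card
        intro c hc
        simp only [Finset.mem_filter] at hc ⊢
        obtain ⟨h1, h2, w', h3, h4, h5⟩ := hc
        refine ⟨h1, h2, w', h3, Or.inr ?_, h5⟩
        rcases h4 with rfl | h4
        · exact hp
        · exact h4.trans hp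
      omega
  · intro a b z ha hs h1 h2
    by_contra hz
    have h3 := st_sorted h1
    have h4 := st_sorted h2
    have hal := hmem _ h1.left
    have hbl := hmem _ h2.right
    have ha' := rk_pushed (ori := ori) (lab := lab) hl hS hSu hmin hz ha hal
    have hb' := rk_pushed (ori := ori) (lab := lab) hl hS hSu hmin hz hs.1 hbl
    by_cases hp : pushed ori S T lab l z a
    · have := hb'.1 (pushed_down hl hS hSu hmin hz ha hs.1 hal hbl (Or.inr hs) hp); omega
    · have := ha'.2 hp; omega
  · intro a y hal ha hori hsc hya
    have hy : T y ≠ S := fun h => sc_not_mem ori lab hSu a (h ▸ hsc)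
    have h3 := st_sorted hya
    by_contra hcon
    have := (rk_pushed (ori := ori) (lab := lab) hl hS hSu hmin hy ha hal).1
      ⟨y, hmem _ hya.left, Or.inl rfl, Or.inr ⟨hori, hsc, hcon⟩⟩
    omega
  · intro a y hal ha hori hsc hay
    have hy : T y ≠ S := fun h => sc_not_mem ori lab hSu a (h ▸ hsc)
    have h3 := st_sorted hay
    by_contra hcon
    have := (rk_pushed (ori := ori) (lab := lab) hl hS hSu hmin hy ha hal).2 (by
      rintro ⟨w', _, h1, h2 | h2⟩
      · rcases h1 with rfl | h1
        · exact hcon h2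
        · exact hcon (h2.trans h1)
      · rw [hori] at h2; exact absurd h2.1 (by simp))
    omega
end exist

section linsec
variable {α β : Type v} {R A : Type u} [Nonempty R]

noncomputable def lin (ori : List A → Bool) : List (Set R) → (α → Set R) → (α → A) → List α → List α
  | [], _, _, l => l
  | S :: Ss, T, lab, l => lin ori Ss (nT ori S T lab l) lab (st ori S T lab l)

def OKS : List (Set R) → Prop
  | [] => True
  | S :: Ss => S.Nonempty ∧ S ≠ Set.univ ∧ (∀ S' ∈ Ss, ¬ S' ⊆ S) ∧
      (∀ s, s ∉ S → insert s S ∈ Ss ∨ insert s S = Set.univ) ∧ OKS Ss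

def Val (Ss : List (Set R)) (T : α → Set R) (l : List α) : Prop := ∀ a ∈ l, T a ∈ Ss ∨ T a = Set.univ

theorem Val.sub {Ss : List (Set R)} {T : α → Set R} {l m : List α} (h : Val Ss T l) (hm : ∀ a ∈ m, a ∈ l) :
    Val Ss T m := fun a ha => h a (hm a ha)

theorem Val.min {S : Set R} {Ss : List (Set R)} (hO : OKS (S :: Ss)) {T : α → Set R} {l : List α}
    (h : Val (S :: Ss) T l) : ∀ z ∈ l, T z ⊆ S → T z = S := by
  intro z hz hsub
  rcases h z hz with h1 | h1
  · rcases List.mem_cons.1 h1 with h1 | h1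
    · exact h1
    · exact absurd hsub (hO.2.2.1 _ h1)
  · rw [h1] at hsub; exact absurd (Set.univ_subset_iff.1 hsub) hO.2.1

theorem Val.next {ori : List A → Bool} {lab : α → A} {S : Set R} {Ss : List (Set R)} (hO : OKS (S :: Ss))
    {T : α → Set R} {l m : List α}
    (h : Val (S :: Ss) T m) : Val Ss (nT ori S T lab l) (m.filter (fun a => decide (a ∈ l))) := by
  intro a ha
  simp only [List.mem_filter, decide_eq_true_eq] at ha
  unfold nT
  by_cases hS : T a = S
  · rw [if_pos ⟨ha.2, hS⟩]
    exact hO.2.2.2.1 _ (sc_not_mem ori lab hO.2.1 a)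
  · rw [if_neg (fun h => hS h.2)]
    rcases h a ha.1 with h | h
    · exact Or.inl ((List.mem_cons.1 h).resolve_left hS)
    · exact Or.inr h

variable {ori : List A → Bool}

theorem Val.next' {lab : α → A} {S : Set R} {Ss : List (Set R)} (hO : OKS (S :: Ss))
    {T : α → Set R} {l m : List α}
    (h : Val (S :: Ss) T l) (hm : ∀ a ∈ m, a ∈ l) : Val Ss (nT ori S T lab l) m := by
  intro a ha
  exact (Val.next (ori := ori) (lab := lab) (l := l) hO h) a (by simp [hm a ha])

theorem nT_mono {lab : α → A} {S : Set R} {T : α → Set R} {l : List α} (a : α) :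
    T a ⊆ nT ori S T lab l a := by
  unfold nT
  split_ifs with h
  · rw [h.2]; exact Set.subset_insert _ _
  · exact subset_rfl

theorem dp_mono {T T' : α → Set R} {a b : α} (ha : T a ⊆ T' a) (hb : T b ⊆ T' b) (h : dp T a b) : dp T' a b := by
  obtain ⟨r, h1, h2⟩ := h; exact ⟨r, ha h1, hb h2⟩

theorem lin_iso {Ss : List (Set R)} (hO : OKS Ss) {e : α → β} {l : List α} {T : α → Set R} {lab : α → A}
    {m : List β} {T2 : β → Set R} {lab2 : β → A} (h : Iso e l T lab m T2 lab2) (hv : Val Ss T l) :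
    lin ori Ss T2 lab2 m = (lin ori Ss T lab l).map e := by
  induction Ss generalizing l T m T2 with
  | nil =>
    unfold lin
    symm
    refine bf_ext (List.Nodup.map_on (fun a ha b hb => h.inj a ha b hb) h.ndl) h.ndm h.perm ?_
    intro a b hab
    obtain ⟨a, ha, rfl⟩ := List.mem_map.1 hab.left
    obtain ⟨b, hb, rfl⟩ := List.mem_map.1 hab.right
    rw [bf_map h.inj ha hb] at hab
    refine h.ord a b ?_ hab
    have h1 := (hv a ha).resolve_left (by simp)
    have h2 := (hv b hb).resolve_left (by simp)
    exact ⟨Classical.arbitrary R, by rw [h1]; trivial, by rw [h2]; trivial⟩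
  | cons S Ss ih =>
    unfold lin
    have hv2 : Val (S :: Ss) T2 m := by
      intro b hb
      obtain ⟨a, ha, rfl⟩ := h.surj hb
      rw [h.ty a ha]; exact hv a ha
    exact ih hO.2.2.2.2 (h.good hO.1 hO.2.1 (st_good h.ndl hO.1 hO.2.1 (hv.min hO))
      (st_good h.ndm hO.1 hO.2.1 (hv2.min hO))) (hv.next' hO (fun a ha => st_perm.mem_iff.2 ha))

theorem lin_perm {Ss : List (Set R)} {l : List α} {T : α → Set R} {lab : α → A} :
    l.Perm (lin ori Ss T lab l) := by
  induction Ss generalizing l T with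
  | nil => exact List.Perm.refl _
  | cons S Ss ih => exact st_perm.trans ih

theorem lin_ord {Ss : List (Set R)} (hO : OKS Ss) {l : List α} (hl : l.Nodup) {T : α → Set R} {lab : α → A}
    (hv : Val Ss T l) {a b : α} (hd : dp T a b) (hb : bf l a b) : bf (lin ori Ss T lab l) a b := by
  induction Ss generalizing l T with
  | nil => exact hb
  | cons S Ss ih =>
    exact ih hO.2.2.2.2 (st_perm.nodup_iff.1 hl) (hv.next' hO (fun a ha => st_perm.mem_iff.2 ha))
      (dp_mono (nT_mono a) (nT_mono b) hd) ((st_good hl hO.1 hO.2.1 (hv.min hO)).ord a b hd hb)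

theorem lin_uniform {Ss : List (Set R)} (hO : OKS Ss) {l : List α} (hl : l.Nodup) {T : α → Set R} {lab : α → A}
    (hv : Val Ss T l) (hd : ∀ a ∈ l, ∀ b ∈ l, dp T a b) : lin ori Ss T lab l = l := by
  symm
  refine bf_ext hl (lin_perm.nodup_iff.1 hl) lin_perm ?_
  intro a b hab
  exact lin_ord hO hl hv (hd a hab.left b hab.right) hab

/-- tagged reducedness -/
def RedT (T0 : α → Set R) (ba : A → A) (lab : α → A) (l : List α) : Prop :=
  ∀ a b, bf l a b → lab b = ba (lab a) → dp T0 a b ∧ ∃ z, bf l a z ∧ bf l z b ∧ dp T0 z a ∧ dp T0 z b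

theorem cont_rev {ba : A → A} {S : Set R} {T : α → Set R} {lab : α → A} {l : List α} (a : α) :
    cont S T (ba ∘ lab) l.reverse a = lstar ba (cont S T lab l a) := by
  unfold cont lstar
  simp only [sm_reverse, List.filter_reverse, List.map_reverse, List.map_map]

theorem cont_red {ba : A → A} {S : Set R} {T T0 : α → Set R} {lab : α → A} {l : List α} (hl : l.Nodup)
    (hT : ∀ a ∈ l, T0 a ⊆ T a) (hr : RedT T0 ba lab l) {a : α} (hal : a ∈ l) (ha : T a = S) :
    Red ba (cont S T lab l a) := by
  unfold cont Red
  rw [List.isChain_map]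
  set f := l.filter (fun b => decide (sm S T l a b)) with hf
  have hfn : f.Nodup := hl.filter _
  rw [List.isChain_iff_forall_rel_of_append_cons_cons]
  intro b c x y hxy hlab
  have hbc : bf f b c := by
    rw [hxy, bf_append, bf_cons]; right; left; left; simp
  have hbc' := hbc
  rw [hf, bf_filter] at hbc'
  simp only [decide_eq_true_eq] at hbc'
  obtain ⟨_, z, h1, h2, h3, _⟩ := hr b c hbc'.1 hlab
  have hbS := hbc'.2.1.1
  have hcS := hbc'.2.2.1
  have hsm : sm S T l b c := (hbc'.2.1.symm ha).trans hl hbS hal hbc'.2.2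
  by_cases hz : T z = S
  · -- z in the run: contradiction with adjacency
    have hzs : sm S T l a z := by
      refine hbc'.2.1.trans hl ha hbc'.1.left ⟨hz, fun hs => ?_, fun hs => ?_⟩
      · obtain ⟨h4, _, w, h5, h6, h7⟩ := hs
        exact hsm.2.1 ⟨h4, hcS, w, h5, h6.trans hl h2, h7⟩
      · exact absurd (hs.pr.bf hl) (h1.asymm hl)
    have hz1 : bf f b z := by rw [hf, bf_filter]; exact ⟨h1, by simpa using hbc'.2.1, by simpa using hzs⟩
    have hz2 : bf f z c := by rw [hf, bf_filter]; exact ⟨h2, by simpa using hzs, by simpa using hbc'.2.2⟩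
    have hzm : z ∈ x ∨ z = b ∨ z = c ∨ z ∈ y := by
      have := hz1.right; rw [hxy] at this; simpa using this
    rcases hzm with h | rfl | rfl | h
    · exact hz1.asymm hfn (by rw [hxy, bf_append]; right; right; exact ⟨h, by simp⟩)
    · exact hz1.ne hfn rfl
    · exact hz2.ne hfn rfl
    · exact hz2.asymm hfn (by rw [hxy, bf_append, bf_cons, bf_cons]; right; left; right; left; exact ⟨rfl, h⟩)
  · refine hsm.2.1 ⟨hbS, hcS, z, h1, h2, hz, ?_⟩
    obtain ⟨r, hr1, hr2⟩ := h3
    exact ⟨r, hT z h1.right hr1, by rw [← hbS]; exact hT b h1.left hr2⟩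

theorem lin_rev {ba : A → A} (hba : Function.Involutive ba) (hfp : ∀ a, ba a ≠ a)
    (hori : ∀ u, lstar ba u ≠ u → ori (lstar ba u) = !ori u)
    {Ss : List (Set R)} (hO : OKS Ss) {l : List α} (hl : l.Nodup) {T T0 : α → Set R} {lab : α → A}
    (hv : Val Ss T l) (hT : ∀ a ∈ l, T0 a ⊆ T a) (hr : RedT T0 ba lab l) :
    lin ori Ss T (ba ∘ lab) l.reverse = (lin ori Ss T lab l).reverse := by
  induction Ss generalizing l T with
  | nil => rfl
  | cons S Ss ih =>
    have hmin := hv.min hO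
    have hlr : l.reverse.Nodup := by simpa using hl
    have hgood : Good ori S T lab l _ := st_good hl hO.1 hO.2.1 hmin
    have horr : ∀ a ∈ l, T a = S → ori (cont S T (ba ∘ lab) l.reverse a) = !ori (cont S T lab l a) := by
      intro a hal ha
      rw [cont_rev]
      refine hori _ fun h => ?_
      have h1 := red_selfbar hba hfp _ (cont_red hl hT hr hal ha) h
      have h2 : lab a ∈ cont S T lab l a := by
        unfold cont
        refine List.mem_map_of_mem ?_
        rw [List.mem_filter]; exact ⟨hal, by simpa using sm.refl hl ha⟩
      rw [h1] at h2; simp at h2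
    have hsc : ∀ a ∈ l, T a = S → sc ori S T (ba ∘ lab) l.reverse a = sc ori S T lab l a := by
      intro a hal ha
      unfold sc
      rw [horr a hal ha, List.reverse_reverse]
      cases ori (cont S T lab l a) <;> simp
    have hnT : nT ori S T (ba ∘ lab) l.reverse = nT ori S T lab l := by
      funext a
      unfold nT
      by_cases h : a ∈ l ∧ T a = S
      · rw [if_pos h, if_pos (by simpa using h), hsc a h.1 h.2]
      · rw [if_neg h, if_neg (by simpa using h)]
    have hg2 : Good ori S T (ba ∘ lab) l.reverse (st ori S T lab l).reverse := by
      refine ⟨?_, ?_, ?_, ?_, ?_⟩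
      · exact (List.reverse_perm _).trans (st_perm.trans (List.reverse_perm _).symm)
      · intro a b hd hab
        exact bf_reverse.2 (hgood.ord b a hd.symm (bf_reverse.1 hab))
      · intro a b z ha hs h1 h2
        rw [sm_reverse] at hs
        exact hgood.run b a z hs.1 (hs.symm ha) (bf_reverse.1 h2) (bf_reverse.1 h1)
      · intro a y hal ha ho hs hb
        have hal' : a ∈ l := by simpa using hal
        rw [horr a hal' ha] at ho
        rw [hsc a hal' ha] at hs
        exact pr_reverse.2 (hgood.rgt a y hal' ha (by simpa using ho) hs (bf_reverse.1 hb))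
      · intro a y hal ha ho hs hb
        have hal' : a ∈ l := by simpa using hal
        rw [horr a hal' ha] at ho
        rw [hsc a hal' ha] at hs
        exact pr_reverse.2 (hgood.lft a y hal' ha (by simpa using ho) hs (bf_reverse.1 hb))
    have hvr : Val (S :: Ss) T l.reverse := hv.sub (by simp)
    have hid : Iso id l.reverse T (ba ∘ lab) l.reverse T (ba ∘ lab) :=
      ⟨hlr, fun _ _ _ _ h => h, by simp, fun _ _ => rfl, fun _ _ => rfl, fun _ _ _ h => h⟩
    have hiso := hid.good hO.1 hO.2.1 hg2 (st_good hlr hO.1 hO.2.1 (hvr.min hO))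
    rw [hnT] at hiso
    have hvn : Val Ss (nT ori S T lab l) (st ori S T lab l) := hv.next' hO (fun a ha => st_perm.mem_iff.2 ha)
    have e1 := lin_iso (ori := ori) hO.2.2.2.2 hiso (hvn.sub (by simp))
    simp only [List.map_id] at e1
    show lin ori Ss (nT ori S T (ba ∘ lab) l.reverse) (ba ∘ lab) _ = _
    rw [hnT, e1]
    refine ih hO.2.2.2.2 (st_perm.nodup_iff.1 hl) hvn
      (fun a ha => (hT a (st_perm.mem_iff.2 ha)).trans (nT_mono a)) ?_
    intro a b hab hlab
    have hal := st_perm.mem_iff.2 hab.left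
    have hbl := st_perm.mem_iff.2 hab.right
    have hm : ∀ x ∈ l, ∀ y ∈ l, dp T0 x y → bf l x y → bf (st ori S T lab l) x y :=
      fun x hx y hy h h' => hgood.ord x y (dp_mono (hT x hx) (hT y hy) h) h'
    have hne := hab.ne (st_perm.nodup_iff.1 hl)
    rcases bf_total hal hbl hne with h1 | h1
    · obtain ⟨h2, z, h3, h4, h5, h6⟩ := hr a b h1 hlab
      exact ⟨h2, z, hm _ hal _ h3.right h5.symm h3, hm _ h3.right _ hbl h6 h4, h5, h6⟩
    · have : lab a = ba (lab b) := by rw [hlab, hba]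
      obtain ⟨h2, _⟩ := hr b a h1 this
      exact absurd (hm _ hbl _ hal h2 h1) (hab.asymm (st_perm.nodup_iff.1 hl))

end linsec

section bs
variable {α : Type v}

/-- one block swap -/
def sw (I : α → α → Prop) (x y : List α) : Prop :=
  ∃ p u d s, x = p ++ u ++ d ++ s ∧ y = p ++ d ++ u ++ s ∧ ∀ a ∈ u, ∀ b ∈ d, I a b

inductive BS (I : α → α → Prop) : ℕ → List α → List α → Prop
  | refl (n : ℕ) (x : List α) : BS I n x x
  | step {n : ℕ} {x y z : List α} : sw I x y → BS I n y z → BS I (n + 1) x z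

variable {I : α → α → Prop}

theorem BS.mono {n m : ℕ} {x y : List α} (h : BS I n x y) (hnm : n ≤ m) : BS I m x y := by
  induction h generalizing m with
  | refl n x => exact BS.refl _ _
  | step h1 h2 ih =>
    obtain ⟨m, rfl⟩ : ∃ m', m = m' + 1 := ⟨m - 1, by omega⟩
    exact BS.step h1 (ih (by omega))

theorem BS.trans {n m : ℕ} {x y z : List α} (h : BS I n x y) (h' : BS I m y z) : BS I (n + m) x z := by
  induction h with
  | refl n x => exact h'.mono (by omega)
  | step h1 h2 ih => exact (BS.step h1 (ih h')).mono (by omega)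

theorem sw.symm (hI : ∀ a b, I a b → I b a) {x y : List α} (h : sw I x y) : sw I y x := by
  obtain ⟨p, u, d, s, rfl, rfl, h⟩ := h
  exact ⟨p, d, u, s, rfl, rfl, fun a ha b hb => hI _ _ (h b hb a ha)⟩

theorem BS.symm (hI : ∀ a b, I a b → I b a) {n : ℕ} {x y : List α} (h : BS I n x y) : BS I n y x := by
  induction h with
  | refl n x => exact BS.refl _ _
  | step h1 h2 ih => exact ih.trans (BS.step (h1.symm hI) (BS.refl 0 _))

theorem BS.ctx {n : ℕ} {x y : List α} (h : BS I n x y) (p s : List α) : BS I n (p ++ x ++ s) (p ++ y ++ s) := by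
  induction h with
  | refl n x => exact BS.refl _ _
  | step h1 h2 ih =>
    refine BS.step ?_ ih
    obtain ⟨q, u, d, t, rfl, rfl, h⟩ := h1
    exact ⟨p ++ q, u, d, t ++ s, by simp, by simp, h⟩

theorem BS.app {n m : ℕ} {x y z w : List α} (h : BS I n x y) (h' : BS I m z w) :
    BS I (n + m) (x ++ z) (y ++ w) := by
  have h1 := h.ctx [] z
  have h2 := h'.ctx y []
  simp only [List.nil_append, List.append_nil] at h1 h2
  exact h1.trans h2

theorem bs_flatten {ι : Type*} (F G : ι → List α) (K : ℕ) (fs : List ι) (h : ∀ f ∈ fs, BS I K (F f) (G f)) :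
    BS I (fs.length * K) (fs.map F).flatten (fs.map G).flatten := by
  induction fs with
  | nil => exact BS.refl _ _
  | cons f fs ih =>
    simp only [List.map_cons, List.flatten_cons, List.length_cons]
    exact ((h f (by simp)).app (ih fun f hf => h f (by simp [hf]))).mono (by ring_nf; omega)

theorem bs_extract {ι : Type*} (P Q : ι → List α) (fs : List ι)
    (h : fs.Pairwise (fun f f' => ∀ a ∈ Q f, ∀ b ∈ P f', I a b)) :
    BS I fs.length (fs.map (fun f => P f ++ Q f)).flatten ((fs.map P).flatten ++ (fs.map Q).flatten) := by
  induction fs with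
  | nil => exact BS.refl _ _
  | cons f fs ih =>
    rw [List.pairwise_cons] at h
    simp only [List.map_cons, List.flatten_cons, List.length_cons]
    have h1 := (ih h.2).ctx (P f ++ Q f) []
    simp only [List.append_nil] at h1
    refine h1.trans (BS.step (y := _) ?_ (BS.refl 0 _))
    refine ⟨P f, Q f, (fs.map P).flatten, (fs.map Q).flatten, by simp, by simp, ?_⟩
    intro a ha b hb
    simp only [List.mem_flatten, List.mem_map] at hb
    obtain ⟨_, ⟨f', hf', rfl⟩, hb⟩ := hb
    exact h.1 f' hf' a ha b hb

variable {B : List α} {Lf : List α → List α} {K : ℕ}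

theorem bs_merge (hLp : ∀ x, (Lf x).Perm x)
    (hK : ∀ x y, (x ++ y).Nodup → (∀ a ∈ x ++ y, a ∈ B) → BS I K (Lf x ++ Lf y) (Lf (x ++ y)))
    (fs : List (List α)) (hnd : fs.flatten.Nodup) (hB : ∀ a ∈ fs.flatten, a ∈ B) :
    BS I (fs.length * K) (fs.map Lf).flatten (Lf fs.flatten) := by
  induction fs with
  | nil =>
    have : Lf [] = [] := List.perm_nil.1 (hLp [])
    simp only [List.map_nil, List.flatten_nil, this]; exact BS.refl _ _
  | cons f fs ih =>
    simp only [List.map_cons, List.flatten_cons, List.length_cons] at hnd hB ⊢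
    have h1 := (ih (List.nodup_append.1 hnd).2.1 (fun a ha => hB a (by simp only [List.mem_append]; exact Or.inr ha))).ctx (Lf f) []
    simp only [List.append_nil] at h1
    exact (h1.trans (hK f fs.flatten hnd hB)).mono (by ring_nf; omega)

theorem filter_flatten' (fs : List (List α)) (p : α → Bool) :
    (fs.map (fun f => f.filter p)).flatten = fs.flatten.filter p := by
  induction fs with
  | nil => rfl
  | cons f fs ih => rw [List.map_cons, List.flatten_cons, List.flatten_cons, List.filter_append, ih]

theorem bf_mem_flatten {fs : List (List α)} {f : List α} (hf : f ∈ fs) {a b : α} (h : bf f a b) :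
    bf fs.flatten a b := by
  induction fs with
  | nil => simp at hf
  | cons g fs ih =>
    rw [List.flatten_cons, bf_append]
    rcases List.mem_cons.1 hf with rfl | hf
    · exact Or.inl h
    · exact Or.inr (Or.inl (ih hf))

theorem pairwise_flatten_bf (fs : List (List α)) :
    fs.Pairwise (fun f f' => ∀ a ∈ f, ∀ b ∈ f', bf fs.flatten a b) := by
  induction fs with
  | nil => simp
  | cons f fs ih =>
    rw [List.pairwise_cons]
    constructor
    · intro f' hf' a ha b hb
      rw [List.flatten_cons, bf_append]; right; right
      exact ⟨ha, List.mem_flatten.2 ⟨f', hf', hb⟩⟩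
    · refine ih.imp fun {f f'} h a ha b hb => ?_
      rw [List.flatten_cons, bf_append]; right; left; exact h a ha b hb

theorem grid (hI : ∀ a b, I a b → I b a) (D : α → α → Prop) (hLp : ∀ x, (Lf x).Perm x)
    (hK : ∀ x y, (x ++ y).Nodup → (∀ a ∈ x ++ y, a ∈ B) → BS I K (Lf x ++ Lf y) (Lf (x ++ y)))
    (hc : ∀ x y, x.Nodup → (∀ a ∈ x, a ∈ B) → x.Perm y → (∀ a b, bf x a b → bf y b a → ¬ D a b) → Lf x = Lf y)
    (gs fs : List (List α)) (hnd : fs.flatten.Nodup) (hB : ∀ a ∈ fs.flatten, a ∈ B)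
    (hp : fs.flatten.Perm gs.flatten)
    (h1 : ∀ a b, bf fs.flatten a b → bf gs.flatten b a → I a b)
    (h2 : ∀ f ∈ fs, ∀ a ∈ f, ∀ b ∈ f, bf fs.flatten a b → bf gs.flatten b a → ¬ D a b)
    (h3 : ∀ f ∈ gs, ∀ a ∈ f, ∀ b ∈ f, bf fs.flatten a b → bf gs.flatten b a → ¬ D a b) :
    BS I (gs.length * (fs.length * K + fs.length + fs.length * K)) (fs.map Lf).flatten (gs.map Lf).flatten := by
  induction gs generalizing fs with
  | nil =>
    have e : (fs.map Lf).flatten = [] := by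
      rw [List.flatten_eq_nil_iff]
      intro l hl
      obtain ⟨f, hf, rfl⟩ := List.mem_map.1 hl
      have : f = [] := (List.flatten_eq_nil_iff.1 (by simpa using hp)) f hf
      rw [this]; exact List.perm_nil.1 (hLp [])
    rw [e]; exact BS.refl _ _
  | cons g gs ih =>
    set P : List α → List α := fun f => f.filter (fun a => decide (a ∈ g)) with hP
    set Q : List α → List α := fun f => f.filter (fun a => decide (a ∉ g)) with hQ
    have hgnd : (g ++ gs.flatten).Nodup := by
      rw [← List.flatten_cons]; exact hp.nodup_iff.1 hnd
    have hmg : ∀ a ∈ fs.flatten, a ∉ g → a ∈ gs.flatten := by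
      intro a ha hg
      have := hp.subset ha
      rw [List.flatten_cons, List.mem_append] at this
      exact this.resolve_left hg
    have hfn : ∀ f ∈ fs, f.Nodup := fun f hf => (List.nodup_flatten.1 hnd).1 f hf
    have hpq : ∀ f : List α, f.Perm (P f ++ Q f) := by
      intro f
      have := List.filter_append_perm (fun a => decide (a ∈ g)) f
      simp only [hP, hQ]
      refine (this.symm).trans ?_
      simp
    have hlast : ∀ a ∈ fs.flatten, ∀ b, b ∈ g → a ∉ g → bf (g :: gs).flatten b a := by
      intro a ha b hb hag
      rw [List.flatten_cons, bf_append]; right; right; exact ⟨hb, hmg a ha hag⟩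
    have e1 : ∀ f ∈ fs, Lf f = Lf (P f ++ Q f) := by
      intro f hf
      refine hc f _ (hfn f hf) (fun a ha => hB a (List.mem_flatten.2 ⟨f, hf, ha⟩)) (hpq f) ?_
      intro a b hab hba
      rw [bf_append] at hba
      simp only [hP, hQ, bf_filter, List.mem_filter, decide_eq_true_eq] at hba
      rcases hba with h | h | h
      · exact absurd h.1 (hab.asymm (hfn f hf))
      · exact absurd h.1 (hab.asymm (hfn f hf))
      · exact h2 f hf a hab.left b hab.right (bf_mem_flatten hf hab)
          (hlast a (List.mem_flatten.2 ⟨f, hf, hab.left⟩) b h.1.2 h.2.2)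
    have s1 : BS I (fs.length * K) (fs.map Lf).flatten (fs.map (fun f => Lf (P f) ++ Lf (Q f))).flatten := by
      refine bs_flatten _ _ K fs fun f hf => ?_
      rw [e1 f hf]
      refine (hK _ _ ((hpq f).nodup_iff.1 (hfn f hf)) ?_).symm hI
      intro a ha
      exact hB a (List.mem_flatten.2 ⟨f, hf, (hpq f).mem_iff.2 ha⟩)
    have s2 : BS I fs.length (fs.map (fun f => Lf (P f) ++ Lf (Q f))).flatten
        ((fs.map (fun f => Lf (P f))).flatten ++ (fs.map (fun f => Lf (Q f))).flatten) := by
      refine bs_extract _ _ fs ?_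
      refine (pairwise_flatten_bf fs).imp fun {f f'} h a ha b hb => ?_
      have ha := (hLp _).subset ha
      have hb := (hLp _).subset hb
      simp only [hP, hQ, List.mem_filter, decide_eq_true_eq] at ha hb
      have hab := h a ha.1 b hb.1
      exact h1 a b hab (hlast a hab.left b hb.2 ha.2)
    have eP : (fs.map P).flatten = fs.flatten.filter (fun a => decide (a ∈ g)) := filter_flatten' fs _
    have eQ : (fs.map Q).flatten = fs.flatten.filter (fun a => decide (a ∉ g)) := filter_flatten' fs _
    have hgm : ∀ a ∈ g, a ∈ fs.flatten := fun a ha =>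
      hp.symm.subset (by rw [List.flatten_cons, List.mem_append]; exact Or.inl ha)
    have e2 : Lf (fs.map P).flatten = Lf g := by
      rw [eP]
      refine hc _ _ (hnd.filter _) (fun a ha => hB a (List.mem_filter.1 ha).1) ?_ ?_
      · rw [List.perm_ext_iff_of_nodup (hnd.filter _) (List.nodup_append.1 hgnd).1]
        intro a
        simp only [List.mem_filter, decide_eq_true_eq]
        exact ⟨fun h => h.2, fun h => ⟨hgm a h, h⟩⟩
      · intro a b hab hba
        rw [bf_filter] at hab
        exact h3 g (by simp) a hba.right b hba.left hab.1 (by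
          rw [List.flatten_cons, bf_append]; exact Or.inl hba)
    have s3 : BS I (fs.length * K) (fs.map (fun f => Lf (P f))).flatten (Lf g) := by
      have := bs_merge hLp hK (fs.map P) (by rw [eP]; exact hnd.filter _)
        (by intro a ha; rw [eP] at ha; exact hB a (List.mem_filter.1 ha).1)
      rw [e2, List.length_map, List.map_map] at this
      exact this
    have s4 := ih (fs.map Q) (by rw [eQ]; exact hnd.filter _)
      (by intro a ha; rw [eQ] at ha; exact hB a (List.mem_filter.1 ha).1)
      (by
        rw [eQ, List.perm_ext_iff_of_nodup (hnd.filter _) (List.nodup_append.1 hgnd).2.1]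
        intro a
        simp only [List.mem_filter, decide_eq_true_eq]
        constructor
        · rintro ⟨ha, hg⟩; exact hmg a ha hg
        · intro ha
          refine ⟨hp.symm.subset (by rw [List.flatten_cons, List.mem_append]; exact Or.inr ha), fun hg => ?_⟩
          exact (List.nodup_append.1 hgnd).2.2 a hg a ha rfl)
      (by
        intro a b hab hba
        rw [eQ, bf_filter] at hab
        exact h1 a b hab.1 (by rw [List.flatten_cons, bf_append]; exact Or.inr (Or.inl hba)))
      (by
        intro f hf a ha b hb hab hba
        rw [eQ, bf_filter] at hab
        obtain ⟨f, hf2, rfl⟩ := List.mem_map.1 hf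
        exact h2 f hf2 a (List.mem_filter.1 ha).1 b (List.mem_filter.1 hb).1 hab.1 (by rw [List.flatten_cons, bf_append]; exact Or.inr (Or.inl hba)))
      (by
        intro f hf a ha b hb hab hba
        rw [eQ, bf_filter] at hab
        exact h3 f (by simp [hf]) a ha b hb hab.1 (by rw [List.flatten_cons, bf_append]; exact Or.inr (Or.inl hba)))
    rw [List.length_map, List.map_map] at s4
    have := (s1.trans s2).trans (s3.app s4)
    rw [List.map_cons, List.flatten_cons, List.length_cons]
    exact this.mono (by ring_nf; omega)

theorem contig (m : List α) (hm : m.Nodup) (P : α → Prop)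
    (hP : ∀ a z b, P a → P b → bf m a z → bf m z b → P z) :
    ∃ m1 m2 m3, m = m1 ++ m2 ++ m3 ∧ (∀ a ∈ m1, ¬ P a) ∧ (∀ a ∈ m2, P a) ∧ ∀ a ∈ m3, ¬ P a := by
  induction m with
  | nil => exact ⟨[], [], [], rfl, by simp, by simp, by simp⟩
  | cons c m ih =>
    rw [List.nodup_cons] at hm
    obtain ⟨m1, m2, m3, rfl, h1, h2, h3⟩ := ih hm.2
      (fun a z b ha hb h h' => hP a z b ha hb (Or.inr h) (Or.inr h'))
    by_cases hc : P c
    · by_cases hm2 : m2 = []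
      · subst hm2
        refine ⟨[], [c], m1 ++ m3, by simp, by simp, by simpa using hc, ?_⟩
        intro a ha
        rcases List.mem_append.1 ha with ha | ha
        · exact h1 a ha
        · exact h3 a ha
      · obtain ⟨b, hb⟩ := List.exists_mem_of_ne_nil _ hm2
        have hm1 : m1 = [] := by
          by_contra hne
          obtain ⟨a, ha⟩ := List.exists_mem_of_ne_nil _ hne
          refine h1 a ha (hP c a b hc (h2 b hb) (Or.inl ⟨rfl, by simp [ha]⟩) (Or.inr ?_))
          rw [bf_append, bf_append]; left; right; right; exact ⟨ha, hb⟩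
        subst hm1
        refine ⟨[], c :: m2, m3, by simp, by simp, ?_, h3⟩
        intro a ha
        rcases List.mem_cons.1 ha with rfl | ha
        · exact hc
        · exact h2 a ha
    · refine ⟨c :: m1, m2, m3, by simp, ?_, h2, h3⟩
      intro a ha
      rcases List.mem_cons.1 ha with rfl | ha
      · exact hc
      · exact h1 a ha
end bs

section prod
variable {α : Type v} {R A : Type u} {S : Set R} {T : α → Set R} {x y : List α}

theorem bf_left (hn : (x ++ y).Nodup) {a b : α} (hb : b ∈ x) (h : bf (x ++ y) a b) : bf x a b := by
  have hd := (List.nodup_append.1 hn).2.2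
  rcases bf_append.1 h with h | h | h
  · exact h
  · exact absurd rfl (hd b hb b h.right)
  · exact absurd rfl (hd b hb b h.2)

theorem bf_right (hn : (x ++ y).Nodup) {a b : α} (ha : a ∈ y) (h : bf (x ++ y) a b) : bf y a b := by
  have hd := (List.nodup_append.1 hn).2.2
  rcases bf_append.1 h with h | h | h
  · exact absurd rfl (hd a h.left a ha)
  · exact h
  · exact absurd rfl (hd a h.1 a ha)

theorem pr_left (hn : (x ++ y).Nodup) {a b : α} (hb : b ∈ x) (h : pr T (x ++ y) a b) : pr T x a b := by
  revert hb
  induction h with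
  | single h => intro hb; exact pr.of (bf_left hn hb h.1) h.2
  | tail _ h ih =>
    intro hb
    have := bf_left hn hb h.1
    exact (ih this.left).trans (pr.of this h.2)

theorem pr_app_left {a b : α} (h : pr T x a b) : pr T (x ++ y) a b := by
  induction h with
  | single h => exact pr.of (bf_append.2 (Or.inl h.1)) h.2
  | tail _ h ih => exact ih.trans (pr.of (bf_append.2 (Or.inl h.1)) h.2)

theorem pr_app_right {a b : α} (h : pr T y a b) : pr T (x ++ y) a b := by
  induction h with
  | single h => exact pr.of (bf_append.2 (Or.inr (Or.inl h.1))) h.2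
  | tail _ h ih => exact ih.trans (pr.of (bf_append.2 (Or.inr (Or.inl h.1))) h.2)

theorem nodup_rev_app (hn : (x ++ y).Nodup) : (y.reverse ++ x.reverse).Nodup := by
  rw [← List.reverse_append]; exact List.nodup_reverse.2 hn

theorem pr_right (hn : (x ++ y).Nodup) {a b : α} (ha : a ∈ y) (h : pr T (x ++ y) a b) : pr T y a b := by
  rw [← pr_reverse, List.reverse_append] at h
  exact pr_reverse.1 (pr_left (nodup_rev_app hn) (by simpa using ha) h)

theorem sep_app_left {a b : α} (h : sep S T x a b) : sep S T (x ++ y) a b := by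
  obtain ⟨h1, h2, z, h3, h4, h5⟩ := h
  exact ⟨h1, h2, z, bf_append.2 (Or.inl h3), bf_append.2 (Or.inl h4), h5⟩

theorem sep_left (hn : (x ++ y).Nodup) {a b : α} (hb : b ∈ x) (h : sep S T (x ++ y) a b) : sep S T x a b := by
  obtain ⟨h1, h2, z, h3, h4, h5⟩ := h
  have h4' := bf_left hn hb h4
  exact ⟨h1, h2, z, bf_left hn h4'.left h3, h4', h5⟩

theorem sep_right (hn : (x ++ y).Nodup) {a b : α} (ha : a ∈ y) (h : sep S T (x ++ y) a b) : sep S T y a b := by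
  rw [← sep_reverse, List.reverse_append] at h
  exact sep_reverse.1 (sep_left (nodup_rev_app hn) (by simpa using ha) h)

theorem n1_filter (hn : (x ++ y).Nodup) {a b0 : α} (ha : a ∈ x) (h0 : sep S T x a b0) :
    (x ++ y).filter (fun b => decide (sm S T (x ++ y) a b)) = x.filter (fun b => decide (sm S T x a b)) := by
  rw [List.filter_append]
  have e1 : y.filter (fun b => decide (sm S T (x ++ y) a b)) = [] := by
    rw [List.filter_eq_nil_iff]
    intro c hc
    simp only [decide_eq_true_eq]
    rintro ⟨h1, h2, _⟩
    obtain ⟨h3, h4, z, h5, h6, h7⟩ := h0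
    exact h2 ⟨h3, h1, z, bf_append.2 (Or.inl h5), bf_append.2 (Or.inr (Or.inr ⟨h6.left, hc⟩)), h7⟩
  rw [e1, List.append_nil]
  refine List.filter_congr fun c hc => ?_
  rw [decide_eq_decide]
  unfold sm
  have : ∀ p q, q ∈ x → (sep S T (x ++ y) p q ↔ sep S T x p q) := fun p q hq =>
    ⟨sep_left hn hq, sep_app_left⟩
  rw [this a c hc, this c a ha]

theorem n1_Gm (hn : (x ++ y).Nodup) {a : α} (ha : a ∈ x) : Gm S T (x ++ y) a = Gm S T x a := by
  have hnx := (List.nodup_append.1 hn).1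
  ext s
  constructor
  · rintro ⟨h1, w, h2, h3, h4⟩
    have h3' := pr_left hn ha h3
    exact ⟨h1, w, h2, h3', fun b hb => pr_left hn (h3'.bf hnx).left (h4 b (sep_app_left hb))⟩
  · rintro ⟨h1, w, h2, h3, h4⟩
    exact ⟨h1, w, h2, pr_app_left h3, fun b hb => pr_app_left (h4 b (sep_left hn ha hb))⟩

theorem n1_Gp (hn : (x ++ y).Nodup) (hS : S.Nonempty) {a b0 : α} (ha : a ∈ x) (h0 : sep S T x a b0) :
    Gm S T (x ++ y).reverse a = Gm S T x.reverse a := by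
  have hnx := (List.nodup_append.1 hn).1
  have hb0 : b0 ∈ x := (h0.pr.bf hnx).right
  ext s
  unfold Gm
  simp only [pr_reverse, sep_reverse, Set.mem_ofPred_eq]
  constructor
  · rintro ⟨h1, w, h2, h3, h4⟩
    have hw : pr T x w b0 := pr_left hn hb0 (h4 b0 (sep_app_left h0))
    refine ⟨h1, w, h2, pr_left hn (hw.bf hnx).left h3, fun b hb => ?_⟩
    exact pr_left hn (hb.pr.bf hnx).right (h4 b (sep_app_left hb))
  · rintro ⟨h1, w, h2, h3, h4⟩
    refine ⟨h1, w, h2, pr_app_left h3, fun b hb => ?_⟩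
    have hbm := (hb.pr.bf hn).right
    rcases List.mem_append.1 hbm with hbx | hby
    · exact pr_app_left (h4 b (sep_left hn hbx hb))
    · exact (pr_app_left (h4 b0 h0)).trans (pr.of (bf_append.2 (Or.inr (Or.inr ⟨hb0, hby⟩))) (dp_S hS h0.2.1 hb.2.1))

variable [Nonempty R] {ori : List A → Bool} {lab : α → A}

theorem n1_cont (hn : (x ++ y).Nodup) {a b0 : α} (ha : a ∈ x) (h0 : sep S T x a b0) :
    cont S T lab (x ++ y) a = cont S T lab x a := by
  unfold cont; rw [n1_filter hn ha h0]

theorem n2_cont (hn : (x ++ y).Nodup) {a b0 : α} (ha : a ∈ y) (h0 : sep S T y b0 a) :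
    cont S T lab (x ++ y) a = cont S T lab y a := by
  have := n1_filter (S := S) (T := T) (nodup_rev_app hn) (by simpa using ha) (sep_reverse.2 h0)
  rw [← List.reverse_append] at this
  simp only [sm_reverse, List.filter_reverse] at this
  unfold cont; rw [List.reverse_injective this]

theorem n1_sc (hn : (x ++ y).Nodup) (hS : S.Nonempty) {a b0 : α} (ha : a ∈ x) (h0 : sep S T x a b0) :
    sc ori S T lab (x ++ y) a = sc ori S T lab x a := by
  unfold sc; rw [n1_cont hn ha h0, n1_Gm hn ha, n1_Gp hn hS ha h0]

theorem n2_sc (hn : (x ++ y).Nodup) (hS : S.Nonempty) {a b0 : α} (ha : a ∈ y) (h0 : sep S T y b0 a) :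
    sc ori S T lab (x ++ y) a = sc ori S T lab y a := by
  have hr := nodup_rev_app hn
  have har : a ∈ y.reverse := by simpa using ha
  have e1 := n1_Gm (S := S) (T := T) hr har
  have e2 := n1_Gp (S := S) (T := T) hr hS har (sep_reverse.2 h0)
  rw [← List.reverse_append] at e1 e2
  simp only [List.reverse_reverse] at e2
  unfold sc; rw [n2_cont hn ha h0, e1, e2]

/-- exceptional letters -/
def exc (S : Set R) (T : α → Set R) (x y : List α) (a : α) : Prop :=
  (a ∈ x ∧ T a = S ∧ ¬ ∃ b, sep S T x a b) ∨ (a ∈ y ∧ T a = S ∧ ¬ ∃ b, sep S T y b a)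

theorem not_exc_left {a : α} (ha : a ∈ x) (hS : T a = S) (h : ¬ exc S T x y a) : ∃ b, sep S T x a b := by
  by_contra hc; exact h (Or.inl ⟨ha, hS, hc⟩)

theorem not_exc_right {a : α} (ha : a ∈ y) (hS : T a = S) (h : ¬ exc S T x y a) : ∃ b, sep S T y b a := by
  by_contra hc; exact h (Or.inr ⟨ha, hS, hc⟩)

theorem nT_left (hn : (x ++ y).Nodup) (hS : S.Nonempty) {a : α} (ha : a ∈ x) (h : ¬ exc S T x y a) :
    nT ori S T lab (x ++ y) a = nT ori S T lab x a := by
  unfold nT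
  by_cases hT : T a = S
  · obtain ⟨b, hb⟩ := not_exc_left ha hT h
    rw [if_pos ⟨by simp [ha], hT⟩, if_pos ⟨ha, hT⟩, n1_sc hn hS ha hb]
  · rw [if_neg (fun h => hT h.2), if_neg (fun h => hT h.2)]

theorem nT_right (hn : (x ++ y).Nodup) (hS : S.Nonempty) {a : α} (ha : a ∈ y) (h : ¬ exc S T x y a) :
    nT ori S T lab (x ++ y) a = nT ori S T lab y a := by
  unfold nT
  by_cases hT : T a = S
  · obtain ⟨b, hb⟩ := not_exc_right ha hT h
    rw [if_pos ⟨by simp [ha], hT⟩, if_pos ⟨ha, hT⟩, n2_sc hn hS ha hb]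
  · rw [if_neg (fun h => hT h.2), if_neg (fun h => hT h.2)]

theorem Good.pr_bf {l l' : List α} (hl : l.Nodup) (h : Good ori S T lab l l') {a b : α} (hp : pr T l a b) : bf l' a b := by
  have hl' : l'.Nodup := h.perm.nodup_iff.1 hl
  induction hp with
  | single h1 => exact h.ord _ _ h1.2 h1.1
  | tail _ h1 ih => exact ih.trans hl' (h.ord _ _ h1.2 h1.1)

theorem Good.bf_back {l l' : List α} (hl : l.Nodup) (h : Good ori S T lab l l') {a b : α} (hd : dp T a b)
    (hb : bf l' a b) : bf l a b := by
  have hl' : l'.Nodup := h.perm.nodup_iff.1 hl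
  rcases bf_total (h.perm.mem_iff.2 hb.left) (h.perm.mem_iff.2 hb.right) (hb.ne hl') with h1 | h1
  · exact h1
  · exact absurd (h.ord _ _ hd.symm h1) (hb.asymm hl')

/-- comparing a part `p` with the whole `z` -/
theorem core_part (hS : S.Nonempty) {p p' z z' : List α} (hp : p.Nodup) (hz : z.Nodup) (hsub : ∀ a ∈ p, a ∈ z)
    (hgp : Good ori S T lab p p') (hgz : Good ori S T lab z z')
    (hpr : ∀ a b, a ∈ p → b ∈ p → (pr T z a b ↔ pr T p a b)) {a b : α} (ha : a ∈ p) (hb : b ∈ p)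
    (hndp : ¬ dp T a b)
    (hca : T a = S → cont S T lab z a = cont S T lab p a ∧ sc ori S T lab z a = sc ori S T lab p a)
    (hcb : T b = S → cont S T lab z b = cont S T lab p b ∧ sc ori S T lab z b = sc ori S T lab p b)
    (hd : dp (nT ori S T lab z) a b) (hab : bf p' a b) : bf z' a b := by
  have hp' : p'.Nodup := hgp.perm.nodup_iff.1 hp
  have tot := bf_total (hgz.perm.subset (hsub a ha)) (hgz.perm.subset (hsub b hb)) (hab.ne hp')
  obtain ⟨r, hr1, hr2⟩ := hd
  unfold nT at hr1 hr2
  by_cases hA : T a = S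
  · by_cases hB : T b = S
    · exact absurd (dp_S hS hA hB) hndp
    rw [if_pos ⟨hsub a ha, hA⟩] at hr1
    rw [if_neg (fun h => hB h.2)] at hr2
    obtain ⟨e1, e2⟩ := hca hA
    rcases hr1 with rfl | hr1
    · cases hori : ori (cont S T lab z a) with
      | true =>
        rcases tot with h1 | h1
        · exact h1
        · have := (hpr b a hb ha).1 (hgz.lft a b (hsub a ha) hA hori hr2 h1)
          exact absurd (hgp.pr_bf hp this) (hab.asymm hp')
      | false =>
        rw [e2] at hr2; rw [e1] at hori
        exact hgz.pr_bf hz ((hpr a b ha hb).2 (hgp.rgt a b ha hA hori hr2 hab))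
    · exact absurd ⟨r, by rw [hA]; exact hr1, hr2⟩ hndp
  · rw [if_neg (fun h => hA h.2)] at hr1
    by_cases hB : T b = S
    · rw [if_pos ⟨hsub b hb, hB⟩] at hr2
      obtain ⟨e1, e2⟩ := hcb hB
      rcases hr2 with rfl | hr2
      · cases hori : ori (cont S T lab z b) with
        | true =>
          rw [e2] at hr1; rw [e1] at hori
          exact hgz.pr_bf hz ((hpr a b ha hb).2 (hgp.lft b a hb hB hori hr1 hab))
        | false =>
          rcases tot with h1 | h1
          · exact h1
          · have := (hpr b a hb ha).1 (hgz.rgt b a (hsub b hb) hB hori hr1 h1)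
            exact absurd (hgp.pr_bf hp this) (hab.asymm hp')
      · exact absurd ⟨r, hr1, by rw [hB]; exact hr2⟩ hndp
    · rw [if_neg (fun h => hB h.2)] at hr2
      exact absurd ⟨r, hr1, hr2⟩ hndp

theorem core_dp (hn : (x ++ y).Nodup) {x' y' z' : List α}
    (hgx : Good ori S T lab x x') (hgy : Good ori S T lab y y') (hgz : Good ori S T lab (x ++ y) z')
    {a b : α} (hd : dp T a b) (hab : bf (x' ++ y') a b) : bf z' a b := by
  have hnx := (List.nodup_append.1 hn).1
  have hny := (List.nodup_append.1 hn).2.1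
  refine hgz.ord a b hd ?_
  rw [bf_append] at hab ⊢
  rcases hab with h | h | h
  · exact Or.inl (hgx.bf_back hnx hd h)
  · exact Or.inr (Or.inl (hgy.bf_back hny hd h))
  · exact Or.inr (Or.inr ⟨hgx.perm.mem_iff.2 h.1, hgy.perm.mem_iff.2 h.2⟩)

theorem core (hn : (x ++ y).Nodup) (hS : S.Nonempty) (hSu : S ≠ Set.univ)
    (hmin : ∀ z ∈ x ++ y, T z ⊆ S → T z = S) {x' y' z' : List α}
    (hgx : Good ori S T lab x x') (hgy : Good ori S T lab y y') (hgz : Good ori S T lab (x ++ y) z')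
    {a b : α} (hea : ¬ exc S T x y a) (heb : ¬ exc S T x y b)
    (hd : dp (nT ori S T lab (x ++ y)) a b) (hab : bf (x' ++ y') a b) : bf z' a b := by
  have hnx := (List.nodup_append.1 hn).1
  have hny := (List.nodup_append.1 hn).2.1
  by_cases hdT : dp T a b
  · exact core_dp hn hgx hgy hgz hdT hab
  have hca : ∀ a, ¬ exc S T x y a → a ∈ x → T a = S → cont S T lab (x ++ y) a = cont S T lab x a ∧
      sc ori S T lab (x ++ y) a = sc ori S T lab x a := by
    intro a he ha hT
    obtain ⟨b, hb⟩ := not_exc_left ha hT he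
    exact ⟨n1_cont hn ha hb, n1_sc hn hS ha hb⟩
  have hcb : ∀ a, ¬ exc S T x y a → a ∈ y → T a = S → cont S T lab (x ++ y) a = cont S T lab y a ∧
      sc ori S T lab (x ++ y) a = sc ori S T lab y a := by
    intro a he ha hT
    obtain ⟨b, hb⟩ := not_exc_right ha hT he
    exact ⟨n2_cont hn ha hb, n2_sc hn hS ha hb⟩
  rcases bf_append.1 hab with h | h | ⟨h1, h2⟩
  · have ha := hgx.perm.mem_iff.2 h.left
    have hb := hgx.perm.mem_iff.2 h.right
    exact core_part hS hnx hn (fun a h => by simp [h]) hgx hgz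
      (fun a b _ hb => ⟨pr_left hn hb, pr_app_left⟩) ha hb hdT (hca a hea ha) (hca b heb hb) hd h
  · have ha := hgy.perm.mem_iff.2 h.left
    have hb := hgy.perm.mem_iff.2 h.right
    exact core_part hS hny hn (fun a h => by simp [h]) hgy hgz
      (fun a b ha _ => ⟨pr_right hn ha, pr_app_right⟩) ha hb hdT (hcb a hea ha) (hcb b heb hb) hd h
  · have ha := hgx.perm.mem_iff.2 h1
    have hb := hgy.perm.mem_iff.2 h2
    have hza : a ∈ x ++ y := by simp [ha]
    have hzb : b ∈ x ++ y := by simp [hb]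
    have hab' : bf (x ++ y) a b := bf_append.2 (Or.inr (Or.inr ⟨ha, hb⟩))
    have hnba : ¬ pr T (x ++ y) b a := fun h => (h.bf hn).asymm hn hab'
    rcases bf_total (hgz.perm.subset hza) (hgz.perm.subset hzb) (hab'.ne hn) with h | hcon
    · exact h
    obtain ⟨r, hr1, hr2⟩ := hd
    unfold nT at hr1 hr2
    by_cases hA : T a = S
    · by_cases hB : T b = S
      · exact absurd (dp_S hS hA hB) hdT
      rw [if_pos ⟨hza, hA⟩] at hr1
      rw [if_neg (fun h => hB h.2)] at hr2
      rcases hr1 with rfl | hr1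
      · cases hori : ori (cont S T lab (x ++ y) a) with
        | true => exact absurd (hgz.lft a b hza hA hori hr2 hcon) hnba
        | false =>
          obtain ⟨b0, hb0⟩ := not_exc_left ha hA hea
          obtain ⟨e1, e2⟩ := hca a hea ha hA
          rw [e2] at hr2
          rw [e1] at hori
          have hne : (Gm S T x.reverse a).Nonempty :=
            Gm_nonempty (by simpa using hnx) hS (fun z hz => hmin z (by
              simp only [List.mem_reverse] at hz; simp [hz])) (sep_reverse.2 hb0)
          unfold sc at hr2
          rw [hori, if_neg (by simp)] at hr2
          obtain ⟨_, w, h3, h4, _⟩ := pick_mem (S := S) hne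
          rw [pr_reverse] at h4
          exact hgz.pr_bf hn ((pr_app_left h4).trans (pr.of (bf_append.2 (Or.inr (Or.inr ⟨(h4.bf hnx).right, hb⟩))) ⟨_, h3, hr2⟩))
      · exact absurd ⟨r, by rw [hA]; exact hr1, hr2⟩ hdT
    · rw [if_neg (fun h => hA h.2)] at hr1
      by_cases hB : T b = S
      · rw [if_pos ⟨hzb, hB⟩] at hr2
        rcases hr2 with rfl | hr2
        · cases hori : ori (cont S T lab (x ++ y) b) with
          | false => exact absurd (hgz.rgt b a hzb hB hori hr1 hcon) hnba
          | true =>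
            obtain ⟨b0, hb0⟩ := not_exc_right hb hB heb
            obtain ⟨e1, e2⟩ := hcb b heb hb hB
            rw [e2] at hr1
            rw [e1] at hori
            have hne : (Gm S T y b).Nonempty :=
              Gm_nonempty hny hS (fun z hz => hmin z (by simp [hz])) hb0
            unfold sc at hr1
            rw [if_pos hori] at hr1
            obtain ⟨_, w, h3, h4, _⟩ := pick_mem (S := S) hne
            exact hgz.pr_bf hn ((pr.of (bf_append.2 (Or.inr (Or.inr ⟨ha, (h4.bf hny).left⟩))) ⟨_, hr1, h3⟩).trans (pr_app_right h4))
        · exact absurd ⟨r, hr1, by rw [hB]; exact hr2⟩ hdT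
      · rw [if_neg (fun h => hB h.2)] at hr2
        exact absurd ⟨r, hr1, hr2⟩ hdT

theorem Good.between {l l' : List α} (hl : l.Nodup) (hS : S.Nonempty) (h : Good ori S T lab l l') {a b c : α} (ha : T a = S)
    (hs : sm S T l a b) (h1 : bf l' a c) (h2 : bf l' c b) : T c = S ∧ bf l a c ∧ bf l c b := by
  have hc := h.run a b c ha hs h1 h2
  exact ⟨hc, h.bf_back hl (dp_S hS ha hc) h1, h.bf_back hl (dp_S hS hc hs.1) h2⟩

/-- last run of `x` -/
def lastR (S : Set R) (T : α → Set R) (x : List α) (a : α) : Prop := a ∈ x ∧ T a = S ∧ ¬ ∃ b, sep S T x a b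
def firstR (S : Set R) (T : α → Set R) (x : List α) (a : α) : Prop := a ∈ x ∧ T a = S ∧ ¬ ∃ b, sep S T x b a

theorem lastR_convex (hn : (x ++ y).Nodup) (hS : S.Nonempty) {z' : List α} (hgz : Good ori S T lab (x ++ y) z') :
    ∀ a c b, lastR S T x a → lastR S T x b → bf z' a c → bf z' c b → lastR S T x c := by
  rintro a c b ⟨ha, hTa, hna⟩ ⟨hb, hTb, hnb⟩ h1 h2
  have hs : sm S T (x ++ y) a b := ⟨hTb, fun h => hna ⟨b, sep_left hn hb h⟩, fun h => hnb ⟨a, sep_left hn ha h⟩⟩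
  obtain ⟨h3, h4, h5⟩ := hgz.between hn hS hTa hs h1 h2
  have h5' := bf_left hn hb h5
  have h4' := bf_left hn h5'.left h4
  refine ⟨h5'.left, h3, ?_⟩
  rintro ⟨d, _, h6, w, h7, h8⟩
  exact hna ⟨d, hTa, h6, w, h4'.trans (List.nodup_append.1 hn).1 h7, h8⟩

theorem firstR_convex (hn : (x ++ y).Nodup) (hS : S.Nonempty) {z' : List α} (hgz : Good ori S T lab (x ++ y) z') :
    ∀ a c b, firstR S T y a → firstR S T y b → bf z' a c → bf z' c b → firstR S T y c := by
  rintro a c b ⟨ha, hTa, hna⟩ ⟨hb, hTb, hnb⟩ h1 h2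
  have hs : sm S T (x ++ y) a b := ⟨hTb, fun h => hnb ⟨a, sep_right hn ha h⟩, fun h => hna ⟨b, sep_right hn hb h⟩⟩
  obtain ⟨h3, h4, h5⟩ := hgz.between hn hS hTa hs h1 h2
  have h4' := bf_right hn ha h4
  have h5' := bf_right hn h4'.right h5
  refine ⟨h4'.right, h3, ?_⟩
  rintro ⟨d, h6, _, w, h7, h8, h9⟩
  exact hnb ⟨d, h6, hTb, w, h7, h8.trans (List.nodup_append.1 hn).2.1 h5', h9⟩

end prod

section prodthm
variable {R A : Type u} [Nonempty R] {ori : List A → Bool}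

theorem lin_congr {α : Type v} {Ss : List (Set R)} (hO : OKS Ss) {l : List α} (hl : l.Nodup) {T T2 : α → Set R} {lab : α → A}
    (hv : Val Ss T l) (h : ∀ a ∈ l, T2 a = T a) : lin ori Ss T2 lab l = lin ori Ss T lab l := by
  have := lin_iso (ori := ori) (e := id) (m := l) (T2 := T2) (lab2 := lab) (lab := lab) hO
    ⟨hl, fun _ _ _ _ h => h, by simp, h, fun _ _ => rfl, fun _ _ _ h => h⟩ hv
  simpa using this

theorem lin_te {α : Type v} {Ss : List (Set R)} (hO : OKS Ss) {l m : List α} (hl : l.Nodup) {T : α → Set R} {lab : α → A}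
    (hv : Val Ss T l) (hp : l.Perm m) (h : ∀ a b, bf l a b → bf m b a → ¬ dp T a b) :
    lin ori Ss T lab l = lin ori Ss T lab m := by
  have := lin_iso (ori := ori) (e := id) (m := m) (T2 := T) (lab2 := lab) (lab := lab) hO
    ⟨hl, fun _ _ _ _ h => h, by simpa using hp, fun _ _ => rfl, fun _ _ => rfl, fun a b hd hab => by
      rcases bf_total (hp.subset hab.left) (hp.subset hab.right) (hab.ne hl) with h1 | h1
      · exact h1
      · exact absurd hd (h a b hab h1)⟩ hv
  simpa using this.symm

theorem lin_prod {Ss : List (Set R)} (hO : OKS Ss) : ∃ K : ℕ, ∀ (α : Type v) (T T0 : α → Set R) (lab : α → A)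
    (x y : List α), (x ++ y).Nodup → Val Ss T (x ++ y) → (∀ a, T0 a ⊆ T a) →
    BS (fun a b => ¬ dp T0 a b) K (lin ori Ss T lab x ++ lin ori Ss T lab y) (lin ori Ss T lab (x ++ y)) := by
  induction Ss with
  | nil => exact ⟨0, fun α T T0 lab x y _ _ _ => BS.refl _ _⟩
  | cons S Ss ih =>
    obtain ⟨K, ih⟩ := ih hO.2.2.2.2
    refine ⟨3 * K + 3 * K + 7 * (6 * K + 6 + 6 * K) + 7 * K, ?_⟩
    intro α T T0 lab x y hn hv hT
    have hnx := (List.nodup_append.1 hn).1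
    have hny := (List.nodup_append.1 hn).2.1
    have hS := hO.1
    have hSu := hO.2.1
    have hO' := hO.2.2.2.2
    have hvx : Val (S :: Ss) T x := hv.sub (by simp +contextual)
    have hvy : Val (S :: Ss) T y := hv.sub (by simp +contextual)
    have hmin := hv.min hO
    have hgx : Good ori S T lab x _ := st_good hnx hS hSu (hvx.min hO)
    have hgy : Good ori S T lab y _ := st_good hny hS hSu (hvy.min hO)
    have hgz : Good ori S T lab (x ++ y) _ := st_good hn hS hSu hmin
    set x' := st ori S T lab x with hx'
    set y' := st ori S T lab y with hy'
    set z' := st ori S T lab (x ++ y) with hz'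
    set Tx := nT ori S T lab x with hTx
    set Ty := nT ori S T lab y with hTy
    set Tz := nT ori S T lab (x ++ y) with hTz
    have hI : ∀ a b, ¬ dp T0 a b → ¬ dp T0 b a := fun a b h h' => h h'.symm
    have hpz : (x' ++ y').Perm z' := (hgx.perm.symm.append hgy.perm.symm).trans hgz.perm
    have hnz' : z'.Nodup := hgz.perm.nodup_iff.1 hn
    have hnxy : (x' ++ y').Nodup := hpz.nodup_iff.2 hnz'
    have hnx' := (List.nodup_append.1 hnxy).1
    have hny' := (List.nodup_append.1 hnxy).2.1
    have hvTx : Val Ss Tx x' := hvx.next' hO (fun a ha => st_perm.mem_iff.2 ha)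
    have hvTy : Val Ss Ty y' := hvy.next' hO (fun a ha => st_perm.mem_iff.2 ha)
    have hvTz : Val Ss Tz (x ++ y) := hv.next' hO (fun a ha => ha)
    have mx : ∀ a ∈ x', a ∈ x := fun a ha => hgx.perm.mem_iff.2 ha
    have my : ∀ a ∈ y', a ∈ y := fun a ha => hgy.perm.mem_iff.2 ha
    have mz : ∀ a ∈ z', a ∈ x ++ y := fun a ha => hgz.perm.mem_iff.2 ha
    -- factorizations
    obtain ⟨a0, a1, a2, ex, hx0, hx1, hx2⟩ := contig x' hnx' (lastR S T x)
      (lastR_convex (x := x) (y := []) (by simpa using hnx) hS (by simpa using hgx))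
    obtain ⟨b0, b1, b2, ey, hy0, hy1, hy2⟩ := contig y' hny' (firstR S T y)
      (firstR_convex (x := []) (y := y) (by simpa using hny) hS (by simpa using hgy))
    obtain ⟨c0, c1, c2, ez, hz0, hz1, hz2⟩ := contig z' hnz' (lastR S T x) (lastR_convex hn hS hgz)
    have hconv := firstR_convex hn hS hgz
    have hnz3 : (c0 ++ c1 ++ c2).Nodup := ez ▸ hnz'
    have hnc0 : c0.Nodup := (List.nodup_append.1 (List.nodup_append.1 hnz3).1).1
    have hnc2 : c2.Nodup := (List.nodup_append.1 hnz3).2.1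
    obtain ⟨d0, d1, d2, ed, hd0, hd1, hd2⟩ := contig c0 hnc0 (firstR S T y)
      (fun a c b ha hb h h' => hconv a c b ha hb
        (by rw [ez, bf_append, bf_append]; exact Or.inl (Or.inl h)) (by rw [ez, bf_append, bf_append]; exact Or.inl (Or.inl h')))
    obtain ⟨e0, e1, e2, ee, he0, he1, he2⟩ := contig c2 hnc2 (firstR S T y)
      (fun a c b ha hb h h' => hconv a c b ha hb
        (by rw [ez, bf_append]; exact Or.inr (Or.inl h)) (by rw [ez, bf_append]; exact Or.inr (Or.inl h')))
    have hndisj : ∀ a, a ∈ x → a ∈ y → False := fun a ha hb => (List.nodup_append.1 hn).2.2 a ha a hb rfl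
    -- classification of factors
    let cls : List α → Prop := fun f => (∀ a ∈ f, T a = S) ∨ (∀ a ∈ f, ¬ exc S T x y a)
    have clsx0 : ∀ f : List α, (∀ a ∈ f, a ∈ x) → (∀ a ∈ f, ¬ lastR S T x a) → ∀ a ∈ f, ¬ exc S T x y a := by
      intro f h1 h2 a ha h
      rcases h with h | h
      · exact h2 a ha h
      · exact hndisj a (h1 a ha) h.1
    have clsy0 : ∀ f : List α, (∀ a ∈ f, a ∈ y) → (∀ a ∈ f, ¬ firstR S T y a) → ∀ a ∈ f, ¬ exc S T x y a := by
      intro f h1 h2 a ha h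
      rcases h with h | h
      · exact hndisj a h.1 (h1 a ha)
      · exact h2 a ha h
    have clsz0 : ∀ f : List α, (∀ a ∈ f, ¬ lastR S T x a) → (∀ a ∈ f, ¬ firstR S T y a) → ∀ a ∈ f, ¬ exc S T x y a := by
      intro f h1 h2 a ha h
      rcases h with h | h
      · exact h1 a ha h
      · exact h2 a ha h
    let fsx : List (List α) := [a0, a1, a2]
    let fsy : List (List α) := [b0, b1, b2]
    let gs : List (List α) := [d0, d1, d2, c1, e0, e1, e2]
    have efx : fsx.flatten = x' := by simp [fsx, ex]
    have efy : fsy.flatten = y' := by simp [fsy, ey]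
    have efz : gs.flatten = z' := by simp [gs, ez, ed, ee]
    have efs : (fsx ++ fsy).flatten = x' ++ y' := by rw [List.flatten_append, efx, efy]
    have hmfx : ∀ f ∈ fsx, ∀ a ∈ f, a ∈ x' := fun f hf a ha => by
      rw [← efx]; exact List.mem_flatten.2 ⟨f, hf, ha⟩
    have hmfy : ∀ f ∈ fsy, ∀ a ∈ f, a ∈ y' := fun f hf a ha => by
      rw [← efy]; exact List.mem_flatten.2 ⟨f, hf, ha⟩
    have cx : ∀ f ∈ fsx, cls f := by
      intro f hf
      have hm := hmfx f hf
      simp only [fsx, List.mem_cons, List.not_mem_nil, or_false] at hf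
      rcases hf with rfl | rfl | rfl
      · exact Or.inr (clsx0 _ (fun a ha => mx a (hm a ha)) hx0)
      · exact Or.inl (fun a ha => (hx1 a ha).2.1)
      · exact Or.inr (clsx0 _ (fun a ha => mx a (hm a ha)) hx2)
    have cy : ∀ f ∈ fsy, cls f := by
      intro f hf
      have hm := hmfy f hf
      simp only [fsy, List.mem_cons, List.not_mem_nil, or_false] at hf
      rcases hf with rfl | rfl | rfl
      · exact Or.inr (clsy0 _ (fun a ha => my a (hm a ha)) hy0)
      · exact Or.inl (fun a ha => (hy1 a ha).2.1)
      · exact Or.inr (clsy0 _ (fun a ha => my a (hm a ha)) hy2)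
    have cz : ∀ f ∈ gs, cls f := by
      intro f hf
      simp only [gs, List.mem_cons, List.not_mem_nil, or_false] at hf
      rcases hf with rfl | rfl | rfl | rfl | rfl | rfl | rfl
      · exact Or.inr (clsz0 _ (fun a ha => hz0 a (by simp [ed, ha])) hd0)
      · exact Or.inl (fun a ha => (hd1 a ha).2.1)
      · exact Or.inr (clsz0 _ (fun a ha => hz0 a (by simp [ed, ha])) hd2)
      · exact Or.inl (fun a ha => (hz1 a ha).2.1)
      · exact Or.inr (clsz0 _ (fun a ha => hz2 a (by simp [ee, ha])) he0)
      · exact Or.inl (fun a ha => (he1 a ha).2.1)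
      · exact Or.inr (clsz0 _ (fun a ha => hz2 a (by simp [ee, ha])) he2)
    have hdpS : ∀ (T' : α → Set R), (∀ a, T a ⊆ T' a) → ∀ f : List α, (∀ a ∈ f, T a = S) → ∀ a ∈ f, ∀ b ∈ f, dp T' a b :=
      fun T' hT' f hf a ha b hb => dp_mono (hT' a) (hT' b) (dp_S hS (hf a ha) (hf b hb))
    have fx : ∀ f ∈ fsx, lin ori Ss Tx lab f = lin ori Ss Tz lab f := by
      intro f hf
      have hfn : f.Nodup := (List.nodup_flatten.1 (efx ▸ hnx' : fsx.flatten.Nodup)).1 f hf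
      have v1 : Val Ss Tx f := hvTx.sub (hmfx f hf)
      have v2 : Val Ss Tz f := hvTz.sub (fun a ha => by simp [mx a (hmfx f hf a ha)])
      rcases cx f hf with h | h
      · rw [lin_uniform hO' hfn v1 (hdpS Tx (fun a => nT_mono a) f h), lin_uniform hO' hfn v2 (hdpS Tz (fun a => nT_mono a) f h)]
      · exact lin_congr hO' hfn v2 (fun a ha => (nT_left hn hS (mx a (hmfx f hf a ha)) (h a ha)).symm)
    have fy : ∀ f ∈ fsy, lin ori Ss Ty lab f = lin ori Ss Tz lab f := by
      intro f hf
      have hfn : f.Nodup := (List.nodup_flatten.1 (efy ▸ hny' : fsy.flatten.Nodup)).1 f hf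
      have v1 : Val Ss Ty f := hvTy.sub (hmfy f hf)
      have v2 : Val Ss Tz f := hvTz.sub (fun a ha => by simp [my a (hmfy f hf a ha)])
      rcases cy f hf with h | h
      · rw [lin_uniform hO' hfn v1 (hdpS Ty (fun a => nT_mono a) f h), lin_uniform hO' hfn v2 (hdpS Tz (fun a => nT_mono a) f h)]
      · exact lin_congr hO' hfn v2 (fun a ha => (nT_right hn hS (my a (hmfy f hf a ha)) (h a ha)).symm)
    have hT' : ∀ (l : List α) a, T0 a ⊆ nT ori S T lab l a := fun l a => (hT a).trans (nT_mono a)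
    -- merging inequalities
    have sx := (bs_merge (B := x') (K := K) (Lf := lin ori Ss Tx lab) (I := fun a b => ¬ dp T0 a b) (fun x => lin_perm.symm)
      (fun p q hpq hB => ih α Tx T0 lab p q hpq (hvTx.sub hB) (hT' x)) fsx (efx ▸ hnx') (by rw [efx]; exact fun a h => h)).symm hI
    have sy := (bs_merge (B := y') (K := K) (Lf := lin ori Ss Ty lab) (I := fun a b => ¬ dp T0 a b) (fun x => lin_perm.symm)
      (fun p q hpq hB => ih α Ty T0 lab p q hpq (hvTy.sub hB) (hT' y)) fsy (efy ▸ hny') (by rw [efy]; exact fun a h => h)).symm hI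
    have sz := bs_merge (B := x ++ y) (K := K) (Lf := lin ori Ss Tz lab) (I := fun a b => ¬ dp T0 a b) (fun x => lin_perm.symm)
      (fun p q hpq hB => ih α Tz T0 lab p q hpq (hvTz.sub hB) (hT' (x ++ y))) gs (efz ▸ hnz') (by rw [efz]; exact mz)
    rw [List.map_congr_left fx, efx] at sx
    rw [List.map_congr_left fy, efy] at sy
    rw [efz] at sz
    have hfac : ∀ f : List α, cls f → ∀ a ∈ f, ∀ b ∈ f, bf (x' ++ y') a b → bf z' b a → ¬ dp Tz a b := by
      intro f hf a ha b hb hab hba hd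
      rcases hf with h | h
      · exact hba.asymm hnz' (core_dp hn hgx hgy hgz (dp_S hS (h a ha) (h b hb)) hab)
      · exact hba.asymm hnz' (core hn hS hSu hmin hgx hgy hgz (h a ha) (h b hb) hd hab)
    have sg := grid (I := fun a b => ¬ dp T0 a b) (K := K) (B := x ++ y) (Lf := lin ori Ss Tz lab) hI (dp Tz) (fun x => lin_perm.symm)
      (fun p q hpq hB => ih α Tz T0 lab p q hpq (hvTz.sub hB) (hT' (x ++ y)))
      (fun p q hp hB hpq h => lin_te hO' hp (hvTz.sub hB) hpq h)
      gs (fsx ++ fsy) (efs ▸ hnxy) (by rw [efs]; exact fun a ha => mz a (hpz.subset ha))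
      (by rw [efs, efz]; exact hpz)
      (by
        rw [efs, efz]
        intro a b hab hba hd
        exact hba.asymm hnz' (core_dp hn hgx hgy hgz (dp_mono (hT a) (hT b) hd) hab))
      (by
        rw [efs, efz]
        intro f hf
        refine hfac f ?_
        rcases List.mem_append.1 hf with h | h
        · exact cx f h
        · exact cy f h)
      (by
        rw [efs, efz]
        intro f hf
        exact hfac f (cz f hf))
    rw [List.map_append, List.flatten_append] at sg
    have := ((sx.app sy).trans sg).trans sz
    exact this.mono (by simp only [fsx, fsy, gs, List.length_cons, List.length_nil, List.length_append]; omega)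

end prodthm

section words

theorem BS.map {α : Type u} {β : Type v} {I : α → α → Prop} {J : β → β → Prop} (f : α → β)
    (hf : ∀ a b, I a b → J (f a) (f b)) {n : ℕ} {x y : List α} (h : BS I n x y) :
    BS J n (x.map f) (y.map f) := by
  induction h with
  | refl n x => exact BS.refl _ _
  | step h1 h2 ih =>
    refine BS.step ?_ ih
    obtain ⟨p, u, d, s, rfl, rfl, h⟩ := h1
    refine ⟨p.map f, u.map f, d.map f, s.map f, by simp, by simp, ?_⟩
    intro a ha b hb
    obtain ⟨a, ha2, rfl⟩ := List.mem_map.1 ha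
    obtain ⟨b, hb2, rfl⟩ := List.mem_map.1 hb
    exact hf _ _ (h a ha2 b hb2)

/-- trace equivalence of words -/
def TE {α : Type u} (I : α → α → Prop) (x y : List α) : Prop := ∃ n, BS I n x y

namespace TE
variable {α : Type u} {I : α → α → Prop}

theorem refl (x : List α) : TE I x x := ⟨0, BS.refl _ _⟩
theorem trans {x y z : List α} (h : TE I x y) (h' : TE I y z) : TE I x z := by
  obtain ⟨n, h⟩ := h; obtain ⟨m, h'⟩ := h'; exact ⟨_, BS.trans h h'⟩
theorem symm (hI : ∀ a b, I a b → I b a) {x y : List α} (h : TE I x y) : TE I y x := by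
  obtain ⟨n, h⟩ := h; exact ⟨n, BS.symm hI h⟩
theorem app {x y z w : List α} (h : TE I x y) (h' : TE I z w) : TE I (x ++ z) (y ++ w) := by
  obtain ⟨n, h⟩ := h; obtain ⟨m, h'⟩ := h'; exact ⟨_, BS.app h h'⟩
theorem swap (p u d s : List α) (h : ∀ a ∈ u, ∀ b ∈ d, I a b) : TE I (p ++ u ++ d ++ s) (p ++ d ++ u ++ s) :=
  ⟨1, BS.step ⟨p, u, d, s, rfl, rfl, h⟩ (BS.refl 0 _)⟩
theorem comm {u d : List α} (h : ∀ a ∈ u, ∀ b ∈ d, I a b) : TE I (u ++ d) (d ++ u) := by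
  simpa using swap [] u d [] h
theorem perm {x y : List α} (h : TE I x y) : x.Perm y := by
  obtain ⟨n, h⟩ := h
  induction h with
  | refl n x => exact List.Perm.refl _
  | step h1 h2 ih =>
    obtain ⟨p, u, d, s, rfl, rfl, h⟩ := h1
    refine List.Perm.trans ?_ ih
    simpa [List.append_assoc] using ((List.perm_append_comm (l₁ := u) (l₂ := d)).append_right s).append_left p
theorem mono {J : α → α → Prop} (hIJ : ∀ a b, I a b → J a b) {x y : List α} (h : TE I x y) : TE J x y := by
  obtain ⟨n, h⟩ := h
  exact ⟨n, by simpa using h.map id hIJ⟩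
theorem lstar {f : α → α} (hI : ∀ a b, I a b → I (f b) (f a)) {x y : List α} (h : TE I x y) :
    TE I (lstar f x) (lstar f y) := by
  obtain ⟨n, h⟩ := h
  induction h with
  | refl n x => exact refl _
  | step h1 h2 ih =>
    obtain ⟨p, u, d, s, rfl, rfl, h⟩ := h1
    refine trans ?_ ih
    simp only [lstar_append]
    have := swap (I := I) (_root_.lstar f s) (_root_.lstar f d) (_root_.lstar f u) (_root_.lstar f p) (by
      intro a ha b hb
      unfold _root_.lstar at ha hb
      simp only [List.mem_reverse, List.mem_map] at ha hb
      obtain ⟨a, ha, rfl⟩ := ha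
      obtain ⟨b, hb, rfl⟩ := hb
      exact hI _ _ (h b hb a ha))
    simpa [List.append_assoc] using this
end TE

/-- reduced traces, on words -/
def TRed {A : Type u} (I : A → A → Prop) (ba : A → A) (w : List A) : Prop :=
  ∀ p a q, ¬ TE I w (p ++ a :: ba a :: q)

theorem TRed.congr {A : Type u} {I : A → A → Prop} {ba : A → A} (hI : ∀ a b, I a b → I b a) {w v : List A}
    (h : TRed I ba w) (h' : TE I w v) : TRed I ba v := fun p a q h2 => h p a q (h'.trans h2)

theorem TRed.red {A : Type u} {I : A → A → Prop} {ba : A → A} {w : List A} (h : TRed I ba w) : Red ba w := by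
  unfold Red
  rw [List.isChain_iff_forall_rel_of_append_cons_cons]
  intro a b p q hw hb
  subst hb
  exact h p a q (hw ▸ TE.refl _)

theorem te_of_ord {α : Type u} {I : α → α → Prop} {l m : List α} (hl : l.Nodup) (hp : l.Perm m)
    (h : ∀ a b, bf l a b → bf m b a → I a b) : TE I l m := by
  induction l generalizing m with
  | nil => rw [List.nil_perm.1 hp]; exact TE.refl _
  | cons a l ih =>
    have hm := hp.nodup_iff.1 hl
    obtain ⟨m1, m2, rfl⟩ := List.append_of_mem (hp.subset List.mem_cons_self)
    have hp2 : l.Perm (m1 ++ m2) := (List.perm_cons a).1 (hp.trans List.perm_middle)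
    have h1 : TE I l (m1 ++ m2) := by
      refine ih (List.nodup_cons.1 hl).2 hp2 ?_
      intro b c hb hc
      refine h b c (Or.inr hb) ?_
      rcases bf_append.1 hc with hc | hc | hc
      · exact bf_append.2 (Or.inl hc)
      · exact bf_append.2 (Or.inr (Or.inl (Or.inr hc)))
      · exact bf_append.2 (Or.inr (Or.inr ⟨hc.1, List.mem_cons_of_mem _ hc.2⟩))
    refine TE.trans (TE.app (TE.refl [a]) h1) ?_
    have := TE.swap (I := I) [] [a] m1 m2 (by
      intro x hx y hy; simp only [List.mem_singleton] at hx; subst hx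
      exact h x y (Or.inl ⟨rfl, hp2.symm.subset (by simp [hy])⟩)
        (bf_append.2 (Or.inr (Or.inr ⟨hy, by simp⟩))))
    simpa using this

theorem exists_ori {A : Type u} [Finite A] {ba : A → A} (hba : Function.Involutive ba) :
    ∃ ori : List A → Bool, ∀ u, lstar ba u ≠ u → ori (lstar ba u) = !ori u := by
  haveI : Countable A := Finite.to_countable
  obtain ⟨f, hf⟩ := exists_injective_nat (List A)
  refine ⟨fun u => decide (f u < f (lstar ba u)), ?_⟩
  intro u hu
  have : f (lstar ba u) ≠ f u := fun h => hu (hf h)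
  simp only [lstar_lstar hba]
  by_cases h : f u < f (lstar ba u)
  · simp [h, h.le]
  · simp [h]; omega

theorem oks_of {R : Type u} [Finite R] (L : List (Set R)) (hn : L.Nodup)
    (hs : L.Pairwise (fun S S' => S.ncard ≤ S'.ncard))
    (h1 : ∀ S ∈ L, S.Nonempty ∧ S ≠ Set.univ) (h2 : ∀ S ∈ L, ∀ S', S ⊆ S' → S' ≠ Set.univ → S' ∈ L) : OKS L := by
  induction L with
  | nil => trivial
  | cons S L ih =>
    have hn' := List.nodup_cons.1 hn
    have hs' := List.pairwise_cons.1 hs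
    refine ⟨(h1 S (by simp)).1, (h1 S (by simp)).2, ?_, ?_, ?_⟩
    · intro S' hS' hsub
      have := Set.eq_of_subset_of_ncard_le hsub (hs'.1 S' hS') (Set.toFinite _)
      exact hn'.1 (this ▸ hS')
    · intro s hs
      by_cases hu : insert s S = Set.univ
      · exact Or.inr hu
      · left
        rcases List.mem_cons.1 (h2 S (by simp) _ (Set.subset_insert s S) hu) with h | h
        · exact absurd (h ▸ Set.mem_insert s S) hs
        · exact h
    · refine ih hn'.2 hs'.2 (fun S' hS' => h1 S' (by simp [hS'])) ?_
      intro S1 hS1 S2 hsub hu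
      rcases List.mem_cons.1 (h2 S1 (by simp [hS1]) S2 hsub hu) with h | h
      · subst h
        have := Set.eq_of_subset_of_ncard_le hsub (hs'.1 S1 hS1) (Set.toFinite _)
        exact absurd (this ▸ hS1) hn'.1
      · exact h

theorem exists_oks (R : Type u) [Finite R] : ∃ L : List (Set R), OKS L ∧ ∀ S : Set R, S.Nonempty → S ∈ L ∨ S = Set.univ := by
  haveI := Fintype.ofFinite R
  let F : Finset (Set R) := Finset.univ.filter (fun S => S.Nonempty ∧ S ≠ Set.univ)
  let L := F.toList.mergeSort (fun S S' => decide (S.ncard ≤ S'.ncard))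
  have hp : L.Perm F.toList := List.mergeSort_perm _ _
  have hmem : ∀ S, S ∈ L ↔ (S.Nonempty ∧ S ≠ Set.univ) := by
    intro S; rw [hp.mem_iff]; simp [F]
  refine ⟨L, oks_of L (hp.nodup_iff.2 F.nodup_toList) ?_ (fun S hS => (hmem S).1 hS) ?_, ?_⟩
  · have := (List.pairwise_mergeSort (le := fun S S' : Set R => decide (S.ncard ≤ S'.ncard))
      (by intro a b c; simp only [decide_eq_true_eq]; exact le_trans)
      (by intro a b; simp only [Bool.or_eq_true, decide_eq_true_eq]; exact le_total _ _) F.toList)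
    exact this.imp (by intro a b h; simpa using h)
  · intro S hS S' hsub hu
    exact (hmem S').2 ⟨((hmem S).1 hS).1.mono hsub, hu⟩
  · intro S hS
    by_cases hu : S = Set.univ
    · exact Or.inr hu
    · exact Or.inl ((hmem S).2 ⟨hS, hu⟩)

theorem zipIdx_nodup {A : Type u} (w : List A) : w.zipIdx.Nodup := by
  have : (w.zipIdx.map Prod.snd).Nodup := by
    rw [List.zipIdx_map_snd]; exact List.nodup_range'
  exact List.Nodup.of_map _ this

theorem bf_split {α : Type u} {l : List α} {a b : α} (h : bf l a b) : ∃ p m s, l = p ++ a :: m ++ b :: s := by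
  induction l with
  | nil => exact h.elim
  | cons c l ih =>
    rcases h with ⟨rfl, h⟩ | h
    · obtain ⟨m, s, rfl⟩ := List.append_of_mem h
      exact ⟨[], m, s, by simp⟩
    · obtain ⟨p, m, s, rfl⟩ := ih h
      exact ⟨c :: p, m, s, by simp⟩

theorem bf_swap {α : Type u} {p u d s : List α} {a b : α} (h1 : bf (p ++ u ++ d ++ s) a b)
    (h2 : ¬ bf (p ++ d ++ u ++ s) a b) : a ∈ u ∧ b ∈ d := by
  simp only [bf_append, List.mem_append, not_or] at h1 h2
  rcases h1 with ((h | h | h) | h | ⟨h1, h⟩) | h | ⟨h1, h⟩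
  · exact absurd h h2.1.1.1
  · exact absurd h h2.1.2.1
  · exact absurd ⟨Or.inl h.1, h.2⟩ h2.1.2.2
  · exact absurd h h2.1.1.2.1
  · rcases h1 with h1 | h1
    · exact absurd ⟨h1, h⟩ h2.1.1.2.2
    · exact ⟨h1, h⟩
  · exact absurd h h2.2.1
  · exact absurd ⟨by tauto, h⟩ h2.2.2

theorem exists_Lin0 {R A : Type u} [Finite R] [Finite A] [Nonempty R] (ρ : A → Set R) (hne : ∀ a, (ρ a).Nonempty)
    {ba : A → A} (hba : Function.Involutive ba) (hfp : ∀ a, ba a ≠ a) (hρ : ∀ a, ρ (ba a) = ρ a) :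
    ∃ (Lin : List A → List A) (K : ℕ),
      (∀ w, TE (fun a b => ¬ dp ρ a b) w (Lin w)) ∧
      (∀ w v, TE (fun a b => ¬ dp ρ a b) w v → Lin w = Lin v) ∧
      (∀ w, TRed (fun a b => ¬ dp ρ a b) ba w → Lin (lstar ba w) = lstar ba (Lin w)) ∧
      ∀ x y, BS (fun a b => ¬ dp ρ a b) K (Lin x ++ Lin y) (Lin (x ++ y)) := by
  obtain ⟨ori, hori⟩ := exists_ori hba
  obtain ⟨Ss, hO, hSs⟩ := exists_oks R
  obtain ⟨K, hK⟩ := lin_prod.{u, u} (R := R) (A := A) (ori := ori) hO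
  let Lin : List A → List A := fun w => (lin ori Ss (ρ ∘ Prod.fst) Prod.fst w.zipIdx).map Prod.fst
  have hval : ∀ {α : Type u} (lab : α → A) (l : List α), Val Ss (ρ ∘ lab) l := fun lab l a _ => hSs _ (hne _)
  have htag : ∀ {α : Type u} (lab : α → A) (l : List α), l.Nodup →
      Lin (l.map lab) = (lin ori Ss (ρ ∘ lab) lab l).map lab := by
    intro α lab l hl
    have he : l.map (fun a => (lab a, l.idxOf a)) = (l.map lab).zipIdx := by
      apply List.ext_getElem
      · simp
      · intro i h1 h2
        simp [hl.idxOf_getElem]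
    have := lin_iso (ori := ori) hO (e := fun a => (lab a, l.idxOf a)) (l := l) (T := ρ ∘ lab) (lab := lab)
      (m := (l.map lab).zipIdx) (T2 := ρ ∘ Prod.fst) (lab2 := Prod.fst)
      ⟨hl, fun a ha b hb h => (List.idxOf_inj ha).1 (Prod.ext_iff.1 h).2, by rw [he], fun a _ => rfl, fun a _ => rfl, by
        intro a b _ h
        rw [← he]
        exact (bf_map (fun a ha b hb h => (List.idxOf_inj ha).1 (Prod.ext_iff.1 h).2) h.left h.right).2 h⟩ (hval _ _)
    change ((lin ori Ss (ρ ∘ Prod.fst) Prod.fst (l.map lab).zipIdx)).map Prod.fst = _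
    rw [this, List.map_map]
    rfl
  have hsplit : ∀ w : List A, ∃ l : List (A × ℕ), l.Nodup ∧ l.map Prod.fst = w :=
    fun w => ⟨w.zipIdx, zipIdx_nodup w, by simp⟩
  refine ⟨Lin, K, ?_, ?_, ?_, ?_⟩
  · intro w
    obtain ⟨l, hl, rfl⟩ := hsplit w
    rw [htag _ l hl]
    obtain ⟨n, h⟩ := te_of_ord (I := fun a b => ¬ dp (ρ ∘ Prod.fst) a b) hl
      (lin_perm (ori := ori) (Ss := Ss) (T := ρ ∘ Prod.fst) (lab := Prod.fst)) (by
      intro a b h1 h2 hd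
      exact (lin_ord hO hl (hval Prod.fst l) hd h1).asymm (lin_perm.nodup_iff.1 hl) h2)
    exact ⟨n, h.map Prod.fst (fun a b h => h)⟩
  · rintro w v ⟨n, h⟩
    induction h with
    | refl n x => rfl
    | step h1 h2 ih =>
      rw [← ih]
      obtain ⟨p, u, d, s, rfl, rfl, h⟩ := h1
      obtain ⟨l, hl, hw⟩ := hsplit (p ++ u ++ d ++ s)
      obtain ⟨l1, s, rfl, hw1, rfl⟩ := List.map_eq_append_iff.1 hw
      obtain ⟨l2, d, rfl, hw2, rfl⟩ := List.map_eq_append_iff.1 hw1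
      obtain ⟨p, u, rfl, rfl, rfl⟩ := List.map_eq_append_iff.1 hw2
      have hp : (p ++ u ++ d ++ s).Perm (p ++ d ++ u ++ s) := by
        simpa [List.append_assoc] using ((List.perm_append_comm (l₁ := u) (l₂ := d)).append_right s).append_left p
      have h3 := lin_te (ori := ori) (lab := Prod.fst) hO hl (hval Prod.fst _) hp (by
        intro a b hab hba hd
        have h4 := hp.nodup_iff.1 hl
        have h5 : ¬ bf (p ++ d ++ u ++ s) a b := fun h => h.asymm h4 hba
        have hn : ∀ a ∈ u, ∀ b ∈ d, ¬ dp (ρ ∘ Prod.fst) a b := by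
          intro a ha b hb
          exact h a.1 (List.mem_map_of_mem ha) b.1 (List.mem_map_of_mem hb)
        obtain ⟨h6, h7⟩ := bf_swap hab h5
        exact hn a h6 b h7 hd)
      rw [← List.map_append, ← List.map_append, ← List.map_append, ← List.map_append, ← List.map_append,
        ← List.map_append]
      rw [htag _ _ hl, htag _ _ (hp.nodup_iff.1 hl), h3]
  · intro w hw
    obtain ⟨l, hl, rfl⟩ := hsplit w
    have h1 : lstar ba (l.map Prod.fst) = l.reverse.map (ba ∘ Prod.fst) := by
      simp [lstar]
    rw [h1, htag _ _ (List.nodup_reverse.2 hl), htag _ _ hl]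
    have h2 : ρ ∘ ba ∘ (Prod.fst : A × ℕ → A) = ρ ∘ Prod.fst := by funext x; simp [hρ]
    rw [h2, lin_rev (T0 := ρ ∘ Prod.fst) hba hfp hori hO hl (hval Prod.fst l) (fun _ _ => le_refl _) ?_]
    · simp [lstar]
    · intro a b hab hlb
      have hT : (ρ ∘ Prod.fst) b = (ρ ∘ Prod.fst) a := by simp [hlb, hρ]
      have hd : ∀ z, dp (ρ ∘ Prod.fst) z b ↔ dp (ρ ∘ Prod.fst) z a := by
        intro z; unfold dp; rw [hT]
      obtain ⟨r, hr⟩ := hne a.1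
      refine ⟨⟨r, hr, by rw [hT]; exact hr⟩, ?_⟩
      by_contra hno
      obtain ⟨p, m, s, rfl⟩ := bf_split hab
      refine hw (p.map Prod.fst ++ m.map Prod.fst) a.1 (s.map Prod.fst) ?_
      have := TE.swap (I := fun a b => ¬ dp ρ a b) (p.map Prod.fst) [a.1] (m.map Prod.fst) (ba a.1 :: s.map Prod.fst) (by
        intro x hx y hy hdp
        simp only [List.mem_singleton] at hx; subst hx
        obtain ⟨z, hz, rfl⟩ := List.mem_map.1 hy
        have hd1 : dp (ρ ∘ Prod.fst) z a := dp.symm hdp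
        refine hno ⟨z, ?_, ?_, hd1, (hd z).2 hd1⟩
        · simp [bf_append, bf_cons, hz]
        · simp [bf_append, bf_cons, hz])
      simpa [hlb] using this
  · intro x y
    obtain ⟨l, hl, hw⟩ := hsplit (x ++ y)
    obtain ⟨x, y, rfl, rfl, rfl⟩ := List.map_eq_append_iff.1 hw
    have h := hK _ (ρ ∘ Prod.fst) (ρ ∘ Prod.fst) Prod.fst x y hl (hval Prod.fst _) (fun _ => le_refl _)
    rw [htag _ _ (List.nodup_append.1 hl).1, htag _ _ (List.nodup_append.1 hl).2.1,
      ← List.map_append, ← List.map_append, htag _ _ hl]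
    exact h.map Prod.fst (fun a b h => h)

end words

section letter
variable {R A : Type u}

/-- strict independence of letters -/
def In (ρ : A → Set R) (ba : A → A) (a b : A) : Prop := ρ a ∩ ρ b = ∅ ∧ b ≠ a ∧ b ≠ ba a

theorem In.symm {ρ : A → Set R} {ba : A → A} (hba : Function.Involutive ba) {a b : A} (h : In ρ ba a b) : In ρ ba b a :=
  ⟨by rw [Set.inter_comm]; exact h.1, h.2.1.symm, fun h2 => h.2.2 (by rw [h2, hba])⟩

theorem In.bar {ρ : A → Set R} {ba : A → A} (hba : Function.Involutive ba) (hρ : ∀ a, ρ (ba a) = ρ a) {a b : A} :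
    In ρ ba a (ba b) ↔ In ρ ba a b := by
  unfold In
  rw [hρ, hba.injective.ne_iff]
  have : ba b ≠ a ↔ b ≠ ba a := by rw [← hba.injective.ne_iff, hba]
  rw [this]
  tauto

theorem exists_Lin [Finite R] [Finite A] (ρ : A → Set R) 
    {ba : A → A} (hba : Function.Involutive ba) (hfp : ∀ a, ba a ≠ a) (hρ : ∀ a, ρ (ba a) = ρ a) :
    ∃ (Lin : List A → List A) (K : ℕ),
      (∀ w, TE (In ρ ba) w (Lin w)) ∧
      (∀ w v, TE (In ρ ba) w v → Lin w = Lin v) ∧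
      (∀ w, TRed (In ρ ba) ba w → Lin (lstar ba w) = lstar ba (Lin w)) ∧
      ∀ x y, BS (In ρ ba) K (Lin x ++ Lin y) (Lin (x ++ y)) := by
  let ρ' : A → Set (Option (R ⊕ A)) := fun a =>
    {x | (∃ r ∈ ρ a, x = some (Sum.inl r)) ∨ x = some (Sum.inr a) ∨ x = some (Sum.inr (ba a))}
  have h := exists_Lin0 ρ' (fun a => ⟨some (Sum.inr a), Or.inr (Or.inl rfl)⟩) hba hfp (by
    intro a
    ext x
    simp only [ρ', Set.mem_ofPred_eq, hρ, hba a]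
    rw [or_comm (a := x = some (Sum.inr (ba a)))])
  have hI : (fun a b => ¬ dp ρ' a b) = In ρ ba := by
    funext a b
    apply propext
    unfold In dp
    constructor
    · intro h
      refine ⟨?_, ?_, ?_⟩
      · ext r
        simp only [Set.mem_inter_iff, Set.mem_empty_iff_false, iff_false]
        rintro ⟨h1, h2⟩
        exact h ⟨some (Sum.inl r), Or.inl ⟨r, h1, rfl⟩, Or.inl ⟨r, h2, rfl⟩⟩
      · rintro rfl
        exact h ⟨some (Sum.inr b), Or.inr (Or.inl rfl), Or.inr (Or.inl rfl)⟩
      · rintro rfl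
        exact h ⟨some (Sum.inr (ba a)), Or.inr (Or.inr rfl), Or.inr (Or.inl rfl)⟩
    · rintro ⟨h1, h2, h3⟩ ⟨x, hx, hy⟩
      have h4 : ba b ≠ a := fun h => h3 (by rw [← h, hba])
      have h5 : ba b ≠ ba a := fun h => h2 (hba.injective h)
      rcases hx with ⟨r, hr, rfl⟩ | rfl | rfl <;> rcases hy with ⟨r', hr', h⟩ | h | h <;>
        simp only [Option.some.injEq, Sum.inl.injEq, Sum.inr.injEq, reduceCtorEq] at h
      · subst h
        have : r ∈ ρ a ∩ ρ b := ⟨hr, hr'⟩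
        rw [h1] at this; exact this
      all_goals first | exact h2 h.symm | exact h3 h.symm | exact h4 h.symm | exact h5 h.symm
  rw [hI] at h
  exact h
end letter

section reduc

structure IC {A : Type u} (I : A → A → Prop) (ba : A → A) : Prop where
  inv : Function.Involutive ba
  symm : ∀ a b, I a b → I b a
  bar : ∀ a b, I a b → I a (ba b)
  irr : ∀ a, ¬ I a a

theorem TE.step_rec {A : Type u} {I : A → A → Prop} {P : List A → List A → Prop} (hr : ∀ x, P x x)
    (ht : ∀ x y z, P x y → P y z → P x z)
    (hstep : ∀ p a b s, I a b → P (p ++ a :: b :: s) (p ++ b :: a :: s)) {x y : List A} (h : TE I x y) : P x y := by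
  have h1 : ∀ (a : A) (d p s : List A), (∀ b ∈ d, I a b) → P (p ++ a :: d ++ s) (p ++ d ++ a :: s) := by
    intro a d
    induction d with
    | nil => intro p s _; simpa using hr (p ++ a :: s)
    | cons b d ih =>
      intro p s h
      refine ht _ _ _ (by simpa using hstep p a b (d ++ s) (h b (by simp))) ?_
      have := ih (p ++ [b]) s (fun c hc => h c (by simp [hc]))
      simpa using this
  have h2 : ∀ (u d p s : List A), (∀ a ∈ u, ∀ b ∈ d, I a b) → P (p ++ u ++ d ++ s) (p ++ d ++ u ++ s) := by
    intro u
    induction u with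
    | nil => intro d p s _; simpa using hr (p ++ d ++ s)
    | cons a u ih =>
      intro d p s h
      have h3 := ih d (p ++ [a]) s (fun c hc => h c (by simp [hc]))
      have h4 := h1 a d p (u ++ s) (h a (by simp))
      refine ht _ (p ++ a :: d ++ (u ++ s)) _ ?_ ?_
      · simpa using h3
      · simpa using h4
  obtain ⟨n, h⟩ := h
  induction h with
  | refl n x => exact hr _
  | step h3 h4 ih =>
    obtain ⟨p, u, d, s, rfl, rfl, h⟩ := h3
    exact ht _ _ _ (h2 u d p s h) ih

variable {A : Type u} {I : A → A → Prop} {ba : A → A}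

def Fst (I : A → A → Prop) : List A → A → Prop
  | [], _ => False
  | a :: w, b => b = a ∨ (I a b ∧ Fst I w b)

def RedW (I : A → A → Prop) (ba : A → A) : List A → Prop
  | [] => True
  | a :: w => ¬ Fst I w (ba a) ∧ RedW I ba w

noncomputable def act (I : A → A → Prop) (ba : A → A) (a : A) (w : List A) : List A :=
  if Fst I w (ba a) then w.erase (ba a) else a :: w

noncomputable def nf (I : A → A → Prop) (ba : A → A) (w : List A) : List A := w.foldr (act I ba) []

theorem TE.cons (a : A) {x y : List A} (h : TE I x y) : TE I (a :: x) (a :: y) := TE.app (TE.refl [a]) h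

theorem TE.swap2 (a b : A) (s : List A) (h : I a b) : TE I (a :: b :: s) (b :: a :: s) := by
  simpa using TE.swap (I := I) [] [a] [b] s (by simpa using h)

theorem fst_te {x y : List A} (hs : ∀ a b, I a b → I b a) (h : TE I x y) : ∀ c, Fst I x c ↔ Fst I y c := by
  refine TE.step_rec (P := fun x y => ∀ c, Fst I x c ↔ Fst I y c) (fun _ _ => Iff.rfl)
    (fun _ _ _ h1 h2 c => (h1 c).trans (h2 c)) ?_ h
  intro p a b s hab c
  induction p with
  | nil =>
    simp only [List.nil_append, Fst]
    constructor
    · rintro (rfl | ⟨h1, rfl | ⟨h2, h3⟩⟩)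
      · exact Or.inr ⟨hs _ _ hab, Or.inl rfl⟩
      · exact Or.inl rfl
      · exact Or.inr ⟨h2, Or.inr ⟨h1, h3⟩⟩
    · rintro (rfl | ⟨h1, rfl | ⟨h2, h3⟩⟩)
      · exact Or.inr ⟨hab, Or.inl rfl⟩
      · exact Or.inl rfl
      · exact Or.inr ⟨h2, Or.inr ⟨h1, h3⟩⟩
  | cons d p ih => simp only [List.cons_append, Fst, ih]

theorem redW_te {x y : List A} (hI : IC I ba) (h : TE I x y) : RedW I ba x ↔ RedW I ba y := by
  refine TE.step_rec (P := fun x y => RedW I ba x ↔ RedW I ba y) (fun _ => Iff.rfl)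
    (fun _ _ _ h1 h2 => h1.trans h2) ?_ h
  intro p a b s hab
  induction p with
  | nil =>
    simp only [List.nil_append, RedW, Fst]
    have h1 : ba a ≠ b := fun h => hI.irr (ba a) (hI.symm _ _ (hI.bar _ _ (hI.symm _ _ (h ▸ hab))))
    have h2 : ba b ≠ a := fun h => hI.irr (ba b) (hI.bar _ _ (by rw [← h] at hab; exact hab))
    have h3 : I b (ba a) := hI.bar _ _ (hI.symm _ _ hab)
    have h4 : I a (ba b) := hI.bar _ _ hab
    tauto
  | cons d p ih =>
    simp only [List.cons_append, RedW, ih, fst_te hI.symm (TE.app (TE.refl p) (TE.swap2 a b s hab))]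

theorem fst_mem {w : List A} {b : A} (h : Fst I w b) : b ∈ w := by
  induction w with
  | nil => exact h.elim
  | cons a w ih =>
    rcases h with rfl | h
    · simp
    · simp [ih h.2]

theorem fst_cons_te (hI : IC I ba) {w : List A} {b : A} (h : Fst I w b) : TE I w (b :: w.erase b) := by
  induction w with
  | nil => exact h.elim
  | cons a w ih =>
    rcases h with rfl | h
    · simpa using TE.refl _
    · have hne : a ≠ b := fun h2 => hI.irr b (h2 ▸ h.1)
      rw [List.erase_cons_tail (by simpa using hne)]
      exact ((ih h.2).cons a).trans (TE.swap2 _ _ _ h.1)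

theorem erase_te (hI : IC I ba) {x y : List A} (c : A) (h : TE I x y) : TE I (x.erase c) (y.erase c) := by
  refine TE.step_rec (P := fun x y => TE I (x.erase c) (y.erase c)) (fun _ => TE.refl _)
    (fun _ _ _ h1 h2 => h1.trans h2) ?_ h
  intro p a b s hab
  by_cases hp : c ∈ p
  · rw [List.erase_append_left _ hp, List.erase_append_left _ hp]
    exact TE.app (TE.refl _) (TE.swap2 a b s hab)
  · rw [List.erase_append_right _ hp, List.erase_append_right _ hp]
    refine TE.app (TE.refl _) ?_
    have hne : a ≠ b := fun h => hI.irr b (h ▸ hab)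
    by_cases ha : a = c
    · subst ha
      rw [List.erase_cons_head, List.erase_cons_tail (by simpa using hne.symm), List.erase_cons_head]
      exact TE.refl _
    · by_cases hb : b = c
      · subst hb
        rw [List.erase_cons_head, List.erase_cons_tail (by simpa using hne), List.erase_cons_head]
        exact TE.refl _
      · rw [List.erase_cons_tail (by simpa using ha), List.erase_cons_tail (by simpa using hb),
          List.erase_cons_tail (by simpa using hb), List.erase_cons_tail (by simpa using ha)]
        exact TE.swap2 _ _ _ hab

theorem act_te (hI : IC I ba) (a : A) {x y : List A} (h : TE I x y) : TE I (act I ba a x) (act I ba a y) := by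
  unfold act
  rw [fst_te hI.symm h]
  split_ifs
  · exact erase_te hI _ h
  · exact h.cons a

theorem fst_erase (hI : IC I ba) {w : List A} {b c : A} (h : Fst I w b) (hbc : I b c) :
    Fst I (w.erase b) c ↔ Fst I w c := by
  rw [fst_te hI.symm (fst_cons_te hI h)]
  have : c ≠ b := fun h2 => hI.irr b (h2 ▸ hbc)
  simp [Fst, this, hbc]

theorem redW_erase (hI : IC I ba) {w : List A} {b : A} (hw : RedW I ba w) (h : Fst I w b) : RedW I ba (w.erase b) := by
  have := (redW_te hI (fst_cons_te hI h)).1 hw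
  exact this.2

theorem redW_act (hI : IC I ba) (a : A) {w : List A} (hw : RedW I ba w) : RedW I ba (act I ba a w) := by
  unfold act
  split_ifs with h
  · exact redW_erase hI hw h
  · exact ⟨h, hw⟩

theorem act_act (hI : IC I ba) (a : A) {w : List A} (hw : RedW I ba w) : TE I (act I ba (ba a) (act I ba a w)) w := by
  unfold act
  split_ifs with h1 h2 h2
  · exfalso
    have := (redW_te hI (fst_cons_te hI h1)).1 hw
    exact this.1 h2
  · exact (fst_cons_te hI h1).symm hI.symm
  · rw [hI.inv, List.erase_cons_head]; exact TE.refl _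
  · exfalso; apply h2; rw [hI.inv]; exact Or.inl rfl

theorem act_comm (hI : IC I ba) {a b : A} (hab : I a b) (w : List A) :
    TE I (act I ba a (act I ba b w)) (act I ba b (act I ba a w)) := by
  have h1 : I b (ba a) := hI.bar _ _ (hI.symm _ _ hab)
  have h2 : I a (ba b) := hI.bar _ _ hab
  have h3 : I (ba b) (ba a) := hI.bar _ _ (hI.symm _ _ h2)
  have h4 := hI.symm _ _ h3
  have n1 : ba a ≠ b := fun h => hI.irr b (h ▸ h1)
  have n2 : ba b ≠ a := fun h => hI.irr a (h ▸ h2)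
  have f1 : Fst I (b :: w) (ba a) ↔ Fst I w (ba a) := by simp [Fst, n1, h1]
  have f2 : Fst I (a :: w) (ba b) ↔ Fst I w (ba b) := by simp [Fst, n2, h2]
  by_cases ha : Fst I w (ba a) <;> by_cases hb : Fst I w (ba b)
  · have e1 := (fst_erase hI hb h3).2 ha
    have e2 := (fst_erase hI ha h4).2 hb
    simp only [act, ha, hb, e1, e2, if_true]
    rw [List.erase_comm]; exact TE.refl _
  · have e2 := fun h => hb ((fst_erase hI ha h4).1 h)
    simp only [act, ha, hb, e2, f1, if_true, if_false]
    rw [List.erase_cons_tail (by simpa using n1.symm), if_neg e2]; exact TE.refl _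
  · have e2 := fun h => ha ((fst_erase hI hb h3).1 h)
    simp only [act, ha, hb, e2, f2, if_true, if_false]
    rw [List.erase_cons_tail (by simpa using n2.symm), if_neg e2]; exact TE.refl _
  · simp only [act, ha, hb, f1, f2, if_false]
    exact TE.swap2 _ _ _ hab

theorem redW_nf (hI : IC I ba) (w : List A) : RedW I ba (nf I ba w) := by
  induction w with
  | nil => trivial
  | cons a w ih => exact redW_act hI a ih

theorem nf_red {w : List A} (hw : RedW I ba w) : nf I ba w = w := by
  induction w with
  | nil => rfl
  | cons a w ih =>
    change act I ba a (nf I ba w) = _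
    rw [ih hw.2, act, if_neg hw.1]

theorem RedW.append_right {x y : List A} (h : RedW I ba (x ++ y)) : RedW I ba y := by
  induction x with
  | nil => exact h
  | cons a x ih => exact ih h.2

theorem fst_append (x y : List A) (b : A) :
    Fst I (x ++ y) b ↔ Fst I x b ∨ ((∀ c ∈ x, I c b) ∧ Fst I y b) := by
  induction x with
  | nil => simp [Fst]
  | cons a x ih =>
    simp only [List.cons_append, Fst, ih, List.forall_mem_cons]
    tauto

theorem RedW.append_left {x y : List A} (h : RedW I ba (x ++ y)) : RedW I ba x := by
  induction x with
  | nil => trivial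
  | cons a x ih => exact ⟨fun h2 => h.1 ((fst_append _ _ _).2 (Or.inl h2)), ih h.2⟩

theorem tred_iff (hI : IC I ba) {w : List A} : TRed I ba w ↔ RedW I ba w := by
  constructor
  · induction w with
    | nil => intro _; trivial
    | cons a w ih =>
      intro h
      refine ⟨fun h1 => h [] a (w.erase (ba a)) ((fst_cons_te hI h1).cons a), ih ?_⟩
      intro p b q h2
      exact h (a :: p) b q (h2.cons a)
  · intro h p a q h2
    have := ((redW_te hI h2).1 h).append_right
    exact this.1 (Or.inl rfl)

theorem interface (hI : IC I ba) {g y : List A} (hg : RedW I ba g) (hy : RedW I ba y) (h : ¬ RedW I ba (g ++ y)) :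
    ∃ a g1 y1, TE I g (g1 ++ [a]) ∧ TE I y (ba a :: y1) := by
  induction g with
  | nil => exact absurd hy h
  | cons a g ih =>
    by_cases h1 : RedW I ba (g ++ y)
    · have h2 : Fst I (g ++ y) (ba a) := by
        by_contra h2; exact h ⟨h2, h1⟩
      rcases (fst_append _ _ _).1 h2 with h3 | ⟨h3, h4⟩
      · exact absurd h3 hg.1
      · refine ⟨a, g, y.erase (ba a), ?_, fst_cons_te hI h4⟩
        have := TE.comm (I := I) (u := [a]) (d := g) (by
          intro x hx c hc
          simp only [List.mem_singleton] at hx; subst hx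
          have := hI.bar _ _ (h3 c hc)
          rw [hI.inv] at this
          exact hI.symm _ _ this)
        exact this
    · obtain ⟨b, g1, y1, h2, h3⟩ := ih hg.2 h1
      exact ⟨b, a :: g1, y1, h2.cons a, h3⟩

theorem interface' (hI : IC I ba) (n : ℕ) : ∀ {g y : List A}, g.length ≤ n → RedW I ba g → RedW I ba y →
    ∃ u c v, TE I g (u ++ c) ∧ TE I y (lstar ba c ++ v) ∧ RedW I ba (u ++ v) := by
  induction n with
  | zero =>
    intro g y hn hg hy
    have : g = [] := List.length_eq_zero_iff.1 (by omega)
    subst this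
    exact ⟨[], [], y, TE.refl _, TE.refl _, hy⟩
  | succ n ih =>
    intro g y hn hg hy
    by_cases h : RedW I ba (g ++ y)
    · exact ⟨g, [], y, by simpa using TE.refl _, TE.refl _, h⟩
    · obtain ⟨a, g1, y1, h1, h2⟩ := interface hI hg hy h
      have hl := h1.perm.length_eq
      simp only [List.length_append, List.length_singleton] at hl
      obtain ⟨u, c, v, h3, h4, h5⟩ := ih (by omega) ((redW_te hI h1).1 hg).append_left ((redW_te hI h2).1 hy).2
      refine ⟨u, c ++ [a], v, ?_, ?_, h5⟩
      · exact h1.trans (by simpa using TE.app h3 (TE.refl [a]))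
      · rw [lstar_append, lstar_singleton]
        exact h2.trans (by simpa using h4.cons (ba a))

theorem redW_lstar (hI : IC I ba) {w : List A} (h : RedW I ba w) : RedW I ba (lstar ba w) := by
  rw [← tred_iff hI] at h ⊢
  intro p a q h2
  have h3 := h2.lstar (f := ba) (by
    intro a b hab
    exact hI.bar _ _ (hI.symm _ _ (hI.bar _ _ hab)))
  rw [lstar_lstar hI.inv, lstar_append, lstar_cons, lstar_cons, hI.inv] at h3
  exact h (lstar ba q) a (lstar ba p) (by simpa using h3)

theorem ic_In {R : Type u} {ρ : A → Set R} (hba : Function.Involutive ba) (hρ : ∀ a, ρ (ba a) = ρ a) : IC (In ρ ba) ba :=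
  ⟨hba, fun _ _ h => h.symm hba, fun _ _ h => (In.bar hba hρ).2 h, fun _ h => h.2.1 rfl⟩

/-- weak independence -/
def In0 {R : Type u} (ρ : A → Set R) (a b : A) : Prop := ρ a ∩ ρ b = ∅

theorem te_In0 {R : Type u} {ρ : A → Set R} (hba : Function.Involutive ba) (hρ : ∀ a, ρ (ba a) = ρ a) {x y : List A}
    (h : TE (In0 ρ) x y) : RedW (In ρ ba) ba x → TE (In ρ ba) x y := by
  have hI := ic_In hba hρ
  refine TE.step_rec (P := fun x y => RedW (In ρ ba) ba x → TE (In ρ ba) x y) (fun _ _ => TE.refl _)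
    (fun x y z h1 h2 h3 => (h1 h3).trans (h2 ((redW_te hI (h1 h3)).1 h3))) ?_ h
  intro p a b s hab hr
  by_cases h1 : b = a
  · subst h1; exact TE.refl _
  · by_cases h2 : b = ba a
    · subst h2
      exact absurd (Or.inl rfl) hr.append_right.1
    · exact TE.app (TE.refl p) (TE.swap2 _ _ _ ⟨hab, h1, h2⟩)

theorem tred_In0 {R : Type u} {ρ : A → Set R} (hba : Function.Involutive ba) (hρ : ∀ a, ρ (ba a) = ρ a) {w : List A} :
    TRed (In0 ρ) ba w ↔ RedW (In ρ ba) ba w := by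
  have hI := ic_In hba hρ
  rw [← tred_iff hI]
  constructor
  · intro h p a q h2
    exact h p a q (h2.mono (fun a b h => h.1))
  · intro h p a q h2
    exact h p a q (te_In0 hba hρ h2 ((tred_iff hI).1 h))

end reduc

section thmEsec

/-- letters of `C` acting as transformations -/
noncomputable def dfa {A C Q : Type u} (cn : A → C) (δ : A → Q → Q) : C → Function.End Q :=
  Function.extend cn (fun a => (δ a : Function.End Q)) (fun _ => 1)

theorem dfa_lift {A C Q : Type u} {cn : A → C} (hcn : Function.Injective cn) (δ : A → Q → Q) (x : FreeMonoid C)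
    (w : List A) (h : FreeMonoid.toList x = w.map cn) (q : Q) :
    (FreeMonoid.lift (dfa cn δ) x) q = w.foldr δ q := by
  rw [← FreeMonoid.ofList_toList x, h]
  clear h
  induction w with
  | nil => rfl
  | cons a w ih =>
    rw [List.map_cons, FreeMonoid.ofList_cons, map_mul]
    change (FreeMonoid.lift (dfa cn δ) (FreeMonoid.of (cn a))) ((FreeMonoid.lift (dfa cn δ) _) q) = _
    rw [ih, FreeMonoid.lift_eval_of]
    have he : dfa cn δ (cn a) = (δ a : Function.End Q) := hcn.extend_apply _ _ a
    rw [he]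
    rfl

instance {Q : Type u} [Finite Q] : Finite (Function.End Q) := inferInstanceAs (Finite (Q → Q))

/-- restricting a rational set by a regular condition on outputs -/
theorem rational_dfa {A C Q J : Type u} [Finite C] [Finite Q] {S : Set (Monoid.End (FreeMonoid C))} (hS : RationalSet S)
    {cn : A → C} (hcn : Function.Injective cn) (δ : A → Q → Q) (q0 : Q) (o : J → C) (Φ : (J → Q) → Prop) :
    ∃ S' ⊆ S, RationalSet S' ∧ ∀ h ∈ S, ∀ w : J → List A,
      (∀ j, FreeMonoid.toList (h (FreeMonoid.of (o j))) = (w j).map cn) →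
      (h ∈ S' ↔ Φ (fun j => (w j).foldr δ q0)) := by
  refine ⟨_, ?_, rational_inter S hS (dfa cn δ) (fun f => Φ (fun j => f (o j) q0)), ?_⟩
  · exact fun h hh => hh.1
  · intro h hh w hw
    have : (fun j => (FreeMonoid.lift (dfa cn δ) (h (FreeMonoid.of (o j)))) q0) = fun j => (w j).foldr δ q0 := by
      funext j; exact dfa_lift hcn δ _ _ (hw j) q0
    rw [← this]
    simp [hh]

theorem alph_foldr {A : Type u} (w : List A) : w.foldr (fun a s => insert a s) (∅ : Set A) = {a | a ∈ w} := by
  induction w with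
  | nil => simp
  | cons a w ih => rw [List.foldr_cons, ih]; ext b; simp

theorem redW_foldr {A : Type u} (I : A → A → Prop) (ba : A → A) (w : List A) :
    w.foldr (fun a (s : Set A × Prop) => ({b | b = a ∨ (I a b ∧ b ∈ s.1)}, ba a ∉ s.1 ∧ s.2)) ((∅ : Set A), True) =
      ({b | Fst I w b}, RedW I ba w) := by
  induction w with
  | nil => simp [Fst, RedW]
  | cons a w ih => rw [List.foldr_cons, ih]; simp [Fst, RedW]

theorem bs_chain {α : Type u} {I : α → α → Prop} {n : ℕ} {x z : List α} (h : BS I n x z) :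
    ∃ f : ℕ → Fin 4 → List α, x = f 0 0 ++ f 0 1 ++ f 0 2 ++ f 0 3 ∧
      (∀ j, f j 0 ++ f j 2 ++ f j 1 ++ f j 3 = f (j+1) 0 ++ f (j+1) 1 ++ f (j+1) 2 ++ f (j+1) 3) ∧
      f n 0 ++ f n 2 ++ f n 1 ++ f n 3 = z ∧ ∀ j, ∀ a ∈ f j 1, ∀ b ∈ f j 2, I a b := by
  induction h with
  | refl n x => exact ⟨fun _ => ![x, [], [], []], by simp, by simp, by simp, by simp⟩
  | step h1 h2 ih =>
    obtain ⟨f, hf0, hf1, hf2, hf3⟩ := ih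
    obtain ⟨p, u, d, s, rfl, rfl, h⟩ := h1
    refine ⟨fun j => Nat.casesOn j ![p, u, d, s] f, by simp, ?_, hf2, ?_⟩
    · intro j
      cases j with
      | zero => simpa using hf0
      | succ j => exact hf1 j
    · intro j
      cases j with
      | zero => simpa using h
      | succ j => exact hf3 j

theorem thmE {R A W Tr : Type u} [Finite R] [Finite A] [Finite W] [Finite Tr] (ρ : A → Set R)
    {ba : A → A} (hba : Function.Involutive ba) (hfp : ∀ a, ba a ≠ a) (hρ : ∀ a, ρ (ba a) = ρ a)
    (wb : W → W) (cst : A → W) (tx ty tz : Tr → W) :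
    ∃ (C : Type u) (_ : Finite C) (cn : A → C) (o : W → C) (S : Set (Monoid.End (FreeMonoid C))),
      Function.Injective cn ∧ RationalSet S ∧ (∀ h ∈ S, ∀ a, h (FreeMonoid.of (cn a)) = FreeMonoid.of (cn a)) ∧
      (∀ h ∈ S, ∀ d, ∃ w : List A, FreeMonoid.toList (h (FreeMonoid.of d)) = w.map cn) ∧
      (∀ h ∈ S, ∃ s : W → List A, (∀ w, RedW (In ρ ba) ba (s w)) ∧ BC ba wb s ∧ (∀ a, s (cst a) = [a]) ∧
        (∀ t, TE (In ρ ba) (s (tx t) ++ s (ty t)) (s (tz t))) ∧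
        ∀ w, FreeMonoid.toList (h (FreeMonoid.of (o w))) = (s w).map cn) ∧
      ∀ t : W → List A, (∀ w, RedW (In ρ ba) ba (t w)) → (∀ w, TE (In ρ ba) (t (wb w)) (lstar ba (t w))) →
        (∀ a, t (cst a) = [a]) → (∀ τ, TE (In ρ ba) (t (tx τ) ++ t (ty τ)) (t (tz τ))) →
        ∃ h ∈ S, ∀ w, ∃ v, TE (In ρ ba) (t w) v ∧ FreeMonoid.toList (h (FreeMonoid.of (o w))) = v.map cn := by
  have hI : IC (In ρ ba) ba := ic_In hba hρ
  obtain ⟨Lin, K, L1, L2, L3, L4⟩ := exists_Lin ρ hba hfp hρ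
  let V := W ⊕ (Tr × Fin (K+1) × Fin 4 × Bool)
  let J := W ⊕ A ⊕ Tr ⊕ (Tr × Fin (K+1) × Fin 4)
  let vb : V → V := Sum.elim (fun w => Sum.inl (wb w)) (fun x => Sum.inr (x.1, x.2.1, x.2.2.1, !x.2.2.2))
  let ax : Tr → Fin (K+1) → Fin 4 → A ⊕ V := fun t j k => Sum.inr (Sum.inr (t, j, k, false))
  let wv : W → A ⊕ V := fun w => Sum.inr (Sum.inl w)
  let w0 : J → List (A ⊕ V) := Sum.elim (fun w => [wv w]) (Sum.elim (fun a => [Sum.inl a])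
    (Sum.elim (fun t => [wv (tx t), wv (ty t)]) (fun x =>
      ![[ax x.1 x.2.1 0, ax x.1 x.2.1 1, ax x.1 x.2.1 2, ax x.1 x.2.1 3],
        [ax x.1 x.2.1 0, ax x.1 x.2.1 2, ax x.1 x.2.1 1, ax x.1 x.2.1 3],
        [ax x.1 x.2.1 1], [ax x.1 x.2.1 2]] x.2.2)))
  let jw : W → J := fun w => Sum.inl w
  let ja : A → J := fun a => Sum.inr (Sum.inl a)
  let jt : Tr → J := fun t => Sum.inr (Sum.inr (Sum.inl t))
  let jx : Tr → Fin (K+1) → Fin 4 → J := fun t j k => Sum.inr (Sum.inr (Sum.inr (t, j, k)))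
  let Eqs : J → J → Prop := fun i j =>
    (∃ a, i = ja a ∧ j = jw (cst a)) ∨ (∃ t, i = jt t ∧ j = jx t 0 0) ∨
    (∃ t, ∃ m m' : Fin (K+1), m'.val = m.val + 1 ∧ i = jx t m 1 ∧ j = jx t m' 0) ∨
    (∃ t, i = jx t (Fin.last K) 1 ∧ j = jw (tz t))
  obtain ⟨C, hC, cn, o, S, hcn, hS, hfix, hintr, hsound, hcomp⟩ := thmC hba hfp vb Eqs w0
  obtain ⟨S1, hS1, hS1r, hS1m⟩ := rational_dfa hS hcn (fun a s => insert a s) (∅ : Set A) o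
    (fun f => ∀ t j, ∀ a ∈ f (jx t j 2), ∀ b ∈ f (jx t j 3), In ρ ba a b)
  obtain ⟨S2, hS2, hS2r, hS2m⟩ := rational_dfa hS1r hcn
    (fun a (s : Set A × Prop) => ({b | b = a ∨ (In ρ ba a b ∧ b ∈ s.1)}, ba a ∉ s.1 ∧ s.2)) ((∅ : Set A), True) o
    (fun f => ∀ w, (f (jw w)).2)
  refine ⟨C, hC, cn, fun w => o (jw w), S2, hcn, hS2r, fun h hh => hfix h (hS1 (hS2 hh)),
    fun h hh => hintr h (hS1 (hS2 hh)), ?_, ?_⟩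
  · intro h hh
    obtain ⟨σ, hBC, hEq, hout⟩ := hsound h (hS1 (hS2 hh))
    have c1 := (hS1m h (hS1 (hS2 hh)) _ hout).1 (hS2 hh)
    have c2 := (hS2m h (hS2 hh) _ hout).1 hh
    simp only [alph_foldr] at c1
    simp only [redW_foldr] at c2
    have ew : ∀ w, (w0 (jw w)).flatMap (ev σ) = σ (Sum.inl w) := by intro w; simp [w0, jw, wv, ev]
    refine ⟨fun w => σ (Sum.inl w), ?_, ?_, ?_, ?_, ?_⟩
    · intro w; have := c2 w; rwa [ew] at this
    · intro w; exact hBC (Sum.inl w)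
    · intro a
      have := hEq (ja a) (jw (cst a)) (Or.inl ⟨a, rfl, rfl⟩)
      rw [ew] at this
      refine this.symm.trans ?_
      simp [w0, ja, ev]
    · intro t
      let F : Fin (K+1) → Fin 4 → List A := fun j k => σ (Sum.inr (t, j, k, false))
      have e0 : ∀ j, (w0 (jx t j 0)).flatMap (ev σ) = F j 0 ++ F j 1 ++ F j 2 ++ F j 3 := by
        intro j; simp [w0, jx, ax, ev, F]
      have e1 : ∀ j, (w0 (jx t j 1)).flatMap (ev σ) = F j 0 ++ F j 2 ++ F j 1 ++ F j 3 := by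
        intro j; simp [w0, jx, ax, ev, F]
      have e2 : ∀ j, (w0 (jx t j 2)).flatMap (ev σ) = F j 1 := by
        intro j; simp [w0, jx, ax, ev, F]
      have e3 : ∀ j, (w0 (jx t j 3)).flatMap (ev σ) = F j 2 := by
        intro j; simp [w0, jx, ax, ev, F]
      have et : (w0 (jt t)).flatMap (ev σ) = σ (Sum.inl (tx t)) ++ σ (Sum.inl (ty t)) := by
        simp [w0, jt, wv, ev]
      have hsw : ∀ j, TE (In ρ ba) (F j 0 ++ F j 1 ++ F j 2 ++ F j 3) (F j 0 ++ F j 2 ++ F j 1 ++ F j 3) := by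
        intro j
        refine TE.swap _ _ _ _ ?_
        have := c1 t j
        simp only [e2, e3] at this
        exact this
      have hind : ∀ n (hn : n < K + 1), TE (In ρ ba) (σ (Sum.inl (tx t)) ++ σ (Sum.inl (ty t)))
          (F ⟨n, hn⟩ 0 ++ F ⟨n, hn⟩ 2 ++ F ⟨n, hn⟩ 1 ++ F ⟨n, hn⟩ 3) := by
        intro n
        induction n with
        | zero =>
          intro hn
          have := hEq (jt t) (jx t 0 0) (Or.inr (Or.inl ⟨t, rfl, rfl⟩))
          rw [et, e0] at this
          rw [this]
          exact hsw _
        | succ n ih =>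
          intro hn
          refine (ih (by omega)).trans ?_
          have := hEq (jx t ⟨n, by omega⟩ 1) (jx t ⟨n+1, hn⟩ 0) (Or.inr (Or.inr (Or.inl ⟨t, _, _, rfl, rfl, rfl⟩)))
          rw [e0, e1] at this
          rw [this]
          exact hsw _
      have hl := hEq (jx t (Fin.last K) 1) (jw (tz t)) (Or.inr (Or.inr (Or.inr ⟨t, rfl, rfl⟩)))
      rw [e1, ew] at hl
      have := hind K (by omega)
      change TE (In ρ ba) _ (σ (Sum.inl (tz t)))
      rw [← hl]
      exact this
    · intro w
      have := hout (jw w)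
      rwa [ew] at this
  · intro t hred hbar hcst htr
    have hch : ∀ τ, ∃ f : ℕ → Fin 4 → List A, Lin (t (tx τ)) ++ Lin (t (ty τ)) = f 0 0 ++ f 0 1 ++ f 0 2 ++ f 0 3 ∧
      (∀ j, f j 0 ++ f j 2 ++ f j 1 ++ f j 3 = f (j+1) 0 ++ f (j+1) 1 ++ f (j+1) 2 ++ f (j+1) 3) ∧
      f K 0 ++ f K 2 ++ f K 1 ++ f K 3 = Lin (t (tz τ)) ∧ ∀ j, ∀ a ∈ f j 1, ∀ b ∈ f j 2, In ρ ba a b := by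
      intro τ
      have := L4 (t (tx τ)) (t (ty τ))
      rw [L2 _ _ (htr τ)] at this
      exact bs_chain this
    choose f hf0 hf1 hf2 hf3 using hch
    let σ : V → List A := Sum.elim (fun w => Lin (t w)) (fun x =>
      if x.2.2.2 then lstar ba (f x.1 x.2.1.val x.2.2.1) else f x.1 x.2.1.val x.2.2.1)
    have hBC : BC ba vb σ := by
      rintro (w | ⟨τ, j, k, b⟩)
      · change Lin (t (wb w)) = lstar ba (Lin (t w))
        rw [L2 _ _ (hbar w), L3 _ ((tred_iff hI).2 (hred w))]
      · cases b
        · simp [σ, vb]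
        · simp [σ, vb, lstar_lstar hba]
    have ew : ∀ w, (w0 (jw w)).flatMap (ev σ) = Lin (t w) := by intro w; simp [w0, jw, wv, ev, σ]
    have ea : ∀ a, (w0 (ja a)).flatMap (ev σ) = [a] := by intro a; simp [w0, ja, ev]
    have et : ∀ τ, (w0 (jt τ)).flatMap (ev σ) = Lin (t (tx τ)) ++ Lin (t (ty τ)) := by
      intro τ; simp [w0, jt, wv, ev, σ]
    have e0 : ∀ τ (j : Fin (K+1)), (w0 (jx τ j 0)).flatMap (ev σ) = f τ j 0 ++ f τ j 1 ++ f τ j 2 ++ f τ j 3 := by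
      intro τ j; simp [w0, jx, ax, ev, σ]
    have e1 : ∀ τ (j : Fin (K+1)), (w0 (jx τ j 1)).flatMap (ev σ) = f τ j 0 ++ f τ j 2 ++ f τ j 1 ++ f τ j 3 := by
      intro τ j; simp [w0, jx, ax, ev, σ]
    have e2 : ∀ τ (j : Fin (K+1)), (w0 (jx τ j 2)).flatMap (ev σ) = f τ j 1 := by
      intro τ j; simp [w0, jx, ax, ev, σ]
    have e3 : ∀ τ (j : Fin (K+1)), (w0 (jx τ j 3)).flatMap (ev σ) = f τ j 2 := by
      intro τ j; simp [w0, jx, ax, ev, σ]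
    have hLr : ∀ w, RedW (In ρ ba) ba (Lin (t w)) := fun w => (redW_te hI (L1 _)).1 (hred w)
    have hred' : ∀ {w}, RedW (In ρ ba) ba w → Red ba w := fun h => ((tred_iff hI).2 h).red
    have hxy : ∀ τ, RedW (In ρ ba) ba (Lin (t (tx τ)) ++ Lin (t (ty τ))) := by
      intro τ
      refine (redW_te hI (TE.trans (TE.app (L1 (t (tx τ))) (L1 (t (ty τ)))) (TE.refl _))).1 ?_
      exact (redW_te hI (htr τ)).2 (hred _)
    have hsw : ∀ τ j, TE (In ρ ba) (f τ j 0 ++ f τ j 1 ++ f τ j 2 ++ f τ j 3) (f τ j 0 ++ f τ j 2 ++ f τ j 1 ++ f τ j 3) :=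
      fun τ j => TE.swap _ _ _ _ (hf3 τ j)
    have hr0 : ∀ τ j, RedW (In ρ ba) ba (f τ j 0 ++ f τ j 1 ++ f τ j 2 ++ f τ j 3) := by
      intro τ j
      induction j with
      | zero => rw [← hf0]; exact hxy τ
      | succ j ih => rw [← hf1]; exact (redW_te hI (hsw τ j)).1 ih
    have hr1 : ∀ τ j, RedW (In ρ ba) ba (f τ j 0 ++ f τ j 2 ++ f τ j 1 ++ f τ j 3) :=
      fun τ j => (redW_te hI (hsw τ j)).1 (hr0 τ j)
    obtain ⟨h, hh, hout⟩ := hcomp σ hBC (by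
      rintro i j (⟨a, rfl, rfl⟩ | ⟨τ, rfl, rfl⟩ | ⟨τ, m, m', hm, rfl, rfl⟩ | ⟨τ, rfl, rfl⟩)
      · rw [ea, ew, hcst]
        exact (List.perm_singleton.1 (L1 [a]).perm.symm).symm
      · rw [et, e0]; exact hf0 τ
      · rw [e1, e0, hm]; exact hf1 τ m
      · rw [e1, ew]; exact hf2 τ) (by
      rintro (w | a | τ | ⟨τ, j, k⟩)
      · change Red ba ((w0 (jw w)).flatMap (ev σ))
        rw [ew]; exact hred' (hLr w)
      · change Red ba ((w0 (ja a)).flatMap (ev σ))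
        rw [ea]; exact List.isChain_singleton _
      · change Red ba ((w0 (jt τ)).flatMap (ev σ))
        rw [et]; exact hred' (hxy τ)
      · change Red ba ((w0 (jx τ j k)).flatMap (ev σ))
        fin_cases k
        · exact (e0 τ j).symm ▸ hred' (hr0 τ j)
        · exact (e1 τ j).symm ▸ hred' (hr1 τ j)
        · exact (e2 τ j).symm ▸ hred' (hr0 τ j).append_left.append_left.append_right
        · exact (e3 τ j).symm ▸ hred' (hr0 τ j).append_left.append_right)
    have m1 : h ∈ S1 := by
      refine (hS1m h hh _ hout).2 ?_
      intro τ j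
      simp only [alph_foldr, e2, e3]
      exact hf3 τ j
    have m2 : h ∈ S2 := by
      refine (hS2m h m1 _ hout).2 ?_
      intro w
      simp only [redW_foldr, ew]
      exact hLr w
    refine ⟨h, m2, fun w => ⟨Lin (t w), L1 _, ?_⟩⟩
    have := hout (jw w)
    rwa [ew] at this

end thmEsec

section grp

theorem mk_eq_iff {R Γ : Type u} (ρ : Γ → Set R) (x y : List Γ) :
    traceMk ρ (FreeMonoid.ofList x) = traceMk ρ (FreeMonoid.ofList y) ↔ TE (In0 ρ) x y := by
  have hs : ∀ a b, In0 ρ a b → In0 ρ b a := fun a b h => by unfold In0 at *; rw [Set.inter_comm]; exact h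
  constructor
  · intro h
    let c : Con (FreeMonoid Γ) :=
      { r := fun x y => TE (In0 ρ) (FreeMonoid.toList x) (FreeMonoid.toList y)
        iseqv := ⟨fun _ => TE.refl _, fun h => h.symm hs, fun h h' => h.trans h'⟩
        mul' := fun h h' => TE.app h h' }
    have hle : traceCon Γ ρ ≤ c := by
      refine Con.conGen_le.2 ?_
      rintro _ _ ⟨a, b, hab, rfl, rfl⟩
      exact TE.swap2 a b [] hab
    exact hle ((Con.eq _).1 h)
  · intro h
    refine TE.step_rec (P := fun x y => traceMk ρ (FreeMonoid.ofList x) = traceMk ρ (FreeMonoid.ofList y))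
      (fun _ => rfl) (fun _ _ _ h1 h2 => h1.trans h2) ?_ h
    intro p a b s hab
    have h1 : traceMk ρ (FreeMonoid.of a * FreeMonoid.of b) = traceMk ρ (FreeMonoid.of b * FreeMonoid.of a) :=
      (Con.eq _).2 (ConGen.Rel.of _ _ ⟨a, b, hab, rfl, rfl⟩)
    have h2 : ∀ a b : Γ, FreeMonoid.ofList (p ++ a :: b :: s) =
        FreeMonoid.ofList p * (FreeMonoid.of a * FreeMonoid.of b) * FreeMonoid.ofList s := by
      intro a b
      apply FreeMonoid.toList.injective
      simp [FreeMonoid.toList_mul]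
    rw [h2, h2, map_mul, map_mul, h1, ← map_mul, ← map_mul]

variable {R A : Type u} {ρ : A → Set R} {ba : A → A}

/-- image in the group -/
def gm (ρ : A → Set R) (ba : A → A) (w : List A) : (raagCon ρ ba).Quotient :=
  (raagCon ρ ba).mk' (traceMk ρ (FreeMonoid.ofList w))

theorem gm_append (x y : List A) : gm ρ ba (x ++ y) = gm ρ ba x * gm ρ ba y := by
  unfold gm; rw [FreeMonoid.ofList_append, map_mul, map_mul]

theorem gm_nil : gm ρ ba [] = 1 := rfl

theorem gm_te0 {x y : List A} (h : TE (In0 ρ) x y) : gm ρ ba x = gm ρ ba y := by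
  unfold gm; rw [(mk_eq_iff ρ x y).2 h]

theorem gm_te {x y : List A} (h : TE (In ρ ba) x y) : gm ρ ba x = gm ρ ba y :=
  gm_te0 (h.mono (fun _ _ h => h.1))

theorem gm_pair (a : A) : gm ρ ba [a, ba a] = 1 := by
  have : (raagCon ρ ba).mk' (traceOf ρ a * traceOf ρ (ba a)) = (raagCon ρ ba).mk' 1 :=
    (Con.eq _).2 (ConGen.Rel.of _ _ ⟨a, rfl, rfl⟩)
  rw [map_one] at this
  rw [← this]
  rfl

theorem gm_inv (c : List A) : gm ρ ba (c ++ lstar ba c) = 1 := by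
  induction c with
  | nil => rfl
  | cons a c ih =>
    have : a :: c ++ lstar ba (a :: c) = [a] ++ (c ++ lstar ba c) ++ [ba a] := by simp [lstar_cons]
    rw [this, gm_append, gm_append, ih, mul_one, ← gm_append]
    exact gm_pair a

theorem gm_inv' (hba : Function.Involutive ba) (c : List A) : gm ρ ba (lstar ba c ++ c) = 1 := by
  have := gm_inv (ρ := ρ) (ba := ba) (lstar ba c)
  rwa [lstar_lstar hba] at this

theorem gm_eq_te (hba : Function.Involutive ba) (hρ : ∀ a, ρ (ba a) = ρ a) {x y : List A}
    (h : gm ρ ba x = gm ρ ba y) : TE (In ρ ba) (nf (In ρ ba) ba x) (nf (In ρ ba) ba y) := by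
  have hI := ic_In hba hρ
  let st : Setoid {w : List A // RedW (In ρ ba) ba w} :=
    ⟨fun x y => TE (In ρ ba) x.1 y.1, ⟨fun _ => TE.refl _, fun h => h.symm hI.symm, fun h h' => h.trans h'⟩⟩
  let Q := Quotient st
  let aQ : A → Function.End Q := fun a => (Quotient.map (fun w => ⟨act (In ρ ba) ba a w.1, redW_act hI a w.2⟩)
    (fun x y h => act_te hI a h) : Q → Q)
  have hinv : ∀ a, aQ a * aQ (ba a) = 1 := by
    intro a
    funext q
    induction q using Quotient.inductionOn with
    | h w =>
      refine Quotient.sound (s := st) ?_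
      have := act_act hI (ba a) w.2
      rw [hI.inv] at this
      exact this
  let Φ : FreeMonoid A →* Function.End Q := FreeMonoid.lift aQ
  have hle : traceCon A ρ ≤ Con.ker Φ := by
    refine Con.conGen_le.2 ?_
    rintro _ _ ⟨a, b, hab, rfl, rfl⟩
    change Φ _ = Φ _
    rw [map_mul, map_mul]
    simp only [Φ, FreeMonoid.lift_eval_of]
    by_cases h1 : b = a
    · subst h1; rfl
    · by_cases h2 : b = ba a
      · subst h2
        have := hinv (ba a)
        rw [hba] at this
        rw [hinv, this]
      · funext q
        induction q using Quotient.inductionOn with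
        | h w => exact Quotient.sound (s := st) (act_comm hI ⟨hab, h1, h2⟩ w.1)
  let Φ1 : Trace A ρ →* Function.End Q := Con.lift _ Φ hle
  have hΦ1 : ∀ x, Φ1 (traceMk ρ x) = Φ x := fun x => rfl
  have hle2 : raagCon ρ ba ≤ Con.ker Φ1 := by
    refine Con.conGen_le.2 ?_
    rintro _ _ ⟨a, rfl, rfl⟩
    change Φ1 _ = Φ1 _
    rw [map_mul, map_one]
    exact hinv a
  have key : Φ (FreeMonoid.ofList x) = Φ (FreeMonoid.ofList y) := by
    have : raagCon ρ ba (traceMk ρ (FreeMonoid.ofList x)) (traceMk ρ (FreeMonoid.ofList y)) := (Con.eq _).1 h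
    exact hle2 this
  have hnf : ∀ w : List A, Φ (FreeMonoid.ofList w) (Quotient.mk st ⟨[], trivial⟩) =
      Quotient.mk st ⟨nf (In ρ ba) ba w, redW_nf hI w⟩ := by
    intro w
    induction w with
    | nil => rfl
    | cons a w ih =>
      rw [FreeMonoid.ofList_cons, map_mul]
      change Φ (FreeMonoid.of a) (Φ (FreeMonoid.ofList w) _) = _
      rw [ih]
      simp only [Φ, FreeMonoid.lift_eval_of]
      rfl
  have := congrFun key (Quotient.mk st ⟨[], trivial⟩)
  rw [hnf, hnf] at this
  exact Quotient.exact this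

theorem thmF {X : Type u} [Finite R] [Finite A] [Finite X] (ρ : A → Set R)
    {ba : A → A} (hba : Function.Involutive ba) (hfp : ∀ a, ba a ≠ a) (hρ : ∀ a, ρ (ba a) = ρ a)
    (bx : X → X) (E : List (A ⊕ X)) :
    ∃ (C : Type u) (_ : Finite C) (cn : A → C) (o : X → C) (S : Set (Monoid.End (FreeMonoid C))),
      Function.Injective cn ∧ RationalSet S ∧ (∀ h ∈ S, ∀ a, h (FreeMonoid.of (cn a)) = FreeMonoid.of (cn a)) ∧
      (∀ h ∈ S, ∀ d, ∃ w : List A, FreeMonoid.toList (h (FreeMonoid.of d)) = w.map cn) ∧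
      (∀ h ∈ S, ∃ s : X → List A, (∀ w, RedW (In ρ ba) ba (s w)) ∧ BC ba bx s ∧
        gm ρ ba (E.flatMap (ev s)) = 1 ∧
        ∀ w, FreeMonoid.toList (h (FreeMonoid.of (o w))) = (s w).map cn) ∧
      ∀ t : X → List A, (∀ w, RedW (In ρ ba) ba (t w)) → (∀ w, TE (In ρ ba) (t (bx w)) (lstar ba (t w))) →
        gm ρ ba (E.flatMap (ev t)) = 1 →
        ∃ h ∈ S, ∀ w, ∃ v, TE (In ρ ba) (t w) v ∧ FreeMonoid.toList (h (FreeMonoid.of (o w))) = v.map cn := by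
  have hI := ic_In hba hρ
  let n := E.length
  let W := (A ⊕ X) ⊕ (Fin (n+1) × Fin 4 × Bool)
  let wb : W → W := Sum.elim (fun p => Sum.inl (Sum.map ba bx p)) (fun x => Sum.inr (x.1, x.2.1, !x.2.2))
  let g : Fin (n+1) → Fin 4 → Bool → W := fun i k b => Sum.inr (i, k, b)
  let Tr := ULift.{u} ((Fin n × Fin 3) ⊕ Bool)
  let fs : Fin n → Fin (n+1) := Fin.castSucc
  let tt : Tr → W × W × W := fun t => Sum.elim (fun x : Fin n × Fin 3 =>
    ![(g (fs x.1) 1 false, g (fs x.1) 2 false, g (fs x.1) 0 false),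
      (g (fs x.1) 2 true, g (fs x.1) 3 false, Sum.inl (E.get x.1)),
      (g (fs x.1) 1 false, g (fs x.1) 3 false, g x.1.succ 0 false)] x.2)
    (fun b => bif b then (g 0 0 false, g 0 0 false, g 0 0 false)
      else (g (Fin.last n) 0 false, g (Fin.last n) 0 false, g (Fin.last n) 0 false)) t.down
  obtain ⟨C, hC, cn, o, S, hcn, hS, hfix, hintr, hsound, hcomp⟩ :=
    thmE (W := W) (Tr := Tr) ρ hba hfp hρ wb (fun a => Sum.inl (Sum.inl a)) (fun t => (tt t).1) (fun t => (tt t).2.1)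
      (fun t => (tt t).2.2)
  refine ⟨C, hC, cn, fun x => o (Sum.inl (Sum.inr x)), S, hcn, hS, hfix, hintr, ?_, ?_⟩
  · intro h hh
    obtain ⟨s, hred, hBC, hcst, htr, hout⟩ := hsound h hh
    refine ⟨fun x => s (Sum.inl (Sum.inr x)), fun x => hred _, fun x => hBC (Sum.inl (Sum.inr x)), ?_, fun x => hout _⟩
    have hev : ∀ p, ev (fun x => s (Sum.inl (Sum.inr x))) p = s (Sum.inl p) := by
      rintro (a | x)
      · simp [ev, hcst]
      · simp [ev]
    have hnil : ∀ w, TE (In ρ ba) (s w ++ s w) (s w) → s w = [] := by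
      intro w h
      have := h.perm.length_eq
      rw [List.length_append] at this
      exact List.length_eq_zero_iff.1 (by omega)
    have h0 : s (g 0 0 false) = [] := hnil _ (htr ⟨Sum.inr true⟩)
    have hn : s (g (Fin.last n) 0 false) = [] := hnil _ (htr ⟨Sum.inr false⟩)
    have hstep : ∀ i : Fin n, gm ρ ba (s (g i.succ 0 false)) =
        gm ρ ba (s (g (fs i) 0 false)) * gm ρ ba (s (Sum.inl (E.get i))) := by
      intro i
      have h1 := gm_te (htr ⟨Sum.inl (i, 0)⟩)
      have h2 := gm_te (htr ⟨Sum.inl (i, 1)⟩)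
      have h3 := gm_te (htr ⟨Sum.inl (i, 2)⟩)
      simp only [tt, Sum.elim_inl, Matrix.cons_val] at h1 h2 h3
      have h4 : s (g (fs i) 2 true) = lstar ba (s (g (fs i) 2 false)) := hBC (g (fs i) 2 false)
      rw [← h1, ← h2, ← h3, h4, gm_append, gm_append, gm_append]
      have h5 := gm_inv (ρ := ρ) (ba := ba) (s (g (fs i) 2 false))
      rw [gm_append] at h5
      rw [mul_assoc, ← mul_assoc (gm ρ ba (s (g (fs i) 2 false))), h5, one_mul]
    have hind : ∀ m (hm : m < n + 1), gm ρ ba (s (g ⟨m, hm⟩ 0 false)) =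
        gm ρ ba ((E.take m).flatMap (ev (fun x => s (Sum.inl (Sum.inr x))))) := by
      intro m
      induction m with
      | zero =>
        intro hm
        have : s (g ⟨0, hm⟩ 0 false) = [] := h0
        rw [this]; simp
      | succ m ih =>
        intro hm
        have hm' : m < n := by omega
        have h1 := hstep ⟨m, hm'⟩
        have h2 := ih (by omega)
        rw [List.take_succ_eq_append_getElem hm', List.flatMap_append, gm_append, ← h2]
        simp only [List.flatMap_cons, List.flatMap_nil, List.append_nil, hev]
        exact h1
    have := hind n (by omega)
    have h6 : E.take n = E := List.take_length
    rw [h6] at this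
    rw [← this]
    change gm ρ ba (s (g (Fin.last n) 0 false)) = 1
    rw [hn]; rfl
  · intro t hred hbar hE
    have hintr' : ∀ g y : {w : List A // RedW (In ρ ba) ba w}, ∃ u c v, TE (In ρ ba) g.1 (u ++ c) ∧
        TE (In ρ ba) y.1 (lstar ba c ++ v) ∧ RedW (In ρ ba) ba (u ++ v) :=
      fun g y => interface' hI _ le_rfl g.2 y.2
    choose u c v hu hc hv using hintr'
    have hevr : ∀ p, RedW (In ρ ba) ba (ev t p) := by
      rintro (a | x)
      · exact ⟨id, trivial⟩
      · exact hred x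
    let y : ℕ → {w : List A // RedW (In ρ ba) ba w} := fun i =>
      if h : i < n then ⟨ev t (E.get ⟨i, h⟩), hevr _⟩ else ⟨[], trivial⟩
    let G : ℕ → {w : List A // RedW (In ρ ba) ba w} := fun i =>
      Nat.rec ⟨[], trivial⟩ (fun i g => ⟨u g (y i) ++ v g (y i), hv g (y i)⟩) i
    have hG0 : G 0 = ⟨[], trivial⟩ := rfl
    have hGs : ∀ i, (G (i+1)).1 = u (G i) (y i) ++ v (G i) (y i) := fun i => rfl
    have hy : ∀ i (h : i < n), (y i).1 = ev t (E.get ⟨i, h⟩) := by intro i h; simp [y, h]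
    have hgm : ∀ i, gm ρ ba (G (i+1)).1 = gm ρ ba (G i).1 * gm ρ ba (y i).1 := by
      intro i
      rw [hGs, gm_te (hu (G i) (y i)), gm_te (hc (G i) (y i)), gm_append, gm_append, gm_append]
      have h5 := gm_inv (ρ := ρ) (ba := ba) (c (G i) (y i))
      rw [gm_append] at h5
      rw [mul_assoc, ← mul_assoc (gm ρ ba (c (G i) (y i))), h5, one_mul]
    have hGE : ∀ m, m ≤ n → gm ρ ba (G m).1 = gm ρ ba ((E.take m).flatMap (ev t)) := by
      intro m
      induction m with
      | zero => intro _; simp [hG0]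
      | succ m ih =>
        intro hm
        have hm' : m < n := by omega
        rw [hgm, ih (by omega), hy m hm', List.take_succ_eq_append_getElem hm', List.flatMap_append, gm_append]
        simp
    have hGn : (G n).1 = [] := by
      have h1 := hGE n le_rfl
      have h6 : E.take n = E := List.take_length
      rw [h6, hE, ← gm_nil] at h1
      have h2 := gm_eq_te hba hρ h1
      rw [nf_red (G n).2] at h2
      exact List.perm_nil.1 h2.perm
    let val : ℕ → Fin 4 → List A := fun i => ![(G i).1, u (G i) (y i), c (G i) (y i), v (G i) (y i)]
    have hval : ∀ i k, RedW (In ρ ba) ba (val i k) := by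
      intro i k
      have h1 := (redW_te hI (hu (G i) (y i))).1 (G i).2
      have h2 := (redW_te hI (hc (G i) (y i))).1 (y i).2
      fin_cases k
      · exact (G i).2
      · exact h1.append_left
      · exact h1.append_right
      · exact h2.append_right
    let t' : W → List A := Sum.elim (fun p => ev t p) (fun x =>
      if x.2.2 then lstar ba (val x.1.val x.2.1) else val x.1.val x.2.1)
    obtain ⟨h, hh, hout⟩ := hcomp t' (by
      rintro (p | ⟨i, k, b⟩)
      · exact hevr p
      · cases b
        · simpa [t'] using hval _ _
        · simpa [t'] using redW_lstar hI (hval _ _)) (by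
      rintro ((a | x) | ⟨i, k, b⟩)
      · exact TE.refl _
      · exact hbar x
      · have : t' (wb (Sum.inr (i, k, b))) = lstar ba (t' (Sum.inr (i, k, b))) := by
          cases b
          · simp [t', wb]
          · simp [t', wb, lstar_lstar hba]
        rw [this]; exact TE.refl _) (fun a => rfl) (by
      rintro ⟨⟨i, k⟩ | b⟩
      · fin_cases k
        · simpa [tt, t', g, val, fs] using (hu (G i) (y i)).symm hI.symm
        · have := (hc (G i) (y i)).symm hI.symm
          rw [hy i i.2] at this
          simpa [tt, t', g, val, fs] using this
        · have : TE (In ρ ba) (u (G i) (y i) ++ v (G i) (y i)) (G (i+1)).1 := by rw [hGs]; exact TE.refl _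
          simpa [tt, t', g, val, fs] using this
      · cases b
        · simp [tt, t', g, val, hGn]; exact TE.refl _
        · simp [tt, t', g, val, hG0]; exact TE.refl _)
    exact ⟨h, hh, fun w => hout (Sum.inl (Sum.inr w))⟩

end grp

section comm

theorem comm_pre {α : Type u} {x y : List α} (h : x ++ y = y ++ x) :
    (∃ y', y = x ++ y' ∧ x ++ y' = y' ++ x) ∨ (y.length < x.length ∧ y <+: x) := by
  rcases Nat.lt_or_ge y.length x.length with h1 | h1
  · exact Or.inr ⟨h1, List.prefix_of_prefix_length_le (⟨x, rfl⟩ : y <+: y ++ x) ⟨y, h⟩ h1.le⟩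
  · left
    obtain ⟨y', rfl⟩ := List.prefix_of_prefix_length_le (⟨y, rfl⟩ : x <+: x ++ y) ⟨x, h.symm⟩ h1
    refine ⟨y', rfl, ?_⟩
    rw [List.append_assoc] at h
    exact List.append_cancel_left h

theorem comm_mem {α : Type u} {x : List α} (hx : x ≠ []) (n : ℕ) : ∀ y : List α, y.length ≤ n →
    x ++ y = y ++ x → ∀ b ∈ y, b ∈ x := by
  have hl := List.length_pos_iff.2 hx
  induction n with
  | zero => intro y hy _ b hb; simp at hy; subst hy; simp at hb
  | succ n ih =>
    intro y hy h b hb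
    rcases comm_pre h with ⟨y', rfl, h'⟩ | ⟨_, h'⟩
    · rcases List.mem_append.1 hb with hb | hb
      · exact hb
      · exact ih y' (by simp at hy; omega) h' b hb
    · exact h'.subset hb

theorem comm_eq {α : Type u} {x : List α} (hx : x ≠ []) (n : ℕ) : ∀ y z : List α, y.length ≤ n → y.length = z.length →
    x ++ y = y ++ x → x ++ z = z ++ x → y = z := by
  have hl := List.length_pos_iff.2 hx
  induction n with
  | zero => intro y z hy hyz _ _; rw [List.length_eq_zero_iff.1 (by omega : y.length = 0), List.length_eq_zero_iff.1 (by omega : z.length = 0)]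
  | succ n ih =>
    intro y z hy hyz h1 h2
    rcases comm_pre h1 with ⟨y', rfl, h1'⟩ | ⟨hl1, h1'⟩ <;> rcases comm_pre h2 with ⟨z', rfl, h2'⟩ | ⟨hl2, h2'⟩
    · simp at hyz hy
      rw [ih y' z' (by omega) hyz h1' h2']
    · simp at hyz; omega
    · simp at hyz; omega
    · exact (List.prefix_of_prefix_length_le h1' h2' hyz.le).eq_of_length hyz

variable {R A : Type u} {ρ : A → Set R} {ba : A → A}

theorem filter_te {x y : List A} (r : R) (h : TE (In0 ρ) x y) :
    x.filter (fun a => r ∈ ρ a) = y.filter (fun a => r ∈ ρ a) := by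
  refine TE.step_rec (P := fun x y => x.filter (fun a => r ∈ ρ a) = y.filter (fun a => r ∈ ρ a))
    (fun _ => rfl) (fun _ _ _ h1 h2 => h1.trans h2) ?_ h
  intro p a b s hab
  rw [List.filter_append, List.filter_append]
  congr 1
  by_cases ha : r ∈ ρ a
  · have hb : r ∉ ρ b := fun hb => by
      have : r ∈ ρ a ∩ ρ b := ⟨ha, hb⟩
      rw [hab] at this; exact this
    simp [List.filter_cons, ha, hb]
  · simp [List.filter_cons, ha]

theorem filter_lstar (hρ : ∀ a, ρ (ba a) = ρ a) (P : Set R → Prop) (w : List A) :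
    (lstar ba w).filter (fun a => P (ρ a)) = lstar ba (w.filter (fun a => P (ρ a))) := by
  induction w with
  | nil => rfl
  | cons a w ih =>
    rw [lstar_cons, List.filter_append, ih]
    by_cases h : P (ρ a)
    · simp [List.filter_cons, h, hρ, lstar_cons]
    · simp [List.filter_cons, h, hρ]

theorem proj_te : ∀ x y : List A, (∀ a ∈ x, (ρ a).Nonempty) → (∀ a ∈ y, (ρ a).Nonempty) →
    (∀ r, x.filter (fun a => r ∈ ρ a) = y.filter (fun a => r ∈ ρ a)) → TE (In0 ρ) x y := by
  intro x
  induction x with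
  | nil =>
    intro y _ hy h
    rcases y with _ | ⟨b, y⟩
    · exact TE.refl _
    · obtain ⟨r, hr⟩ := hy b (by simp)
      have := h r
      simp [hr] at this
  | cons a x ih =>
    intro y hx hy h
    have hay : a ∈ y := by
      obtain ⟨r, hr⟩ := hx a (by simp)
      have h1 : a ∈ (a :: x).filter (fun a => r ∈ ρ a) := by simp [hr]
      rw [h r] at h1
      exact (List.mem_filter.1 h1).1
    obtain ⟨p, q, rfl, hap⟩ := List.eq_append_cons_of_mem hay
    have hpi : ∀ b ∈ p, In0 ρ a b := by
      intro b hb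
      by_contra hne
      obtain ⟨r, hr1, hr2⟩ := Set.nonempty_iff_ne_empty.2 hne
      have h1 := h r
      rw [List.filter_append] at h1
      have hb' : b ∈ p.filter (fun a => r ∈ ρ a) := by simp [hb, hr2]
      have hsub : ∀ c ∈ p.filter (fun a => r ∈ ρ a), c ∈ p := fun c hc => (List.mem_filter.1 hc).1
      rcases hp : p.filter (fun a => r ∈ ρ a) with _ | ⟨c, p'⟩
      · rw [hp] at hb'; simp at hb'
      · rw [hp] at h1 hsub
        simp [hr1] at h1
        exact hap (h1.1 ▸ hsub c (by simp))
    have h1 : TE (In0 ρ) (a :: (p ++ q)) (p ++ a :: q) := by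
      have := TE.swap (I := In0 ρ) [] [a] p q (by simpa using hpi)
      simpa using this
    refine (TE.cons a (ih (p ++ q) (fun b hb => hx b (by simp [hb])) (fun b hb => hy b (by
      rcases List.mem_append.1 hb with hb | hb <;> simp [hb])) ?_)).trans h1
    intro r
    have h2 := (h r).trans (filter_te r h1).symm
    by_cases hr : r ∈ ρ a
    · simpa [List.filter_cons, hr] using h2
    · simpa [List.filter_cons, hr] using h2

theorem split_te {I : A → A → Prop} (hs : ∀ a b, I a b → I b a) (P : A → Prop) : ∀ w : List A,
    (∀ a ∈ w, ∀ b ∈ w, P a → ¬ P b → I a b) → TE I w (w.filter (fun a => P a) ++ w.filter (fun a => ¬ P a)) := by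
  intro w
  induction w with
  | nil => intro _; exact TE.refl _
  | cons a w ih =>
    intro h
    have ih' := TE.cons a (ih (fun b hb c hc => h b (by simp [hb]) c (by simp [hc])))
    by_cases ha : P a
    · simpa [List.filter_cons, ha] using ih'
    · have := TE.swap (I := I) [] [a] (w.filter (fun a => P a)) (w.filter (fun a => ¬ P a)) (by
        simp only [List.mem_singleton, List.mem_filter]
        rintro _ rfl b hb
        exact hs _ _ (h b (by simp [hb.1]) _ (by simp) (by simpa using hb.2) ha))
      simp only [List.filter_cons, ha]
      simpa using ih'.trans (by simpa using this)

theorem comm_lemma [Finite R] [Finite A] (hba : Function.Involutive ba) (hfp : ∀ a, ba a ≠ a)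
    (hρ : ∀ a, ρ (ba a) = ρ a) {x y : List A} (hy : RedW (In ρ ba) ba y)
    (h1 : TE (In0 ρ) (x ++ y) (y ++ x)) (h2 : TE (In0 ρ) (x ++ lstar ba y) (lstar ba y ++ x)) :
    ∀ a ∈ x, ∀ b ∈ y, ρ a ∩ ρ b = ∅ := by
  have hI := ic_In hba hρ
  let P : Set R := {r | (∃ a ∈ x, r ∈ ρ a) ∧ ∃ b ∈ y, r ∈ ρ b}
  have hmeet : ∀ r ∈ P, (∀ b ∈ y, r ∈ ρ b → b ∈ x) ∧
      y.filter (fun a => r ∈ ρ a) = lstar ba (y.filter (fun a => r ∈ ρ a)) := by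
    rintro r ⟨⟨a, ha, har⟩, _⟩
    have e1 := filter_te r h1
    have e2 := filter_te r h2
    rw [List.filter_append, List.filter_append] at e1 e2
    rw [filter_lstar hρ (fun s => r ∈ s)] at e2
    have hne : x.filter (fun a => r ∈ ρ a) ≠ [] := by
      apply List.ne_nil_of_mem (a := a); simp [ha, har]
    refine ⟨fun b hb hbr => ?_, comm_eq hne _ _ _ le_rfl (length_lstar _ _).symm e1 e2⟩
    have := comm_mem hne _ _ le_rfl e1 b (by simp [hb, hbr])
    exact (List.mem_filter.1 this).1
  let M : A → Prop := fun b => (ρ b ∩ P).Nonempty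
  have hM : ∀ b ∈ y, M b → ρ b ⊆ P := by
    rintro b hb ⟨r, hr, hrP⟩ r' hr'
    exact ⟨⟨b, (hmeet r hrP).1 b hb hr, hr'⟩, b, hb, hr'⟩
  have hsp := split_te (I := In ρ ba) hI.symm M y (by
    intro a ha b hb hMa hMb
    refine ⟨?_, ?_, ?_⟩
    · rw [← Set.not_nonempty_iff_eq_empty]
      rintro ⟨r, hra, hrb⟩
      exact hMb ⟨r, hrb, hM a ha hMa hra⟩
    · rintro rfl; exact hMb hMa
    · rintro rfl; apply hMb; simp only [M]; rw [hρ]; exact hMa)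
  have hred : RedW (In ρ ba) ba (y.filter (fun a => M a)) := ((redW_te hI hsp).1 hy).append_left
  have hself : TE (In0 ρ) (y.filter (fun a => M a)) (lstar ba (y.filter (fun a => M a))) := by
    have hne : ∀ a ∈ y.filter (fun a => M a), (ρ a).Nonempty := by
      intro a ha
      obtain ⟨r, hr, _⟩ : M a := by simpa using (List.mem_filter.1 ha).2
      exact ⟨r, hr⟩
    refine proj_te _ _ hne ?_ ?_
    · intro a ha
      obtain ⟨b, hb, rfl⟩ : ∃ b ∈ y.filter (fun a => M a), ba b = a := by simpa [lstar] using ha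
      rw [hρ]; exact hne b hb
    · intro r
      rw [filter_lstar hρ (fun s => r ∈ s), List.filter_filter]
      by_cases hr : r ∈ P
      · have : y.filter (fun a => decide (r ∈ ρ a) && decide (M a)) = y.filter (fun a => r ∈ ρ a) := by
          apply List.filter_congr
          intro a _
          by_cases har : r ∈ ρ a
          · have : M a := ⟨r, har, hr⟩
            simp [har, this]
          · simp [har]
        rw [this]
        exact (hmeet r hr).2
      · have : y.filter (fun a => decide (r ∈ ρ a) && decide (M a)) = [] := by
          rw [List.filter_eq_nil_iff]
          intro a ha
          simp only [Bool.and_eq_true, decide_eq_true_eq]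
          rintro ⟨h3, h4⟩
          exact hr (hM a ha h4 h3)
        rw [this]; rfl
  have hnil : y.filter (fun a => M a) = [] := by
    obtain ⟨Lin, K, hL1, hL2, hL3, _⟩ := exists_Lin ρ hba hfp hρ
    have e1 := hL2 _ _ (te_In0 hba hρ hself hred)
    rw [hL3 _ ((tred_iff hI).2 hred)] at e1
    have hr : TRed (In ρ ba) ba (Lin (y.filter (fun a => M a))) :=
      (tred_iff hI).2 ((redW_te hI (hL1 _)).1 hred)
    have e2 := red_selfbar hba hfp _ hr.red e1.symm
    have e3 := hL1 (y.filter (fun a => M a))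
    rw [e2] at e3
    exact List.perm_nil.1 e3.perm
  intro a ha b hb
  rw [← Set.not_nonempty_iff_eq_empty]
  rintro ⟨r, hra, hrb⟩
  have : b ∈ y.filter (fun a => M a) := by
    have : M b := ⟨r, hrb, ⟨a, ha, hra⟩, b, hb, hrb⟩
    simp [hb, this]
  rw [hnil] at this
  simp at this

end comm

section fin

theorem mk_surj {R Γ : Type u} (ρ : Γ → Set R) (t : Trace Γ ρ) : ∃ w : List Γ, t = traceMk ρ (FreeMonoid.ofList w) := by
  obtain ⟨w, hw⟩ := Con.mk'_surjective (c := traceCon Γ ρ) t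
  exact ⟨FreeMonoid.toList w, hw.symm⟩

variable {R A X N : Type u} [Monoid N]

theorem In0.symm {ρ : A → Set R} : ∀ a b, In0 ρ a b → In0 ρ b a :=
  fun a b h => by unfold In0 at *; rw [Set.inter_comm]; exact h

/-- word-level solutions -/
structure SolW (ba : A → A) (bx : X → X) (ρ : A ⊕ X → Set R) (ρA : A → Set R)
    (μ : Trace (A ⊕ X) ρ →* N) (E : List (A ⊕ X)) (s : X → List A) : Prop where
  red : ∀ x, RedW (In ρA ba) ba (s x)
  bar : ∀ x, TE (In ρA ba) (s (bx x)) (lstar ba (s x))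
  eqn : gm ρA ba (E.flatMap (ev s)) = 1
  com : ∀ p q, ρ p ∩ ρ q = ∅ → ∀ a ∈ ev s p, ∀ b ∈ ev s q, ρA a ∩ ρA b = ∅
  mon : ∀ x, μ (traceMk ρ (FreeMonoid.ofList ((s x).map Sum.inl))) = μ (traceOf ρ (Sum.inr x))

theorem star_flatMap {ba : A → A} {bx : X → X} {I : A → A → Prop} {s : X → List A}
    (hb : ∀ x, TE I (s (bx x)) (lstar ba (s x))) (l : List (A ⊕ X)) :
    TE I ((lstar (Sum.map ba bx) l).flatMap (ev s)) (lstar ba (l.flatMap (ev s))) := by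
  induction l with
  | nil => exact TE.refl _
  | cons p l ih =>
    rw [lstar_cons, List.flatMap_append, List.flatMap_cons (xs := l), lstar_append]
    refine TE.app ih ?_
    rcases p with a | x
    · simpa [ev, lstar] using TE.refl _
    · simpa [ev] using hb x

theorem gm_eqn_iff {ba : A → A} {bx : X → X} {ρA : A → Set R} (hba : Function.Involutive ba) {s : X → List A}
    (hb : ∀ x, TE (In0 ρA) (s (bx x)) (lstar ba (s x))) (U V : List (A ⊕ X)) :
    gm ρA ba ((U ++ lstar (Sum.map ba bx) V).flatMap (ev s)) = 1 ↔
      gm ρA ba (U.flatMap (ev s)) = gm ρA ba (V.flatMap (ev s)) := by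
  rw [List.flatMap_append, gm_append, gm_te0 (star_flatMap hb V)]
  have h1 := gm_inv (ρ := ρA) (ba := ba) (V.flatMap (ev s))
  have h2 := gm_inv' (ρ := ρA) hba (V.flatMap (ev s))
  rw [gm_append] at h1 h2
  constructor
  · intro h
    have := congrArg (· * gm ρA ba (V.flatMap (ev s))) h
    simpa [mul_assoc, h2] using this
  · intro h
    rw [h, h1]

theorem te_inl {ρ : A ⊕ X → Set R} {ρA : A → Set R} (hρA : ∀ a : A, ρA a = ρ (Sum.inl a)) {x y : List A}
    (h : TE (In0 ρA) x y) : TE (In0 ρ) (x.map Sum.inl) (y.map Sum.inl) := by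
  obtain ⟨n, h⟩ := h
  exact ⟨n, h.map Sum.inl (fun a b hab => by unfold In0 at *; rwa [hρA, hρA] at hab)⟩

theorem hom_word {ρ : A ⊕ X → Set R} {ρA : A → Set R} {σ : Trace (A ⊕ X) ρ →* Trace A ρA} {s : X → List A}
    (h1 : ∀ a : A, σ (traceOf ρ (Sum.inl a)) = traceOf ρA a)
    (h2 : ∀ x, σ (traceOf ρ (Sum.inr x)) = traceMk ρA (FreeMonoid.ofList (s x))) (l : List (A ⊕ X)) :
    σ (traceMk ρ (FreeMonoid.ofList l)) = traceMk ρA (FreeMonoid.ofList (l.flatMap (ev s))) := by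
  induction l with
  | nil => 
    rw [FreeMonoid.ofList_nil, map_one, map_one, List.flatMap_nil, FreeMonoid.ofList_nil, map_one]
  | cons p l ih =>
    rw [FreeMonoid.ofList_cons, map_mul, map_mul, ih, List.flatMap_cons, FreeMonoid.ofList_append, map_mul]
    congr 1
    rcases p with a | x
    · exact h1 a
    · exact h2 x

theorem solW_sound {ba : A → A} {bx : X → X} (hba : Function.Involutive ba) 
    {ρ : A ⊕ X → Set R} {ρA : A → Set R} (hρA : ∀ a : A, ρA a = ρ (Sum.inl a)) (hρ : ∀ a, ρA (ba a) = ρA a)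
    {μ : Trace (A ⊕ X) ρ →* N} {U V : FreeMonoid (A ⊕ X)} {s : X → List A}
    (hs : SolW ba bx ρ ρA μ (FreeMonoid.toList U ++ lstar (Sum.map ba bx) (FreeMonoid.toList V)) s) :
    ∃ σ, IsSolutionG ba bx ρ ρA μ U V σ ∧ ∀ x, σ (traceOf ρ (Sum.inr x)) = traceMk ρA (FreeMonoid.ofList (s x)) := by
  let f : FreeMonoid (A ⊕ X) →* Trace A ρA := FreeMonoid.lift (fun p => traceMk ρA (FreeMonoid.ofList (ev s p)))
  have hf : ∀ p, f (FreeMonoid.of p) = traceMk ρA (FreeMonoid.ofList (ev s p)) := fun p => FreeMonoid.lift_eval_of _ _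
  have hle : traceCon (A ⊕ X) ρ ≤ Con.ker f := by
    refine Con.conGen_le.2 ?_
    rintro _ _ ⟨p, q, hpq, rfl, rfl⟩
    change f _ = f _
    rw [map_mul, map_mul, hf, hf, ← map_mul (traceMk ρA), ← map_mul (traceMk ρA), ← FreeMonoid.ofList_append, ← FreeMonoid.ofList_append, mk_eq_iff]
    exact TE.comm (hs.com p q hpq)
  let σ : Trace (A ⊕ X) ρ →* Trace A ρA := (traceCon (A ⊕ X) ρ).lift f hle
  have hσ : ∀ p, σ (traceOf ρ p) = traceMk ρA (FreeMonoid.ofList (ev s p)) := fun p => hf p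
  have h1 : ∀ a : A, σ (traceOf ρ (Sum.inl a)) = traceOf ρA a := fun a => hσ (Sum.inl a)
  have h2 : ∀ x, σ (traceOf ρ (Sum.inr x)) = traceMk ρA (FreeMonoid.ofList (s x)) := fun x => hσ (Sum.inr x)
  have hw := hom_word h1 h2
  have hb0 : ∀ x, TE (In0 ρA) (s (bx x)) (lstar ba (s x)) := fun x => (hs.bar x).mono (fun _ _ h => h.1)
  refine ⟨σ, ⟨h1, ?_, ?_, ?_, ?_⟩, h2⟩
  · intro u w huw
    have e1 : TE (In0 ρA) ((FreeMonoid.toList u).flatMap (ev s)) (FreeMonoid.toList w) := by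
      rw [← mk_eq_iff]
      exact (hw (FreeMonoid.toList u)).symm.trans huw
    refine (hw (lstar (Sum.map ba bx) (FreeMonoid.toList u))).trans ?_
    change _ = traceMk ρA (FreeMonoid.ofList (lstar ba (FreeMonoid.toList w)))
    rw [mk_eq_iff]
    refine (star_flatMap hb0 _).trans (TE.lstar ?_ e1)
    intro a b hab
    unfold In0 at *
    rw [hρ, hρ, Set.inter_comm]; exact hab
  · rintro Y ⟨p, q, a, h⟩
    obtain ⟨p, rfl⟩ := mk_surj _ p
    obtain ⟨q, rfl⟩ := mk_surj _ q
    refine (tred_In0 hba hρ).2 (hs.red Y) p a q ?_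
    rw [← mk_eq_iff, ← h2, h]
    have : FreeMonoid.ofList (p ++ a :: ba a :: q) = FreeMonoid.ofList p * (FreeMonoid.of a * FreeMonoid.of (ba a)) * FreeMonoid.ofList q := by
      apply FreeMonoid.toList.injective
      simp [FreeMonoid.toList_mul]
    rw [this, map_mul, map_mul, map_mul]
    rfl
  · have := (gm_eqn_iff hba hb0 _ _).1 hs.eqn
    unfold gm at this
    rw [← hw, ← hw] at this
    exact this
  · intro Y w h
    rw [h2] at h
    have e := (mk_eq_iff ρA (s Y) (FreeMonoid.toList w)).1 h
    have e2 := (mk_eq_iff ρ _ _).2 (te_inl hρA e)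
    rw [← hs.mon Y, e2]
    rfl

theorem solW_complete [Finite R] [Finite A] {ba : A → A} {bx : X → X} (hba : Function.Involutive ba) (hfp : ∀ a, ba a ≠ a)
    {ρ : A ⊕ X → Set R} {ρA : A → Set R} (hρA : ∀ a : A, ρA a = ρ (Sum.inl a))
    (hρbar : ∀ x : A ⊕ X, ρ (Sum.map ba bx x) = ρ x)
    {μ : Trace (A ⊕ X) ρ →* N} {U V : FreeMonoid (A ⊕ X)} {s : X → List A}
    {σ : Trace (A ⊕ X) ρ →* Trace A ρA} (hσ : IsSolutionG ba bx ρ ρA μ U V σ)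
    (h2 : ∀ x, σ (traceOf ρ (Sum.inr x)) = traceMk ρA (FreeMonoid.ofList (s x))) :
    SolW ba bx ρ ρA μ (FreeMonoid.toList U ++ lstar (Sum.map ba bx) (FreeMonoid.toList V)) s := by
  have hρ : ∀ a, ρA (ba a) = ρA a := by
    intro a; rw [hρA, hρA]; exact hρbar (Sum.inl a)
  have hI := ic_In (ρ := ρA) hba hρ
  obtain ⟨h1, hst, hred, heq, hmon⟩ := hσ
  have hw := hom_word h1 h2
  have hred' : ∀ x, RedW (In ρA ba) ba (s x) := by
    intro x
    rw [← tred_In0 hba hρ]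
    intro p a q h
    refine hred x ⟨traceMk ρA (FreeMonoid.ofList p), traceMk ρA (FreeMonoid.ofList q), a, ?_⟩
    rw [h2, (mk_eq_iff _ _ _).2 h]
    have : FreeMonoid.ofList (p ++ a :: ba a :: q) = FreeMonoid.ofList p * (FreeMonoid.of a * FreeMonoid.of (ba a)) * FreeMonoid.ofList q := by
      apply FreeMonoid.toList.injective
      simp [FreeMonoid.toList_mul]
    rw [this, map_mul, map_mul, map_mul]
    rfl
  have hb0 : ∀ x, TE (In0 ρA) (s (bx x)) (lstar ba (s x)) := by
    intro x
    have := hst (FreeMonoid.of (Sum.inr x)) _ (h2 x)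
    rw [← mk_eq_iff, ← h2]
    exact this
  have hev : ∀ p, RedW (In ρA ba) ba (ev s p) := by
    rintro (a | x)
    · exact ⟨fun h => h.elim, trivial⟩
    · exact hred' x
  have hcomm : ∀ p q, ρ p ∩ ρ q = ∅ → TE (In0 ρA) (ev s p ++ ev s q) (ev s q ++ ev s p) := by
    intro p q hpq
    have e := (mk_eq_iff ρ [p, q] [q, p]).2 (TE.swap2 p q [] hpq)
    have e2 := congrArg σ e
    rw [hw, hw, mk_eq_iff] at e2
    simpa using e2
  refine ⟨hred', fun x => te_In0 hba hρ (hb0 x) (hred' _), ?_, ?_, ?_⟩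
  · rw [gm_eqn_iff hba hb0]
    unfold gm
    rw [← hw, ← hw]
    exact heq
  · intro p q hpq
    refine comm_lemma hba hfp hρ (hev q) (hcomm p q hpq) ?_
    have e := hcomm p (Sum.map ba bx q) (by rw [hρbar]; exact hpq)
    have e3 : TE (In0 ρA) (ev s (Sum.map ba bx q)) (lstar ba (ev s q)) := by
      rcases q with a | x
      · exact TE.refl _
      · exact hb0 x
    exact ((TE.app (TE.refl _) (e3.symm In0.symm)).trans e).trans (TE.app e3 (TE.refl _))
  · intro x
    exact hmon x (FreeMonoid.ofList (s x)) (h2 x)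

theorem hom_ext_X {ρ : A ⊕ X → Set R} {ρA : A → Set R} {σ τ : Trace (A ⊕ X) ρ →* Trace A ρA}
    (h1 : ∀ p, σ (traceOf ρ p) = τ (traceOf ρ p)) : σ = τ := by
  refine MonoidHom.ext fun t => ?_
  obtain ⟨w, rfl⟩ := mk_surj ρ t
  induction w with
  | nil => rw [FreeMonoid.ofList_nil, map_one, map_one, map_one]
  | cons p l ih =>
    rw [FreeMonoid.ofList_cons, map_mul, map_mul, ih, map_mul]
    congr 1
    exact h1 p

/-- transfer along equivalence -/
theorem sol_congr {ba : A → A} {ρ : A ⊕ X → Set R} {ρA : A → Set R} {σ : Trace (A ⊕ X) ρ →* Trace A ρA}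
    {s v : X → List A} (h : ∀ x, σ (traceOf ρ (Sum.inr x)) = traceMk ρA (FreeMonoid.ofList (s x)))
    (hv : ∀ x, TE (In ρA ba) (s x) (v x)) :
    ∀ x, σ (traceOf ρ (Sum.inr x)) = traceMk ρA (FreeMonoid.ofList (v x)) := by
  intro x
  rw [h, mk_eq_iff]
  exact (hv x).mono (fun _ _ h => h.1)

theorem fold_eq {ρ : A ⊕ X → Set R} (μ : Trace (A ⊕ X) ρ →* N) (w : List A) :
    w.foldr (fun a (q : N × Set A) => (μ (traceOf ρ (Sum.inl a)) * q.1, insert a q.2)) (1, ∅) =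
      (μ (traceMk ρ (FreeMonoid.ofList (w.map Sum.inl))), {a | a ∈ w}) := by
  induction w with
  | nil => simp
  | cons a w ih =>
    rw [List.foldr_cons, ih, List.map_cons, FreeMonoid.ofList_cons, map_mul, map_mul]
    refine Prod.ext rfl ?_
    ext b; simp

theorem map_cn_inj {C : Type u} {cn : A → C} (hcn : Function.Injective cn) {x y : List A} (h : x.map cn = y.map cn) : x = y :=
  List.map_injective_iff.2 hcn h

theorem main_thm [Finite R] [Finite A] [Finite X] [Finite N] {ba : A → A} {bx : X → X} (hba : Function.Involutive ba)
    (hfp : ∀ a, ba a ≠ a)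
    {ρ : A ⊕ X → Set R} {ρA : A → Set R} (hρA : ∀ a : A, ρA a = ρ (Sum.inl a))
    (hρbar : ∀ x : A ⊕ X, ρ (Sum.map ba bx x) = ρ x)
    (μ : Trace (A ⊕ X) ρ →* N) (U V : FreeMonoid (A ⊕ X)) :
    ∃ (C : Type u) (_ : Finite C) (cn : A → C) (o : X → C) (S : Set (Monoid.End (FreeMonoid C))),
      Function.Injective cn ∧ RationalSet S ∧ (∀ h ∈ S, ∀ a, h (FreeMonoid.of (cn a)) = FreeMonoid.of (cn a)) ∧
      (∀ h ∈ S, ∀ d, ∃ w : List A, FreeMonoid.toList (h (FreeMonoid.of d)) = w.map cn) ∧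
      (∀ h ∈ S, ∃ (s : X → List A) (σ : _), IsSolutionG ba bx ρ ρA μ U V σ ∧
        (∀ x, σ (traceOf ρ (Sum.inr x)) = traceMk ρA (FreeMonoid.ofList (s x))) ∧
        ∀ w, FreeMonoid.toList (h (FreeMonoid.of (o w))) = (s w).map cn) ∧
      ∀ σ, IsSolutionG ba bx ρ ρA μ U V σ → ∃ h ∈ S, ∃ s : X → List A,
        (∀ x, σ (traceOf ρ (Sum.inr x)) = traceMk ρA (FreeMonoid.ofList (s x))) ∧
        ∀ w, FreeMonoid.toList (h (FreeMonoid.of (o w))) = (s w).map cn := by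
  have hρ : ∀ a, ρA (ba a) = ρA a := by
    intro a; rw [hρA, hρA]; exact hρbar (Sum.inl a)
  obtain ⟨C, hC, cn, o, S, hcn, hS, hfix, hintr, hsound, hcomp⟩ := thmF ρA hba hfp hρ bx
    (FreeMonoid.toList U ++ lstar (Sum.map ba bx) (FreeMonoid.toList V))
  let Al : (X → N × Set A) → A ⊕ X → Set A := fun g => Sum.elim (fun a => {a}) (fun x => (g x).2)
  obtain ⟨S', hS'S, hS', hiff⟩ := rational_dfa hS hcn
    (fun a (q : N × Set A) => (μ (traceOf ρ (Sum.inl a)) * q.1, insert a q.2)) (1, ∅) o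
    (fun g => (∀ x, (g x).1 = μ (traceOf ρ (Sum.inr x))) ∧
      ∀ p q, ρ p ∩ ρ q = ∅ → ∀ a ∈ Al g p, ∀ b ∈ Al g q, ρA a ∩ ρA b = ∅)
  simp only [fold_eq] at hiff
  have hAl : ∀ (s : X → List A) (p : A ⊕ X) (a : A), a ∈ Al (fun j =>
      (μ (traceMk ρ (FreeMonoid.ofList ((s j).map Sum.inl))), {a | a ∈ s j})) p ↔ a ∈ ev s p := by
    rintro s (b | x) a <;> simp [Al, ev]
  simp only [hAl] at hiff
  refine ⟨C, hC, cn, o, S', hcn, hS', fun h hh => hfix h (hS'S hh), fun h hh => hintr h (hS'S hh), ?_, ?_⟩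
  · intro h hh
    obtain ⟨s, h1, h2, h3, h4⟩ := hsound h (hS'S hh)
    obtain ⟨h5, h6⟩ := (hiff h (hS'S hh) s h4).1 hh
    obtain ⟨σ, hσ, h7⟩ := solW_sound (U := U) (V := V) (s := s) (μ := μ) (bx := bx) hba hρA hρ
      ⟨h1, fun x => h2 x ▸ TE.refl _, h3, h6, h5⟩
    exact ⟨s, σ, hσ, h7, h4⟩
  · intro σ hσ
    choose t ht using fun x => mk_surj ρA (σ (traceOf ρ (Sum.inr x)))
    have hsol := solW_complete hba hfp hρA hρbar hσ ht
    obtain ⟨h, hh, hout⟩ := hcomp t hsol.red hsol.bar hsol.eqn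
    choose v hv1 hv2 using hout
    have hv := sol_congr ht hv1
    have hsolv := solW_complete hba hfp hρA hρbar hσ hv
    exact ⟨h, (hiff h hh v hv2).2 ⟨hsolv.mon, hsolv.com⟩, v, hv, hv2⟩

end fin

/-- group/RAAG version of the main theorem, existence form.  For every
equation `(U, V)` with constraints `μ` over constants `A` (no self-involuting letters)
and variables `X`, with distinguished variables `Xs 0, …, Xs (k-1)`, there are a finite
alphabet `C ⊇ A`, letters `c i ∈ C`, and a rational set `Rset` of `A`-endomorphisms of
the free monoid `C*` such that: (i) every `h ∈ Rset` maps every letter of `C` into `A*`;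
(ii) applying `h ∈ Rset` to the letters `c i` and projecting to `M(A, ρA)` yields exactly
the tuples `(σ(X₁), …, σ(X_k))` over all group solutions `σ`; and (iii) `Rset` is
infinite iff there are infinitely many group solutions. -/
theorem stmt_13 {R A X N : Type u} [Fintype R] [Fintype A] [Fintype X]
    [Monoid N] [StarMul N] [Fintype N]
    (barA : A → A) (barX : X → X)
    (hbarA : Function.Involutive barA) (hbarX : Function.Involutive barX)
    (hAnoself : ∀ a : A, barA a ≠ a)
    (ρ : A ⊕ X → Set R)
    (hρbar : ∀ x : A ⊕ X, ρ (Sum.map barA barX x) = ρ x)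
    (ρA : A → Set R) (hρA : ∀ a : A, ρA a = ρ (Sum.inl a))
    (μ : Trace (A ⊕ X) ρ →* N)
    (hμstar : ∀ u : FreeMonoid (A ⊕ X),
      μ (traceMk ρ (wordStar (Sum.map barA barX) u)) = star (μ (traceMk ρ u)))
    (k : ℕ) (Xs : Fin k → X)
    (U V : FreeMonoid (A ⊕ X)) :
    ∃ (C : Type u) (_ : Fintype C) (emb : A ↪ C) (c : Fin k → C)
      (Rset : Set (Monoid.End (FreeMonoid C))),
      RationalSet Rset ∧
      (∀ h ∈ Rset, ∀ a : A, h (FreeMonoid.of (emb a)) = FreeMonoid.of (emb a)) ∧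
      (∀ h ∈ Rset, ∀ d : C, ∃ w : FreeMonoid A,
        h (FreeMonoid.of d) = FreeMonoid.map emb w) ∧
      ({t : Fin k → Trace A ρA | ∃ h ∈ Rset, ∀ i : Fin k, ∃ w : FreeMonoid A,
          h (FreeMonoid.of (c i)) = FreeMonoid.map emb w ∧ t i = traceMk ρA w} =
        {t : Fin k → Trace A ρA | ∃ σ : Trace (A ⊕ X) ρ →* Trace A ρA,
          IsSolutionG barA barX ρ ρA μ U V σ ∧
          ∀ i : Fin k, t i = σ (traceOf ρ (Sum.inr (Xs i)))}) ∧
      (Rset.Infinite ↔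
        {σ : Trace (A ⊕ X) ρ →* Trace A ρA |
          IsSolutionG barA barX ρ ρA μ U V σ}.Infinite) := by
  by_cases hfin : {σ : Trace (A ⊕ X) ρ →* Trace A ρA | IsSolutionG barA barX ρ ρA μ U V σ}.Finite
  · choose w hw using fun (σ : Trace (A ⊕ X) ρ →* Trace A ρA) (i : Fin k) =>
      mk_surj ρA (σ (traceOf ρ (Sum.inr (Xs i))))
    let C := A ⊕ ULift.{u} (Fin k)
    let emb : A ↪ C := ⟨Sum.inl, Sum.inl_injective⟩
    let H : (Trace (A ⊕ X) ρ →* Trace A ρA) → Monoid.End (FreeMonoid C) := fun σ =>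
      (FreeMonoid.lift (Sum.elim (fun a => FreeMonoid.of (emb a))
        (fun i => FreeMonoid.map emb (FreeMonoid.ofList (w σ i.down)))) : FreeMonoid C →* FreeMonoid C)
    have hH : ∀ σ p, H σ (FreeMonoid.of p) = Sum.elim (fun a => FreeMonoid.of (emb a))
        (fun i => FreeMonoid.map emb (FreeMonoid.ofList (w σ i.down))) p := fun σ p => FreeMonoid.lift_eval_of _ _
    have hinj : Function.Injective (FreeMonoid.map emb) := fun x y h => map_cn_inj emb.injective h
    refine ⟨C, inferInstance, emb, fun i => Sum.inr ⟨i⟩,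
      H '' {σ | IsSolutionG barA barX ρ ρA μ U V σ}, rational_finite _ (hfin.image _), ?_, ?_, ?_, ?_⟩
    · rintro _ ⟨σ, _, rfl⟩ a
      exact hH σ (Sum.inl a)
    · rintro _ ⟨σ, _, rfl⟩ (a | i)
      · exact ⟨FreeMonoid.of a, hH σ (Sum.inl a)⟩
      · exact ⟨_, hH σ (Sum.inr i)⟩
    · ext t
      constructor
      · rintro ⟨_, ⟨σ, hσ, rfl⟩, ht⟩
        refine ⟨σ, hσ, fun i => ?_⟩
        obtain ⟨v, hv, hv2⟩ := ht i
        have h1 := (hH σ (Sum.inr ⟨i⟩)).symm.trans hv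
        have h2 : FreeMonoid.ofList (w σ i) = v := hinj h1
        rw [hv2, ← h2, ← hw]
      · rintro ⟨σ, hσ, ht⟩
        exact ⟨H σ, ⟨σ, hσ, rfl⟩, fun i => ⟨_, hH σ (Sum.inr ⟨i⟩), (ht i).trans (hw σ i)⟩⟩
    · exact ⟨fun h => absurd (hfin.image _) h, fun h => absurd hfin h⟩
  · obtain ⟨C, hC, cn, o, S, hcn, hS, hfix, hintr, hsound, hcomp⟩ :=
      main_thm (ba := barA) (bx := barX) hbarA hAnoself hρA hρbar μ U V
    refine ⟨C, Fintype.ofFinite C, ⟨cn, hcn⟩, fun i => o (Xs i), S, hS, hfix, ?_, ?_, ?_⟩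
    · intro h hh d
      obtain ⟨w, hw⟩ := hintr h hh d
      exact ⟨FreeMonoid.ofList w, hw⟩
    · ext t
      constructor
      · rintro ⟨h, hh, ht⟩
        obtain ⟨s, σ, hσ, h1, h2⟩ := hsound h hh
        refine ⟨σ, hσ, fun i => ?_⟩
        obtain ⟨v, hv, hv2⟩ := ht i
        have h3 : (FreeMonoid.toList v).map cn = (s (Xs i)).map cn :=
          (congrArg FreeMonoid.toList hv).symm.trans (h2 (Xs i))
        have h4 := map_cn_inj hcn h3
        rw [hv2, h1, ← h4]
        rfl
      · rintro ⟨σ, hσ, ht⟩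
        obtain ⟨h, hh, s, h1, h2⟩ := hcomp σ hσ
        exact ⟨h, hh, fun i => ⟨FreeMonoid.ofList (s (Xs i)), h2 (Xs i), (ht i).trans (h1 (Xs i))⟩⟩
    · refine ⟨fun _ => hfin, fun h => ?_⟩
      have hc : ∀ σ, ∃ h : Monoid.End (FreeMonoid C), IsSolutionG barA barX ρ ρA μ U V σ →
          h ∈ S ∧ ∃ s : X → List A,
        (∀ x, σ (traceOf ρ (Sum.inr x)) = traceMk ρA (FreeMonoid.ofList (s x))) ∧
        ∀ w, FreeMonoid.toList (h (FreeMonoid.of (o w))) = (s w).map cn := by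
        intro σ
        by_cases hσ : IsSolutionG barA barX ρ ρA μ U V σ
        · obtain ⟨h, hh, hs⟩ := hcomp σ hσ
          exact ⟨h, fun _ => ⟨hh, hs⟩⟩
        · exact ⟨1, fun h => absurd h hσ⟩
      choose H hH using hc
      refine Set.infinite_of_injOn_mapsTo (f := H) ?_ (fun σ hσ => (hH σ hσ).1) h
      intro σ hσ τ hτ hστ
      obtain ⟨_, s, h1, h2⟩ := hH σ hσ
      obtain ⟨_, t, h3, h4⟩ := hH τ hτ
      rw [hστ] at h2
      refine hom_ext_X ?_
      rintro (a | x)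
      · rw [hσ.1, hτ.1]
      · rw [h1, h3, map_cn_inj hcn ((h2 x).symm.trans (h4 x))]
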